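/- Let ∂G be piecewise analytic, with the smallest exterior angle λπ, 0 < λ < 2, at the junction points of its analytic arcs. If F ⊂ G is compact, then there is a constant C₁(G,F) > 0, depending only on G and F, such that for every ζ ∈ F and every n ∈ ℕ: |p_n(ζ)| ≤ C₁(G,F) · n^{−λ/(4−2λ)}. -/

import Mathlib

open Complex MeasureTheory Set Filter Metric

noncomputable section

/-- A bounded Jordan domain `G ⊆ ℂ` whose boundary is a rectifiable Jordan curve
of length `l`, given together with a unit-speed (arclength) parametrization `γ`
of the boundary curve `L = frontier G`. -/
structure JordanDomain where
  /-- the domain -/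
  G : Set ℂ
  isOpen : IsOpen G
  nonempty : G.Nonempty
  bounded : Bornology.IsBounded G
  connected : IsConnected G
  simplyConnected : SimplyConnectedSpace ↥G
  /-- the length of the boundary curve -/
  l : ℝ
  l_pos : 0 < l
  /-- arclength parametrization of the boundary curve -/
  γ : ℝ → ℂ
  γ_cont : Continuous γ
  γ_periodic : Function.Periodic γ l
  γ_injOn : InjOn γ (Ico 0 l)
  γ_boundary : γ '' Ico 0 l = frontier G
  /-- `γ` is a unit-speed (arclength) parametrization; in particular the boundary
  is rectifiable with length `l`. -/
  γ_unitSpeed : ∀ s t : ℝ, s ≤ t → t ≤ s + l →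
    eVariationOn γ (Icc s t) = ENNReal.ofReal (t - s)

/-- The `E₂(G)`-norm of (the boundary trace of) a function, computed through the
arclength parametrization of the boundary: `‖g‖₂ = ((1/l) ∫₀^l ‖g(s)‖² ds)^{1/2}`. -/
def JordanDomain.bnorm (D : JordanDomain) (g : ℝ → ℂ) : ℝ :=
  Real.sqrt ((1 / D.l) * ∫ s in (0:ℝ)..D.l, ‖g s‖ ^ 2)

/-- `p` is the sequence of orthonormal polynomials of `E₂(G)` obtained by Gram–Schmidt
orthonormalization of the monomials `1, z, z², …`: `deg p k = k`, the leading
coefficients are positive reals, and the polynomials are orthonormal with respect to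
the arclength inner product `(f,g) = (1/l) ∫_L f conj(g) |dz|`. -/
def JordanDomain.IsONPolys (D : JordanDomain) (p : ℕ → Polynomial ℂ) : Prop :=
  (∀ k, (p k).natDegree = k) ∧
  (∀ k, ∃ c : ℝ, 0 < c ∧ (p k).leadingCoeff = (c : ℂ)) ∧
  (∀ j k, (1 / (D.l : ℂ)) * (∫ s in (0:ℝ)..D.l,
      (p j).eval (D.γ s) * (starRingEnd ℂ) ((p k).eval (D.γ s))) =
    if j = k then 1 else 0)

/-- The `n`-th partial sum `Σ_{k=0}^n conj(p_k(ζ))·p_k(z)` of the Szegő kernel expansion. -/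
def partialSum (p : ℕ → Polynomial ℂ) (ζ : ℂ) (n : ℕ) : ℂ → ℂ := fun z =>
  ∑ k ∈ Finset.range (n + 1), (starRingEnd ℂ) ((p k).eval ζ) * (p k).eval z

/-- The Szegő kernel `K(z,ζ) = Σ_{k=0}^∞ conj(p_k(ζ))·p_k(z)`. -/
def szegoKernel (p : ℕ → Polynomial ℂ) (ζ z : ℂ) : ℂ :=
  ∑' k : ℕ, (starRingEnd ℂ) ((p k).eval ζ) * (p k).eval z

/-- The approximating polynomials
`J_{2n+1}(z) = (2π/l)·(∫_ζ^z (Σ_{k=0}^n conj(p_k(ζ))p_k(t))² dt) / (Σ_{k=0}^n |p_k(ζ)|²)`;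
the (path-independent) integral of the polynomial integrand is written out explicitly,
using `∫_ζ^z t^i dt = (z^{i+1} - ζ^{i+1})/(i+1)`. -/
def Jfun (D : JordanDomain) (p : ℕ → Polynomial ℂ) (ζ : ℂ) (n : ℕ) : ℂ → ℂ := fun z =>
  let S : Polynomial ℂ :=
    (∑ k ∈ Finset.range (n + 1), Polynomial.C ((starRingEnd ℂ) ((p k).eval ζ)) * p k) ^ 2
  (((2 * Real.pi / D.l : ℝ) : ℂ) / (∑ k ∈ Finset.range (n + 1), ((‖(p k).eval ζ‖ : ℂ)) ^ 2)) *
    ∑ i ∈ Finset.range (S.natDegree + 1),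
      S.coeff i * ((z ^ (i + 1) - ζ ^ (i + 1)) / ((i : ℂ) + 1))

/-- `Q_n(z) = ((l/2π)·Σ_{k=0}^n |p_k(ζ)|²)^{-1/2} · Σ_{k=0}^n conj(p_k(ζ))·p_k(z)`,
so that `J'_{2n+1} = Q_n²`. -/
def Qfun (D : JordanDomain) (p : ℕ → Polynomial ℂ) (ζ : ℂ) (n : ℕ) : ℂ → ℂ := fun z =>
  ((Real.sqrt ((D.l / (2 * Real.pi)) *
      ∑ k ∈ Finset.range (n + 1), ‖(p k).eval ζ‖ ^ 2) : ℝ) : ℂ)⁻¹ * partialSum p ζ n z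

/-- The sup norm `⨆_{z ∈ K} ‖f(z)‖` on a set `K ⊆ ℂ`. -/
def supNormOn (K : Set ℂ) (f : ℂ → ℂ) : ℝ := ⨆ z : K, ‖f (z : ℂ)‖

/-- `g` has nontangential limit `v` at the boundary point `w` of `G`:
`g(z) → v` as `z → w` inside every cone `{z ∈ G : ‖z - w‖ ≤ M·dist(z, ∂G)}`. -/
def NTLim (G : Set ℂ) (g : ℂ → ℂ) (w v : ℂ) : Prop :=
  ∀ M : ℝ, 1 < M →
    Tendsto g (nhdsWithin w {z | z ∈ G ∧ ‖z - w‖ ≤ M * infDist z (frontier G)}) (nhds v)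

/-- `φ` is the conformal map of `G` onto the unit disk `D` normalized by
`φ(ζ) = 0` and `φ'(ζ) > 0`. -/
structure ConformalOnto (G : Set ℂ) (φ : ℂ → ℂ) (ζ : ℂ) : Prop where
  differentiable : ∀ z ∈ G, DifferentiableAt ℂ φ z
  bijOn : BijOn φ G (ball (0 : ℂ) 1)
  map_center : φ ζ = 0
  deriv_center_pos : ∃ c : ℝ, 0 < c ∧ deriv φ ζ = (c : ℂ)

/-- `G` is a Smirnov domain: for any conformal map `ψ` of the unit disk onto `G`,
`log|ψ'|` is represented by the Poisson integral of its (radial) boundary values.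
(By the Keldysh–Lavrentiev theorem this is equivalent to polynomials being dense
in the Smirnov classes `E_p(G)`.) -/
def IsSmirnovDomain (G : Set ℂ) : Prop :=
  ∀ ψ : ℂ → ℂ,
    (∀ w ∈ ball (0 : ℂ) 1, DifferentiableAt ℂ ψ w) →
    BijOn ψ (ball (0 : ℂ) 1) G →
    ∃ h : ℝ → ℝ,
      IntervalIntegrable h volume 0 (2 * Real.pi) ∧
      (∀ᵐ (θ : ℝ) ∂(volume.restrict (Ioc (0 : ℝ) (2 * Real.pi))),
        Tendsto (fun r : ℝ => Real.log ‖deriv ψ ((r : ℂ) * Complex.exp ((θ : ℂ) * Complex.I))‖)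
          (nhdsWithin 1 (Iio 1)) (nhds (h θ))) ∧
      (∀ w ∈ ball (0 : ℂ) 1,
        Real.log ‖deriv ψ w‖ =
          (1 / (2 * Real.pi)) * ∫ θ in (0 : ℝ)..(2 * Real.pi),
            ((1 - ‖w‖ ^ 2) / ‖Complex.exp ((θ : ℂ) * Complex.I) - w‖ ^ 2) * h θ)

/-- The (interior) opening angle of `G` at the boundary point `z₀` equals `a`:
the angular measure of the set of directions in which `G` is seen from `z₀`
at distance `r` tends to `a` as `r → 0⁺`. -/
def HasCornerAngle (G : Set ℂ) (z₀ : ℂ) (a : ℝ) : Prop :=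
  Tendsto (fun r : ℝ =>
      (volume {θ : ℝ | θ ∈ Ico 0 (2 * Real.pi) ∧
        z₀ + (r : ℂ) * Complex.exp ((θ : ℂ) * Complex.I) ∈ G}).toReal)
    (nhdsWithin 0 (Ioi 0)) (nhds a)

/-- The boundary of the Jordan domain `D` is piecewise analytic: it is a union of
finitely many analytic arcs `τ i '' [0,1]` (each `τ i` is conformal, i.e. injective
and holomorphic, on an open neighborhood `U i` of the segment `[0,1]`), consecutive
arcs are joined at the junction points `τ i 1 = τ (i+1) 0`, and at the junction
point `τ i 1` the exterior angle of `G` is `extAngle i · π` (so the interior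
opening angle there is `(2 - extAngle i) · π`). -/
structure PiecewiseAnalyticBoundary (D : JordanDomain) where
  /-- number of analytic arcs -/
  m : ℕ
  m_pos : 0 < m
  /-- conformal parametrizations of the arcs -/
  τ : Fin m → ℂ → ℂ
  /-- neighborhoods of the segment `[0,1]` on which the `τ i` are conformal -/
  U : Fin m → Set ℂ
  U_open : ∀ i, IsOpen (U i)
  seg_sub : ∀ i, (Complex.ofReal '' Icc (0 : ℝ) 1) ⊆ U i
  analytic : ∀ i, DifferentiableOn ℂ (τ i) (U i)
  inj : ∀ i, InjOn (τ i) (U i)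
  cover : (⋃ i, τ i '' (Complex.ofReal '' Icc (0 : ℝ) 1)) = frontier D.G
  junction : ∀ i : Fin m,
    τ i 1 = τ (Fin.mk ((i.val + 1) % m) (Nat.mod_lt _ m_pos)) 0
  /-- `extAngle i · π` is the exterior angle at the junction point `τ i 1` -/
  extAngle : Fin m → ℝ
  extAngle_mem : ∀ i, extAngle i ∈ Ioo (0 : ℝ) 2
  extAngle_spec : ∀ i, HasCornerAngle D.G (τ i 1) ((2 - extAngle i) * Real.pi)

end


notation "I01" => Icc (0 : ℝ) 1
notation "O01" => Ioo (0 : ℝ) 1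
notation "mh12" => (-(1 / 2) : ℝ)
notation "mh34" => (-(3 / 4) : ℝ)
notation "rpi" => Real.pi
notation "rex" => Real.exp
notation "cnj" => (starRingEnd ℂ)
notation "pvt" => (by positivity)
notation "nnm" => (by norm_num)
notation "lnr" => (by linarith)
notation "mnl" => (min_le_left _ _)
notation "mnr" => (min_le_right _ _)
notation "zrR" => (0 : ℝ)
notation "onR" => (1 : ℝ)
notation "zrC" => (0 : ℂ)
notation "bsp" => (by simp)
notation "bfp" => (by fun_prop)
notation "bom" => (by omega)
notation "rlg" => Real.log
notation "rcs" => Real.cos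
notation "nng" => (norm_nonneg _)
notation "rxp" => (Real.exp_pos _)
notation "nh0" => (nhds 0)
notation "qrR" => (1 / 4 : ℝ)
notation "rnn" => Real.norm_of_nonneg
notation "rna" => Real.norm_eq_abs
notation "rxq" => Real.exp_pos
notation "rmr" => Real.mul_rpow
notation "rpp" => Real.pi_pos
notation "rea" => Real.exp_add
notation "rrn" => Real.rpow_neg
notation "rra" => Real.rpow_add
notation "rel" => Real.exp_log
notation "fsc" => Finset.sum_congr
notation "evf" => Filter.Eventually.of_forall
notation "cxe" => Complex.ext

lemma hurw {ι : Type*} {l : Filter ι} [NeBot l] {F : ι → ℂ → ℂ} {F0 : ℂ → ℂ} {z0 : ℂ} {r : ℝ}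
    (hr : 0 < r) (hd : ∀ᶠ i in l, DifferentiableOn ℂ (F i) (closedBall z0 r))
    (nz : ∀ᶠ i in l, ∀ z ∈ closedBall z0 r, F i z ≠ 0)
    (tu : TendstoUniformlyOn F F0 l (sphere z0 r))
    (hz : Tendsto (fun i ↦ F i z0) l nh0)
    (hc : ContinuousOn F0 (sphere z0 r)) (h0 : ∀ z ∈ sphere z0 r, F0 z ≠ 0) : False := by
  have hne : (sphere z0 r).Nonempty := NormedSpace.sphere_nonempty.2 hr.le
  obtain ⟨x, hx, hmin⟩ := (isCompact_sphere z0 r).exists_isMinOn hne hc.norm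
  have hδ : 0 < ‖F0 x‖ := norm_pos_iff.2 (h0 x hx)
  have h1 := (Metric.tendstoUniformlyOn_iff.1 tu) (‖F0 x‖ / 2) pvt
  have h2 := (Metric.tendsto_nhds.1 hz) (‖F0 x‖ / 2) pvt
  obtain ⟨i, a1, a2, a3, a4⟩ := (hd.and (nz.and (h1.and h2))).exists
  have hsub : sphere z0 r ⊆ closedBall z0 r := sphere_subset_closedBall
  have hD : DiffContOnCl ℂ (fun z ↦ (F i z)⁻¹) (ball z0 r) := by
    apply DifferentiableOn.diffContOnCl
    rw [closure_ball z0 hr.ne']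
    exact a1.inv a2
  have := Complex.norm_le_of_forall_mem_frontier_norm_le (C := 2 / ‖F0 x‖) isBounded_ball hD
    (by
      intro z hz
      rw [frontier_ball z0 hr.ne'] at hz
      have e1 := a3 z hz
      have e2 : ‖F0 x‖ ≤ ‖F0 z‖ := hmin hz
      rw [dist_eq_norm] at e1
      have e3 : ‖F0 z‖ ≤ ‖F0 z - F i z‖ + ‖F i z‖ := by
        simpa using norm_add_le (F0 z - F i z) (F i z)
      rw [norm_inv, inv_le_comm₀ (norm_pos_iff.2 (a2 z (hsub hz))) pvt, inv_div]
      linarith) (subset_closure (mem_ball_self hr))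
  rw [norm_inv, inv_le_comm₀ (norm_pos_iff.2 (a2 z0 (mem_closedBall_self hr.le)))
    pvt, inv_div] at this
  rw [dist_zero_right] at a4
  linarith

lemma isolated_val {U : Set ℂ} (hU : IsOpen U) {f : ℂ → ℂ} (hf : DifferentiableOn ℂ f U) {z0 : ℂ}
    (hz0 : z0 ∈ U) (hn : ∃ᶠ z in nhdsWithin z0 {z0}ᶜ, f z ≠ f z0) {ε : ℝ} (hε : 0 < ε) :
    ∃ r, 0 < r ∧ r < ε ∧ closedBall z0 r ⊆ U ∧ ∀ z ∈ closedBall z0 r, z ≠ z0 → f z ≠ f z0 := by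
  have ha : AnalyticAt ℂ f z0 := hf.analyticAt (hU.mem_nhds hz0)
  have hb : ∀ᶠ z in nhdsWithin z0 {z0}ᶜ, f z - f z0 ≠ 0 := by
    rcases (ha.sub analyticAt_const : AnalyticAt ℂ (fun z ↦ f z - f z0) z0).eventually_eq_zero_or_eventually_ne_zero with h | h
    · exfalso
      refine hn ((h.filter_mono nhdsWithin_le_nhds).mono fun z hz ↦ ?_)
      simpa [sub_eq_zero] using hz
    · exact h
  rw [eventually_nhdsWithin_iff] at hb
  obtain ⟨s, hs, hs'⟩ := Metric.eventually_nhds_iff_ball.1 (hb.and (hU.mem_nhds hz0))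
  refine ⟨min s ε / 2, by positivity, by linarith [min_le_right s ε], ?_, ?_⟩
  · intro z hz
    exact (hs' z (closedBall_subset_ball (by linarith [min_le_left s ε, lt_min hs hε]) hz)).2
  · intro z hz hne
    exact sub_ne_zero.1 ((hs' z (closedBall_subset_ball (by linarith [min_le_left s ε, lt_min hs hε]) hz)).1 hne)

lemma deriv_ne_zero_of_injOn {U : Set ℂ} (hU : IsOpen U) {f : ℂ → ℂ} (hf : DifferentiableOn ℂ f U)
    (hi : InjOn f U) {z0 : ℂ} (hz0 : z0 ∈ U) : deriv f z0 ≠ 0 := by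
  intro h0
  have hfd : ∀ z ∈ U, DifferentiableAt ℂ f z := fun z hz ↦ hf.differentiableAt (hU.mem_nhds hz)
  obtain ⟨s, hs, hsU⟩ := Metric.isOpen_iff.1 hU z0 hz0
  have hn : ∃ᶠ z in nhdsWithin z0 {z0}ᶜ, deriv f z ≠ deriv f z0 := by
    intro hcon
    simp only [h0, ne_eq, not_not] at hcon
    rw [eventually_nhdsWithin_iff] at hcon
    obtain ⟨t, ht, ht'⟩ := Metric.eventually_nhds_iff_ball.1 hcon
    have hm : 0 < min s t := lt_min hs ht
    have hz1 : z0 + ((min s t / 2 : ℝ) : ℂ) ∈ ball z0 (min s t) := by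
      simp only [mem_ball, dist_self_add_left, norm_real, rna]
      rw [abs_of_pos pvt]; linarith
    have hcst : f (z0 + ((min s t / 2 : ℝ) : ℂ)) = f z0 := by
      have := (convex_ball z0 (min s t)).norm_image_sub_le_of_norm_deriv_le (C := 0) (f := f)
        (fun x hx ↦ hfd x (hsU (ball_subset_ball mnl hx)))
        (fun x hx ↦ by
          by_cases hxz : x = z0
          · simp [hxz, h0]
          · simp [ht' x (ball_subset_ball mnr hx) hxz])
        (mem_ball_self hm) hz1
      simpa [sub_eq_zero] using this
    have := hi (hsU (ball_subset_ball mnl hz1)) hz0 hcst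
    simp at this; linarith
  obtain ⟨r, hr, -, hrU, hrd⟩ := isolated_val hU (hf.deriv hU) hz0 hn hs
  have hnb : NeBot (nhdsWithin z0 {z0}ᶜ) := inferInstance
  have hds : ∀ w ∈ U, DifferentiableOn ℂ (dslope f w) U := fun w hw ↦
    (differentiableOn_dslope (hU.mem_nhds hw)).2 hf
  refine hurw (l := nhdsWithin z0 {z0}ᶜ) (F := fun w ↦ dslope f w) (F0 := dslope f z0) (z0 := z0) hr
    ?_ ?_ ?_ ?_ ?_ ?_
  · filter_upwards [nhdsWithin_le_nhds (hU.mem_nhds hz0)] with w hw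
    exact (hds w hw).mono hrU
  · have : ball z0 r ∈ nhdsWithin z0 {z0}ᶜ := nhdsWithin_le_nhds (ball_mem_nhds z0 hr)
    filter_upwards [this, self_mem_nhdsWithin] with w hw hwz z hz
    have hwc := ball_subset_closedBall hw
    by_cases hzw : z = w
    · subst hzw
      rw [dslope_same]
      rw [h0] at hrd; exact hrd z hwc hwz
    · rw [dslope_of_ne _ hzw, slope_def_field]
      refine div_ne_zero (sub_ne_zero.2 fun h ↦ hzw (hi (hrU hz) (hrU hwc) h)) (sub_ne_zero.2 hzw)
  ·
    rw [Metric.tendstoUniformlyOn_iff]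
    intro ε hε
    have hcU : ContinuousAt f z0 := (hfd z0 hz0).continuousAt
    obtain ⟨M, hM⟩ := (isCompact_sphere z0 r).exists_bound_of_continuousOn
      (f := f) (hf.continuousOn.mono (sphere_subset_closedBall.trans hrU))
    have t1 : Tendsto (fun w ↦ ‖f w - f z0‖ * (2 / r) + (|M| + ‖f z0‖) * (‖w - z0‖ * (2 / (r * r)))) (nhdsWithin z0 {z0}ᶜ) nh0 := by
      have e1 : Tendsto (fun w ↦ ‖f w - f z0‖) (nhds z0) nh0 := by
        have := (hcU.sub (continuousAt_const (y := f z0))).norm; simpa [ContinuousAt] using this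
      have e2 : Tendsto (fun w ↦ ‖w - z0‖) (nhds z0) nh0 := by
        have : Continuous fun w : ℂ ↦ ‖w - z0‖ := by fun_prop
        simpa using this.tendsto z0
      have := (e1.mul_const (2 / r)).add ((e2.mul_const (2 / (r * r))).const_mul (|M| + ‖f z0‖))
      simp only [zero_mul, mul_zero, add_zero] at this
      exact this.mono_left nhdsWithin_le_nhds
    have hb : ball z0 (r / 2) ∈ nhdsWithin z0 {z0}ᶜ := nhdsWithin_le_nhds (ball_mem_nhds z0 pvt)
    filter_upwards [t1.eventually (gt_mem_nhds hε), hb] with w hw hwb x hx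
    refine lt_of_le_of_lt ?_ hw
    have hxn : ‖x - z0‖ = r := by simpa [dist_eq_norm] using hx
    have hwn : ‖w - z0‖ < r / 2 := by simpa [dist_eq_norm] using hwb
    have hxw : r / 2 ≤ ‖x - w‖ := by
      have := norm_sub_norm_le (x - z0) (w - z0)
      rw [sub_sub_sub_cancel_right] at this; linarith
    have hne : x ≠ w := by rintro rfl; simp at hxw; linarith
    have hne0 : x ≠ z0 := by rintro rfl; simp at hxn; linarith
    rw [dslope_of_ne _ hne, dslope_of_ne _ hne0, slope_def_field, slope_def_field, dist_eq_norm]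
    have h1 : x - w ≠ 0 := sub_ne_zero.2 hne
    have h2 : x - z0 ≠ 0 := sub_ne_zero.2 hne0
    have : (f x - f z0) / (x - z0) - (f x - f w) / (x - w) =
        (f w - f z0) / (x - w) + (f x - f z0) * ((z0 - w) / ((x - z0) * (x - w))) := by
      field_simp; ring
    rw [this]
    refine (norm_add_le _ _).trans (add_le_add ?_ ?_)
    · rw [norm_div, div_eq_mul_inv]
      refine mul_le_mul_of_nonneg_left ?_ nng
      rw [inv_le_comm₀ lnr pvt, inv_div]; exact hxw
    · rw [norm_mul, norm_div, norm_mul, hxn, norm_sub_rev z0 w, div_eq_mul_inv]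
      refine mul_le_mul ?_ ?_ pvt pvt
      · exact (norm_sub_le _ _).trans (add_le_add ((hM x hx).trans (le_abs_self _)) le_rfl)
      · refine mul_le_mul_of_nonneg_left ?_ nng
        rw [inv_le_comm₀ pvt pvt, inv_div]
        nlinarith
  · have : Tendsto (fun w ↦ dslope f z0 w) (nhds z0) (nhds (dslope f z0 z0)) :=
      ((hds z0 hz0).differentiableAt (hU.mem_nhds hz0)).continuousAt
    rw [dslope_same, h0] at this
    refine (this.mono_left nhdsWithin_le_nhds).congr' ?_
    filter_upwards [self_mem_nhdsWithin] with w hw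
    have hw' : w ≠ z0 := hw
    rw [dslope_of_ne _ hw', dslope_of_ne _ hw'.symm, slope_comm]
  · exact ((hds z0 hz0).mono (sphere_subset_closedBall.trans hrU)).continuousOn
  · intro z hz
    have hne0 : z ≠ z0 := by rintro rfl; simp at hz; linarith
    rw [dslope_of_ne _ hne0, slope_def_field]
    exact div_ne_zero (sub_ne_zero.2 fun h ↦ hne0 (hi (hrU (sphere_subset_closedBall hz)) hz0 h))
      (sub_ne_zero.2 hne0)

noncomputable def mob (a w : ℂ) : ℂ := (w - a) / (1 - starRingEnd ℂ a * w)

lemma mob_den {a w : ℂ} (ha : ‖a‖ < 1) (hw : ‖w‖ ≤ 1) : 1 - starRingEnd ℂ a * w ≠ 0 := by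
  intro h
  have : ‖starRingEnd ℂ a * w‖ < 1 := by
    rw [norm_mul, RCLike.norm_conj]; nlinarith [norm_nonneg a, norm_nonneg w]
  rw [← sub_eq_zero.1 h] at this; simp at this

lemma mob_ident (a w : ℂ) : ‖1 - starRingEnd ℂ a * w‖ ^ 2 - ‖w - a‖ ^ 2 = (1 - ‖a‖ ^ 2) * (1 - ‖w‖ ^ 2) := by
  simp only [← Complex.normSq_eq_norm_sq, Complex.normSq_apply]
  simp; ring

lemma mob_mapsTo {a : ℂ} (ha : ‖a‖ < 1) : MapsTo (mob a) (ball 0 1) (ball 0 1) := by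
  intro w hw
  simp only [mem_ball, dist_zero_right] at *
  have h := mob_ident a w
  have hd := norm_pos_iff.2 (mob_den ha hw.le)
  rw [mob, norm_div, div_lt_one hd]
  have : 0 < (1 - ‖a‖ ^ 2) * (1 - ‖w‖ ^ 2) := by
    apply mul_pos <;> nlinarith [norm_nonneg a, norm_nonneg w]
  nlinarith [norm_nonneg (w - a)]

lemma mob_inj {a : ℂ} (ha : ‖a‖ < 1) : InjOn (mob a) (ball 0 1) := by
  intro w hw v hv h
  simp only [mem_ball, dist_zero_right] at hw hv
  rw [mob, mob, div_eq_div_iff (mob_den ha hw.le) (mob_den ha hv.le)] at h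
  have h2 : (w - v) * (1 - starRingEnd ℂ a * a) = 0 := by linear_combination h
  rcases mul_eq_zero.1 h2 with h3 | h3
  · exact sub_eq_zero.1 h3
  · exact absurd h3 (mob_den ha ha.le)

lemma mob_hasDerivAt {a w : ℂ} (ha : ‖a‖ < 1) (hw : ‖w‖ ≤ 1) :
    HasDerivAt (mob a) ((1 - starRingEnd ℂ a * a) / (1 - starRingEnd ℂ a * w) ^ 2) w := by
  have h1 : HasDerivAt (fun w : ℂ ↦ w - a) 1 w := (hasDerivAt_id w).sub_const a
  have h2 : HasDerivAt (fun w : ℂ ↦ 1 - starRingEnd ℂ a * w) (-(starRingEnd ℂ a * 1)) w :=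
    ((hasDerivAt_id w).const_mul _).const_sub 1
  refine (h1.div h2 (mob_den ha hw)).congr_deriv ?_
  congr 1; ring

lemma norm_one_sub_conj_mul_self {a : ℂ} (ha : ‖a‖ ≤ 1) : ‖1 - starRingEnd ℂ a * a‖ = 1 - ‖a‖ ^ 2 := by
  rw [mul_comm, Complex.mul_conj, Complex.normSq_eq_norm_sq]
  rw [← ofReal_one, ← ofReal_sub, norm_real, rnn]
  nlinarith [norm_nonneg a]

lemma exists_sqrt {U : Set ℂ} (hU : IsOpen U) (hs : IsSimplyConnected U) {f : ℂ → ℂ}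
    (hf : DifferentiableOn ℂ f U) (h0 : ∀ z ∈ U, f z ≠ 0) :
    ∃ q : ℂ → ℂ, DifferentiableOn ℂ q U ∧ ∀ z ∈ U, q z ^ 2 = f z := by
  obtain ⟨q, hq, hq2⟩ := Complex.exists_continuousOn_pow_eq hs hU hf.continuousOn
    (by rintro ⟨z, hz, h⟩; exact h0 z hz h) two_ne_zero
  have hq2' : ∀ z ∈ U, q z ^ 2 = f z := fun z _ ↦ by simpa using hq2 z
  refine ⟨q, fun z hz ↦ ?_, hq2'⟩
  have hqz : q z ≠ 0 := fun h ↦ h0 z hz (by rw [← hq2' z hz, h]; simp)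
  have hfz : HasDerivAt f (deriv f z) z := (hf.differentiableAt (hU.mem_nhds hz)).hasDerivAt
  have hc : ContinuousAt q z := hq.continuousAt (hU.mem_nhds hz)
  have : HasDerivAt q (deriv f z / (2 * q z)) z := by
    rw [hasDerivAt_iff_tendsto_slope] at hfz ⊢
    have h1 : Tendsto (fun w ↦ slope f z w / (q w + q z)) (nhdsWithin z {z}ᶜ)
        (nhds (deriv f z / (q z + q z))) := by
      refine hfz.div ((hc.tendsto.mono_left nhdsWithin_le_nhds).add_const _) ?_
      rw [← two_mul]; exact mul_ne_zero two_ne_zero hqz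
    rw [two_mul]
    refine h1.congr' ?_
    have h3 : ∀ᶠ w in nhds z, q w + q z ≠ 0 :=
      (hc.add continuousAt_const : ContinuousAt (fun w ↦ q w + q z) z).eventually_ne
        (by show q z + q z ≠ 0; rw [← two_mul]; exact mul_ne_zero two_ne_zero hqz)
    filter_upwards [self_mem_nhdsWithin, nhdsWithin_le_nhds h3, nhdsWithin_le_nhds (hU.mem_nhds hz)] with w hw hw3 hwU
    have hwz : w - z ≠ 0 := sub_ne_zero.2 hw
    rw [slope_def_field, slope_def_field, ← hq2' w hwU, ← hq2' z hz]
    field_simp; ring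
  exact this.differentiableAt.differentiableWithinAt

lemma lip_ball {U : Set ℂ} {f : ℂ → ℂ} (hf : DifferentiableOn ℂ f U) (hm : MapsTo f U (ball 0 1))
    {z w : ℂ} {R : ℝ} (hR : ball z R ⊆ U) (hw : w ∈ ball z R) : dist (f w) (f z) ≤ 2 / R * dist w z := by
  have hz : z ∈ U := hR (mem_ball_self ((dist_nonneg).trans_lt hw))
  refine Complex.dist_le_div_mul_dist_of_mapsTo_ball (hf.mono hR) ?_ hw
  intro x hx
  have h1 := hm (hR hx); have h2 := hm hz
  simp only [mem_closedBall, mem_ball, dist_zero_right] at *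
  rw [dist_eq_norm]
  linarith [norm_sub_le (f x) (f z)]

theorem riemann_map {U : Set ℂ} (hU : IsOpen U) (hs : IsSimplyConnected U) (hbd : Bornology.IsBounded U) :
    ∃ φ : ℂ → ℂ, DifferentiableOn ℂ φ U ∧ InjOn φ U ∧ φ '' U = ball 0 1 := by
  obtain ⟨f0, hf0m, hf0i, hf0d⟩ : ∃ f : ℂ → ℂ, MapsTo f U (ball 0 1) ∧ InjOn f U ∧
      ∀ z ∈ U, deriv f z ≠ 0 := by
    obtain ⟨K, hK, hUK⟩ := hbd.subset_ball_lt 0 0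
    have hKc : (K : ℂ) ≠ 0 := by exact_mod_cast hK.ne'
    refine ⟨fun z ↦ z / K, fun z hz ↦ ?_, fun z _ w _ h ↦ ?_, fun z _ ↦ ?_⟩
    · have := hUK hz
      simp only [mem_ball, dist_zero_right, norm_div, norm_real, rna, abs_of_pos hK] at *
      rwa [div_lt_one hK]
    · field_simp at h; exact h
    · simp [hKc]
  obtain ⟨z0, hz0⟩ := hs.nonempty
  have hpc : IsPreconnected U := hs.isPathConnected.isConnected.isPreconnected
  let S : Set (ℂ → ℂ) := {f | DifferentiableOn ℂ f U ∧ MapsTo f U (ball 0 1) ∧ InjOn f U}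
  have hf0S : f0 ∈ S := ⟨fun z hz ↦ (differentiableAt_of_deriv_ne_zero (hf0d z hz)).differentiableWithinAt, hf0m, hf0i⟩
  obtain ⟨R, hR, hRU⟩ := Metric.isOpen_iff.1 hU z0 hz0
  let A : Set ℝ := (fun f ↦ ‖deriv f z0‖) '' S
  have hA : BddAbove A := by
    refine ⟨2 / R, ?_⟩
    rintro _ ⟨f, hf, rfl⟩
    refine Complex.norm_deriv_le_div_of_mapsTo_ball (hf.1.mono hRU) ?_ hR
    intro x hx
    have h1 := hf.2.1 (hRU hx); have h2 := hf.2.1 hz0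
    simp only [mem_closedBall, mem_ball, dist_zero_right] at *
    rw [dist_eq_norm]
    linarith [norm_sub_le (f x) (f z0)]
  have hAne : A.Nonempty := ⟨_, f0, hf0S, rfl⟩
  obtain ⟨u, -, hulim, hu⟩ := exists_seq_tendsto_sSup hAne hA
  choose fn hfn hfnu using hu
  set l : Ultrafilter ℕ := Filter.hyperfilter ℕ
  have hl : (l : Filter ℕ) ≤ atTop := Nat.hyperfilter_le_atTop
  have hlim : ∀ z ∈ U, ∃ y, Tendsto (fun n ↦ fn n z) l (nhds y) := by
    intro z hz
    have hc := (isCompact_closedBall zrC 1).ultrafilter_le_nhds (l.map fun n ↦ fn n z)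
      (by
        rw [Filter.le_principal_iff]
        exact Filter.mem_map.2 (Filter.univ_mem' fun n ↦ ball_subset_closedBall ((hfn n).2.1 hz)))
    obtain ⟨y, -, hy⟩ := hc
    exact ⟨y, hy⟩
  choose! g hg using hlim
  have hloc : TendstoLocallyUniformlyOn fn g (l : Filter ℕ) U := by
    rw [Metric.tendstoLocallyUniformlyOn_iff]
    intro ε hε z hz
    obtain ⟨r, hr, hrU⟩ := Metric.isOpen_iff.1 hU z hz
    refine ⟨ball z (min r (ε * r / 8)), mem_nhdsWithin_of_mem_nhds (ball_mem_nhds _ pvt), ?_⟩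
    filter_upwards [(Metric.tendsto_nhds.1 (hg z hz)) (ε / 4) pvt] with n hn y hy
    have hyr : y ∈ ball z r := ball_subset_ball mnl hy
    have hyd : dist y z < ε * r / 8 := ball_subset_ball mnr hy
    have hb : 2 / r * dist y z < ε / 4 := by
      rw [div_mul_eq_mul_div, div_lt_iff₀ hr]; linarith
    have h1 : ∀ n, dist (fn n y) (fn n z) ≤ ε / 4 := fun n ↦
      (lip_ball (hfn n).1 (hfn n).2.1 hrU hyr).trans hb.le
    have h2 : dist (g y) (g z) ≤ ε / 4 :=
      le_of_tendsto ((hg y (hrU hyr)).dist (hg z hz)) (Eventually.of_forall h1)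
    have := dist_triangle4 (g y) (g z) (fn n z) (fn n y)
    have h3 := h1 n
    rw [dist_comm (fn n y)] at h3
    rw [dist_comm (fn n z)] at hn
    linarith
  have hgd : DifferentiableOn ℂ g U := hloc.differentiableOn (Eventually.of_forall fun n ↦ (hfn n).1) hU
  have hderiv : ‖deriv g z0‖ = sSup A := by
    have h1 := (hloc.deriv (Eventually.of_forall fun n ↦ (hfn n).1) hU).tendsto_at hz0
    refine tendsto_nhds_unique h1.norm ?_
    have : (fun n ↦ ‖(deriv ∘ fn) n z0‖) = u := by ext n; exact hfnu n
    rw [this]; exact hulim.mono_left hl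
  have hpos : 0 < ‖deriv g z0‖ := by
    rw [hderiv]
    exact lt_of_lt_of_le (norm_pos_iff.2 (hf0d z0 hz0)) (le_csSup hA ⟨f0, hf0S, rfl⟩)
  have hga : AnalyticOnNhd ℂ g U := hgd.analyticOnNhd hU
  have hnc : ∀ w ∈ U, ∃ᶠ z in nhdsWithin w {w}ᶜ, g z ≠ g w := by
    intro w hw hcon
    have : EqOn g (fun _ ↦ g w) U := by
      refine hga.eqOn_of_preconnected_of_eventuallyEq analyticOnNhd_const hpc hw ?_
      rw [eventually_nhdsWithin_iff] at hcon
      filter_upwards [hcon] with z hz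
      by_cases h : z = w
      · rw [h]
      · simpa using hz h
    have h2 : deriv g z0 = 0 := by
      rw [(this.eventuallyEq_of_mem (hU.mem_nhds hz0)).deriv_eq]; simp
    rw [h2] at hpos; simp at hpos
  have hgi : InjOn g U := by
    intro w1 h1 w2 h2 heq
    by_contra hne
    obtain ⟨r, hr, hr2, hrU, hrv⟩ := isolated_val hU hgd h2 (hnc w2 h2) (dist_pos.2 hne)
    have hnm : w1 ∉ closedBall w2 r := by simp [not_le.2 hr2]
    refine hurw (l := (l : Filter ℕ)) (F := fun n z ↦ fn n z - fn n w1) (F0 := fun z ↦ g z - g w1)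
      (z0 := w2) hr ?_ ?_ ?_ ?_ ?_ ?_
    · exact Eventually.of_forall fun n ↦ ((hfn n).1.mono hrU).sub_const _
    · refine Eventually.of_forall fun n z hz ↦ sub_ne_zero.2 fun h ↦ hnm ?_
      rwa [← (hfn n).2.2 (hrU hz) h1 h]
    · have e1 := (tendstoLocallyUniformlyOn_iff_forall_isCompact hU).1 hloc (sphere w2 r)
        (sphere_subset_closedBall.trans hrU) (isCompact_sphere _ _)
      rw [Metric.tendstoUniformlyOn_iff] at e1 ⊢
      intro ε hε
      filter_upwards [e1 (ε / 2) pvt, (Metric.tendsto_nhds.1 (hg w1 h1)) (ε / 2) pvt] with n hn hn1 x hx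
      have := dist_sub_sub_le (g x) (g w1) (fn n x) (fn n w1)
      have := hn x hx
      rw [dist_comm] at hn1
      linarith
    · have := (hg w2 h2).sub (hg w1 h1)
      rwa [heq, sub_self] at this
    · exact ((hgd.mono (sphere_subset_closedBall.trans hrU)).sub_const _).continuousOn
    · intro z hz
      rw [heq]
      refine sub_ne_zero.2 (hrv z (sphere_subset_closedBall hz) ?_)
      rintro rfl; simp at hz; linarith
  have hgle : ∀ z ∈ U, ‖g z‖ ≤ 1 := fun z hz ↦
    le_of_tendsto (hg z hz).norm (Eventually.of_forall fun n ↦ by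
      have := (hfn n).2.1 hz; rw [mem_ball, dist_zero_right] at this; exact this.le)
  have hgm : MapsTo g U (ball 0 1) := by
    intro z hz
    rw [mem_ball, dist_zero_right]
    refine lt_of_le_of_ne (hgle z hz) fun h1 ↦ ?_
    have hmax : IsLocalMax (norm ∘ g) z := by
      filter_upwards [hU.mem_nhds hz] with w hw
      simpa [h1] using hgle w hw
    have := Complex.eventually_eq_of_isLocalMax_norm
      (by filter_upwards [hU.mem_nhds hz] with w hw using hgd.differentiableAt (hU.mem_nhds hw)) hmax
    exact (hnc z hz) ((this.filter_mono nhdsWithin_le_nhds).mono fun w hw ↦ by simpa using hw)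
  have hopt : ∀ h ∈ S, ‖deriv h z0‖ ≤ ‖deriv g z0‖ := fun h hh ↦ hderiv ▸ le_csSup hA ⟨h, hh, rfl⟩
  have hcomp : ∀ q ∈ S, ‖deriv q z0‖ ≤ ‖deriv g z0‖ * (1 - ‖q z0‖ ^ 2) := by
    intro q hq
    have hq0 : ‖q z0‖ < 1 := by simpa using hq.2.1 hz0
    have hS : (mob (q z0)) ∘ q ∈ S := by
      refine ⟨fun z hz ↦ ?_, (mob_mapsTo hq0).comp hq.2.1, (mob_inj hq0).comp hq.2.2 hq.2.1⟩
      have hqz : ‖q z‖ < 1 := by simpa using hq.2.1 hz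
      exact ((mob_hasDerivAt hq0 hqz.le).differentiableAt.comp z
        (hq.1.differentiableAt (hU.mem_nhds hz))).differentiableWithinAt
    have hd := ((mob_hasDerivAt hq0 hq0.le).comp z0 (hq.1.differentiableAt (hU.mem_nhds hz0)).hasDerivAt).deriv
    have := hopt _ hS
    have hp : 0 < 1 - ‖q z0‖ ^ 2 := by nlinarith [norm_nonneg (q z0)]
    rw [hd, norm_mul, norm_div, norm_pow, norm_one_sub_conj_mul_self hq0.le, pow_two (1 - ‖q z0‖ ^ 2), div_mul_eq_mul_div,
      div_le_iff₀ pvt] at this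
    nlinarith
  have hgS : g ∈ S := ⟨hgd, hgm, hgi⟩
  have hg0 : g z0 = 0 := by
    have := hcomp g hgS
    have h2 : ‖g z0‖ ^ 2 ≤ 0 := by
      by_contra hc
      push Not at hc
      nlinarith
    simpa using h2
  refine ⟨g, hgd, hgi, Subset.antisymm hgm.image_subset fun a ha ↦ ?_⟩
  by_contra hna
  have ha1 : ‖a‖ < 1 := by simpa using ha
  have hgn : ∀ z ∈ U, ‖g z‖ < 1 := fun z hz ↦ by simpa using hgm hz
  have hmd : DifferentiableOn ℂ (mob a ∘ g) U := fun z hz ↦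
    ((mob_hasDerivAt ha1 (hgn z hz).le).differentiableAt.comp z
        (hgd.differentiableAt (hU.mem_nhds hz))).differentiableWithinAt
  have hm0 : ∀ z ∈ U, (mob a ∘ g) z ≠ 0 := by
    intro z hz
    refine div_ne_zero (sub_ne_zero.2 fun h ↦ hna ⟨z, hz, h⟩) (mob_den ha1 (hgn z hz).le)
  obtain ⟨q, hqd, hq2⟩ := exists_sqrt hU hs hmd hm0
  have hqS : q ∈ S := by
    refine ⟨hqd, fun z hz ↦ ?_, fun z hz w hw h ↦ ?_⟩
    · have h1 : ‖(mob a ∘ g) z‖ < 1 := by simpa using mob_mapsTo ha1 (hgm hz)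
      rw [← hq2 z hz, norm_pow] at h1
      rw [mem_ball, dist_zero_right]
      nlinarith [norm_nonneg (q z)]
    · refine hgi hz hw (mob_inj ha1 (hgm hz) (hgm hw) ?_)
      have := hq2 z hz
      rw [h, hq2 w hw] at this
      exact this.symm
  have hq1 := hcomp q hqS
  have hqn : ‖q z0‖ ^ 2 = ‖a‖ := by
    rw [← norm_pow, hq2 z0 hz0]; simp [hg0, mob]
  have hdq : 2 * ‖q z0‖ * ‖deriv q z0‖ = (1 - ‖a‖ ^ 2) * ‖deriv g z0‖ := by
    have e1 := ((hqd.differentiableAt (hU.mem_nhds hz0)).hasDerivAt.pow 2).deriv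
    have e2 := ((mob_hasDerivAt ha1 (hgn z0 hz0).le).comp z0 (hgd.differentiableAt (hU.mem_nhds hz0)).hasDerivAt).deriv
    have e3 : deriv (q ^ 2) z0 = deriv (mob a ∘ g) z0 := by
      apply Filter.EventuallyEq.deriv_eq
      filter_upwards [hU.mem_nhds hz0] with z hz using hq2 z hz
    rw [e1, e2] at e3
    have := congrArg norm e3
    simpa [hg0, norm_one_sub_conj_mul_self ha1.le] using this
  have hqlt : ‖q z0‖ < 1 := by simpa using hqS.2.1 hz0
  set t := ‖q z0‖
  rw [hqn] at hq1
  rw [← hqn] at hq1 hdq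
  have ht0 : 0 ≤ t := norm_nonneg _
  have hk : (1 - (t ^ 2) ^ 2) * ‖deriv g z0‖ ≤ 2 * t * (‖deriv g z0‖ * (1 - t ^ 2)) := by
    rw [← hdq]; exact mul_le_mul_of_nonneg_left hq1 pvt
  have : 0 < ‖deriv g z0‖ * ((1 - t ^ 2) * (1 - t) ^ 2) := by
    have : 0 < 1 - t := by linarith
    have : 0 < 1 - t ^ 2 := by nlinarith
    positivity
  nlinarith

lemma riemann_bdry {U : Set ℂ} (hU : IsOpen U) (hbd : Bornology.IsBounded U) {φ : ℂ → ℂ}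
    (hd : DifferentiableOn ℂ φ U) (hi : InjOn φ U) (him : φ '' U = ball 0 1) {ε : ℝ} (hε : 0 < ε) :
    ∃ η, 0 < η ∧ ∀ z ∈ U, infDist z (frontier U) < η → 1 - ε < ‖φ z‖ := by
  set ψ := Function.invFunOn φ U
  have hψ : ∀ z ∈ U, ψ (φ z) = z := fun z hz ↦ hi.leftInvOn_invFunOn hz
  have hψc : ContinuousOn ψ (ball 0 1) := by
    intro w hw
    rw [← him] at hw
    obtain ⟨z, hz, rfl⟩ := hw
    apply ContinuousAt.continuousWithinAt
    intro V hV
    rw [hψ z hz] at hV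
    have hs : HasStrictDerivAt φ (deriv φ z) z := (hd.analyticAt (hU.mem_nhds hz)).hasStrictDerivAt
    have := hs.map_nhds_eq (deriv_ne_zero_of_injOn hU hd hi hz)
    rw [Filter.mem_map, ← this, Filter.mem_map]
    filter_upwards [hV, hU.mem_nhds hz] with w hw hwU
    simpa [hψ w hwU] using hw
  have hK : IsCompact (ψ '' closedBall 0 (1 - ε)) :=
    (isCompact_closedBall _ _).image_of_continuousOn (hψc.mono (closedBall_subset_ball lnr))
  have hKU : ψ '' closedBall 0 (1 - ε) ⊆ U := by
    rintro _ ⟨w, hw, rfl⟩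
    have : w ∈ φ '' U := him ▸ closedBall_subset_ball lnr hw
    exact Function.invFunOn_mem this
  have hdis : Disjoint (ψ '' closedBall 0 (1 - ε)) (frontier U) := by
    rw [Set.disjoint_left]
    intro z hz hz'
    rw [hU.frontier_eq] at hz'
    exact hz'.2 (hKU hz)
  obtain ⟨η, hη, hηd⟩ := hdis.exists_thickenings hK isClosed_frontier
  refine ⟨η, hη, fun z hz hzd ↦ ?_⟩
  by_contra hcon
  push Not at hcon
  have hzK : z ∈ ψ '' closedBall 0 (1 - ε) := ⟨φ z, by simpa using hcon, hψ z hz⟩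
  have hne : (frontier U).Nonempty := by
    by_contra hemp
    rw [Set.not_nonempty_iff_eq_empty, ← isClopen_iff_frontier_eq_empty] at hemp
    rcases isClopen_iff.1 hemp with h | h
    · exact (Set.ext_iff.1 h z).1 hz
    rw [h] at hbd
    exact NoncompactSpace.noncompact_univ (X := ℂ) (Metric.isCompact_of_isClosed_isBounded isClosed_univ hbd)
  refine Set.disjoint_left.1 hηd (self_subset_thickening hη _ hzK) ?_
  rw [mem_thickening_iff_infDist_lt hne]
  exact hzd

lemma glue {U S : Set ℂ} (hU : IsOpen U) {f : ℂ → ℂ} (hS : U ⊆ closure S)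
    (h : ∀ z ∈ U, ∃ r > 0, ∃ g : ℂ → ℂ, DifferentiableOn ℂ g (ball z r) ∧ ∀ w ∈ ball z r, w ∈ S → g w = f w) :
    ∃ F : ℂ → ℂ, DifferentiableOn ℂ F U ∧ ∀ z ∈ U, z ∈ S → F z = f z := by
  choose! r hr g hg hgf using h
  have key : ∀ z ∈ U, ∀ w ∈ ball z (r z), w ∈ U → g w w = g z w := by
    intro z hz w hw hwU
    have h1 : ContinuousAt (g w) w :=
      ((hg w hwU).differentiableAt (ball_mem_nhds w (hr w hwU))).continuousAt
    have h2 : ContinuousAt (g z) w :=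
      ((hg z hz).differentiableAt (isOpen_ball.mem_nhds hw)).continuousAt
    have hnb : NeBot (nhdsWithin w S) := mem_closure_iff_nhdsWithin_neBot.1 (hS hwU)
    refine tendsto_nhds_unique (l := nhdsWithin w S) (h1.tendsto.mono_left nhdsWithin_le_nhds)
      ((h2.tendsto.mono_left nhdsWithin_le_nhds).congr' ?_)
    filter_upwards [self_mem_nhdsWithin, nhdsWithin_le_nhds (isOpen_ball.mem_nhds hw),
      nhdsWithin_le_nhds (ball_mem_nhds w (hr w hwU))] with x hx h3 h4
    rw [hgf z hz x h3 hx, hgf w hwU x h4 hx]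
  refine ⟨fun z ↦ g z z, fun z hz ↦ ?_, fun z hz hzS ↦ hgf z hz z (mem_ball_self (hr z hz)) hzS⟩
  have : DifferentiableAt ℂ (g z) z := (hg z hz).differentiableAt (ball_mem_nhds z (hr z hz))
  refine (this.congr_of_eventuallyEq ?_).differentiableWithinAt
  filter_upwards [ball_mem_nhds z (hr z hz), hU.mem_nhds hz] with w hw hwU
  exact key z hz w hw hwU

lemma morera_axis {x0 : ℂ} {r : ℝ} {f : ℂ → ℂ} (hc : ContinuousOn f (ball x0 r))
    (hd : ∀ z ∈ ball x0 r, z.im ≠ 0 → DifferentiableAt ℂ f z) : DifferentiableOn ℂ f (ball x0 r) := by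
  have hcons : IsConservativeOn f (ball x0 r) := by
    intro z w hzw
    rw [← add_eq_zero_iff_eq_neg, wedgeIntegral_add_wedgeIntegral_eq]
    have hcr : ContinuousOn f ((uIcc z.re w.re) ×ℂ (uIcc z.im w.im)) := hc.mono hzw
    have main : ∀ y1 y2 : ℝ, (uIcc y1 y2) ⊆ (uIcc z.im w.im) → 0 ∉ Ioo (min y1 y2) (max y1 y2) →
        (∫ x : ℝ in z.re..w.re, f (x + y1 * I)) - (∫ x : ℝ in z.re..w.re, f (x + y2 * I)) +
        I • (∫ y : ℝ in y1..y2, f (w.re + y * I)) - I • (∫ y : ℝ in y1..y2, f (z.re + y * I)) = 0 := by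
      intro y1 y2 hy h0
      have := integral_boundary_rect_eq_zero_of_continuousOn_of_differentiableOn f
        (⟨z.re, y1⟩ : ℂ) (⟨w.re, y2⟩ : ℂ) (hcr.mono (fun u hu ↦ ⟨hu.1, hy hu.2⟩)) ?_
      · simpa using this
      · intro u hu
        have hu' : u ∈ ball x0 r := hzw ⟨Ioo_subset_Icc_self hu.1, hy (Ioo_subset_Icc_self hu.2)⟩
        refine (hd u hu' fun h ↦ h0 ?_).differentiableWithinAt
        have := hu.2
        simpa [h] using this
    by_cases h0 : zrR ∈ (uIcc z.im w.im)
    · have hs1 : (uIcc z.im 0) ⊆ (uIcc z.im w.im) := uIcc_subset_uIcc left_mem_uIcc h0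
      have hs2 : (uIcc 0 w.im) ⊆ (uIcc z.im w.im) := uIcc_subset_uIcc h0 right_mem_uIcc
      have h1 := main z.im 0 hs1 (by
        rintro ⟨h1, h2⟩; rcases le_total z.im 0 with h | h <;> simp [h] at h1 h2)
      have h2 := main 0 w.im hs2 (by
        rintro ⟨h1, h2⟩; rcases le_total w.im 0 with h | h <;> simp [h] at h1 h2)
      have hint : ∀ c ∈ (uIcc z.re w.re), ∀ y1 y2 : ℝ, (uIcc y1 y2) ⊆ (uIcc z.im w.im) →
          IntervalIntegrable (fun y : ℝ ↦ f ((c : ℂ) + y * I)) volume y1 y2 := by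
        intro c hcc y1 y2 hy
        apply ContinuousOn.intervalIntegrable
        refine hcr.comp bfp fun y hy' ↦ ?_
        constructor
        · simpa using hcc
        · simpa using hy hy'
      rw [← intervalIntegral.integral_add_adjacent_intervals (hint w.re right_mem_uIcc _ _ hs1)
          (hint w.re right_mem_uIcc _ _ hs2),
        ← intervalIntegral.integral_add_adjacent_intervals (hint z.re left_mem_uIcc _ _ hs1)
          (hint z.re left_mem_uIcc _ _ hs2)]
      simp only [smul_eq_mul] at h1 h2 ⊢
      linear_combination h1 + h2
    · exact main _ _ subset_rfl fun h ↦ h0 (Ioo_subset_Icc_self h)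
  exact (hcons.isExactOn_ball hc).differentiableOn isOpen_ball

lemma vert {f f' : ℝ → ℂ} {E E' : ℝ → ℝ} {a b : ℝ} (hab : a ≤ b)
    (hf : ∀ t ∈ Icc a b, HasDerivAt f (f' t) t) (hE : ∀ t ∈ Icc a b, HasDerivAt E (E' t) t)
    (hle : ∀ t ∈ Icc a b, ‖f' t‖ ≤ E' t) : ‖f b - f a‖ ≤ E b - E a := by
  have := image_norm_le_of_norm_deriv_right_le_deriv_boundary' (f := fun t ↦ f t - f a) (f' := f')
    (a := a) (b := b) (B := fun t ↦ E t - E a) (B' := E')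
    (fun t ht ↦ ((hf t ht).sub_const _).continuousAt.continuousWithinAt)
    (fun t ht ↦ ((hf t (Ico_subset_Icc_self ht)).sub_const _).hasDerivWithinAt)
    bsp
    (fun t ht ↦ ((hE t ht).sub_const _).continuousAt.continuousWithinAt)
    (fun t ht ↦ ((hE t (Ico_subset_Icc_self ht)).sub_const _).hasDerivWithinAt)
    (fun t ht ↦ hle t (Ico_subset_Icc_self ht))
  exact this (right_mem_Icc.2 hab)

def Box (x0 r : ℝ) : Set ℂ := Ioo (x0 - r) (x0 + r) ×ℂ Ioo 0 r

lemma mem_Box {x0 r : ℝ} {z : ℂ} : z ∈ Box x0 r ↔ (x0 - r < z.re ∧ z.re < x0 + r) ∧ 0 < z.im ∧ z.im < r :=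
  Iff.rfl

lemma isOpen_Box {x0 r : ℝ} : IsOpen (Box x0 r) := isOpen_Ioo.reProdIm isOpen_Ioo

lemma hasDerivAt_vline (x t : ℝ) : HasDerivAt (fun t : ℝ ↦ (x : ℂ) + t * I) I t := by
  simpa using ((Complex.ofRealCLM.hasDerivAt (x := t)).mul_const I).const_add (x : ℂ)

lemma hasDerivAt_hline (y t : ℝ) : HasDerivAt (fun t : ℝ ↦ (t : ℂ) + y * I) 1 t := by
  simpa using (Complex.ofRealCLM.hasDerivAt (x := t)).add_const ((y : ℂ) * I)

lemma reflect_growth {x0 r A : ℝ} (hr : 0 < r) {s : ℂ → ℂ} (hs : DifferentiableOn ℂ s (Box x0 r))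
    (hA : ∀ z ∈ Box x0 r, ‖deriv s z‖ ≤ A / z.im) :
    ∃ C1, 0 ≤ C1 ∧ ∀ x y : ℝ, |x - x0| < r / 2 → 0 < y → y ≤ r / 2 → ‖s (x + y * I)‖ ≤ C1 / √y := by
  have hmem : ∀ x y : ℝ, |x - x0| ≤ r / 2 → 0 < y → y ≤ r / 2 → (x + y * I : ℂ) ∈ Box x0 r := by
    intro x y hx hy hy'
    rw [abs_le] at hx
    rw [mem_Box]
    simp
    constructor <;> constructor <;> linarith
  have hA0 : 0 ≤ A := by
    have := (nng).trans (hA _ (hmem x0 (r / 2) (by simp; linarith) lnr le_rfl))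
    simp at this
    by_contra h
    push Not at h
    have := div_neg_of_neg_of_pos h (half_pos hr)
    linarith
  have hcomp : IsCompact ((fun x : ℝ ↦ (x : ℂ) + (r / 2 : ℝ) * I) '' Icc (x0 - r / 2) (x0 + r / 2)) :=
    isCompact_Icc.image bfp
  have hcont : ContinuousOn s ((fun x : ℝ ↦ (x : ℂ) + (r / 2 : ℝ) * I) '' Icc (x0 - r / 2) (x0 + r / 2)) := by
    refine hs.continuousOn.mono ?_
    rintro _ ⟨x, hx, rfl⟩
    exact hmem x (r / 2) (by rw [abs_le]; constructor <;> linarith [hx.1, hx.2]) lnr le_rfl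
  obtain ⟨C0, hC0⟩ := hcomp.exists_bound_of_continuousOn hcont
  refine ⟨max C0 0 * √r + 2 * A * √r, by positivity, fun x y hx hy hy' ↦ ?_⟩
  have hb : ‖s (x + (r / 2 : ℝ) * I)‖ ≤ max C0 0 :=
    (hC0 _ ⟨x, by rw [abs_lt] at hx; constructor <;> linarith, rfl⟩).trans (le_max_left _ _)
  have hv := vert (f := fun t : ℝ ↦ s (x + t * I)) (f' := fun t ↦ deriv s (x + t * I) * I)
    (E := fun t ↦ -(2 * A * √r * (√t)⁻¹)) (E' := fun t ↦ -(2 * A * √r * (-(1 / (2 * √t)) / √t ^ 2))) (a := y) (b := r / 2)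
    hy' ?_ ?_ ?_
  · have h1 : ‖s (x + y * I)‖ ≤ ‖s (x + (r / 2 : ℝ) * I)‖ + ‖s (x + (r / 2 : ℝ) * I) - s (x + y * I)‖ := by
      have := norm_sub_le (s (x + (r / 2 : ℝ) * I)) (s (x + (r / 2 : ℝ) * I) - s (x + y * I))
      simpa using this
    have hsy : 0 < √y := Real.sqrt_pos.2 hy
    have h2 : 1 ≤ √r * (√y)⁻¹ := by
      rw [← div_eq_mul_inv, le_div_iff₀ hsy, one_mul]
      exact Real.sqrt_le_sqrt lnr
    have h3 : 0 ≤ 2 * A * √r * (√(r / 2))⁻¹ := by positivity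
    have h4 : max C0 0 * 1 ≤ max C0 0 * (√r * (√y)⁻¹) := by gcongr
    rw [div_eq_mul_inv]
    calc _ ≤ _ := h1
      _ ≤ max C0 0 + 2 * A * √r * (√y)⁻¹ := by linarith
      _ ≤ _ := by linarith
  · intro t ht
    have := (hs.differentiableAt (isOpen_Box.mem_nhds (hmem x t hx.le (by linarith [ht.1]) ht.2))).hasDerivAt.comp_of_eq t (hasDerivAt_vline x t) rfl
    exact this
  · intro t ht
    have ht0 : 0 < t := by linarith [ht.1]
    exact (((Real.hasDerivAt_sqrt ht0.ne').inv (Real.sqrt_pos.2 ht0).ne').const_mul (2 * A * √r)).neg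
  · intro t ht
    have ht0 : 0 < t := by linarith [ht.1]
    rw [norm_mul, norm_I, mul_one]
    refine (hA _ (hmem x t hx.le ht0 ht.2)).trans ?_
    simp only [add_im, ofReal_im, mul_im, ofReal_re, I_im, mul_one, I_re, mul_zero, add_zero, zero_add]
    have hst : 0 < √t := Real.sqrt_pos.2 ht0
    have h2 : √t ≤ √r := Real.sqrt_le_sqrt (by linarith [ht.2])
    have h3 : √t ^ 2 = t := Real.sq_sqrt ht0.le
    rw [h3]
    have : -(2 * A * √r * (-(1 / (2 * √t)) / t)) = A / t * (√r / √t) := by field_simp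
    rw [this]
    exact le_mul_of_one_le_right pvt ((one_le_div hst).2 h2)

lemma reflect {x0 r A : ℝ} (hr : 0 < r) {s : ℂ → ℂ} (hs : DifferentiableOn ℂ s (Box x0 r))
    (hA : ∀ z ∈ Box x0 r, ‖deriv s z‖ ≤ A / z.im)
    (h0 : ∀ ε > 0, ∃ η > 0, ∀ z ∈ Box x0 r, z.im < η → |(s z).re| ≤ ε) :
    ∃ S : ℂ → ℂ, DifferentiableOn ℂ S (ball (x0 : ℂ) (r / 2)) ∧
      (∀ z ∈ ball (x0 : ℂ) (r / 2), 0 < z.im → S z = s z) ∧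
      (∀ z ∈ ball (x0 : ℂ) (r / 2), z.im < 0 → S z = - cnj (s (cnj z))) := by
  obtain ⟨C1, hC10, hC1⟩ := reflect_growth hr hs hA
  have hmem : ∀ x y : ℝ, |x - x0| < r / 2 → 0 < y → y ≤ r / 2 → (x + y * I : ℂ) ∈ Box x0 r := by
    intro x y hx hy hy'
    rw [abs_lt] at hx
    rw [mem_Box]
    simp
    constructor <;> constructor <;> linarith
  have hconv : Convex ℝ (Box x0 r) := 
    ((convex_Ioo _ _).linear_preimage Complex.reLm).inter ((convex_Ioo _ _).linear_preimage Complex.imLm)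
  obtain ⟨T, hT⟩ := hconv.exists_forall_hasDerivWithinAt hs
  replace hT : ∀ z ∈ Box x0 r, HasDerivAt T (s z) z := fun z hz ↦
    (hT z hz).hasDerivAt (isOpen_Box.mem_nhds hz)
  have hTv : ∀ x y1 y2 : ℝ, |x - x0| < r / 2 → 0 < y1 → y1 ≤ y2 → y2 ≤ r / 2 →
      ‖T (x + y2 * I) - T (x + y1 * I)‖ ≤ 2 * C1 * √y2 - 2 * C1 * √y1 := by
    intro x y1 y2 hx h1 h2 h3
    refine vert (f := fun t : ℝ ↦ T (x + t * I)) (f' := fun t ↦ s (x + t * I) * I)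
      (E := fun t ↦ 2 * C1 * √t) (E' := fun t ↦ 2 * C1 * (1 / (2 * √t))) h2 ?_ ?_ ?_
    · intro t ht
      exact (hT _ (hmem x t hx (by linarith [ht.1]) (by linarith [ht.2]))).comp_of_eq t (hasDerivAt_vline x t) rfl
    · intro t ht
      exact (Real.hasDerivAt_sqrt (by linarith [ht.1])).const_mul _
    · intro t ht
      rw [norm_mul, norm_I, mul_one]
      refine (hC1 x t hx (by linarith [ht.1]) (by linarith [ht.2])).trans (le_of_eq ?_)
      field_simp
  have hB : ∀ x : ℝ, ∃ b : ℂ, |x - x0| < r / 2 → ∀ y : ℝ, 0 < y → y ≤ r / 2 → ‖T (x + y * I) - b‖ ≤ 2 * C1 * √y := by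
    intro x
    by_cases hx : |x - x0| < r / 2
    swap
    · exact ⟨0, fun h ↦ absurd h hx⟩
    have hcau : CauchySeq (fun n : ℕ ↦ T (x + ((r / 2 / (n + 1) : ℝ)) * I)) := by
      refine cauchySeq_of_le_tendsto_0 (fun n : ℕ ↦ 2 * (2 * C1 * √(r / 2 / (n + 1)))) ?_ ?_
      · intro n m N hn hm
        have key : ∀ k : ℕ, N ≤ k → ‖T (x + ((r / 2 / (N + 1) : ℝ)) * I) - T (x + ((r / 2 / (k + 1) : ℝ)) * I)‖ ≤ 2 * C1 * √(r / 2 / (N + 1)) := by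
          intro k hk
          have h1 : (N : ℝ) ≤ k := by exact_mod_cast hk
          have h0 : zrR ≤ N := by positivity
          have := hTv x (r / 2 / (k + 1)) (r / 2 / (N + 1)) hx pvt (by gcongr)
            (div_le_self pvt lnr)
          have h5 : 0 ≤ 2 * C1 * √(r / 2 / (k + 1)) := by positivity
          linarith
        rw [dist_eq_norm]
        have h1 := key n hn
        have h2 := key m hm
        have := norm_sub_le (T (x + ((r / 2 / (N + 1) : ℝ)) * I) - T (x + ((r / 2 / (m + 1) : ℝ)) * I)) (T (x + ((r / 2 / (N + 1) : ℝ)) * I) - T (x + ((r / 2 / (n + 1) : ℝ)) * I))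
        rw [sub_sub_sub_cancel_left] at this
        linarith
      · have : Tendsto (fun n : ℕ ↦ r / 2 / ((n : ℝ) + 1)) atTop nh0 :=
          tendsto_const_nhds.div_atTop (tendsto_atTop_add_const_right _ _ tendsto_natCast_atTop_atTop)
        have h2 := ((Real.continuous_sqrt.tendsto _).comp this).const_mul (2 * C1)
        have h3 := h2.const_mul 2
        simpa using h3
    obtain ⟨b, hb⟩ := cauchySeq_tendsto_of_complete hcau
    refine ⟨b, fun _ y hy hy' ↦ ?_⟩
    have hlim := (tendsto_const_nhds (x := T (x + y * I))).sub hb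
    refine le_of_tendsto hlim.norm ?_
    have : Tendsto (fun n : ℕ ↦ r / 2 / ((n : ℝ) + 1)) atTop nh0 :=
          tendsto_const_nhds.div_atTop (tendsto_atTop_add_const_right _ _ tendsto_natCast_atTop_atTop)
    filter_upwards [this.eventually (gt_mem_nhds hy)] with n hn
    have := hTv x (r / 2 / (n + 1)) y hx pvt hn.le hy'
    have h5 : 0 ≤ 2 * C1 * √(r / 2 / (n + 1)) := by positivity
    linarith
  choose B hB using hB
  have hsq : ∀ ε > 0, ∃ δ > 0, ∀ y : ℝ, 0 < y → y < δ → 2 * C1 * √y < ε := by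
    intro ε hε
    have : Tendsto (fun y : ℝ ↦ 2 * C1 * √y) nh0 (nhds (2 * C1 * √0)) :=
      (Real.continuous_sqrt.tendsto _).const_mul _
    rw [Real.sqrt_zero, mul_zero, Metric.tendsto_nhds_nhds] at this
    obtain ⟨δ, hδ, h⟩ := this ε hε
    refine ⟨δ, hδ, fun y hy hyδ ↦ ?_⟩
    have := h (x := y) (by simpa [abs_of_pos hy] using hyδ)
    rw [Real.dist_eq, sub_zero] at this
    exact (le_abs_self _).trans_lt this
  have hBre : ∀ x1 x2 : ℝ, x1 ≤ x2 → |x1 - x0| < r / 2 → |x2 - x0| < r / 2 → (B x1).re = (B x2).re := by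
    intro x1 x2 h12 hx1 hx2
    have hkey : ∀ ε > 0, |(B x2).re - (B x1).re| ≤ ε * (x2 - x1) + 2 * ε := by
      intro ε hε
      obtain ⟨η, hη, hη'⟩ := h0 ε hε
      obtain ⟨δ, hδ, hδ'⟩ := hsq ε hε
      set y := min (min (η / 2) (δ / 2)) (r / 2) with hy
      have hy0 : 0 < y := by rw [hy]; positivity
      have hyr : y ≤ r / 2 := min_le_right _ _
      have hyη : y < η := by have := (mnl).trans mnl (a := y); linarith
      have hyδ : y < δ := by have := (mnl).trans mnr (a := y); linarith
      have hv := vert (f := fun t : ℝ ↦ (((T (t + y * I)).re : ℝ) : ℂ)) (f' := fun t ↦ (((s (t + y * I)).re : ℝ) : ℂ))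
        (E := fun t ↦ ε * t) (E' := fun t ↦ ε) h12 ?_ ?_ ?_
      · have e1 := (Complex.abs_re_le_norm _).trans (hB x1 hx1 y hy0 hyr)
        have e2 := (Complex.abs_re_le_norm _).trans (hB x2 hx2 y hy0 hyr)
        have e3 := hδ' y hy0 hyδ
        simp only [← ofReal_sub, norm_real, rna] at hv
        rw [sub_re] at e1 e2
        rw [abs_le] at *
        constructor <;> linarith
      · intro t ht
        have htx : |t - x0| < r / 2 := by
          rw [abs_lt] at *; constructor <;> linarith [ht.1, ht.2]
        have h1 : HasDerivAt (fun t : ℝ ↦ T (t + y * I)) (s (t + y * I)) t := by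
          have := (hT _ (hmem t y htx hy0 hyr)).comp_of_eq t (hasDerivAt_hline y t) rfl
          rw [mul_one] at this
          exact this
        exact (Complex.reCLM.hasFDerivAt.comp_hasDerivAt t h1).ofReal_comp
      · intro t ht
        simpa using (hasDerivAt_id t).const_mul ε
      · intro t ht
        have htx : |t - x0| < r / 2 := by
          rw [abs_lt] at *; constructor <;> linarith [ht.1, ht.2]
        simpa using hη' _ (hmem t y htx hy0 hyr) (by simpa using hyη)
    have : |(B x2).re - (B x1).re| ≤ 0 := by
      refine le_of_forall_pos_le_add fun ε hε ↦ ?_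
      have hp : 0 < x2 - x1 + 2 := by linarith
      have := hkey (ε / (x2 - x1 + 2)) pvt
      have e : ε / (x2 - x1 + 2) * (x2 - x1) + 2 * (ε / (x2 - x1 + 2)) = ε := by field_simp
      linarith
    have := abs_nonpos_iff.1 this
    linarith
  have hx00 : |x0 - x0| < r / 2 := by simp; linarith
  set b : ℝ := (B x0).re with hb
  have hBb : ∀ x : ℝ, |x - x0| < r / 2 → (B x).re = b := by
    intro x hx
    rcases le_total x x0 with h | h
    · exact hBre _ _ h hx hx00
    · exact (hBre _ _ h hx00 hx).symm
  set T2 : ℂ → ℂ := fun z ↦ if 0 < z.im then T z - b else if z.im = 0 then B z.re - b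
    else - cnj (T (cnj z) - b) with hT2
  have hball : ∀ z ∈ ball (x0 : ℂ) (r / 2), |z.re - x0| < r / 2 ∧ |z.im| < r / 2 := by
    intro z hz
    rw [mem_ball, dist_eq_norm] at hz
    have h1 := abs_re_le_norm (z - x0)
    have h2 := abs_im_le_norm (z - x0)
    simp at h1 h2
    constructor <;> linarith
  have hBox : ∀ z ∈ ball (x0 : ℂ) (r / 2), 0 < z.im → z ∈ Box x0 r := by
    intro z hz hz'
    obtain ⟨h1, h2⟩ := hball z hz
    have := hmem z.re z.im h1 hz' (by rw [abs_lt] at h2; exact h2.2.le)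
    rwa [re_add_im] at this
  have hcball : ∀ z ∈ ball (x0 : ℂ) (r / 2), cnj z ∈ ball (x0 : ℂ) (r / 2) := by
    intro z hz
    rw [mem_ball, dist_eq_norm] at *
    rw [← conj_ofReal x0, ← map_sub, norm_conj]
    exact hz
  have hclose : ∀ z ∈ ball (x0 : ℂ) (r / 2), ‖T2 z - (B z.re - b)‖ ≤ 2 * C1 * √|z.im| := by
    intro z hz
    obtain ⟨h1, h2⟩ := hball z hz
    rw [abs_lt] at h2
    rcases lt_trichotomy z.im 0 with h | h | h
    · have e := hB z.re h1 (-z.im) lnr lnr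
      have : cnj z = z.re + ((-z.im : ℝ) : ℂ) * I := by apply cxe <;> simp
      simp only [hT2, h.not_gt, h.ne, if_false, this, abs_of_neg h]
      refine le_trans (le_of_eq ?_) e
      rw [← norm_conj (T _ - B z.re), ← norm_neg]
      congr 1
      have : B z.re - b = ((B z.re).im : ℂ) * I := by
        apply cxe <;> simp [hBb _ h1]
      have h4 : B z.re = b + ((B z.re).im : ℂ) * I := by rw [← this]; ring
      rw [this]
      conv_rhs => rw [h4]
      simp
      ring
    · simp [hT2, h]
    · have e := hB z.re h1 z.im h lnr
      rw [re_add_im] at e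
      simp only [hT2, h, if_true, abs_of_pos h]
      rwa [sub_sub_sub_cancel_right]
  have hBc : ∀ x : ℝ, |x - x0| < r / 2 → ContinuousAt B x := by
    intro x hx
    rw [Metric.continuousAt_iff]
    intro ε hε
    obtain ⟨δ, hδ, hδ'⟩ := hsq (ε / 3) pvt
    set y := min (δ / 2) (r / 2) with hy
    have hy0 : 0 < y := by rw [hy]; positivity
    have hyr : y ≤ r / 2 := min_le_right _ _
    have hyδ : y < δ := by have := min_le_left (δ / 2) (r / 2); linarith
    have hc : ContinuousAt (fun t : ℝ ↦ T (t + y * I)) x :=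
      ((hT _ (hmem x y hx hy0 hyr)).comp_of_eq x (hasDerivAt_hline y x) rfl).continuousAt
    rw [Metric.continuousAt_iff] at hc
    obtain ⟨δ2, hδ2, h2⟩ := hc (ε / 3) pvt
    refine ⟨min δ2 (r / 2 - |x - x0|), lt_min hδ2 lnr, fun {x'} hx' ↦ ?_⟩
    have hx'2 : |x' - x0| < r / 2 := by
      have e1 := hx'.trans_le mnr
      rw [Real.dist_eq] at e1
      have := abs_sub_le x' x x0
      linarith
    have e1 := h2 (hx'.trans_le mnl)
    have e2 := hB x hx y hy0 hyr
    have e3 := hB x' hx'2 y hy0 hyr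
    have e4 := hδ' y hy0 hyδ
    rw [← dist_eq_norm] at e2 e3
    have t1 := dist_triangle (B x') (T (x' + y * I)) (B x)
    have t2 := dist_triangle (T (x' + y * I)) (T (x + y * I)) (B x)
    rw [dist_comm] at e3
    linarith
  have hup : ∀ z ∈ ball (x0 : ℂ) (r / 2), 0 < z.im → HasDerivAt T2 (s z) z := by
    intro z hz hz'
    have := (hT z (hBox z hz hz')).sub_const (b : ℂ)
    refine this.congr_of_eventuallyEq ?_
    filter_upwards [(isOpen_lt continuous_const continuous_im).mem_nhds hz'] with w hw
    simp only [hT2]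
    rw [if_pos hw]
  have hdown : ∀ z ∈ ball (x0 : ℂ) (r / 2), z.im < 0 →
      HasDerivAt T2 (-cnj (s (cnj z))) z := by
    intro z hz hz'
    have h1 := (hT _ (hBox _ (hcball z hz) (by simpa using hz'))).sub_const (b : ℂ)
    have h2 := h1.conj_conj.neg
    rw [conj_conj] at h2
    refine h2.congr_of_eventuallyEq ?_
    filter_upwards [(isOpen_lt continuous_im continuous_const).mem_nhds hz'] with w hw
    have hw' : w.im < 0 := hw
    simp only [hT2]
    rw [if_neg hw'.not_gt, if_neg hw'.ne]
    rfl
  have hcont : ContinuousOn T2 (ball (x0 : ℂ) (r / 2)) := by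
    intro z hz
    apply ContinuousAt.continuousWithinAt
    rcases lt_trichotomy z.im 0 with h | h | h
    · exact (hdown z hz h).continuousAt
    · have h1 := (hball z hz).1
      have e0 : T2 z = B z.re - b := by simp [hT2, h]
      have hg : Tendsto (fun w : ℂ ↦ T2 w - (B w.re - b)) (nhds z) nh0 := by
        refine squeeze_zero_norm' (a := fun w : ℂ ↦ 2 * C1 * √|w.im|) ?_ ?_
        · filter_upwards [isOpen_ball.mem_nhds hz] with w hw using hclose w hw
        · have : Continuous (fun w : ℂ ↦ 2 * C1 * √|w.im|) := by fun_prop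
          have := this.tendsto z
          simpa [h] using this
      have hg2 : Tendsto (fun w : ℂ ↦ B w.re - b) (nhds z) (nhds (B z.re - b)) :=
        (Tendsto.comp (hBc z.re h1) (continuous_re.tendsto z)).sub_const _
      have := hg.add hg2
      rw [ContinuousAt, e0]
      simpa using this
    · exact (hup z hz h).continuousAt
  have hdiff := morera_axis hcont (fun z hz hz' ↦ by
    rcases lt_or_gt_of_ne hz' with h | h
    · exact (hdown z hz h).differentiableAt
    · exact (hup z hz h).differentiableAt)
  exact ⟨deriv T2, hdiff.deriv isOpen_ball, fun z hz hz' ↦ (hup z hz hz').deriv,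
    fun z hz hz' ↦ (hdown z hz hz').deriv⟩

def bb (x : ℝ) : ℝ := x * (1 - x)

def Lens (c : ℝ) : Set ℂ := {z | |z.im| < c * bb z.re}

lemma bb_lip (x y : ℝ) (hx : x ∈ I01) : bb x - |x - y| - |x - y| ^ 2 ≤ bb y := by
  have h1 := hx.1
  have h2 := hx.2
  unfold bb
  rcases abs_cases (x - y) with ⟨h, h'⟩ | ⟨h, h'⟩ <;> rw [h] <;> nlinarith

lemma bb_lip2 (x y : ℝ) (hx : x ∈ I01) (hy : y ∈ I01) : |bb x - bb y| ≤ |x - y| := by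
  have : bb x - bb y = (x - y) * (1 - x - y) := by unfold bb; ring
  rw [this, abs_mul]
  refine mul_le_of_le_one_right (abs_nonneg _) (abs_le.2 ?_)
  constructor <;> linarith [hx.1, hx.2, hy.1, hy.2]

lemma bb_le (x : ℝ) : bb x ≤ 1 / 4 := by unfold bb; nlinarith [sq_nonneg (x - 1 / 2)]

lemma bb_pos {x : ℝ} (hx : x ∈ O01) : 0 < bb x := mul_pos hx.1 (by linarith [hx.2])

lemma of_bb_pos {x : ℝ} (hx : 0 < bb x) : x ∈ O01 := by
  unfold bb at hx
  constructor
  · by_contra h; push Not at h; nlinarith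
  · by_contra h; push Not at h; nlinarith

lemma isOpen_Lens {c : ℝ} : IsOpen (Lens c) := by
  unfold Lens bb
  exact isOpen_lt bfp bfp

lemma Lens_bb {c : ℝ} (hc : 0 < c) {z : ℂ} (hz : z ∈ Lens c) : 0 < bb z.re :=
  pos_of_mul_pos_right ((abs_nonneg _).trans_lt hz) hc.le

lemma convex_Lens {c : ℝ} (hc : 0 < c) : Convex ℝ (Lens c) := by
  intro z hz w hw a b ha hb hab
  have h1 : |(a • z + b • w).im| ≤ a * |z.im| + b * |w.im| := by
    simp
    exact (abs_add_le _ _).trans (by rw [abs_mul, abs_mul, abs_of_nonneg ha, abs_of_nonneg hb])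
  have h2 : a * bb z.re + b * bb w.re ≤ bb (a • z + b • w).re := by
    have : a = 1 - b := by linarith
    subst this
    simp [bb]
    nlinarith [mul_nonneg (mul_nonneg ha hb) (sq_nonneg (z.re - w.re))]
  have h3 : a * |z.im| + b * |w.im| < c * (a * bb z.re + b * bb w.re) := by
    have hz' : |z.im| < c * bb z.re := hz
    have hw' : |w.im| < c * bb w.re := hw
    rcases ha.eq_or_lt with h | h
    · have : b = 1 := by linarith
      subst h; subst this; simpa using hw'
    · nlinarith
  calc _ ≤ _ := h1
    _ < _ := h3
    _ ≤ _ := by gcongr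

lemma Lens_ball {c : ℝ} (hc : 0 < c) (hc1 : c ≤ 1) {z w : ℂ} (hz : z ∈ Lens (c / 2))
    (hw : ‖w - z‖ ≤ c / 6 * bb z.re) : w ∈ Lens c ∧ bb z.re / 2 ≤ bb w.re ∧ bb w.re ≤ 2 * bb z.re := by
  have hb := Lens_bb (half_pos hc) hz
  have hz01 := of_bb_pos hb
  have h1 := (abs_re_le_norm (w - z)).trans hw
  have h2 := (abs_im_le_norm (w - z)).trans hw
  rw [sub_re] at h1
  rw [sub_im] at h2
  have hb4 := bb_le z.re
  have hz' : |z.im| < c / 2 * bb z.re := hz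
  have h3 := bb_lip z.re w.re ⟨hz01.1.le, hz01.2.le⟩
  rw [abs_sub_comm] at h3
  have hR : c / 6 * bb z.re ≤ bb z.re / 6 := by nlinarith
  have h4 : |w.re - z.re| ^ 2 ≤ bb z.re / 6 * |w.re - z.re| := by
    rw [sq]; exact mul_le_mul_of_nonneg_right (h1.trans hR) (abs_nonneg _)
  have h0 := abs_nonneg (w.re - z.re)
  have hlow : 19 / 24 * bb z.re ≤ bb w.re := by nlinarith
  refine ⟨?_, by linarith, ?_⟩
  · have h5 : |w.im| ≤ |z.im| + |w.im - z.im| := by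
      have := abs_add_le z.im (w.im - z.im); simpa using this
    show |w.im| < c * bb w.re
    nlinarith
  · have hw01 := of_bb_pos (by linarith : 0 < bb w.re)
    have := bb_lip2 w.re z.re ⟨hw01.1.le, hw01.2.le⟩ ⟨hz01.1.le, hz01.2.le⟩
    have := (le_abs_self _).trans this
    linarith

lemma Lens_ofReal {c : ℝ} (hc : 0 < c) {x : ℝ} (hx : x ∈ O01) : (x : ℂ) ∈ Lens c := by
  show |(x : ℂ).im| < c * bb (x : ℂ).re
  simpa using mul_pos hc (bb_pos hx)

lemma Lens_conj {c : ℝ} {z : ℂ} : cnj z ∈ Lens c ↔ z ∈ Lens c := by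
  simp [Lens]

lemma Lens_mono {c d : ℝ} (hc : 0 < c) (h : c ≤ d) : Lens c ⊆ Lens d := fun z hz ↦ by
  have h1 := Lens_bb hc hz
  show |z.im| < d * bb z.re
  exact lt_of_lt_of_le hz (by gcongr)

lemma deriv_le_of_re_le {s : ℂ → ℂ} {z : ℂ} {R m : ℝ} (hR : 0 < R) (hm : 0 < m)
    (hs : DifferentiableOn ℂ s (ball z R)) (hre : ∀ w ∈ ball z R, |(s w).re| ≤ m) :
    ‖deriv s z‖ ≤ 18 * m / R := by
  set F : ℂ → ℂ := fun w ↦ exp (s w / m)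
  have hFd : DifferentiableOn ℂ F (ball z R) := (hs.div_const _).cexp
  have hn : ∀ w, ‖F w‖ = rex ((s w).re / m) := by
    intro w
    rw [norm_exp]
    simp
  have hup : ∀ w ∈ ball z R, ‖F w‖ ≤ rex 1 := by
    intro w hw
    rw [hn]
    apply Real.exp_le_exp.2
    rw [div_le_one hm]
    exact (le_abs_self _).trans (hre w hw)
  have hlow : rex (-1) ≤ ‖F z‖ := by
    rw [hn]
    apply Real.exp_le_exp.2
    rw [le_div_iff₀ hm]
    have := neg_abs_le (s z).re
    have := hre z (mem_ball_self hR)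
    linarith
  have hz : DifferentiableAt ℂ s z := hs.differentiableAt (ball_mem_nhds z hR)
  have hder : deriv F z = F z * (deriv s z / m) := by
    have := (hz.hasDerivAt.div_const (m : ℂ)).cexp
    exact this.deriv
  have hc : ‖deriv F z‖ ≤ rex 1 / (R / 2) := by
    refine norm_deriv_le_of_forall_mem_sphere_norm_le (half_pos hR) ?_ ?_
    · refine (hFd.mono ?_).diffContOnCl_ball (U := ball z R) ?_
      · exact subset_rfl
      · exact closedBall_subset_ball lnr
    · intro w hw
      exact hup w (sphere_subset_closedBall.trans (closedBall_subset_ball lnr) hw)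
  rw [hder, norm_mul, norm_div, norm_real, rnn hm.le] at hc
  have h1 : rex (-1) * (‖deriv s z‖ / m) ≤ rex 1 / (R / 2) :=
    (mul_le_mul_of_nonneg_right hlow pvt).trans hc
  have he : rex 1 * rex 1 ≤ 9 := by
    have := Real.exp_one_lt_three
    have := rxq 1
    nlinarith
  rw [Real.exp_neg] at h1
  have he0 := rxq 1
  have h2 : ‖deriv s z‖ / m ≤ rex 1 * (rex 1 / (R / 2)) := by
    rw [inv_mul_le_iff₀ he0] at h1
    exact h1
  rw [div_le_iff₀ hm] at h2
  calc _ ≤ _ := h2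
    _ = (rex 1 * rex 1) * (2 * m / R) := by field_simp
    _ ≤ 9 * (2 * m / R) := by gcongr
    _ = _ := by ring

lemma hopf {f : ℂ → ℂ} {x ρ : ℝ} (hρ : 0 < ρ) (hf : DifferentiableOn ℂ f (ball ((x : ℂ) + ρ * I) ρ))
    (hpos : ∀ z ∈ ball ((x : ℂ) + ρ * I) ρ, 0 < (f z).re) :
    ∃ t, 0 < t ∧ ∀ y : ℝ, 0 < y → y < ρ → t * y ≤ (f (x + y * I)).re := by
  set c : ℂ := (x : ℂ) + ρ * I
  set f0 := f c
  have hf0 : 0 < f0.re := hpos c (mem_ball_self hρ)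
  set F : ℂ → ℂ := fun w ↦ (f w - f0) / (f w + cnj f0)
  have hden : ∀ w ∈ ball c ρ, f w + cnj f0 ≠ 0 := by
    intro w hw h
    have := congrArg re h
    simp at this
    linarith [hpos w hw]
  have hid : ∀ w, ‖f w + cnj f0‖ ^ 2 - ‖f w - f0‖ ^ 2 = 4 * (f w).re * f0.re := by
    intro w
    simp only [← normSq_eq_norm_sq, normSq_apply]
    simp
    ring
  have hmaps : MapsTo F (ball c ρ) (ball (F c) 1) := by
    intro w hw
    have hFc : F c = 0 := by simp [F, f0]
    rw [hFc, mem_ball_zero_iff, norm_div, div_lt_one (norm_pos_iff.2 (hden w hw))]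
    have := hid w
    have h2 := mul_pos (mul_pos (by norm_num : zrR < 4) (hpos w hw)) hf0
    exact lt_of_pow_lt_pow_left₀ 2 nng lnr
  have hFd : DifferentiableOn ℂ F (ball c ρ) :=
    (hf.sub_const _).div (hf.add_const _) hden
  refine ⟨f0.re / (4 * ρ), by positivity, fun y hy hyρ ↦ ?_⟩
  set w : ℂ := x + y * I
  have hwc : dist w c = ρ - y := by
    rw [dist_eq_norm]
    have : w - c = ((y - ρ : ℝ) : ℂ) * I := by simp only [w, c]; push_cast; ring
    rw [this, norm_mul, norm_I, mul_one, norm_real, rna, abs_of_neg lnr]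
    ring
  have hw : w ∈ ball c ρ := by rw [mem_ball, hwc]; linarith
  have hS := dist_le_div_mul_dist_of_mapsTo_ball hFd (hmaps.mono_right ball_subset_closedBall) hw
  have hFc : F c = 0 := by simp [F, f0]
  rw [hFc, dist_zero_right, hwc, norm_div] at hS
  have hd0 := norm_pos_iff.2 (hden w hw)
  rw [div_le_iff₀ hd0] at hS
  set d := ‖f w + cnj f0‖
  have hq : 1 / ρ * (ρ - y) = 1 - y / ρ := by field_simp
  rw [hq] at hS
  have hyr : y / ρ < 1 := (div_lt_one hρ).2 hyρ
  have hyr0 : 0 < y / ρ := by positivity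
  have h1 : ‖f w - f0‖ ^ 2 ≤ ((1 - y / ρ) * d) ^ 2 := by gcongr
  have h2 := hid w
  have h3 : d ^ 2 * (y / ρ) ≤ 4 * (f w).re * f0.re := by nlinarith [sq_nonneg d]
  have h4 : f0.re ≤ d := by
    have := abs_re_le_norm (f w + cnj f0)
    simp only [add_re, conj_re] at this
    have h5 := (le_abs_self _).trans this
    linarith [hpos w hw]
  have h5 : f0.re ^ 2 * (y / ρ) ≤ d ^ 2 * (y / ρ) := by gcongr
  have h6 : f0.re * (y / ρ) ≤ 4 * (f w).re := by
    have : f0.re * (f0.re * (y / ρ)) ≤ f0.re * (4 * (f w).re) := by nlinarith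
    exact le_of_mul_le_mul_left this hf0
  have : f0.re / (4 * ρ) * y = f0.re * (y / ρ) / 4 := by field_simp
  rw [this]; linarith

lemma exists_log_convex {U : Set ℂ} (hU : IsOpen U) (hc : Convex ℝ U) {h : ℂ → ℂ}
    (hh : DifferentiableOn ℂ h U) (h0 : ∀ z ∈ U, h z ≠ 0) :
    ∃ s : ℂ → ℂ, DifferentiableOn ℂ s U ∧ ∀ z ∈ U, h z = exp (-s z) := by
  obtain ⟨s1, hs1⟩ := hc.exists_forall_hasDerivWithinAt
    (f := fun z ↦ - deriv h z / h z) (((hh.deriv hU).neg).div hh h0)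
  replace hs1 : ∀ z ∈ U, HasDerivAt s1 (-deriv h z / h z) z := fun z hz ↦ (hs1 z hz).hasDerivAt (hU.mem_nhds hz)
  have hd : ∀ z ∈ U, HasDerivAt (fun z ↦ h z * exp (s1 z)) 0 z := by
    intro z hz
    have h1 := ((hh.differentiableAt (hU.mem_nhds hz)).hasDerivAt).mul (hs1 z hz).cexp
    refine h1.congr_deriv ?_
    field_simp [h0 z hz]
    ring
  rcases U.eq_empty_or_nonempty with he | ⟨z0, hz0⟩
  · subst he; exact ⟨0, by simp, by simp⟩
  have hconst : ∀ z ∈ U, h z * exp (s1 z) = h z0 * exp (s1 z0) := by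
    intro z hz
    exact hU.is_const_of_deriv_eq_zero hc.isPreconnected
      (fun z hz ↦ (hd z hz).differentiableAt.differentiableWithinAt) (fun z hz ↦ (hd z hz).deriv) hz hz0
  have hk : h z0 * exp (s1 z0) ≠ 0 := mul_ne_zero (h0 z0 hz0) (exp_ne_zero _)
  refine ⟨fun z ↦ s1 z - log (h z0 * exp (s1 z0)), fun z hz ↦
    ((hs1 z hz).differentiableAt.sub_const _).differentiableWithinAt, fun z hz ↦ ?_⟩
  rw [neg_sub, exp_sub, exp_log hk, ← hconst z hz, mul_div_assoc, div_self (exp_ne_zero _), mul_one]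

lemma dense_im_ne : ∀ z : ℂ, z ∈ closure {z : ℂ | z.im ≠ 0} := by
  intro z
  rw [Metric.mem_closure_iff]
  intro ε hε
  by_cases h : z.im = 0
  · refine ⟨z + (ε / 2 : ℝ) * I, ?_, ?_⟩
    · simp [h, hε.ne']
    · rw [dist_eq_norm]
      simp only [sub_add_cancel_left, norm_neg, norm_mul, norm_I, norm_real, mul_one, rna]
      rw [abs_of_pos lnr]; linarith
  · exact ⟨z, h, by simpa using hε⟩

lemma lens_ext {c q : ℝ} (hc : 0 < c) (hc1 : c ≤ 1) (hq : 0 < q) (hq1 : q < 1) {h : ℂ → ℂ}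
    (hd : DifferentiableOn ℂ h (Lens c ∩ {z | 0 < z.im}))
    (hlt : ∀ z ∈ Lens c, 0 < z.im → ‖h z‖ < 1) (hge : ∀ z ∈ Lens c, 0 < z.im → q ≤ ‖h z‖)
    (hb : ∀ ε > 0, ∃ η > 0, ∀ z ∈ Lens c, 0 < z.im → z.im < η → 1 - ε < ‖h z‖) :
    ∃ st : ℂ → ℂ, DifferentiableOn ℂ st (Lens c) ∧ (∀ z ∈ Lens c, 0 < z.im → h z = exp (-st z)) ∧
      (∀ z ∈ Lens c, st (cnj z) = - cnj (st z)) ∧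
      (∀ x ∈ O01, ∃ t : ℝ, 0 < t ∧ deriv st x = -(t * I)) := by
  set Up : Set ℂ := Lens c ∩ {z | 0 < z.im} with hUp
  have hUo : IsOpen Up := isOpen_Lens.inter (isOpen_lt continuous_const continuous_im)
  have hUc : Convex ℝ Up := (convex_Lens hc).inter (convex_halfSpace_im_gt 0)
  obtain ⟨s, hsd, hs⟩ := exists_log_convex hUo hUc hd (fun z hz h0 ↦ by
    have := hge z hz.1 hz.2
    rw [h0, norm_zero] at this; linarith)
  have hre : ∀ z ∈ Up, (s z).re = - rlg ‖h z‖ := by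
    intro z hz
    rw [hs z hz, norm_exp, Real.log_exp]; simp
  have hh0 : ∀ z ∈ Up, 0 < ‖h z‖ := fun z hz ↦ hq.trans_le (hge z hz.1 hz.2)
  have hpos : ∀ z ∈ Up, 0 < (s z).re := by
    intro z hz
    rw [hre z hz]
    have := Real.log_neg (hh0 z hz) (hlt z hz.1 hz.2)
    linarith
  set m := - rlg q with hm
  have hm0 : 0 < m := by have := Real.log_neg hq hq1; linarith
  have hle : ∀ z ∈ Up, |(s z).re| ≤ m := by
    intro z hz
    rw [abs_of_pos (hpos z hz), hre z hz]
    have := Real.log_le_log hq (hge z hz.1 hz.2)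
    linarith
  have hsmall : ∀ ε > 0, ∃ η > 0, ∀ z ∈ Up, z.im < η → |(s z).re| ≤ ε := by
    intro ε hε
    have h1 : rex (-ε) < 1 := by rw [Real.exp_lt_one_iff]; linarith
    obtain ⟨η, hη, hη'⟩ := hb (1 - rex (-ε)) lnr
    refine ⟨η, hη, fun z hz hzη ↦ ?_⟩
    rw [abs_of_pos (hpos z hz), hre z hz]
    have h2 := hη' z hz.1 hz.2 hzη
    have h3 := Real.log_le_log (rxq (-ε)) (by linarith : rex (-ε) ≤ ‖h z‖)
    rw [Real.log_exp] at h3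
    linarith
  have hcl : ∀ x ∈ O01, ∀ w : ℂ, ‖w - x‖ ≤ c / 6 * bb x → w ∈ Lens c := by
    intro x hx w hw
    exact (Lens_ball hc hc1 (Lens_ofReal (half_pos hc) hx) (by simpa using hw)).1
  have hbox : ∀ x ∈ O01, ∀ z ∈ Box x (c / 24 * bb x), ball z z.im ⊆ Up := by
    intro x hx z hz w hw
    rw [mem_Box] at hz
    rw [mem_ball, dist_eq_norm] at hw
    have h1 : ‖z - x‖ ≤ c / 12 * bb x := by
      refine (norm_le_abs_re_add_abs_im _).trans ?_
      simp only [sub_re, sub_im, ofReal_re, ofReal_im, sub_zero]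
      rw [abs_of_pos hz.2.1]
      have : |z.re - x| ≤ c / 24 * bb x := abs_le.2 ⟨by linarith, by linarith⟩
      linarith
    refine ⟨hcl x hx w ?_, ?_⟩
    · have := norm_add_le (w - z) (z - x)
      rw [sub_add_sub_cancel] at this
      linarith [hz.2.2, mul_pos hc (bb_pos hx)]
    · have h2 := (abs_im_le_norm (w - z)).trans_lt hw
      rw [sub_im, abs_lt] at h2
      show 0 < w.im
      linarith
  have hboxUp : ∀ x ∈ O01, Box x (c / 24 * bb x) ⊆ Up := fun x hx z hz ↦
    hbox x hx z hz (mem_ball_self hz.2.1)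
  set f : ℂ → ℂ := fun z ↦ if 0 < z.im then s z else -cnj (s (cnj z)) with hf
  obtain ⟨st, hst, hstf⟩ := glue (U := Lens c) (S := {z | z.im ≠ 0}) (f := f) isOpen_Lens
    (fun z _ ↦ dense_im_ne z) (by
    intro z hz
    rcases lt_trichotomy z.im 0 with h | h | h
    · have hz' : cnj z ∈ Up := ⟨Lens_conj.2 hz, by simpa using h⟩
      have hcc : Continuous cnj := continuous_conj
      obtain ⟨r, hr, hrU⟩ := Metric.isOpen_iff.1 (hUo.preimage hcc) z hz'
      refine ⟨r, hr, fun z ↦ -cnj (s (cnj z)), ?_, ?_⟩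
      · intro w hw
        have h1 := (hsd.differentiableAt (hUo.mem_nhds (hrU hw))).hasDerivAt.conj_conj.neg
        rw [conj_conj] at h1
        exact DifferentiableAt.differentiableWithinAt (f := fun z ↦ -cnj (s (cnj z))) h1.differentiableAt
      · intro w hw _
        have : 0 < (cnj w).im := (hrU hw).2
        simp only [hf]
        rw [if_neg]
        simp at this
        linarith
    · have hx : z.re ∈ O01 := of_bb_pos (Lens_bb hc hz)
      have hzx : z = (z.re : ℂ) := by apply cxe <;> simp [h]
      have hr : 0 < c / 24 * bb z.re := by have := bb_pos hx; positivity
      obtain ⟨S, hS, hS1, hS2⟩ := reflect (A := 18 * m) hr (hsd.mono (hboxUp _ hx))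
        (fun w hw ↦ deriv_le_of_re_le hw.2.1 hm0 (hsd.mono (hbox _ hx w hw)) (fun u hu ↦ hle u (hbox _ hx w hw hu)))
        (fun ε hε ↦ by
          obtain ⟨η, hη, hη'⟩ := hsmall ε hε
          exact ⟨η, hη, fun w hw ↦ hη' w (hboxUp _ hx hw)⟩)
      rw [← hzx] at hS hS1 hS2
      refine ⟨_, half_pos hr, S, hS, fun w hw hw0 ↦ ?_⟩
      rcases lt_or_gt_of_ne hw0 with h1 | h1
      · rw [hS2 w hw h1]; simp only [hf]; rw [if_neg h1.not_gt]
      · rw [hS1 w hw h1]; simp only [hf]; rw [if_pos h1]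
    · obtain ⟨r, hr, hrU⟩ := Metric.isOpen_iff.1 hUo z ⟨hz, h⟩
      refine ⟨r, hr, s, hsd.mono hrU, fun w hw _ ↦ ?_⟩
      have : 0 < w.im := (hrU hw).2
      simp only [hf]
      rw [if_pos this])
  have hst1 : ∀ z ∈ Lens c, 0 < z.im → st z = s z := by
    intro z hz h
    rw [hstf z hz h.ne']; simp only [hf]; rw [if_pos h]
  have haxis : ∀ x ∈ O01, (st x).re = 0 := by
    intro x hx
    have hxl := Lens_ofReal hc hx
    have hcont : ContinuousAt st x := (hst.differentiableAt (isOpen_Lens.mem_nhds hxl)).continuousAt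
    have hl : Tendsto (fun y : ℝ ↦ (x : ℂ) + y * I) (nhdsWithin 0 (Ioi 0)) (nhds (x : ℂ)) := by
      have : Continuous (fun y : ℝ ↦ (x : ℂ) + y * I) := by fun_prop
      have := this.tendsto 0
      simp at this
      exact this.mono_left nhdsWithin_le_nhds
    have h1 : Tendsto (fun y : ℝ ↦ |(st (x + y * I)).re|) (nhdsWithin 0 (Ioi 0)) (nhds |(st x).re|) :=
      ((continuous_re.tendsto _).comp (hcont.tendsto.comp hl)).abs
    have h2 : |(st x).re| ≤ 0 := by
      refine le_of_forall_pos_le_add fun ε hε ↦ ?_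
      rw [zero_add]
      obtain ⟨η, hη, hη'⟩ := hsmall ε hε
      refine le_of_tendsto h1 ?_
      filter_upwards [hl (isOpen_Lens.mem_nhds hxl), self_mem_nhdsWithin,
        nhdsWithin_le_nhds (gt_mem_nhds hη)] with y hy hy0 hyη
      have hy0' : 0 < ((x : ℂ) + y * I).im := by simpa using hy0
      rw [hst1 _ hy hy0']
      exact hη' _ ⟨hy, hy0'⟩ (by simpa using hyη)
    exact abs_nonpos_iff.1 h2
  refine ⟨st, hst, fun z hz h ↦ by rw [hst1 z hz h]; exact hs z ⟨hz, h⟩, ?_, ?_⟩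
  · intro z hz
    have hz' := Lens_conj.2 hz
    rcases lt_trichotomy z.im 0 with h | h | h
    · rw [hst1 _ hz' (by simpa using h), hstf z hz h.ne]
      simp only [hf]; rw [if_neg h.not_gt]; simp
    · have hx : z.re ∈ O01 := of_bb_pos (Lens_bb hc hz)
      have hzx : z = (z.re : ℂ) := by apply cxe <;> simp [h]
      rw [hzx, conj_ofReal]
      apply cxe <;> simp [haxis _ hx]
    · rw [hst1 _ hz h, hstf _ hz' (by simpa using h.ne')]
      simp only [hf]; rw [if_neg (by simp [h.le]), conj_conj]
  · intro x hx
    have hxl := Lens_ofReal hc hx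
    have hder := (hst.differentiableAt (isOpen_Lens.mem_nhds hxl)).hasDerivAt
    set ρ := c / 24 * bb x with hρd
    have hρ : 0 < ρ := by have := bb_pos hx; positivity
    have hsub : ball ((x : ℂ) + (ρ / 2 : ℝ) * I) (ρ / 2) ⊆ Up := by
      have := hbox x hx ((x : ℂ) + (ρ / 2 : ℝ) * I) (by rw [mem_Box, ← hρd]; simp; exact hρ)
      simpa using this
    obtain ⟨t, ht, htle⟩ := hopf (half_pos hρ) (hsd.mono hsub) (fun z hz ↦ hpos z (hsub hz))
    have hv : HasDerivAt (fun y : ℝ ↦ (st (x + y * I)).re) ((deriv st x * I).re) 0 := by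
      have h1 := HasDerivAt.comp_of_eq (h₂ := st) zrR hder (hasDerivAt_vline x 0) bsp
      exact Complex.reCLM.hasFDerivAt.comp_hasDerivAt 0 h1
    have hh : HasDerivAt (fun y : ℝ ↦ (st (y : ℂ)).re) ((deriv st x).re) x := hder.real_of_complex
    have hh0 : (deriv st x).re = 0 := by
      have h2 : HasDerivAt (fun y : ℝ ↦ (st (y : ℂ)).re) 0 x := by
        refine (hasDerivAt_const x zrR).congr_of_eventuallyEq ?_
        filter_upwards [isOpen_Ioo.mem_nhds hx] with y hy using haxis y hy
      exact hh.unique h2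
    have hge' : t ≤ (deriv st x * I).re := by
      have h3 := hv.hasDerivWithinAt (s := Ioi 0)
      rw [hasDerivWithinAt_iff_tendsto_slope' bsp] at h3
      refine ge_of_tendsto h3 ?_
      filter_upwards [self_mem_nhdsWithin, nhdsWithin_le_nhds (gt_mem_nhds (half_pos hρ))] with y hy hyρ
      have hy0 : 0 < y := hy
      have hmem : (x : ℂ) + y * I ∈ Up := hboxUp x hx (by rw [mem_Box, ← hρd]; simp; refine ⟨?_, ?_, ?_⟩ <;> linarith)
      rw [slope_def_field]
      simp only [ofReal_zero, zero_mul, add_zero, sub_zero, haxis x hx]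
      rw [hst1 _ hmem.1 hmem.2, le_div_iff₀ hy0]
      exact htle y hy0 hyρ
    refine ⟨(deriv st x * I).re, by linarith, ?_⟩
    apply cxe
    · simp [hh0]
    · simp

def Rc (r : ℝ) : Set ℂ := {z | -r < z.re ∧ z.re < 1 + r ∧ |z.im| < r}

lemma isOpen_Rc {r : ℝ} : IsOpen (Rc r) :=
  (isOpen_lt continuous_const continuous_re).inter
    ((isOpen_lt continuous_re continuous_const).inter (isOpen_lt continuous_im.abs continuous_const))

structure Geo (G : Set ℂ) where
  N : ℕ
  σ : Fin N → ℂ → ℂ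
  r0 : ℝ
  c0 : ℝ
  m : ℝ
  M : ℝ
  r0_pos : 0 < r0
  c0_pos : 0 < c0
  c0_le : c0 ≤ 1
  c0_le_r0 : c0 ≤ r0
  m_pos : 0 < m
  m_le : m ≤ M
  diff : ∀ k, DifferentiableOn ℂ (σ k) (Rc r0)
  colip : ∀ k, ∀ z ∈ Rc r0, ∀ w ∈ Rc r0, m * ‖z - w‖ ≤ ‖σ k z - σ k w‖
  lip : ∀ k, ∀ z ∈ Rc r0, ∀ w ∈ Rc r0, ‖σ k z - σ k w‖ ≤ M * ‖z - w‖
  up : ∀ k, ∀ z ∈ Lens c0, 0 < z.im → σ k z ∈ G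
  down : ∀ k, ∀ z ∈ Lens c0, z.im < 0 → σ k z ∉ closure G
  memL : ∀ k, ∀ x ∈ I01, σ k x ∈ frontier G
  cover : ∀ z ∈ frontier G, ∃ k, ∃ x ∈ I01, σ k x = z
  sep : ∀ j k, j ≠ k → ∀ x ∈ I01, ∀ y ∈ I01, m * bb x ≤ ‖σ j x - σ k y‖

namespace Geo
variable {G : Set ℂ} (Γ : Geo G)

lemma M_pos : 0 < Γ.M := Γ.m_pos.trans_le Γ.m_le

lemma ofReal_mem_Rc {x : ℝ} (hx : x ∈ I01) : (x : ℂ) ∈ Rc Γ.r0 := by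
  have := Γ.r0_pos
  refine ⟨?_, ?_, ?_⟩ <;> simp <;> linarith [hx.1, hx.2]

lemma Lens_Rc {z : ℂ} (hz : z ∈ Lens Γ.c0) : z ∈ Rc Γ.r0 := by
  have h1 := of_bb_pos (Lens_bb Γ.c0_pos hz)
  have h2 := bb_le z.re
  have h3 : |z.im| < Γ.c0 * bb z.re := hz
  have := Γ.r0_pos
  have := Γ.c0_le_r0
  have := Γ.c0_pos
  refine ⟨by linarith [h1.1], by linarith [h1.2], by nlinarith⟩

lemma diffAt (k : Fin Γ.N) {z : ℂ} (hz : z ∈ Rc Γ.r0) : DifferentiableAt ℂ (Γ.σ k) z :=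
  (Γ.diff k).differentiableAt (isOpen_Rc.mem_nhds hz)

lemma deriv_bounds (k : Fin Γ.N) {z : ℂ} (hz : z ∈ Rc Γ.r0) :
    Γ.m ≤ ‖deriv (Γ.σ k) z‖ ∧ ‖deriv (Γ.σ k) z‖ ≤ Γ.M := by
  have h1 := (Γ.diffAt k hz).hasDerivAt.tendsto_slope.norm
  have hev : ∀ᶠ w in nhdsWithin z {z}ᶜ, w ∈ Rc Γ.r0 ∧ w ≠ z := by
    filter_upwards [nhdsWithin_le_nhds (isOpen_Rc.mem_nhds hz), self_mem_nhdsWithin] with w h h' using ⟨h, h'⟩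
  constructor
  · refine ge_of_tendsto h1 ?_
    filter_upwards [hev] with w hw
    rw [slope_def_field, norm_div, le_div_iff₀ (norm_pos_iff.2 (sub_ne_zero.2 hw.2))]
    exact Γ.colip k w hw.1 z hz
  · refine le_of_tendsto h1 ?_
    filter_upwards [hev] with w hw
    rw [slope_def_field, norm_div, div_le_iff₀ (norm_pos_iff.2 (sub_ne_zero.2 hw.2))]
    exact Γ.lip k w hw.1 z hz

lemma infDist_le (k : Fin Γ.N) {z : ℂ} (hz : z ∈ Lens Γ.c0) :
    infDist (Γ.σ k z) (frontier G) ≤ Γ.M * |z.im| := by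
  have h1 := of_bb_pos (Lens_bb Γ.c0_pos hz)
  have hx : z.re ∈ I01 := ⟨h1.1.le, h1.2.le⟩
  refine (infDist_le_dist_of_mem (Γ.memL k z.re hx)).trans ?_
  rw [dist_eq_norm]
  refine (Γ.lip k z (Γ.Lens_Rc hz) z.re (Γ.ofReal_mem_Rc hx)).trans (le_of_eq ?_)
  have : z - z.re = z.im * I := by apply cxe <;> simp
  rw [this, norm_mul, norm_I, mul_one, norm_real, rna]

end Geo

lemma arc_ext {G : Set ℂ} (Γ : Geo G) (k : Fin Γ.N) (hG : IsOpen G) (hbd : Bornology.IsBounded G)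
    {φ κ : ℂ → ℂ} (hφ : DifferentiableOn ℂ φ G) (hi : InjOn φ G) (him : φ '' G = ball 0 1)
    (hκ : DifferentiableOn ℂ κ G) (hκ2 : ∀ z ∈ G, κ z ^ 2 = deriv φ z)
    {q η c : ℝ} (hq : 0 < q) (hq1 : q < 1)
    (hη : ∀ z ∈ G, infDist z (frontier G) < η → q < ‖φ z‖)
    (hc : 0 < c) (hcc0 : c ≤ Γ.c0) (hcη : c * Γ.M ≤ η) :
    ∃ ht kt : ℂ → ℂ, DifferentiableOn ℂ ht (Lens c) ∧ DifferentiableOn ℂ kt (Lens c) ∧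
      (∀ z ∈ Lens c, 0 < z.im → ht z = φ (Γ.σ k z) ∧ kt z = κ (Γ.σ k z)) ∧
      (∀ z ∈ Lens c, q ≤ ‖ht z‖ ∧ ‖ht z‖ ≤ q⁻¹) ∧
      (∀ x ∈ O01, ‖ht x‖ = 1 ∧
        kt x * deriv (Γ.σ k) x = I * cnj (kt x) * ‖deriv (Γ.σ k) x‖ * ht x) ∧
      (∀ z ∈ Lens (c / 2), ∀ m : ℝ, 0 < m → (∀ w ∈ Lens c, 0 < w.im → |w.re - z.re| ≤ bb z.re / 6 →
        - rlg ‖φ (Γ.σ k w)‖ ≤ m) → ‖kt z‖ ^ 2 ≤ 108 / (c * q * Γ.m) * m / bb z.re) := by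
  have hsub := Lens_mono hc hcc0
  have hUo : IsOpen (Lens c ∩ {z | 0 < z.im}) := isOpen_Lens.inter (isOpen_lt continuous_const continuous_im)
  have hmaps : ∀ z ∈ Lens c, 0 < z.im → Γ.σ k z ∈ G := fun z hz h ↦ Γ.up k z (hsub hz) h
  have hc1 : c ≤ 1 := hcc0.trans Γ.c0_le
  have hM := Γ.M_pos
  have hσd : ∀ z ∈ Lens c, DifferentiableAt ℂ (Γ.σ k) z := fun z hz ↦ Γ.diffAt k (Γ.Lens_Rc (hsub hz))
  have hσ0 : ∀ z ∈ Lens c, deriv (Γ.σ k) z ≠ 0 := fun z hz h ↦ by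
    have := (Γ.deriv_bounds k (Γ.Lens_Rc (hsub hz))).1
    rw [h, norm_zero] at this; linarith [Γ.m_pos]
  have hhd : ∀ z ∈ Lens c, 0 < z.im →
      HasDerivAt (fun z ↦ φ (Γ.σ k z)) (deriv φ (Γ.σ k z) * deriv (Γ.σ k) z) z := fun z hz h ↦
    (hφ.differentiableAt (hG.mem_nhds (hmaps z hz h))).hasDerivAt.comp z (hσd z hz).hasDerivAt
  have hge : ∀ z ∈ Lens c, 0 < z.im → q ≤ ‖φ (Γ.σ k z)‖ := by
    intro z hz h
    refine (hη _ (hmaps z hz h) ((Γ.infDist_le k (hsub hz)).trans_lt ?_)).le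
    have h3 : |z.im| < c * bb z.re := hz
    have h2 := bb_le z.re
    calc Γ.M * |z.im| < Γ.M * (c * bb z.re) := by gcongr
      _ ≤ Γ.M * (c * 1) := by gcongr; linarith
      _ ≤ η := by linarith
  have hlt : ∀ z ∈ Lens c, 0 < z.im → ‖φ (Γ.σ k z)‖ < 1 := by
    intro z hz h
    have : φ (Γ.σ k z) ∈ ball zrC 1 := him ▸ mem_image_of_mem φ (hmaps z hz h)
    simpa using this
  obtain ⟨st, hst, hsth, hstc, hsta⟩ := lens_ext (h := fun z ↦ φ (Γ.σ k z)) hc hc1 hq hq1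
    (fun z hz ↦ (hhd z hz.1 hz.2).differentiableAt.differentiableWithinAt) hlt hge (by
      intro ε hε
      obtain ⟨η', hη', h'⟩ := riemann_bdry hG hbd hφ hi him hε
      refine ⟨η' / Γ.M, by positivity, fun z hz h0 hzη ↦ h' _ (hmaps z hz h0) ?_⟩
      refine (Γ.infDist_le k (hsub hz)).trans_lt ?_
      rw [lt_div_iff₀ hM] at hzη
      rw [abs_of_pos h0]; linarith)
  have hnorm : ∀ z, ‖exp (-st z)‖ = rex (-(st z).re) := by intro z; rw [norm_exp]; simp
  have hreu : ∀ z ∈ Lens c, 0 < z.im → (st z).re = - rlg ‖φ (Γ.σ k z)‖ := by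
    intro z hz h
    rw [hsth z hz h, hnorm, Real.log_exp]; ring
  have hupos : ∀ z ∈ Lens c, 0 < z.im → 0 ≤ (st z).re := by
    intro z hz h
    rw [hreu z hz h]
    have := Real.log_nonpos nng (hlt z hz h).le
    linarith
  have habs : ∀ z ∈ Lens c, ∀ m, 0 ≤ m → (∀ w ∈ Lens c, 0 < w.im → w.re = z.re →
      - rlg ‖φ (Γ.σ k w)‖ ≤ m) → |(st z).re| ≤ m := by
    intro z hz m hm h
    have hre : (st (cnj z)).re = - (st z).re := by rw [hstc z hz]; simp
    rcases lt_trichotomy z.im 0 with h1 | h1 | h1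
    · have h2 : 0 < (cnj z).im := by simpa using h1
      have h3 := h _ (Lens_conj.2 hz) h2 bsp
      rw [← hreu _ (Lens_conj.2 hz) h2, hre] at h3
      have h4 := hupos _ (Lens_conj.2 hz) h2
      rw [hre] at h4
      rw [abs_of_nonpos lnr]; exact h3
    · have h2 : cnj z = z := by apply cxe <;> simp [h1]
      rw [h2] at hre
      have : (st z).re = 0 := by linarith
      simpa [this] using hm
    · have h3 := h z hz h1 rfl
      rw [← hreu z hz h1] at h3
      rwa [abs_of_nonneg (hupos z hz h1)]
  have hbd2 : ∀ z ∈ Lens c, q ≤ ‖exp (-st z)‖ ∧ ‖exp (-st z)‖ ≤ q⁻¹ := by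
    intro z hz
    have h1 := habs z hz (-rlg q) (by have := Real.log_neg hq hq1; linarith) (fun w hw hw0 _ ↦ by
      have := Real.log_le_log hq (hge w hw hw0); linarith)
    rw [abs_le] at h1
    rw [hnorm]
    constructor
    · rw [← Real.log_le_iff_le_exp hq]; linarith
    · rw [← Real.le_log_iff_exp_le pvt, Real.log_inv]; linarith
  have hhtd : ∀ z ∈ Lens c, HasDerivAt (fun z ↦ exp (-st z)) (exp (-st z) * -deriv st z) z := fun z hz ↦
    ((hst.differentiableAt (isOpen_Lens.mem_nhds hz)).hasDerivAt.neg).cexp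
  set w2 : ℂ → ℂ := fun z ↦ exp (-st z) * -deriv st z / deriv (Γ.σ k) z with hw2
  have hw2d : DifferentiableOn ℂ w2 (Lens c) := by
    refine DifferentiableOn.div ?_ (fun z hz ↦ ?_) hσ0
    · have hE : DifferentiableOn ℂ (fun z ↦ exp (-st z)) (Lens c) := hst.neg.cexp
      exact hE.mul (hst.deriv isOpen_Lens).neg
    · exact ((Γ.diff k).deriv isOpen_Rc).differentiableAt (isOpen_Rc.mem_nhds (Γ.Lens_Rc (hsub hz))) |>.differentiableWithinAt
  have hw2up : ∀ z ∈ Lens c, 0 < z.im → w2 z = κ (Γ.σ k z) ^ 2 := by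
    intro z hz h
    rw [hκ2 _ (hmaps z hz h)]
    have e : HasDerivAt (fun z ↦ φ (Γ.σ k z)) (exp (-st z) * -deriv st z) z := by
      refine (hhtd z hz).congr_of_eventuallyEq ?_
      filter_upwards [hUo.mem_nhds ⟨hz, h⟩] with w hw using hsth w hw.1 hw.2
    simp only [hw2]
    rw [e.unique (hhd z hz h), mul_div_assoc, div_self (hσ0 z hz), mul_one]
  have hφ'0 : ∀ z ∈ G, deriv φ z ≠ 0 := fun z hz ↦ deriv_ne_zero_of_injOn hG hφ hi hz
  have hw20u : ∀ z ∈ Lens c, 0 < z.im → deriv st z ≠ 0 := by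
    intro z hz h h0
    have := hw2up z hz h
    rw [hκ2 _ (hmaps z hz h)] at this
    simp only [hw2, h0] at this
    simp at this
    exact hφ'0 _ (hmaps z hz h) this.symm
  have hder0 : ∀ z ∈ Lens c, deriv st z ≠ 0 := by
    intro z hz h0
    rcases lt_trichotomy z.im 0 with h1 | h1 | h1
    · have h2 : 0 < (cnj z).im := by simpa using h1
      refine hw20u _ (Lens_conj.2 hz) h2 ?_
      have h3 := (hst.differentiableAt (isOpen_Lens.mem_nhds hz)).hasDerivAt.conj_conj.neg
      rw [h0, map_zero, neg_zero] at h3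
      refine HasDerivAt.deriv (h3.congr_of_eventuallyEq ?_)
      filter_upwards [isOpen_Lens.mem_nhds (Lens_conj.2 hz)] with w hw
      have := hstc _ (Lens_conj.2 hw)
      rw [conj_conj] at this
      rw [this]; rfl
    · have hx : z.re ∈ O01 := of_bb_pos (Lens_bb hc hz)
      have hzx : z = (z.re : ℂ) := by apply cxe <;> simp [h1]
      obtain ⟨t, ht, ht'⟩ := hsta _ hx
      rw [← hzx, h0] at ht'
      have := congrArg im ht'
      simp at this
      exact ht.ne' this
    · exact hw20u z hz h1 h0
  have hw20 : ∀ z ∈ Lens c, w2 z ≠ 0 := fun z hz ↦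
    div_ne_zero (mul_ne_zero (exp_ne_zero _) (neg_ne_zero.2 (hder0 z hz))) (hσ0 z hz)
  obtain ⟨sl, hsl, hsl2⟩ := exists_log_convex isOpen_Lens (convex_Lens hc) hw2d hw20
  set k0 : ℂ → ℂ := fun z ↦ exp (-(sl z / 2)) with hk0
  have hk02 : ∀ z ∈ Lens c, k0 z ^ 2 = w2 z := by
    intro z hz
    simp only [hk0]
    rw [← exp_nat_mul, hsl2 z hz]; congr 1; push_cast; ring
  have hk0d : DifferentiableOn ℂ k0 (Lens c) := ((hsl.div_const _).neg).cexp
  have hUc : Convex ℝ (Lens c ∩ {z | 0 < z.im}) := (convex_Lens hc).inter (convex_halfSpace_im_gt 0)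
  have hkc : ContinuousOn (fun z ↦ κ (Γ.σ k z)) (Lens c ∩ {z | 0 < z.im}) := fun z hz ↦
    (ContinuousAt.comp (hκ.differentiableAt (hG.mem_nhds (hmaps z hz.1 hz.2))).continuousAt
      (hσd z hz.1).continuousAt).continuousWithinAt
  obtain ⟨ε, hε, hεk⟩ : ∃ ε : ℂ, (ε = 1 ∨ ε = -1) ∧ ∀ z ∈ Lens c, 0 < z.im → κ (Γ.σ k z) = ε * k0 z := by
    rcases hUc.isPreconnected.eq_or_eq_neg_of_sq_eq hkc (hk0d.continuousOn.mono inter_subset_left)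
      (fun z hz ↦ by simp only [Pi.pow_apply]; rw [hk02 z hz.1, hw2up z hz.1 hz.2]) (fun {z} _ ↦ exp_ne_zero _) with h | h
    · exact ⟨1, Or.inl rfl, fun z hz h0 ↦ by rw [one_mul]; exact h ⟨hz, h0⟩⟩
    · exact ⟨-1, Or.inr rfl, fun z hz h0 ↦ by rw [neg_one_mul]; exact h ⟨hz, h0⟩⟩
  have hε2 : ε ^ 2 = 1 := by rcases hε with h | h <;> simp [h]
  have hk2 : ∀ z ∈ Lens c, (ε * k0 z) ^ 2 = w2 z := fun z hz ↦ by rw [mul_pow, hε2, one_mul, hk02 z hz]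
  refine ⟨fun z ↦ exp (-st z), fun z ↦ ε * k0 z, hst.neg.cexp, hk0d.const_mul _,
    fun z hz h ↦ ⟨(hsth z hz h).symm, (hεk z hz h).symm⟩, hbd2, ?_, ?_⟩
  · intro x hx
    have hxl := Lens_ofReal hc hx
    have hre : (st x).re = 0 := by
      have := congrArg re (hstc x hxl)
      rw [conj_ofReal] at this
      simp at this
      linarith
    have hn1 : ‖exp (-st x)‖ = 1 := by rw [hnorm, hre]; simp
    refine ⟨hn1, ?_⟩
    obtain ⟨t, ht, ht'⟩ := hsta x hx
    have hkk := hk2 x hxl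
    have hσx := hσ0 x hxl
    simp only [hw2] at hkk
    rw [ht', neg_neg, eq_div_iff hσx] at hkk
    show ε * k0 x * deriv (Γ.σ k) x = I * cnj (ε * k0 x) * ‖deriv (Γ.σ k) x‖ * exp (-st x)
    set K := ε * k0 x with hK
    clear_value K
    have hK0 : K ≠ 0 := by
      intro h
      rw [h] at hkk
      have : exp (-st x) * (t * I) ≠ 0 := mul_ne_zero (exp_ne_zero _) (mul_ne_zero (by exact_mod_cast ht.ne') I_ne_zero)
      apply this; rw [← hkk]; ring
    apply mul_left_cancel₀ hK0
    have hnn : ‖K‖ ^ 2 * ‖deriv (Γ.σ k) x‖ = t := by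
      have := congrArg norm hkk
      rw [norm_mul, norm_pow, norm_mul, hn1, norm_mul, norm_I, norm_real, rnn ht.le] at this
      linarith
    have hKc : K * cnj K = (‖K‖ ^ 2 : ℝ) := by rw [mul_conj, normSq_eq_norm_sq]
    calc K * (K * deriv (Γ.σ k) x) = exp (-st x) * (t * I) := by rw [← hkk]; ring
      _ = I * (K * cnj K) * ‖deriv (Γ.σ k) x‖ * exp (-st x) := by
          rw [hKc, ← hnn]; push_cast; ring
      _ = _ := by ring
  · intro z hz m hm h
    have hb := Lens_bb (half_pos hc) hz
    have hzc : z ∈ Lens c := Lens_mono (half_pos hc) lnr hz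
    have hR : 0 < c / 6 * bb z.re := by positivity
    have hball : ∀ w ∈ ball z (c / 6 * bb z.re), w ∈ Lens c ∧ |w.re - z.re| ≤ bb z.re / 6 := by
      intro w hw
      rw [mem_ball, dist_eq_norm] at hw
      refine ⟨(Lens_ball hc hc1 hz hw.le).1, ?_⟩
      have := (abs_re_le_norm (w - z)).trans hw.le
      rw [sub_re] at this
      nlinarith
    have hd := deriv_le_of_re_le hR hm (hst.mono fun w hw ↦ (hball w hw).1) (fun w hw ↦
      habs w (hball w hw).1 m hm.le fun v hv hv0 hvw ↦ h v hv hv0 (by rw [hvw]; exact (hball w hw).2))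
    have hσm := (Γ.deriv_bounds k (Γ.Lens_Rc (hsub hzc))).1
    have hmp := Γ.m_pos
    rw [← norm_pow, hk2 z hzc]
    simp only [hw2]
    rw [norm_div, norm_mul, norm_neg]
    calc _ ≤ q⁻¹ * (18 * m / (c / 6 * bb z.re)) / Γ.m := by
          gcongr
          exact (hbd2 z hzc).2
      _ = _ := by field_simp; norm_num

noncomputable def xi (s x : ℝ) : ℂ := (x : ℂ) + ((s * bb x : ℝ) : ℂ) * I
noncomputable def xi' (s x : ℝ) : ℂ := 1 + ((s * (1 - 2 * x) : ℝ) : ℂ) * I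

lemma xi_re (s x : ℝ) : (xi s x).re = x := by simp [xi]
lemma xi_im (s x : ℝ) : (xi s x).im = s * bb x := by simp [xi]

lemma continuous_xi (s : ℝ) : Continuous (xi s) := by unfold xi bb; fun_prop
lemma continuous_xi' (s : ℝ) : Continuous (xi' s) := by unfold xi'; fun_prop

lemma hasDerivAt_xi (s x : ℝ) : HasDerivAt (xi s) (xi' s x) x := by
  unfold xi xi'
  have h1 : HasDerivAt (fun x : ℝ ↦ s * bb x) (s * (1 - 2 * x)) x := by
    unfold bb
    refine (((hasDerivAt_id x).mul ((hasDerivAt_id x).const_sub 1)).const_mul s).congr_deriv ?_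
    simp; left; ring
  exact (hasDerivAt_id x).ofReal_comp.add (h1.ofReal_comp.mul_const I)

lemma norm_xi'_le {s x : ℝ} (hs : |s| ≤ 1) (hx : x ∈ I01) : ‖xi' s x‖ ≤ 2 := by
  unfold xi'
  refine (norm_add_le _ _).trans ?_
  rw [norm_one, norm_mul, norm_I, norm_real, rna, abs_mul]
  have : |1 - 2 * x| ≤ 1 := abs_le.2 ⟨by linarith [hx.2], by linarith [hx.1]⟩
  nlinarith [abs_nonneg s, abs_nonneg (1 - 2 * x)]

lemma xi_mem_Lens {s c x : ℝ} (hs : |s| < c) (hx : x ∈ O01) : xi s x ∈ Lens c := by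
  show |(xi s x).im| < c * bb (xi s x).re
  rw [xi_re, xi_im, abs_mul, abs_of_pos (bb_pos hx)]
  exact mul_lt_mul_of_pos_right hs (bb_pos hx)

lemma xi_zero (x : ℝ) : xi 0 x = x := by simp [xi]

lemma int_bb {t : ℝ} (ht : -1 < t) (ht0 : t ≤ 0) :
    IntegrableOn (fun x ↦ bb x ^ t) (O01) := by
  have h1 : IntegrableOn (fun x : ℝ ↦ x ^ t) (O01) := by
    have := (intervalIntegral.intervalIntegrable_rpow' (a := 0) (b := 1) ht).1
    exact this.mono_set Ioo_subset_Ioc_self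
  have h2 : IntegrableOn (fun x : ℝ ↦ (1 - x) ^ t) (O01) := by
    have := ((intervalIntegral.intervalIntegrable_rpow' (a := 0) (b := 1) ht).comp_sub_left 1).symm
    simp at this
    exact this.1.mono_set Ioo_subset_Ioc_self
  refine Integrable.mono' ((h1.add h2).const_mul (2⁻¹ ^ t)) ?_ ?_
  · refine ContinuousOn.aestronglyMeasurable ?_ measurableSet_Ioo
    refine ContinuousOn.rpow_const (by unfold bb; fun_prop) fun x hx ↦ Or.inl (bb_pos hx).ne'
  · refine (ae_restrict_iff' measurableSet_Ioo).2 (Eventually.of_forall fun x hx ↦ ?_)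
    rw [rnn (by have := bb_pos hx; positivity)]
    have hx0 := hx.1
    have hx1 : 0 < 1 - x := by linarith [hx.2]
    have e1 : 0 ≤ x ^ t := by positivity
    have e2 : 0 ≤ (1 - x) ^ t := by positivity
    have e3 : (0:ℝ) ≤ 2⁻¹ ^ t := by positivity
    rcases le_total x (1 / 2) with h | h
    · have : bb x ^ t ≤ (2⁻¹ * x) ^ t := by
        refine Real.rpow_le_rpow_of_nonpos pvt ?_ ht0
        unfold bb; nlinarith
      rw [rmr nnm hx0.le] at this
      simp only [Pi.add_apply]
      nlinarith
    · have : bb x ^ t ≤ (2⁻¹ * (1 - x)) ^ t := by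
        refine Real.rpow_le_rpow_of_nonpos pvt ?_ ht0
        unfold bb; nlinarith
      rw [rmr nnm hx1.le] at this
      simp only [Pi.add_apply]
      nlinarith

noncomputable def cau (w g : ℝ → ℂ) (z : ℂ) : ℂ := ∫ x in O01, w x / (g x - z)

lemma cau_int {w g : ℝ → ℂ} (hw : IntegrableOn w (Ioo 0 1)) (hg : ContinuousOn g (Icc 0 1)) {z : ℂ} {d : ℝ} (hd : 0 < d)
    (h : ∀ x ∈ O01, d ≤ ‖g x - z‖) : IntegrableOn (fun x ↦ w x / (g x - z)) (Ioo 0 1) := by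
  refine Integrable.mono' (hw.norm.const_mul d⁻¹) ?_ ?_
  · simp_rw [div_eq_mul_inv]
    exact hw.aestronglyMeasurable.mul ((((hg.mono Ioo_subset_Icc_self).aemeasurable measurableSet_Ioo).sub_const z).inv.aestronglyMeasurable)
  · refine (ae_restrict_iff' measurableSet_Ioo).2 (Eventually.of_forall fun x hx ↦ ?_)
    rw [norm_div, div_eq_inv_mul]
    gcongr
    exact h x hx

lemma cau_diff {w g : ℝ → ℂ} (hw : IntegrableOn w (Ioo 0 1)) (hg : ContinuousOn g (Icc 0 1)) {z : ℂ}
    (hz : ∀ x ∈ I01, g x ≠ z) : DifferentiableAt ℂ (cau w g) z := by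
  obtain ⟨d, hd, hdz⟩ : ∃ d > 0, ∀ x ∈ I01, d ≤ ‖g x - z‖ := by
    obtain ⟨x, hx, hm⟩ := isCompact_Icc.exists_isMinOn (nonempty_Icc.2 zero_le_one)
      (f := fun x ↦ ‖g x - z‖) (s := I01) bfp
    exact ⟨_, norm_pos_iff.2 (sub_ne_zero.2 (hz x hx)), fun y hy ↦ hm hy⟩
  have hb : ∀ x ∈ O01, ∀ v ∈ ball z (d / 2), d / 2 ≤ ‖g x - v‖ := by
    intro x hx v hv
    rw [mem_ball, dist_eq_norm] at hv
    have h1 := hdz x (Ioo_subset_Icc_self hx)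
    have h2 : ‖g x - z‖ ≤ ‖g x - v‖ + ‖v - z‖ := by
      rw [← sub_add_sub_cancel (g x) v z]; exact norm_add_le _ _
    linarith
  have hd2 := half_pos hd
  refine (hasDerivAt_integral_of_dominated_loc_of_deriv_le (F := fun z x ↦ w x / (g x - z))
    (F' := fun z x ↦ w x * ((g x - z)⁻¹) ^ 2) (bound := fun x ↦ ‖w x‖ * ((d / 2)⁻¹) ^ 2)
    (ball_mem_nhds z hd2) ?_ (cau_int hw hg hd2 fun x hx ↦ hb x hx z (mem_ball_self hd2)) ?_ ?_ ?_ ?_).2.differentiableAt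
  · filter_upwards [ball_mem_nhds z hd2] with v hv
    exact (cau_int hw hg hd2 fun x hx ↦ hb x hx v hv).aestronglyMeasurable
  · exact hw.aestronglyMeasurable.mul (((((hg.mono Ioo_subset_Icc_self).aemeasurable measurableSet_Ioo).sub_const z).inv.pow_const 2).aestronglyMeasurable)
  · refine (ae_restrict_iff' measurableSet_Ioo).2 (Eventually.of_forall fun x hx v hv ↦ ?_)
    rw [norm_mul, norm_pow, norm_inv]
    gcongr
    exact hb x hx v hv
  · exact hw.norm.mul_const _
  · refine (ae_restrict_iff' measurableSet_Ioo).2 (Eventually.of_forall fun x hx v hv ↦ ?_)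
    have hne : g x - v ≠ 0 := norm_pos_iff.1 (hd2.trans_le (hb x hx v hv))
    refine (((hasDerivAt_id v).const_sub (g x)).inv hne).const_mul (w x) |>.congr_deriv ?_
    simp [div_eq_mul_inv]

lemma bb_tendsto {a : ℝ} (ha : bb a = 0) {s : Set ℝ} : Tendsto bb (nhdsWithin a s) nh0 := by
  rw [← ha]
  exact ((by unfold bb; fun_prop : Continuous bb).tendsto a).mono_left nhdsWithin_le_nhds

lemma contour_prim {U : Set ℂ} (hU : IsOpen U) (hUc : Convex ℝ U) {Q : ℂ → ℂ} (hQ : DifferentiableOn ℂ Q U)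
    {s C δ : ℝ} (hs : 0 < s) (hδ : 0 < δ)
    (h0 : ∀ x ∈ O01, xi 0 x ∈ U) (h1 : ∀ x ∈ O01, xi (-s) x ∈ U)
    (hb : ∀ x ∈ O01, bb x < δ → ∀ t ∈ Icc (-s) 0, ‖Q (xi t x)‖ ≤ C * bb x ^ mh12) :
    ∃ D : ℝ → ℂ, (∀ x ∈ O01, HasDerivAt D (Q (xi 0 x) * xi' 0 x - Q (xi (-s) x) * xi' (-s) x) x) ∧
      Tendsto D (nhdsWithin 0 (Ioi 0)) nh0 ∧ Tendsto D (nhdsWithin 1 (Iio 1)) nh0 := by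
  obtain ⟨P, hP⟩ := hUc.exists_forall_hasDerivWithinAt hQ
  replace hP : ∀ z ∈ U, HasDerivAt P (Q z) z := fun z hz ↦ (hP z hz).hasDerivAt (hU.mem_nhds hz)
  have hbd : ∀ x ∈ O01, bb x < δ → ‖P (xi 0 x) - P (xi (-s) x)‖ ≤ C * s * bb x ^ (1 / 2 : ℝ) := by
    intro x hx hxd
    have hp := bb_pos hx
    have hseg : segment ℝ (xi (-s) x) (xi 0 x) ⊆ U := hUc.segment_subset (h1 x hx) (h0 x hx)
    have := (convex_segment (𝕜 := ℝ) (xi (-s) x) (xi 0 x)).norm_image_sub_le_of_norm_hasDerivWithin_le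
      (f := P) (f' := Q) (C := C * bb x ^ mh12) (fun z hz ↦ (hP z (hseg hz)).hasDerivWithinAt) (by
        rintro z ⟨a, b, ha, hb', hab, rfl⟩
        have : a • xi (-s) x + b • xi 0 x = xi (-(a * s)) x := by
          have : b = 1 - a := by linarith
          subst this
          apply cxe <;> simp [xi] <;> ring
        rw [this]
        exact hb x hx hxd _ ⟨by nlinarith, by nlinarith⟩) (left_mem_segment _ _ _) (right_mem_segment _ _ _)
    refine this.trans (le_of_eq ?_)
    have e : xi 0 x - xi (-s) x = ((s * bb x : ℝ) : ℂ) * I := by simp [xi]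
    rw [e, norm_mul, norm_I, mul_one, norm_real, rnn pvt]
    have : bb x ^ (1 / 2 : ℝ) = bb x ^ mh12 * bb x := by
      conv_rhs => rw [← Real.rpow_one (bb x), ← Real.rpow_mul hp.le, ← rra hp]
      norm_num
    rw [this]; ring
  have hlim : ∀ a s', bb a = 0 → Tendsto (fun x ↦ C * s * bb x ^ (1 / 2 : ℝ)) (nhdsWithin a s') nh0 := by
    intro a s' ha
    have := ((bb_tendsto ha (s := s')).rpow_const (p := 1 / 2) (Or.inr nnm)).const_mul (C * s)
    rwa [Real.zero_rpow nnm, mul_zero] at this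
  refine ⟨fun x ↦ P (xi 0 x) - P (xi (-s) x), fun x hx ↦ ?_, ?_, ?_⟩
  · exact ((hP _ (h0 x hx)).comp x (hasDerivAt_xi 0 x)).sub ((hP _ (h1 x hx)).comp x (hasDerivAt_xi (-s) x))
  · refine squeeze_zero_norm' ?_ (hlim 0 (Ioi 0) (by simp [bb]))
    filter_upwards [(bb_tendsto (by simp [bb])).eventually_lt_const hδ, Ioo_mem_nhdsGT zero_lt_one] with x h h' using hbd x h' h
  · refine squeeze_zero_norm' ?_ (hlim 1 (Iio 1) (by simp [bb]))
    filter_upwards [(bb_tendsto (by simp [bb])).eventually_lt_const hδ, Ioo_mem_nhdsLT zero_lt_one] with x h h' using hbd x h' h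

namespace Geo
variable {G : Set ℂ} (Γ : Geo G)

structure Adm (c : ℝ) : Prop where
  pos : 0 < c
  le : c ≤ Γ.c0
  sm : 16 * Γ.M * c ≤ Γ.m

structure LF (c C : ℝ) (F : Fin Γ.N → ℂ → ℂ) : Prop where
  C_pos : 0 < C
  diff : ∀ k, DifferentiableOn ℂ (F k) (Lens c)
  bd : ∀ k, ∀ z ∈ Lens (c / 2), ‖F k z‖ ≤ C * bb z.re ^ mh12

noncomputable def wt (F : Fin Γ.N → ℂ → ℂ) (s : ℝ) (k : Fin Γ.N) (x : ℝ) : ℂ :=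
  F k (xi s x) * deriv (Γ.σ k) (xi s x) * xi' s x

noncomputable def Psi (F : Fin Γ.N → ℂ → ℂ) (s : ℝ) (k : Fin Γ.N) : ℂ → ℂ :=
  cau (Γ.wt F s k) (fun x ↦ Γ.σ k (xi s x))

variable {Γ} {c C : ℝ} {F : Fin Γ.N → ℂ → ℂ}

lemma Adm.le1 (hc : Γ.Adm c) : c ≤ 1 := hc.le.trans Γ.c0_le

lemma Adm.Rc (hc : Γ.Adm c) {z : ℂ} (hz : z ∈ Lens c) : z ∈ Rc Γ.r0 := Γ.Lens_Rc (Lens_mono hc.pos hc.le hz)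

lemma xi_Rc {s : ℝ} (hs : |s| < Γ.c0) {x : ℝ} (hx : x ∈ I01) : xi s x ∈ Rc Γ.r0 := by
  have h0 := Γ.c0_le_r0
  have h1 := Γ.r0_pos
  have h2 := bb_le x
  have h3 : 0 ≤ bb x := mul_nonneg hx.1 (by linarith [hx.2])
  refine ⟨?_, ?_, ?_⟩
  · rw [xi_re]; linarith [hx.1]
  · rw [xi_re]; linarith [hx.2]
  · rw [xi_im, abs_mul, abs_of_nonneg h3]; nlinarith [abs_nonneg s]

lemma cont_σxi (k : Fin Γ.N) {s : ℝ} (hs : |s| < Γ.c0) : ContinuousOn (fun x ↦ Γ.σ k (xi s x)) (Icc 0 1) :=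
  (Γ.diff k).continuousOn.comp (continuous_xi s).continuousOn fun _ hx ↦ xi_Rc hs hx

lemma wt_bd (hc : Γ.Adm c) (hF : Γ.LF c C F) {s : ℝ} (hs : |s| < c / 2) (k : Fin Γ.N) {x : ℝ} (hx : x ∈ O01) :
    ‖Γ.wt F s k x‖ ≤ 2 * C * Γ.M * bb x ^ mh12 := by
  have h1 := hF.bd k _ (xi_mem_Lens hs hx)
  rw [xi_re] at h1
  have hC := hF.C_pos
  have hM := Γ.M_pos
  have hp := bb_pos hx
  have hcp := hc.pos
  have h2 := (Γ.deriv_bounds k (hc.Rc (xi_mem_Lens (by linarith : |s| < c) hx))).2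
  have h3 := norm_xi'_le (by linarith [hc.le1] : |s| ≤ 1) (Ioo_subset_Icc_self hx)
  unfold wt
  rw [norm_mul, norm_mul]
  calc _ ≤ C * bb x ^ mh12 * Γ.M * 2 := by gcongr
    _ = _ := by ring

lemma wt_int (hc : Γ.Adm c) (hF : Γ.LF c C F) {s : ℝ} (hs : |s| < c / 2) (k : Fin Γ.N) :
    IntegrableOn (Γ.wt F s k) (Ioo 0 1) := by
  have hcp := hc.pos
  refine Integrable.mono' ((int_bb (by norm_num : (-1 : ℝ) < -(1 / 2)) nnm).const_mul (2 * C * Γ.M)) ?_ ?_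
  · refine ContinuousOn.aestronglyMeasurable ?_ measurableSet_Ioo
    have hm : MapsTo (xi s) (O01) (Lens c) := fun x hx ↦ xi_mem_Lens lnr hx
    exact (((hF.diff k).continuousOn.comp (continuous_xi s).continuousOn hm).mul
      (((Γ.diff k).deriv isOpen_Rc).continuousOn.comp (continuous_xi s).continuousOn fun x hx ↦ hc.Rc (hm hx))).mul
      (continuous_xi' s).continuousOn
  · exact (ae_restrict_iff' measurableSet_Ioo).2 (Eventually.of_forall fun x hx ↦ wt_bd hc hF hs k hx)

lemma Psi_diff (hc : Γ.Adm c) (hF : Γ.LF c C F) {s : ℝ} (hs : |s| < c / 2) (k : Fin Γ.N) {z : ℂ}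
    (hz : ∀ x ∈ I01, Γ.σ k (xi s x) ≠ z) : DifferentiableAt ℂ (Γ.Psi F s k) z :=
  cau_diff (wt_int hc hF hs k) (cont_σxi k (by linarith [hc.le, hc.pos])) hz

lemma Psi_eq (hc : Γ.Adm c) (hF : Γ.LF c C F) (k : Fin Γ.N) {z : ℂ} {d : ℝ} (hd : 0 < d) {D : ℝ → ℂ} {a b : ℂ}
    (hD : ∀ x ∈ O01, HasDerivAt D (F k (xi 0 x) * deriv (Γ.σ k) (xi 0 x) / (Γ.σ k (xi 0 x) - z) * xi' 0 x
      - F k (xi (-(c / 4)) x) * deriv (Γ.σ k) (xi (-(c / 4)) x) / (Γ.σ k (xi (-(c / 4)) x) - z) * xi' (-(c / 4)) x) x)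
    (ha : Tendsto D (nhdsWithin 0 (Ioi 0)) (nhds a)) (hb : Tendsto D (nhdsWithin 1 (Iio 1)) (nhds b))
    (h0 : ∀ x ∈ O01, d ≤ ‖Γ.σ k (xi 0 x) - z‖)
    (h1 : ∀ x ∈ O01, d ≤ ‖Γ.σ k (xi (-(c / 4)) x) - z‖) :
    Γ.Psi F 0 k z - Γ.Psi F (-(c / 4)) k z = b - a := by
  have hcp := hc.pos
  have hs0 : |(0:ℝ)| < c / 2 := by simpa using hcp
  have hs1 : |-(c / 4)| < c / 2 := by rw [abs_neg, abs_of_pos pvt]; linarith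
  have i0 := cau_int (wt_int hc hF hs0 k) (cont_σxi k (by simpa using Γ.c0_pos)) hd h0
  have i1 := cau_int (wt_int hc hF hs1 k) (cont_σxi k (by linarith [hc.le])) hd h1
  unfold Psi cau
  rw [← integral_sub i0 i1, ← integral_Ioc_eq_integral_Ioo, ← intervalIntegral.integral_of_le zero_le_one]
  refine intervalIntegral.integral_eq_sub_of_hasDerivAt_of_tendsto zero_lt_one (fun x hx ↦ ?_) ?_ ha hb
  · refine (hD x hx).congr_deriv ?_
    unfold wt; ring
  · rw [intervalIntegrable_iff_integrableOn_Ioo_of_le zero_le_one]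
    exact i0.sub i1

lemma Psi_shift (hc : Γ.Adm c) (hF : Γ.LF c C F) (k : Fin Γ.N) {z : ℂ} {d : ℝ} (hd : 0 < d) {U : Set ℂ} (hU : IsOpen U)
    (hUc : Convex ℝ U) (hUL : U ⊆ Lens c) (hxi : ∀ x ∈ O01, ∀ t ∈ Icc (-(c / 4)) 0, xi t x ∈ U)
    (hne : ∀ w ∈ U, Γ.σ k w ≠ z) (hdz : ∀ x ∈ O01, ∀ t ∈ Icc (-(c / 4)) 0, d ≤ ‖Γ.σ k (xi t x) - z‖) :
    Γ.Psi F 0 k z = Γ.Psi F (-(c / 4)) k z := by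
  have hcp := hc.pos
  have hQ : DifferentiableOn ℂ (fun w ↦ F k w * deriv (Γ.σ k) w / (Γ.σ k w - z)) U :=
    (((hF.diff k).mono hUL).mul (((Γ.diff k).deriv isOpen_Rc).mono fun w hw ↦ hc.Rc (hUL hw))).div
      (((Γ.diff k).mono fun w hw ↦ hc.Rc (hUL hw)).sub_const z) fun w hw ↦ sub_ne_zero.2 (hne w hw)
  have m0 : (0:ℝ) ∈ Icc (-(c / 4)) 0 := ⟨by linarith, le_rfl⟩
  have m1 : -(c / 4) ∈ Icc (-(c / 4)) 0 := ⟨le_rfl, by linarith⟩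
  obtain ⟨D, hD, ha, hb⟩ := contour_prim (s := c / 4) (C := C * Γ.M / d) (δ := 1) hU hUc hQ pvt one_pos
    (fun x hx ↦ hxi x hx _ m0) (fun x hx ↦ hxi x hx _ m1) (by
      intro x hx _ t ht
      have hC := hF.C_pos
      have hM := Γ.M_pos
      have hp := bb_pos hx
      have hs : |t| < c / 2 := abs_lt.2 ⟨by linarith [ht.1], by linarith [ht.2]⟩
      have h1 := hF.bd k _ (xi_mem_Lens hs hx)
      rw [xi_re] at h1
      have h2 := (Γ.deriv_bounds k (hc.Rc (xi_mem_Lens (by linarith : |t| < c) hx))).2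
      rw [norm_div, norm_mul]
      calc _ ≤ C * bb x ^ mh12 * Γ.M / d := by gcongr; exact hdz x hx t ht
        _ = _ := by ring)
  have := Psi_eq hc hF k hd hD ha hb (fun x hx ↦ hdz x hx _ m0) (fun x hx ↦ hdz x hx _ m1)
  rwa [sub_zero, sub_eq_zero] at this

lemma log_neg_im_pos {w : ℂ} (h : 0 < w.im) : log (-w) - log w = -(rpi * I) := by
  unfold log
  rw [arg_neg_eq_arg_sub_pi_of_im_pos h, norm_neg]; push_cast; ring

lemma log_neg_im_neg {w : ℂ} (h : w.im < 0) : log (-w) - log w = rpi * I := by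
  unfold log
  rw [arg_neg_eq_arg_add_pi_of_im_neg h, norm_neg]; push_cast; ring

lemma Psi_jump (hc : Γ.Adm c) (hF : Γ.LF c C F) (k : Fin Γ.N) {z' : ℂ} (hz : z' ∈ Lens (c / 8)) (hz0 : z'.im < 0) :
    Γ.Psi F 0 k (Γ.σ k z') - Γ.Psi F (-(c / 4)) k (Γ.σ k z') = - (2 * rpi * I * F k z') := by
  have hcp := hc.pos
  have hzc : z' ∈ Lens c := Lens_mono pvt lnr hz
  have hzc2 : z' ∈ Lens (c / 2) := Lens_mono pvt lnr hz
  have hbz := Lens_bb hcp hzc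
  have hx01 := of_bb_pos hbz
  have hzim : |z'.im| < c / 8 * bb z'.re := hz
  rw [abs_of_neg hz0] at hzim
  have hcol : ∀ w ∈ Lens c, Γ.m * ‖w - z'‖ ≤ ‖Γ.σ k w - Γ.σ k z'‖ := fun w hw ↦ Γ.colip k w (hc.Rc hw) z' (hc.Rc hzc)
  have hm := Γ.m_pos
  have hM := Γ.M_pos
  have hnb : Lens c ∈ nhds z' := isOpen_Lens.mem_nhds hzc
  have hσd : DifferentiableOn ℂ (Γ.σ k) (Lens c) := (Γ.diff k).mono fun w hw ↦ hc.Rc hw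
  have hds : DifferentiableOn ℂ (dslope (Γ.σ k) z') (Lens c) := (differentiableOn_dslope hnb).2 hσd
  have hds0 : ∀ w ∈ Lens c, dslope (Γ.σ k) z' w ≠ 0 := by
    intro w hw h0
    by_cases hwz : w = z'
    · rw [hwz, dslope_same] at h0
      have := (Γ.deriv_bounds k (hc.Rc hzc)).1
      rw [h0, norm_zero] at this; linarith
    · rw [dslope_of_ne _ hwz, slope_def_field, div_eq_zero_iff] at h0
      have h1 := norm_pos_iff.2 (sub_ne_zero.2 hwz)
      rcases h0 with h0 | h0
      · have := hcol w hw
        rw [h0, norm_zero] at this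
        nlinarith
      · exact hwz (sub_eq_zero.1 h0)
  set R : ℂ → ℂ := fun w ↦ F k w * deriv (Γ.σ k) w / dslope (Γ.σ k) z' w with hR
  have hRd : DifferentiableOn ℂ R (Lens c) :=
    ((hF.diff k).mul (((Γ.diff k).deriv isOpen_Rc).mono fun w hw ↦ hc.Rc hw)).div hds hds0
  have hRz : R z' = F k z' := by
    simp only [hR, dslope_same]
    rw [mul_div_assoc, div_self, mul_one]
    have := hds0 z' hzc
    rwa [dslope_same] at this
  have hQ1 : DifferentiableOn ℂ (dslope R z') (Lens c) := (differentiableOn_dslope hnb).2 hRd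
  have hQeq : ∀ w ∈ Lens c, w ≠ z' → dslope R z' w =
      F k w * deriv (Γ.σ k) w / (Γ.σ k w - Γ.σ k z') - F k z' / (w - z') := by
    intro w hw hwz
    have h1 := sub_ne_zero.2 hwz
    have h2 : Γ.σ k w - Γ.σ k z' ≠ 0 := by
      have := hds0 w hw
      rw [dslope_of_ne _ hwz, slope_def_field] at this
      exact fun h ↦ this (by rw [h, zero_div])
    rw [dslope_of_ne _ hwz, slope_def_field, hRz]
    simp only [hR]
    rw [dslope_of_ne _ hwz, slope_def_field]
    field_simp
  have hs1 : |-(c / 4)| < c := by rw [abs_neg, abs_of_pos pvt]; linarith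
  have L0 : ∀ x ∈ O01, xi 0 x ∈ Lens c := fun x hx ↦ xi_mem_Lens (by simpa using hcp) hx
  have L1 : ∀ x ∈ O01, xi (-(c / 4)) x ∈ Lens c := fun x hx ↦ xi_mem_Lens hs1 hx
  have hre : ∀ x ∈ O01, ∀ t, bb x < bb z'.re / 2 → bb z'.re / 2 ≤ ‖xi t x - z'‖ := by
    intro x hx t hb
    have h1 := abs_re_le_norm (xi t x - z')
    rw [sub_re, xi_re] at h1
    have h2 := bb_lip2 x z'.re (Ioo_subset_Icc_self hx) (Ioo_subset_Icc_self hx01)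
    have h3 := (abs_le.1 h2).1
    linarith
  obtain ⟨D, hD, ha, hb⟩ := contour_prim (s := c / 4) (δ := bb z'.re / 2)
    (C := C * Γ.M / (Γ.m * (bb z'.re / 2)) + ‖F k z'‖ / (bb z'.re / 2)) isOpen_Lens (convex_Lens hcp) hQ1
    pvt pvt L0 L1 (by
      intro x hx hxb t ht
      have hC := hF.C_pos
      have hp := bb_pos hx
      have hs : |t| < c / 2 := abs_lt.2 ⟨by linarith [ht.1], by linarith [ht.2]⟩
      have h1 := hF.bd k _ (xi_mem_Lens hs hx)
      rw [xi_re] at h1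
      have hw : xi t x ∈ Lens c := xi_mem_Lens (by linarith : |t| < c) hx
      have h2 := (Γ.deriv_bounds k (hc.Rc hw)).2
      have h3 := hre x hx t hxb
      have hne : xi t x ≠ z' := by
        intro h
        rw [h, sub_self, norm_zero] at h3
        linarith
      have h4 : Γ.m * (bb z'.re / 2) ≤ ‖Γ.σ k (xi t x) - Γ.σ k z'‖ := le_trans (by gcongr) (hcol _ hw)
      have h5 : 1 ≤ bb x ^ mh12 :=
        Real.one_le_rpow_of_pos_of_le_one_of_nonpos hp (by linarith [bb_le x]) nnm
      rw [hQeq _ hw hne]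
      refine (norm_sub_le _ _).trans ?_
      rw [norm_div, norm_div, norm_mul, add_mul]
      have h6 : ‖F k z'‖ / ‖xi t x - z'‖ ≤ ‖F k z'‖ / (bb z'.re / 2) := by gcongr
      refine add_le_add ?_ (h6.trans (le_mul_of_one_le_right pvt h5))
      calc _ ≤ C * bb x ^ mh12 * Γ.M / (Γ.m * (bb z'.re / 2)) := by gcongr
        _ = _ := by ring)
  have hne0 : ∀ x ∈ I01, xi 0 x ≠ z' := by
    intro x hx h
    rw [← h, xi_im] at hz0; simp at hz0
  have hne1 : ∀ x ∈ I01, xi (-(c / 4)) x ≠ z' := by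
    intro x hx h
    have h1 := xi_im (-(c / 4)) x
    have h2 := xi_re (-(c / 4)) x
    rw [h] at h1 h2
    rw [h1, h2] at hzim
    rw [h2] at hbz
    nlinarith
  have hlow : ∀ s, |s| < Γ.c0 → (∀ x ∈ I01, xi s x ≠ z') → ∃ d > 0, ∀ x ∈ O01, d ≤ ‖Γ.σ k (xi s x) - Γ.σ k z'‖ := by
    intro s hs hne
    obtain ⟨x, hx, hmin⟩ := isCompact_Icc.exists_isMinOn (nonempty_Icc.2 zero_le_one)
      (f := fun x ↦ ‖xi s x - z'‖) (s := I01) ((continuous_xi s).sub continuous_const).norm.continuousOn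
    refine ⟨Γ.m * ‖xi s x - z'‖, mul_pos hm (norm_pos_iff.2 (sub_ne_zero.2 (hne x hx))), fun y hy ↦ ?_⟩
    refine le_trans ?_ (Γ.colip k _ (xi_Rc hs (Ioo_subset_Icc_self hy)) z' (hc.Rc hzc))
    have := hmin (Ioo_subset_Icc_self hy)
    exact mul_le_mul_of_nonneg_left this hm.le
  obtain ⟨d0, hd0, hd0'⟩ := hlow 0 (by simpa using Γ.c0_pos) hne0
  obtain ⟨d1, hd1, hd1'⟩ := hlow (-(c / 4)) (hs1.trans_le hc.le) hne1
  have s0 : ∀ x, -I * (xi 0 x - z') ∈ slitPlane := by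
    intro x
    left
    simp [xi_im]; exact hz0
  have s1 : ∀ x ∈ I01, I * (xi (-(c / 4)) x - z') ∈ slitPlane := by
    intro x hx
    by_cases hxz : x = z'.re
    · left
      simp [xi_im]
      have : c / 4 * bb x = 2 * (c / 8 * bb z'.re) := by rw [hxz]; ring
      rw [this]; nlinarith
    · right
      simp [xi_re]
      exact sub_ne_zero.2 hxz
  set LD : ℝ → ℂ := fun x ↦ log (-I * (xi 0 x - z')) - log (I * (xi (-(c / 4)) x - z')) with hLD
  have hLDd : ∀ x ∈ I01, HasDerivAt LD (xi' 0 x / (xi 0 x - z') - xi' (-(c / 4)) x / (xi (-(c / 4)) x - z')) x := by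
    intro x hx
    have e0 := (((hasDerivAt_xi 0 x).sub_const z').const_mul (-I)).clog_real (s0 x)
    have e1 := (((hasDerivAt_xi (-(c / 4)) x).sub_const z').const_mul I).clog_real (s1 x hx)
    refine (e0.sub e1).congr_deriv ?_
    rw [mul_div_mul_left _ _ (neg_ne_zero.2 I_ne_zero), mul_div_mul_left _ _ I_ne_zero]
  have hLD0 : LD 0 = rpi * I := by
    simp only [hLD]
    have : xi (-(c / 4)) 0 = xi 0 0 := by simp [xi, bb]
    rw [this, neg_mul]
    refine log_neg_im_neg ?_
    simp [xi_re]; exact hx01.1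
  have hLD1 : LD 1 = -(rpi * I) := by
    simp only [hLD]
    have : xi (-(c / 4)) 1 = xi 0 1 := by simp [xi, bb]
    rw [this, neg_mul]
    refine log_neg_im_pos ?_
    simp [xi_re]; exact hx01.2
  have hfin := Psi_eq (D := fun x ↦ D x + F k z' * LD x) (z := Γ.σ k z') (d := min d0 d1)
    (a := 0 + F k z' * LD 0) (b := 0 + F k z' * LD 1) hc hF k (lt_min hd0 hd1) (by
      intro x hx
      refine ((hD x hx).add ((hLDd x (Ioo_subset_Icc_self hx)).const_mul (F k z'))).congr_deriv ?_
      rw [hQeq _ (L0 x hx) (hne0 x (Ioo_subset_Icc_self hx)), hQeq _ (L1 x hx) (hne1 x (Ioo_subset_Icc_self hx))]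
      ring)
    (ha.add (((hLDd 0 ⟨le_rfl, zero_le_one⟩).continuousAt.tendsto.mono_left nhdsWithin_le_nhds).const_mul _))
    (hb.add (((hLDd 1 ⟨zero_le_one, le_rfl⟩).continuousAt.tendsto.mono_left nhdsWithin_le_nhds).const_mul _))
    (fun x hx ↦ (mnl).trans (hd0' x hx)) (fun x hx ↦ (mnr).trans (hd1' x hx))
  rw [hfin, hLD0, hLD1]; ring

end Geo

namespace Geo
variable {G : Set ℂ} {Γ : Geo G} {c C : ℝ} {F : Fin Γ.N → ℂ → ℂ}

lemma norm_im (z : ℂ) : ‖z - z.re‖ = |z.im| := by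
  have : z - z.re = z.im * I := by apply cxe <;> simp
  rw [this, norm_mul, norm_I, mul_one, norm_real, rna]

lemma re_dist (hc : Γ.Adm c) (k : Fin Γ.N) {z : ℂ} (hz : z ∈ Rc Γ.r0) (hx : z.re ∈ I01) {b : ℝ}
    (h : |z.im| ≤ c * b) : ‖Γ.σ k z - Γ.σ k z.re‖ ≤ Γ.m / 16 * b := by
  have h1 := Γ.lip k z hz z.re (Γ.ofReal_mem_Rc hx)
  rw [norm_im] at h1
  have hM := Γ.M_pos
  have := hc.sm
  have h2 : 0 ≤ b := nonneg_of_mul_nonneg_right ((abs_nonneg _).trans h) hc.pos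
  nlinarith [abs_nonneg z.im]

lemma ker_far (hc : Γ.Adm c) {j k : Fin Γ.N} (hjk : j ≠ k) {w z : ℂ} (hw : w ∈ Rc Γ.r0) (hwx : w.re ∈ I01)
    (hwi : |w.im| ≤ c * bb w.re) (hz : z ∈ Rc Γ.r0) (hzx : z.re ∈ I01) (hzi : |z.im| ≤ c * bb z.re) :
    Γ.m / 2 * bb w.re ≤ ‖Γ.σ j w - Γ.σ k z‖ ∧ Γ.m / 2 * bb z.re ≤ ‖Γ.σ j w - Γ.σ k z‖ := by
  have h1 := re_dist hc j hw hwx hwi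
  have h2 := re_dist hc k hz hzx hzi
  have h3 := Γ.sep j k hjk w.re hwx z.re hzx
  have h4 := Γ.sep k j hjk.symm z.re hzx w.re hwx
  rw [norm_sub_rev] at h4
  have h5 : ‖Γ.σ j w.re - Γ.σ k z.re‖ ≤ ‖Γ.σ j w - Γ.σ j w.re‖ + ‖Γ.σ j w - Γ.σ k z‖ + ‖Γ.σ k z - Γ.σ k z.re‖ := by
    rw [norm_sub_rev (Γ.σ j w) (Γ.σ j w.re)]
    have : Γ.σ j w.re - Γ.σ k z.re = (Γ.σ j w.re - Γ.σ j w) + (Γ.σ j w - Γ.σ k z) + (Γ.σ k z - Γ.σ k z.re) := by ring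
    rw [this]
    exact norm_add₃_le
  constructor <;> linarith [norm_nonneg (Γ.σ j w.re - Γ.σ k z.re)]

lemma ker (hc : Γ.Adm c) (j k : Fin Γ.N) {x : ℝ} (hx : x ∈ I01) {z : ℂ} (hz : z ∈ Rc Γ.r0)
    (hzx : z.re ∈ I01) (hzi : |z.im| ≤ c / 8 * bb z.re) :
    Γ.m * c / 16 * bb x ≤ ‖Γ.σ j (xi (-(c / 4)) x) - Γ.σ k z‖ ∧
    Γ.m * c / 16 * bb z.re ≤ ‖Γ.σ j (xi (-(c / 4)) x) - Γ.σ k z‖ := by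
  have hcp := hc.pos
  have hc1 := hc.le1
  have hm := Γ.m_pos
  have hb0 : ∀ y ∈ I01, 0 ≤ bb y := fun y hy ↦ mul_nonneg hy.1 (by linarith [hy.2])
  have hbx := hb0 x hx
  have hbz := hb0 _ hzx
  have hxR : xi (-(c / 4)) x ∈ Rc Γ.r0 := xi_Rc (by rw [abs_neg, abs_of_pos pvt]; linarith [hc.le]) hx
  by_cases hjk : j = k
  · subst hjk
    have h1 := Γ.colip j _ hxR z hz
    set e := ‖xi (-(c / 4)) x - z‖
    have h2 : |x - z.re| ≤ e := by simpa [xi_re] using abs_re_le_norm (xi (-(c / 4)) x - z)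
    have h3 : |-(c / 4) * bb x - z.im| ≤ e := by simpa only [sub_im, xi_im] using abs_im_le_norm (xi (-(c / 4)) x - z)
    have h4 := abs_le.1 ((bb_lip2 x z.re hx hzx).trans h2)
    have h5 := (abs_le.1 h3).1
    have h6 := (abs_le.1 hzi).1
    have e1 : c / 16 * bb x ≤ e := by nlinarith
    have e2 : c / 16 * bb z.re ≤ e := by nlinarith
    constructor <;> nlinarith
  · have := ker_far hc hjk hxR (by rwa [xi_re]) (by
      rw [xi_re, xi_im, abs_mul, abs_neg, abs_of_pos (by positivity : 0 < c / 4), abs_of_nonneg hbx]; nlinarith)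
      hz hzx (hzi.trans (by nlinarith))
    rw [xi_re] at this
    have h1 : Γ.m * c / 16 ≤ Γ.m / 2 := by nlinarith
    constructor
    · exact le_trans (by gcongr) this.1
    · exact le_trans (by gcongr) this.2

lemma Lens_Icc {c : ℝ} (hc : 0 < c) {z : ℂ} (hz : z ∈ Lens c) : z.re ∈ I01 :=
  Ioo_subset_Icc_self (of_bb_pos (Lens_bb hc hz))

lemma σ_inv (Γ : Geo G) (k : Fin Γ.N) {z0 : ℂ} {ρ : ℝ} (hρ : 0 < ρ) (h : closedBall z0 ρ ⊆ Rc Γ.r0) :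
    ∃ τ : ℂ → ℂ, DifferentiableOn ℂ τ (ball (Γ.σ k z0) (Γ.m * ρ / 2)) ∧
      ∀ v ∈ ball (Γ.σ k z0) (Γ.m * ρ / 2), τ v ∈ closedBall z0 ρ ∧ Γ.σ k (τ v) = v := by
  have hz0 := h (mem_closedBall_self hρ.le)
  have hm := Γ.m_pos
  have hsub : ball (Γ.σ k z0) (Γ.m * ρ / 2) ⊆ Γ.σ k '' closedBall z0 ρ := by
    refine DiffContOnCl.ball_subset_image_closedBall ?_ hρ (fun z hz ↦ ?_) ?_
    · refine DifferentiableOn.diffContOnCl ?_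
      rw [closure_ball _ hρ.ne']
      exact (Γ.diff k).mono h
    · have := Γ.colip k z (h (sphere_subset_closedBall hz)) z0 hz0
      rwa [mem_sphere_iff_norm.1 hz] at this
    · have : ∀ᶠ z in nhdsWithin z0 {z0}ᶜ, Γ.σ k z ≠ Γ.σ k z0 := by
        filter_upwards [nhdsWithin_le_nhds (isOpen_Rc.mem_nhds hz0), self_mem_nhdsWithin] with w hw hw' he
        have := Γ.colip k w hw z0 hz0
        rw [he, sub_self, norm_zero] at this
        have := norm_pos_iff.2 (sub_ne_zero.2 (show w ≠ z0 from hw'))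
        nlinarith
      exact this.frequently.filter_mono nhdsWithin_le_nhds
  choose! τ hτ hτ' using hsub
  refine ⟨τ, fun v hv ↦ ?_, fun v hv ↦ ⟨hτ hv, hτ' hv⟩⟩
  have hvn := isOpen_ball.mem_nhds hv
  have hR := h (hτ hv)
  refine (HasDerivAt.of_local_left_inverse (f := Γ.σ k) ?_ (Γ.diffAt k hR).hasDerivAt ?_ ?_).differentiableAt.differentiableWithinAt
  · rw [Metric.continuousAt_iff]
    intro ε hε
    obtain ⟨δ, hδ, hδ'⟩ := Metric.mem_nhds_iff.1 hvn
    refine ⟨min δ (Γ.m * ε), lt_min hδ pvt, fun {w} hw ↦ ?_⟩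
    have hw1 := hδ' (mem_ball.2 (hw.trans_le mnl))
    have h2 := Γ.colip k _ (h (hτ hw1)) _ hR
    rw [hτ' hw1, hτ' hv] at h2
    rw [dist_eq_norm] at hw ⊢
    have := hw.trans_le mnr
    nlinarith
  · intro h0
    have := (Γ.deriv_bounds k hR).1
    rw [h0, norm_zero] at this; linarith
  · filter_upwards [hvn] with w hw using hτ' hw

lemma cau_bd {w g : ℝ → ℂ} {A κ e : ℝ} {z : ℂ} (hκ : 0 < κ) (he : 0 < e) (hA : 0 ≤ A)
    (hw : ∀ x ∈ O01, ‖w x‖ ≤ A * bb x ^ mh12)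
    (h1 : ∀ x ∈ O01, κ * bb x ≤ ‖g x - z‖) (h2 : ∀ x ∈ O01, κ * e ≤ ‖g x - z‖) :
    ‖cau w g z‖ ≤ A / κ * (∫ x in O01, bb x ^ mh34) * e ^ mh34 := by
  have hi := (int_bb (by norm_num : (-1 : ℝ) < -(3 / 4)) nnm).const_mul (A / κ * e ^ mh34)
  have : ‖cau w g z‖ ≤ ∫ x in O01, A / κ * e ^ mh34 * bb x ^ mh34 := by
    refine norm_integral_le_of_norm_le hi ((ae_restrict_iff' measurableSet_Ioo).2 (Eventually.of_forall fun x hx ↦ ?_))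
    have hb := bb_pos hx
    have h3 : κ * (bb x ^ qrR * e ^ (3 / 4 : ℝ)) ≤ ‖g x - z‖ := by
      have : bb x ^ qrR * e ^ (3 / 4 : ℝ) ≤ max (bb x) e := by
        calc _ ≤ (max (bb x) e) ^ qrR * (max (bb x) e) ^ (3 / 4 : ℝ) := by
              gcongr
              · exact le_max_left _ _
              · exact le_max_right _ _
          _ = _ := by rw [← rra (lt_max_of_lt_left hb)]; norm_num
      refine (mul_le_mul_of_nonneg_left this hκ.le).trans ?_
      rcases max_cases (bb x) e with h | h <;> rw [h.1]
      · exact h1 x hx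
      · exact h2 x hx
    rw [norm_div]
    calc _ ≤ A * bb x ^ mh12 / (κ * (bb x ^ qrR * e ^ (3 / 4 : ℝ))) := by
          gcongr; exact hw x hx
      _ = _ := by
          have e1 : bb x ^ mh34 = bb x ^ mh12 * (bb x ^ qrR)⁻¹ := by
            rw [← rrn hb.le, ← rra hb]; norm_num
          rw [e1, rrn he.le]; field_simp
  rw [integral_const_mul] at this
  linarith

noncomputable def M1 (F : Fin Γ.N → ℂ → ℂ) (c : ℝ) (k : Fin Γ.N) (z : ℂ) : ℂ :=
  (∑ j, Γ.Psi F (-(c / 4)) j (Γ.σ k z)) - 2 * rpi * I * F k z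

open Classical in
noncomputable def M0 (F : Fin Γ.N → ℂ → ℂ) (f : ℂ → ℂ) (z : ℂ) : ℂ :=
  (∑ j, Γ.Psi F 0 j z) - 2 * rpi * I * (if z ∈ G then f z else 0)

lemma s1_lt (hc : Γ.Adm c) : |-(c / 4)| < c / 2 := by
  have := hc.pos
  rw [abs_neg, abs_of_pos pvt]; linarith

lemma M1_diff (hc : Γ.Adm c) (hF : Γ.LF c C F) (k : Fin Γ.N) {z : ℂ} (hz : z ∈ Lens (c / 8)) :
    DifferentiableAt ℂ (M1 F c k) z := by
  have hcp := hc.pos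
  have hzc : z ∈ Lens c := Lens_mono pvt lnr hz
  have hzi : |z.im| < c / 8 * bb z.re := hz
  have hm := Γ.m_pos
  refine DifferentiableAt.sub ?_ (((hF.diff k).differentiableAt (isOpen_Lens.mem_nhds hzc)).const_mul _)
  refine DifferentiableAt.fun_sum fun j _ ↦ ?_
  refine DifferentiableAt.comp z (Psi_diff hc hF (s1_lt hc) j fun x hx h ↦ ?_) (Γ.diffAt k (hc.Rc hzc))
  have := (ker hc j k hx (hc.Rc hzc) (Lens_Icc hcp hzc) hzi.le).2
  rw [h, sub_self, norm_zero] at this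
  have := Lens_bb hcp hzc
  nlinarith [mul_pos hm hcp]

lemma loc_eq (hc : Γ.Adm c) (hF : Γ.LF c C F) {f : ℂ → ℂ}
    (hfF : ∀ k, ∀ z ∈ Lens c, 0 < z.im → F k z = f (Γ.σ k z)) (k : Fin Γ.N) {z : ℂ} (hz : z ∈ Lens (c / 8)) (hz0 : z.im ≠ 0) :
    M0 F f (Γ.σ k z) = M1 F c k z := by
  classical
  have hcp := hc.pos
  have hm := Γ.m_pos
  have hzc : z ∈ Lens c := Lens_mono pvt lnr hz
  have hzx := Lens_Icc hcp hzc
  have hbz := Lens_bb hcp hzc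
  have hzi : |z.im| < c * bb z.re := hzc
  have hxiL : ∀ x ∈ O01, ∀ t ∈ Icc (-(c / 4)) 0, xi t x ∈ Lens c := fun x hx t ht ↦
    xi_mem_Lens (abs_lt.2 ⟨by linarith [ht.1], by linarith [ht.2]⟩) hx
  have hfar : ∀ j, j ≠ k → Γ.Psi F 0 j (Γ.σ k z) = Γ.Psi F (-(c / 4)) j (Γ.σ k z) := by
    intro j hj
    have hk : ∀ w ∈ Lens c, Γ.m / 2 * bb z.re ≤ ‖Γ.σ j w - Γ.σ k z‖ := fun w hw ↦
      (ker_far hc hj (hc.Rc hw) (Lens_Icc hcp hw) (le_of_lt hw) (hc.Rc hzc) hzx hzi.le).2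
    refine Psi_shift hc hF j (d := Γ.m / 2 * bb z.re) pvt isOpen_Lens (convex_Lens hcp) subset_rfl hxiL
      (fun w hw h ↦ ?_) (fun x hx t ht ↦ hk _ (hxiL x hx t ht))
    have := hk w hw
    rw [h, sub_self, norm_zero] at this
    nlinarith [mul_pos hm hbz]
  unfold M0 M1
  rcases lt_or_gt_of_ne hz0 with h | h
  · have hnG : Γ.σ k z ∉ G := fun hG ↦ Γ.down k z (Lens_mono hcp hc.le hzc) h (subset_closure hG)
    rw [if_neg hnG, mul_zero, sub_zero, ← Finset.add_sum_erase _ _ (Finset.mem_univ k),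
      ← Finset.add_sum_erase _ _ (Finset.mem_univ k), fsc rfl fun j hj ↦ hfar j (Finset.ne_of_mem_erase hj)]
    have := Psi_jump hc hF k hz h
    linear_combination this
  · rw [if_pos (Γ.up k z (Lens_mono hcp hc.le hzc) h), ← hfF k z hzc h]
    congr 1
    refine fsc rfl fun j _ ↦ ?_
    by_cases hj : j = k
    · subst hj
      have hb : ∀ w ∈ Lens c, Γ.m * ‖w - z‖ ≤ ‖Γ.σ j w - Γ.σ j z‖ := fun w hw ↦ Γ.colip j w (hc.Rc hw) z (hc.Rc hzc)
      refine Psi_shift hc hF j (d := Γ.m * z.im) pvt (U := Lens c ∩ {w | w.im < z.im})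
        (isOpen_Lens.inter (isOpen_lt continuous_im continuous_const))
        ((convex_Lens hcp).inter (convex_halfSpace_im_lt _)) inter_subset_left
        (fun x hx t ht ↦ ⟨hxiL x hx t ht, ?_⟩) (fun w hw he ↦ ?_) (fun x hx t ht ↦ ?_)
      · show (xi t x).im < z.im
        rw [xi_im]; nlinarith [ht.2, bb_pos hx]
      · have h1 := hb w hw.1
        rw [he, sub_self, norm_zero] at h1
        have h2 : w.im < z.im := hw.2
        have h3 : 0 < ‖w - z‖ := norm_pos_iff.2 (sub_ne_zero.2 (by rintro rfl; exact lt_irrefl _ h2))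
        nlinarith
      · refine le_trans ?_ (hb _ (hxiL x hx t ht))
        have h1 := abs_im_le_norm (xi t x - z)
        rw [sub_im, xi_im, abs_sub_comm] at h1
        have h2 := le_abs_self (z.im - t * bb x)
        have h3 : t * bb x ≤ 0 := mul_nonpos_of_nonpos_of_nonneg ht.2 (bb_pos hx).le
        gcongr; linarith
    · exact hfar j hj

def J (Γ : Geo G) : Set ℂ := ⋃ k, {Γ.σ k 0, Γ.σ k 1}

lemma J_finite (Γ : Geo G) : (J Γ).Finite := finite_iUnion fun _ ↦ (finite_singleton _).insert _

lemma mem_J0 (k : Fin Γ.N) : Γ.σ k 0 ∈ J Γ := mem_iUnion.2 ⟨k, by simp⟩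
lemma mem_J1 (k : Fin Γ.N) : Γ.σ k 1 ∈ J Γ := mem_iUnion.2 ⟨k, by simp⟩

lemma d_le (hc : Γ.Adm c) (k : Fin Γ.N) {z : ℂ} (hz : z ∈ Lens c) {v : ℂ} {d : ℝ} (h : ∀ p ∈ J Γ, d ≤ ‖v - p‖) :
    d ≤ ‖v - Γ.σ k z‖ + 3 * Γ.M * bb z.re := by
  have hzc := of_bb_pos (Lens_bb hc.pos hz)
  have hb := Lens_bb hc.pos hz
  have hM := Γ.M_pos
  have hzi : |z.im| ≤ bb z.re := (le_of_lt hz).trans (mul_le_of_le_one_left hb.le hc.le1)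
  have key : ∀ a ∈ I01, Γ.σ k a ∈ J Γ → |z.re - a| ≤ 2 * bb z.re → d ≤ ‖v - Γ.σ k z‖ + 3 * Γ.M * bb z.re := by
    intro a ha hJ hle
    have h1 := Γ.lip k z (hc.Rc hz) a (Γ.ofReal_mem_Rc ha)
    have h2 : ‖z - a‖ ≤ |z.re - a| + |z.im| := by simpa using norm_le_abs_re_add_abs_im (z - a)
    have h3 : ‖v - Γ.σ k a‖ ≤ ‖v - Γ.σ k z‖ + ‖Γ.σ k z - Γ.σ k a‖ := by
      rw [← sub_add_sub_cancel v (Γ.σ k z) (Γ.σ k a)]; exact norm_add_le _ _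
    have h4 := h _ hJ
    have h5 : Γ.M * ‖z - a‖ ≤ Γ.M * (3 * bb z.re) := by gcongr; linarith
    linarith
  rcases le_total z.re (1 / 2) with h2 | h2
  · refine key 0 bsp (by simpa using mem_J0 k) ?_
    rw [sub_zero, abs_of_pos hzc.1]
    unfold bb; nlinarith [hzc.1]
  · refine key 1 bsp (by simpa using mem_J1 k) ?_
    rw [abs_of_nonpos (by linarith [hzc.2])]
    unfold bb; nlinarith [hzc.2]

lemma off_lens (hc : Γ.Adm c) (k : Fin Γ.N) {v : ℂ} (hv : ∀ z ∈ Lens (c / 8), Γ.σ k z ≠ v) {x : ℝ} (hx : x ∈ O01) :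
    Γ.m * c / 96 * bb x ≤ ‖Γ.σ k x - v‖ := by
  have hcp := hc.pos
  have hb := bb_pos hx
  by_contra hcon
  push Not at hcon
  have hsub : closedBall (x : ℂ) (c / 8 / 6 * bb x) ⊆ Lens (c / 8) := by
    intro w hw
    rw [mem_closedBall, dist_eq_norm] at hw
    exact (Lens_ball pvt (by linarith [hc.le1]) (Lens_ofReal pvt hx) (by simpa using hw)).1
  obtain ⟨τ, -, hτ⟩ := σ_inv Γ k (z0 := x) (ρ := c / 8 / 6 * bb x) pvt
    (fun w hw ↦ hc.Rc (Lens_mono pvt lnr (hsub hw)))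
  have := hτ v (by rw [mem_ball, dist_eq_norm, norm_sub_rev]; linarith)
  exact hv _ (hsub this.1) this.2

lemma memL' (k : Fin Γ.N) {z : ℂ} (hz : z.re ∈ I01) (h0 : z.im = 0) : Γ.σ k z ∈ frontier G := by
  have : z = (z.re : ℂ) := by apply cxe <;> simp [h0]
  rw [this]; exact Γ.memL k _ hz

lemma off_lens_all (hc : Γ.Adm c) {v : ℂ} (hv : ∀ k, ∀ z ∈ Lens (c / 8), Γ.σ k z ≠ v) {d : ℝ} (hdJ : ∀ p ∈ J Γ, d ≤ ‖v - p‖)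
    (k : Fin Γ.N) {x : ℝ} (hx : x ∈ I01) :
    min (min (1 / 2) (Γ.m * c / 96)) (Γ.m * c / (600 * Γ.M)) * d ≤ ‖Γ.σ k x - v‖ := by
  have hcp := hc.pos
  have hm := Γ.m_pos
  have hM := Γ.M_pos
  set e := min (min (1 / 2) (Γ.m * c / 96)) (Γ.m * c / (600 * Γ.M)) with he
  have he1 : e ≤ 1 / 2 := (mnl).trans mnl
  have he2 : e * (600 * Γ.M) ≤ Γ.m * c := by
    have := min_le_right (min (1 / 2) (Γ.m * c / 96)) (Γ.m * c / (600 * Γ.M))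
    rwa [le_div_iff₀ pvt] at this
  have he0 : 0 < e := lt_min (lt_min nnm pvt) pvt
  have hend : ∀ p ∈ J Γ, e * d ≤ ‖p - v‖ := by
    intro p hp
    have := hdJ p hp
    rw [norm_sub_rev] at this
    nlinarith [norm_nonneg (p - v)]
  rcases eq_or_lt_of_le hx.1 with h | h
  · rw [← h]; exact hend _ (by simpa using mem_J0 k)
  rcases eq_or_lt_of_le hx.2 with h' | h'
  · rw [h']; exact hend _ (by simpa using mem_J1 k)
  have h1 := off_lens hc k (hv k) ⟨h, h'⟩
  have h2 := d_le hc k (Lens_ofReal hcp ⟨h, h'⟩) hdJ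
  rw [norm_sub_rev, ofReal_re] at h2
  nlinarith [norm_nonneg (Γ.σ k x - v), bb_pos ⟨h, h'⟩]

lemma M0_bd (hne : (frontier G).Nonempty) (hc : Γ.Adm c) (hF : Γ.LF c C F) {f : ℂ → ℂ}
    (hfF : ∀ k, ∀ z ∈ Lens c, 0 < z.im → F k z = f (Γ.σ k z))
    (hfb : ∀ z ∈ G, ‖f z‖ ≤ C * infDist z (frontier G) ^ mh12) :
    ∃ C', ∀ v ∉ frontier G, ∀ d, 0 < d → d ≤ 1 → (∀ p ∈ J Γ, d ≤ ‖v - p‖) → ‖M0 F f v‖ ≤ C' * d ^ mh34 := by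
  classical
  have hcp := hc.pos
  have hm := Γ.m_pos
  have hM := Γ.M_pos
  have hC := hF.C_pos
  set I0 := ∫ x in O01, bb x ^ mh34
  have hI0 : 0 ≤ I0 := setIntegral_nonneg measurableSet_Ioo fun x hx ↦ by have := bb_pos hx; positivity
  set e := min (min (1 / 2) (Γ.m * c / 96)) (Γ.m * c / (600 * Γ.M)) with he
  have he0 : 0 < e := lt_min (lt_min nnm pvt) pvt
  have hpi : ‖(2 * rpi * I : ℂ)‖ = 2 * rpi := by
    rw [norm_mul, norm_I, mul_one, norm_mul, norm_real, rnn Real.pi_pos.le]; simp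
  have hpi0 := rpp
  set Ca := (Γ.N * (2 * C * Γ.M / (Γ.m * c / 16) * I0) + 2 * rpi * C) * (3 * Γ.M) ^ (3 / 4 : ℝ)
  set Cb := Γ.N * (2 * C * Γ.M / e * I0) + 2 * rpi * (C * e ^ mh12)
  have hCa : 0 ≤ Ca := by positivity
  have hCb : 0 ≤ Cb := by positivity
  have hexp : ∀ b : ℝ, 0 < b → b ≤ 1 → b ^ mh12 ≤ b ^ mh34 := fun b hb hb1 ↦
    Real.rpow_le_rpow_of_exponent_ge hb hb1 nnm
  refine ⟨Ca + Cb, fun v hvL d hd hd1 hdJ ↦ ?_⟩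
  have hdp : 0 < d ^ mh34 := by positivity
  by_cases hv : ∀ k, ∀ z ∈ Lens (c / 8), Γ.σ k z ≠ v
  · have hL := fun k ↦ fun x hx ↦ off_lens_all hc hv hdJ k (x := x) hx
    suffices ‖M0 F f v‖ ≤ Cb * d ^ mh34 by nlinarith
    unfold M0
    refine (norm_sub_le _ _).trans ?_
    rw [add_mul]
    refine add_le_add ?_ ?_
    · refine (norm_sum_le_of_le (f := fun j ↦ Γ.Psi F 0 j v) (n := fun _ ↦ 2 * C * Γ.M / e * I0 * d ^ mh34) Finset.univ fun j _ ↦ ?_).trans (le_of_eq ?_)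
      · refine cau_bd he0 hd pvt (fun x hx ↦ wt_bd hc hF (by simpa using hcp) j hx) (fun x hx ↦ ?_) (fun x hx ↦ ?_)
        · rw [xi_zero]
          refine le_trans ?_ (off_lens hc j (hv j) hx)
          have := bb_pos hx
          have h3 : e ≤ Γ.m * c / 96 := (mnl).trans mnr
          gcongr
        · rw [xi_zero]; exact hL j x (Ioo_subset_Icc_self hx)
      · simp; ring
    · rw [norm_mul, hpi]
      split_ifs with hvG
      · have hi : e * d ≤ infDist v (frontier G) := by
          refine (le_infDist hne).2 fun y hy ↦ ?_
          obtain ⟨k, x, hx, rfl⟩ := Γ.cover y hy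
          rw [dist_comm, dist_eq_norm]
          exact hL k x hx
        have h1 := hfb v hvG
        have h2 : infDist v (frontier G) ^ mh12 ≤ (e * d) ^ mh12 :=
          Real.rpow_le_rpow_of_nonpos pvt hi nnm
        rw [rmr he0.le hd.le] at h2
        calc _ ≤ 2 * rpi * (C * (e ^ mh12 * d ^ mh34)) := by
              gcongr
              refine h1.trans ?_
              gcongr
              exact h2.trans (mul_le_mul_of_nonneg_left (hexp d hd hd1) pvt)
          _ = _ := by ring
      · rw [norm_zero, mul_zero]; positivity
  · push Not at hv
    obtain ⟨k, z, hz, rfl⟩ := hv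
    have hzc : z ∈ Lens c := Lens_mono pvt lnr hz
    have hb := Lens_bb hcp hzc
    have hzi : |z.im| < c / 8 * bb z.re := hz
    have hz0 : z.im ≠ 0 := fun h0 ↦ hvL (memL' k (Lens_Icc hcp hzc) h0)
    have h3 := d_le hc k hzc hdJ
    rw [sub_self, norm_zero, zero_add] at h3
    suffices ‖M0 F f (Γ.σ k z)‖ ≤ Ca * d ^ mh34 by nlinarith
    rw [loc_eq hc hF hfF k hz hz0]
    have h4 : bb z.re ^ mh34 ≤ (3 * Γ.M) ^ (3 / 4 : ℝ) * d ^ mh34 := by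
      have : bb z.re ^ mh34 ≤ (d / (3 * Γ.M)) ^ mh34 :=
        Real.rpow_le_rpow_of_nonpos pvt (by rw [div_le_iff₀ pvt]; linarith) nnm
      rw [Real.div_rpow hd.le pvt, rrn (by positivity : 0 ≤ 3 * Γ.M), div_inv_eq_mul] at this
      linarith
    have h5 : ‖M1 F c k z‖ ≤ (Γ.N * (2 * C * Γ.M / (Γ.m * c / 16) * I0) + 2 * rpi * C) * bb z.re ^ mh34 := by
      unfold M1
      refine (norm_sub_le _ _).trans ?_
      rw [add_mul]
      refine add_le_add ?_ ?_
      · refine (norm_sum_le_of_le (f := fun j ↦ Γ.Psi F (-(c / 4)) j (Γ.σ k z)) (n := fun _ ↦ 2 * C * Γ.M / (Γ.m * c / 16) * I0 * bb z.re ^ mh34) Finset.univ fun j _ ↦ ?_).trans (le_of_eq ?_)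
        · have hk := fun x (hx : x ∈ O01) ↦ ker hc j k (Ioo_subset_Icc_self hx) (hc.Rc hzc) (Lens_Icc hcp hzc) hzi.le
          exact cau_bd pvt hb pvt (fun x hx ↦ wt_bd hc hF (s1_lt hc) j hx) (fun x hx ↦ (hk x hx).1) (fun x hx ↦ (hk x hx).2)
        · simp; ring
      · rw [norm_mul, hpi, mul_assoc (2 * rpi)]
        gcongr
        exact (hF.bd k z (Lens_mono pvt lnr hz)).trans
          (mul_le_mul_of_nonneg_left (hexp _ hb (by linarith [bb_le z.re])) hC.le)
    refine h5.trans ?_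
    calc _ ≤ (Γ.N * (2 * C * Γ.M / (Γ.m * c / 16) * I0) + 2 * rpi * C) * ((3 * Γ.M) ^ (3 / 4 : ℝ) * d ^ mh34) := by gcongr
      _ = _ := by ring

end Geo

lemma cau_tendsto {w g : ℝ → ℂ} (hw : IntegrableOn w (Ioo 0 1)) {R : ℝ} (h : ∀ x ∈ O01, ‖g x‖ ≤ R) :
    Tendsto (cau w g) (cocompact ℂ) nh0 := by
  have h0 := tendsto_norm_cocompact_atTop (E := ℂ)
  have h1 : Tendsto (fun z : ℂ ↦ (∫ x in O01, ‖w x‖) * (‖z‖ - R)⁻¹) (cocompact ℂ) nh0 := by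
    simpa [sub_eq_add_neg] using (tendsto_inv_atTop_zero.comp (tendsto_atTop_add_const_right _ (-R) h0)).const_mul
      (∫ x in O01, ‖w x‖)
  refine squeeze_zero_norm' ?_ h1
  filter_upwards [h0.eventually_gt_atTop R] with z hz
  rw [← integral_mul_const]
  refine norm_integral_le_of_norm_le (hw.norm.mul_const _) ((ae_restrict_iff' measurableSet_Ioo).2 (Eventually.of_forall fun x hx ↦ ?_))
  rw [norm_div, div_eq_mul_inv]
  have := norm_sub_norm_le z (g x)
  rw [norm_sub_rev] at this
  have := h x hx
  gcongr
  linarith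

lemma dense_compl_frontier {G : Set ℂ} (hG : IsOpen G) : Dense (frontier G)ᶜ := by
  rw [← interior_eq_empty_iff_dense_compl, ← frontier_compl]; exact interior_frontier hG.isClosed_compl

namespace Geo
variable {G : Set ℂ} {Γ : Geo G} {c C : ℝ} {F : Fin Γ.N → ℂ → ℂ}

set_option maxHeartbeats 800000 in
lemma cauchy_formula (hG : IsOpen G) (hbd : Bornology.IsBounded G) (hne : (frontier G).Nonempty) (hc : Γ.Adm c) (hF : Γ.LF c C F)
    {f : ℂ → ℂ} (hf : DifferentiableOn ℂ f G)
    (hfF : ∀ k, ∀ z ∈ Lens c, 0 < z.im → F k z = f (Γ.σ k z))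
    (hfb : ∀ z ∈ G, ‖f z‖ ≤ C * infDist z (frontier G) ^ mh12) :
    (∀ z ∈ G, ∑ j, Γ.Psi F 0 j z = 2 * rpi * I * f z) ∧ ∀ k, ∀ z ∈ Lens (c / 8), M1 F c k z = 0 := by
  classical
  have hcp := hc.pos
  have hm := Γ.m_pos
  have hs0 : |(0:ℝ)| < c / 2 := by simpa using hcp
  have hdL := dense_compl_frontier hG
  have hclosed : IsClosed (J Γ) := Γ.J_finite.isClosed
  obtain ⟨F1, hF1d, hF1⟩ : ∃ F1 : ℂ → ℂ, DifferentiableOn ℂ F1 (J Γ)ᶜ ∧ ∀ z ∈ (J Γ)ᶜ, z ∈ (frontier G)ᶜ → F1 z = M0 F f z := by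
    refine glue hclosed.isOpen_compl (fun z _ ↦ hdL z) fun z hz ↦ ?_
    by_cases hzL : z ∈ frontier G
    · obtain ⟨k, x, hx, rfl⟩ := Γ.cover z hzL
      have hx0 : x ∈ O01 := by
        refine ⟨hx.1.lt_of_ne ?_, hx.2.lt_of_ne ?_⟩
        · rintro rfl; exact hz (by simpa using mem_J0 k)
        · rintro rfl; exact hz (by simpa using mem_J1 k)
      have hb := bb_pos hx0
      have hsub : closedBall (x : ℂ) (c / 8 / 6 * bb x) ⊆ Lens (c / 8) := by
        intro w hw
        rw [mem_closedBall, dist_eq_norm] at hw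
        exact (Lens_ball pvt (by linarith [hc.le1]) (Lens_ofReal pvt hx0) (by simpa using hw)).1
      obtain ⟨τ, hτd, hτ⟩ := σ_inv Γ k (z0 := x) (ρ := c / 8 / 6 * bb x) pvt
        (fun w hw ↦ hc.Rc (Lens_mono pvt lnr (hsub hw)))
      refine ⟨Γ.m * (c / 8 / 6 * bb x) / 2, by positivity, fun v ↦ M1 F c k (τ v), fun v hv ↦ ?_, fun v hv hvS ↦ ?_⟩
      · exact ((M1_diff hc hF k (hsub (hτ v hv).1)).comp v (hτd.differentiableAt (isOpen_ball.mem_nhds hv))).differentiableWithinAt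
      · have h1 := hsub (hτ v hv).1
        beta_reduce
        rw [← loc_eq hc hF hfF k h1, (hτ v hv).2]
        intro h0
        refine hvS ?_
        rw [← (hτ v hv).2]
        exact memL' k (Lens_Icc pvt h1) h0
    · obtain ⟨r, hr, hrs⟩ := Metric.isOpen_iff.1 (isClosed_frontier (s := G)).isOpen_compl z hzL
      refine ⟨r, hr, M0 F f, fun v hv ↦ DifferentiableAt.differentiableWithinAt ?_, fun _ _ _ ↦ rfl⟩
      have hvL := hrs hv
      refine DifferentiableAt.sub (DifferentiableAt.fun_sum fun j _ ↦ Psi_diff hc hF hs0 j fun x hx h ↦ hvL ?_)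
        (DifferentiableAt.const_mul ?_ _)
      · rw [← h, xi_zero]; exact Γ.memL j x hx
      · by_cases hvG : v ∈ G
        · refine (hf.differentiableAt (hG.mem_nhds hvG)).congr_of_eventuallyEq ?_
          filter_upwards [hG.mem_nhds hvG] with w hw
          rw [if_pos hw]
        · have : v ∈ (closure G)ᶜ := fun h ↦ hvL ⟨h, by rwa [hG.interior_eq]⟩
          refine (differentiableAt_const zrC).congr_of_eventuallyEq ?_
          filter_upwards [isClosed_closure.isOpen_compl.mem_nhds this] with w hw
          rw [if_neg fun h ↦ hw (subset_closure h)]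
  obtain ⟨C', hC'⟩ := M0_bd hne hc hF hfF hfb
  obtain ⟨F2, hF2d, hF2⟩ : ∃ F2 : ℂ → ℂ, DifferentiableOn ℂ F2 univ ∧ ∀ z ∈ univ, z ∈ (J Γ)ᶜ → F2 z = F1 z := by
    refine glue isOpen_univ (fun z _ ↦ Γ.J_finite.countable.dense_compl ℝ z) fun p _ ↦ ?_
    by_cases hp : p ∈ J Γ
    · have hcl : IsClosed (J Γ \ {p}) := (Γ.J_finite.subset sdiff_subset).isClosed
      obtain ⟨r, hr, hrs⟩ := Metric.isOpen_iff.1 hcl.isOpen_compl p (fun h ↦ h.2 rfl)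
      set e := min (r / 2) 1
      have he : 0 < e := lt_min pvt one_pos
      have hoff : ∀ v ∈ ball p e, v ≠ p → v ∉ J Γ := fun v hv hvp hvJ ↦
        hrs (ball_subset_ball (by linarith [min_le_left (r/2) 1]) hv) ⟨hvJ, hvp⟩
      refine ⟨e, he, _, Complex.differentiableOn_update_limUnder_of_isLittleO (f := F1) (ball_mem_nhds p he)
        (hF1d.mono fun v hv ↦ hoff v hv.1 hv.2) ?_, fun v hv hvJ ↦ ?_⟩
      · have hb1 : ∀ v ∈ ball p e, v ≠ p → v ∉ frontier G → ‖F1 v‖ ≤ C' * ‖v - p‖ ^ mh34 := by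
          intro v hv hvp hvL
          rw [hF1 v (hoff v hv hvp) hvL]
          rw [mem_ball, dist_eq_norm] at hv
          refine hC' v hvL _ (norm_pos_iff.2 (sub_ne_zero.2 hvp)) (hv.le.trans mnr) fun p' hp' ↦ ?_
          by_cases hpp : p' = p
          · rw [hpp]
          · have h1 : r ≤ ‖p' - p‖ := by
              by_contra hcon
              push Not at hcon
              exact hrs (by rwa [mem_ball, dist_eq_norm] : p' ∈ ball p r) ⟨hp', hpp⟩
            have h2 := norm_sub_le (v - p) (v - p')
            rw [show v - p - (v - p') = p' - p by ring] at h2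
            linarith [min_le_left (r/2) 1]
        have hb2 : ∀ v ∈ ball p e, v ≠ p → ‖F1 v‖ ≤ C' * ‖v - p‖ ^ mh34 := by
          intro v hv hvp
          by_contra hcon
          push Not at hcon
          have hvJ := hoff v hv hvp
          have c1 : ContinuousAt F1 v := (hF1d.differentiableAt (hclosed.isOpen_compl.mem_nhds hvJ)).continuousAt
          have c2 : ContinuousAt (fun w ↦ C' * ‖w - p‖ ^ mh34) v :=
            continuousAt_const.mul (ContinuousAt.rpow_const bfp (Or.inl (norm_ne_zero_iff.2 (sub_ne_zero.2 hvp))))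
          have h3 := (c2.eventually_lt c1.norm hcon).and ((show ∀ᶠ w in nhds v, w ∈ ball p e from isOpen_ball.mem_nhds hv).and
            (show ∀ᶠ w in nhds v, w ≠ p from isOpen_ne.mem_nhds hvp))
          obtain ⟨w, hw, hwL⟩ := mem_closure_iff_nhds.1 (hdL v) _ h3
          exact (hb1 w hw.2.1 hw.2.2 hwL).not_gt hw.1
        rw [Asymptotics.isLittleO_iff]
        intro ε hε
        have ht : Tendsto (fun d : ℝ ↦ C' * d ^ qrR + ‖F1 p‖ * d) nh0 nh0 := by
          have : Continuous (fun d : ℝ ↦ C' * d ^ qrR + ‖F1 p‖ * d) :=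
            (continuous_const.mul (Real.continuous_rpow_const nnm)).add bfp
          simpa using this.tendsto 0
        have hn : Tendsto (fun v : ℂ ↦ ‖v - p‖) (nhdsWithin p {p}ᶜ) nh0 := by
          have : Continuous (fun v : ℂ ↦ ‖v - p‖) := by fun_prop
          simpa using (this.tendsto p).mono_left nhdsWithin_le_nhds
        filter_upwards [(ht.comp hn).eventually_lt_const hε, self_mem_nhdsWithin,
          mem_nhdsWithin_of_mem_nhds (ball_mem_nhds p he)] with v h1 h2 h3
        have hd : 0 < ‖v - p‖ := norm_pos_iff.2 (sub_ne_zero.2 h2)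
        rw [norm_inv, ← div_eq_mul_inv, le_div_iff₀ hd]
        have h4 := hb2 v h3 h2
        have h5 : ‖v - p‖ ^ mh34 * ‖v - p‖ = ‖v - p‖ ^ qrR := by
          conv_lhs => rw [← Real.rpow_one ‖v - p‖, ← Real.rpow_mul hd.le, ← rra hd]
          norm_num
        calc _ ≤ (C' * ‖v - p‖ ^ mh34 + ‖F1 p‖) * ‖v - p‖ := by
              gcongr; exact (norm_sub_le _ _).trans lnr
          _ = C' * ‖v - p‖ ^ qrR + ‖F1 p‖ * ‖v - p‖ := by rw [← h5]; ring
          _ ≤ ε := h1.le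
      · rw [Function.update_of_ne]
        rintro rfl; exact hvJ hp
    · obtain ⟨r, hr, hrs⟩ := Metric.isOpen_iff.1 hclosed.isOpen_compl p hp
      exact ⟨r, hr, F1, hF1d.mono hrs, fun _ _ _ ↦ rfl⟩
  have hJL : ∀ z, z ∉ frontier G → z ∉ J Γ := by
    intro z hz h
    obtain ⟨k, hk⟩ := mem_iUnion.1 h
    rcases hk with rfl | hk
    · exact hz (memL' k bsp bsp)
    · rw [mem_singleton_iff.1 hk] at hz; exact hz (memL' k bsp bsp)
  have h20 : ∀ z, z ∉ frontier G → F2 z = M0 F f z := fun z hz ↦ by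
    rw [hF2 z trivial (hJL z hz), hF1 z (hJL z hz) hz]
  have hM0 : ∀ z, z ∉ frontier G → M0 F f z = 0 := by
    intro z hz
    rw [← h20 z hz]
    refine (differentiableOn_univ.1 hF2d).apply_eq_of_tendsto_cocompact z ?_
    obtain ⟨R, hR⟩ := hbd.closure.exists_norm_le
    have h1 : Tendsto (fun z ↦ ∑ j, Γ.Psi F 0 j z) (cocompact ℂ) nh0 := by
      have h2 : ∀ j, Tendsto (Γ.Psi F 0 j) (cocompact ℂ) nh0 := fun j ↦ by
        refine cau_tendsto (wt_int hc hF hs0 j) (R := R) fun x hx ↦ hR _ (frontier_subset_closure ?_)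
        rw [xi_zero]; exact Γ.memL j x (Ioo_subset_Icc_self hx)
      simpa using tendsto_finsetSum Finset.univ fun j _ ↦ h2 j
    refine h1.congr' ?_
    filter_upwards [tendsto_norm_cocompact_atTop.eventually_gt_atTop R] with v hv
    have hvc : v ∉ closure G := fun h ↦ (hR v h).not_gt hv
    rw [h20 v fun h ↦ hvc (frontier_subset_closure h)]
    unfold M0
    rw [if_neg fun h ↦ hvc (subset_closure h)]; ring
  constructor
  · intro z hz
    have h1 := hM0 z fun h ↦ by rw [hG.frontier_eq] at h; exact h.2 hz
    unfold M0 at h1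
    rwa [if_pos hz, sub_eq_zero] at h1
  · intro k z hz
    by_contra hcon
    have h3 := ((M1_diff hc hF k hz).continuousAt.eventually_ne hcon).and (isOpen_Lens.mem_nhds hz)
    obtain ⟨w, hw, hw0⟩ := mem_closure_iff_nhds.1 (dense_im_ne z) _ h3
    have hwc : w ∈ Lens c := Lens_mono pvt lnr hw.2
    refine hw.1 ?_
    rw [← loc_eq hc hF hfF k hw.2 hw0]
    refine hM0 _ fun h ↦ ?_
    rcases lt_or_gt_of_ne hw0 with h0 | h0
    · exact Γ.down k w (Lens_mono hcp hc.le hwc) h0 (frontier_subset_closure h)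
    · rw [hG.frontier_eq] at h; exact h.2 (Γ.up k w (Lens_mono hcp hc.le hwc) h0)

end Geo

lemma sub_of_frontier {t G : Set ℂ} (ht : IsPreconnected t) (h : (t ∩ G).Nonempty) (hd : ∀ z ∈ t, z ∉ frontier G) : t ⊆ G := by
  intro z hz
  by_contra hzG
  obtain ⟨y, hy, hyG⟩ := h
  obtain ⟨w, -, hw, hw'⟩ := ht (interior G) (closure G)ᶜ isOpen_interior isClosed_closure.isOpen_compl
    (fun w hw ↦ or_iff_not_imp_left.2 fun h1 h2 ↦ hd w hw ⟨h2, h1⟩)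
    ⟨y, hy, by_contra fun h ↦ hd y hy ⟨subset_closure hyG, h⟩⟩
    ⟨z, hz, fun h ↦ hd z hz ⟨h, fun h' ↦ hzG (interior_subset h')⟩⟩
  exact hw' (subset_closure (interior_subset hw))

lemma ball_sub_of_infDist {G : Set ℂ} {z : ℂ} (hz : z ∈ G) {r : ℝ} (hr : r ≤ infDist z (frontier G)) : ball z r ⊆ G := by
  by_cases h : 0 < r
  · refine sub_of_frontier (convex_ball z r).isPreconnected ⟨z, mem_ball_self h, hz⟩ fun w hw hwf ↦ ?_
    have := infDist_le_dist_of_mem (x := z) hwf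
    rw [dist_comm] at this
    linarith [mem_ball.1 hw]
  · rw [ball_eq_empty.2 (not_lt.1 h)]; exact empty_subset _

namespace Geo
variable {G : Set ℂ}

structure Dat (Γ : Geo G) where
  φ : ℂ → ℂ
  κ : ℂ → ℂ
  q : ℝ
  η : ℝ
  c : ℝ
  ht : Fin Γ.N → ℂ → ℂ
  kt : Fin Γ.N → ℂ → ℂ
  isOpen : IsOpen G
  bdd : Bornology.IsBounded G
  ne : (frontier G).Nonempty
  hφ : DifferentiableOn ℂ φ G
  inj : InjOn φ G
  im : φ '' G = ball 0 1
  hκ : DifferentiableOn ℂ κ G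
  hκ2 : ∀ z ∈ G, κ z ^ 2 = deriv φ z
  q0 : 1 / 2 ≤ q
  q1 : q < 1
  η0 : 0 < η
  hη : ∀ z ∈ G, infDist z (frontier G) < η → q < ‖φ z‖
  adm : Γ.Adm c
  cη : c * Γ.M ≤ η
  dht : ∀ k, DifferentiableOn ℂ (ht k) (Lens c)
  dkt : ∀ k, DifferentiableOn ℂ (kt k) (Lens c)
  eq : ∀ k, ∀ z ∈ Lens c, 0 < z.im → ht k z = φ (Γ.σ k z) ∧ kt k z = κ (Γ.σ k z)
  hb : ∀ k, ∀ z ∈ Lens c, q ≤ ‖ht k z‖ ∧ ‖ht k z‖ ≤ q⁻¹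
  ax : ∀ k, ∀ x ∈ O01, ‖ht k x‖ = 1 ∧
    kt k x * deriv (Γ.σ k) x = I * cnj (kt k x) * ‖deriv (Γ.σ k) x‖ * ht k x
  kb : ∀ k, ∀ z ∈ Lens (c / 2), ∀ m : ℝ, 0 < m → (∀ w ∈ Lens c, 0 < w.im → |w.re - z.re| ≤ bb z.re / 6 →
    - rlg ‖φ (Γ.σ k w)‖ ≤ m) → ‖kt k z‖ ^ 2 ≤ 108 / (c * q * Γ.m) * m / bb z.re

lemma exists_dat (Γ : Geo G) (hG : IsOpen G) (hbd : Bornology.IsBounded G) (hne : (frontier G).Nonempty)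
    (hs : IsSimplyConnected G) {K : Set ℂ} (hK : IsCompact K) (hKG : K ⊆ G) :
    ∃ D : Dat Γ, ∀ z ∈ K, ‖D.φ z‖ ≤ 2 * D.q - 1 := by
  obtain ⟨φ, hφ, hi, him⟩ := riemann_map hG hs hbd
  obtain ⟨κ, hκ, hκ2⟩ := exists_sqrt hG hs (hφ.deriv hG) fun z hz ↦ deriv_ne_zero_of_injOn hG hφ hi hz
  obtain ⟨a, ha0, ha1, ha⟩ : ∃ a, 0 ≤ a ∧ a < 1 ∧ ∀ z ∈ K, ‖φ z‖ ≤ a := by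
    rcases K.eq_empty_or_nonempty with rfl | hKn
    · exact ⟨0, le_rfl, one_pos, by simp⟩
    · obtain ⟨w, hw, hmax⟩ := hK.exists_isMaxOn hKn (hφ.continuousOn.mono hKG).norm
      refine ⟨‖φ w‖, norm_nonneg _, ?_, fun z hz ↦ hmax hz⟩
      have : φ w ∈ ball zrC 1 := him ▸ mem_image_of_mem φ (hKG hw)
      simpa using this
  obtain ⟨η, hη0, hη⟩ := riemann_bdry hG hbd hφ hi him (ε := 1 - (1 + a) / 2) lnr
  have hM := Γ.M_pos
  have hm := Γ.m_pos
  have hc0 := Γ.c0_pos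
  set c := min Γ.c0 (min (Γ.m / (16 * Γ.M)) (η / Γ.M))
  have hc : Γ.Adm c := ⟨by positivity, min_le_left _ _, by
    have : c ≤ Γ.m / (16 * Γ.M) := (mnr).trans mnl
    rw [le_div_iff₀ pvt] at this; linarith⟩
  have hcη : c * Γ.M ≤ η := by
    have : c ≤ η / Γ.M := (mnr).trans mnr
    rwa [le_div_iff₀ hM] at this
  rw [sub_sub_cancel] at hη
  choose ht kt h1 h2 h3 h4 h5 h6 using fun k ↦ arc_ext Γ k hG hbd hφ hi him hκ hκ2 (by linarith : 0 < (1 + a) / 2)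
    lnr hη hc.pos hc.le hcη
  exact ⟨⟨φ, κ, (1 + a) / 2, η, c, ht, kt, hG, hbd, hne, hφ, hi, him, hκ, hκ2, by linarith, by linarith, hη0, hη, hc, hcη, h1, h2, h3,
    h4, h5, h6⟩, fun z hz ↦ by linarith [ha z hz]⟩

namespace Dat
variable {Γ : Geo G} (D : Dat Γ)

lemma φ_lt {z : ℂ} (hz : z ∈ G) : ‖D.φ z‖ < 1 := by
  have : D.φ z ∈ ball zrC 1 := D.im ▸ mem_image_of_mem _ hz
  simpa using this

lemma κ_ne {z : ℂ} (hz : z ∈ G) : D.κ z ≠ 0 := fun h ↦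
  deriv_ne_zero_of_injOn D.isOpen D.hφ D.inj hz (by rw [← D.hκ2 z hz, h]; ring)

lemma σ_G {k : Fin Γ.N} {z : ℂ} (hz : z ∈ Lens D.c) (h : 0 < z.im) : Γ.σ k z ∈ G :=
  Γ.up k z (Lens_mono D.adm.pos D.adm.le hz) h

lemma φσ {k : Fin Γ.N} {z : ℂ} (hz : z ∈ Lens D.c) (h : 0 < z.im) : D.q < ‖D.φ (Γ.σ k z)‖ := by
  refine D.hη _ (D.σ_G hz h) ((Γ.infDist_le k (Lens_mono D.adm.pos D.adm.le hz)).trans_lt ?_)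
  have h3 : |z.im| < D.c * bb z.re := hz
  have h2 := bb_le z.re
  have hM := Γ.M_pos
  have := D.adm.pos
  calc Γ.M * |z.im| < Γ.M * (D.c * bb z.re) := by gcongr
    _ ≤ Γ.M * (D.c * 1) := by gcongr; linarith
    _ ≤ D.η := by linarith [D.cη]

lemma bound : ∃ B, 0 < B ∧ (∀ k, ∀ z ∈ Lens (D.c / 2), ‖D.kt k z‖ ≤ B * bb z.re ^ mh12) ∧
    ∀ z ∈ G, ‖D.κ z‖ ≤ B * infDist z (frontier G) ^ mh12 := by
  have hcp := D.adm.pos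
  have hm := Γ.m_pos
  have hq : 0 < D.q := by linarith [D.q0]
  have hl : 0 < - rlg D.q := by linarith [Real.log_neg hq D.q1]
  set A := 108 / (D.c * D.q * Γ.m) * (- rlg D.q)
  have hs : ∀ x A y : ℝ, 0 < x → 0 ≤ y → y ^ 2 ≤ A / x → y ≤ Real.sqrt A * x ^ mh12 := by
    intro x A y hx hy h
    rw [rrn hx.le, ← Real.sqrt_eq_rpow, ← div_eq_mul_inv, ← Real.sqrt_div' _ hx.le]
    exact Real.le_sqrt_of_sq_le h
  refine ⟨Real.sqrt A + Real.sqrt 2, by positivity, fun k z hz ↦ ?_, fun z hz ↦ ?_⟩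
  · have hb := Lens_bb pvt hz
    refine (hs _ A _ hb nng (D.kb k z hz _ hl fun w hw h _ ↦ ?_)).trans (by gcongr; linarith [Real.sqrt_nonneg 2])
    have := Real.log_le_log hq (D.φσ (k := k) hw h).le
    linarith
  · have hd : 0 < infDist z (frontier G) := (isClosed_frontier.notMem_iff_infDist_pos D.ne).1 fun h ↦ by
      rw [D.isOpen.frontier_eq] at h; exact h.2 hz
    refine (hs _ 2 _ hd nng ?_).trans (by gcongr; linarith [Real.sqrt_nonneg A])
    rw [← norm_pow, D.hκ2 z hz]
    have hsub := ball_sub_of_infDist hz le_rfl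
    refine Complex.norm_deriv_le_div_of_mapsTo_ball (D.hφ.mono hsub) (fun w hw ↦ ?_) hd
    rw [mem_closedBall, dist_eq_norm]
    linarith [norm_sub_le (D.φ w) (D.φ z), D.φ_lt (hsub hw), D.φ_lt hz]

lemma cf {g : ℂ → ℂ} {g' : Fin Γ.N → ℂ → ℂ} {A : ℝ} (hg : DifferentiableOn ℂ g G) (hg' : ∀ k, DifferentiableOn ℂ (g' k) (Lens D.c))
    (e : ∀ k, ∀ z ∈ Lens D.c, 0 < z.im → g' k z = g (Γ.σ k z)) (hgb : ∀ z ∈ G, ‖g z‖ ≤ A) (hgb' : ∀ k, ∀ z ∈ Lens D.c, ‖g' k z‖ ≤ A) :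
    (∃ C, Γ.LF D.c C (fun k z ↦ g' k z * D.kt k z)) ∧
    (∀ z ∈ G, ∑ j, Γ.Psi (fun k z ↦ g' k z * D.kt k z) 0 j z = 2 * rpi * I * (g z * D.κ z)) ∧
    ∀ k, ∀ z ∈ Lens (D.c / 8), M1 (fun k z ↦ g' k z * D.kt k z) D.c k z = 0 := by
  obtain ⟨B, hB, hB1, hB2⟩ := D.bound
  have hcp := D.adm.pos
  have hA1 : A ≤ |A| + 1 := by linarith [le_abs_self A]
  have hF : Γ.LF D.c ((|A| + 1) * B) (fun k z ↦ g' k z * D.kt k z) := by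
    refine ⟨by positivity, fun k ↦ (hg' k).mul (D.dkt k), fun k z hz ↦ ?_⟩
    rw [norm_mul, mul_assoc]
    exact mul_le_mul ((hgb' k z (Lens_mono pvt lnr hz)).trans hA1) (hB1 k z hz) nng pvt
  refine ⟨⟨_, hF⟩, cauchy_formula D.isOpen D.bdd D.ne D.adm hF (hg.mul D.hκ) (fun k z hz h ↦ ?_) fun z hz ↦ ?_⟩
  · simp only [e k z hz h, (D.eq k z hz h).2]
  · rw [norm_mul, mul_assoc]
    exact mul_le_mul ((hgb z hz).trans hA1) (hB2 z hz) nng pvt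

end Dat
end Geo

namespace Geo
variable {G : Set ℂ} {Γ : Geo G}

noncomputable def cw (Γ : Geo G) (P : Polynomial ℂ) (j : Fin Γ.N) (x : ℝ) : ℂ :=
  cnj (P.eval (Γ.σ j x)) * ‖deriv (Γ.σ j) x‖

noncomputable def H (Γ : Geo G) (P : Polynomial ℂ) (t : ℂ) : ℂ :=
  ∑ j, ∫ x in O01, Γ.cw P j x / (t - Γ.σ j x)

lemma cont_σ (k : Fin Γ.N) : ContinuousOn (fun x : ℝ ↦ Γ.σ k x) (Icc 0 1) :=
  (Γ.diff k).continuousOn.comp continuous_ofReal.continuousOn fun _ hx ↦ Γ.ofReal_mem_Rc hx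

lemma cont_σ' (k : Fin Γ.N) : ContinuousOn (fun x : ℝ ↦ deriv (Γ.σ k) x) (Icc 0 1) :=
  ((Γ.diff k).deriv isOpen_Rc).continuousOn.comp continuous_ofReal.continuousOn fun _ hx ↦ Γ.ofReal_mem_Rc hx

lemma cont_cw (P : Polynomial ℂ) (j : Fin Γ.N) : ContinuousOn (Γ.cw P j) (Icc 0 1) :=
  (continuous_conj.comp_continuousOn (P.continuous.comp_continuousOn (cont_σ j))).mul
    (continuous_ofReal.comp_continuousOn (cont_σ' j).norm)

lemma cw_bd (P : Polynomial ℂ) (j : Fin Γ.N) : ∃ B, 0 < B ∧ ∀ x ∈ I01, ‖Γ.cw P j x‖ ≤ B := by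
  obtain ⟨B, hB⟩ := isCompact_Icc.exists_bound_of_continuousOn (cont_cw P j)
  exact ⟨|B| + 1, by positivity, fun x hx ↦ (hB x hx).trans (by linarith [le_abs_self B])⟩

namespace Dat
variable (D : Dat Γ)

lemma denA {a w : ℂ} (ha : ‖a‖ ≤ 2 * D.q - 1) (hw : ‖w‖ ≤ D.q⁻¹) : 1 - D.q ≤ ‖1 - cnj a * w‖ := by
  have hq0 := D.q0
  have hq1 := D.q1
  have h1 : ‖cnj a * w‖ ≤ (2 * D.q - 1) * D.q⁻¹ := by
    rw [norm_mul, RCLike.norm_conj]; gcongr; linarith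
  have h2 := norm_sub_norm_le 1 (cnj a * w)
  rw [norm_one] at h2
  have h3 : (2 * D.q - 1) * D.q⁻¹ ≤ D.q := by
    rw [← div_eq_mul_inv, div_le_iff₀ lnr]; nlinarith [sq_nonneg (D.q - 1)]
  linarith

noncomputable def FA (a : ℂ) (k : Fin Γ.N) (z : ℂ) : ℂ := (1 - cnj a * D.ht k z)⁻¹ * D.kt k z

lemma FA_cf {a : ℂ} (ha : ‖a‖ ≤ 2 * D.q - 1) : (∃ C, Γ.LF D.c C (D.FA a)) ∧
    ∀ k, ∀ z ∈ Lens (D.c / 8), M1 (D.FA a) D.c k z = 0 := by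
  have hq0 := D.q0
  have hq1 := D.q1
  have hφ : ∀ z ∈ G, ‖D.φ z‖ ≤ D.q⁻¹ := fun z hz ↦
    (D.φ_lt hz).le.trans (one_le_inv_iff₀.2 ⟨by linarith, by linarith⟩)
  have hp : ∀ w : ℂ, ‖w‖ ≤ D.q⁻¹ → 1 - cnj a * w ≠ 0 := fun w hw h0 ↦ by
    have := D.denA ha hw
    rw [h0, norm_zero] at this; linarith
  have hn : ∀ w : ℂ, ‖w‖ ≤ D.q⁻¹ → ‖(1 - cnj a * w)⁻¹‖ ≤ (1 - D.q)⁻¹ := fun w hw ↦ by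
    rw [norm_inv]; exact inv_anti₀ lnr (D.denA ha hw)
  have := D.cf (g := fun z ↦ (1 - cnj a * D.φ z)⁻¹) (g' := fun k z ↦ (1 - cnj a * D.ht k z)⁻¹)
    (A := (1 - D.q)⁻¹) (((D.hφ.const_mul _).const_sub 1).inv fun z hz ↦ hp _ (hφ z hz))
    (fun k ↦ (((D.dht k).const_mul _).const_sub 1).inv fun z hz ↦ hp _ (D.hb k z hz).2)
    (fun k z hz h ↦ by rw [(D.eq k z hz h).1]) (fun z hz ↦ hn _ (hφ z hz)) (fun k z hz ↦ hn _ (D.hb k z hz).2)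
  exact ⟨this.1, this.2.2⟩

lemma stepB {ζ : ℂ} (hζ : ζ ∈ G) (ha : ‖D.φ ζ‖ ≤ 2 * D.q - 1) (P : Polynomial ℂ) :
    2 * rpi * cnj (P.eval ζ / D.κ ζ) = ∑ j, ∫ x in O01, Γ.cw P j x * D.FA (D.φ ζ) j x := by
  have hq0 := D.q0
  have hq1 := D.q1
  set a := D.φ ζ with hadef
  have hds : DifferentiableOn ℂ (dslope D.φ ζ) G := (differentiableOn_dslope (D.isOpen.mem_nhds hζ)).2 D.hφ
  have hdne : ∀ z ∈ G, dslope D.φ ζ z ≠ 0 := by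
    intro z hz
    by_cases h : z = ζ
    · rw [h, dslope_same]; exact deriv_ne_zero_of_injOn D.isOpen D.hφ D.inj hζ
    · rw [dslope_of_ne _ h, slope_def_field]
      exact div_ne_zero (sub_ne_zero.2 fun h' ↦ h (D.inj hz hζ h')) (sub_ne_zero.2 h)
  have hden : ∀ w : ℂ, D.q ≤ ‖w‖ → 1 - D.q ≤ ‖w - a‖ := fun w hw ↦ by
    linarith [norm_sub_norm_le w a]
  obtain ⟨R, hR⟩ := D.bdd.closure.exists_norm_le
  have hR0 : 0 ≤ R := (nng).trans (hR ζ (subset_closure hζ))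
  obtain ⟨B1, hB1⟩ := (isCompact_closedBall zrC (R + 3 * Γ.M)).exists_bound_of_continuousOn P.continuous.continuousOn
  have hM := Γ.M_pos
  have hcp := D.adm.pos
  have hB10 : 0 ≤ B1 := (nng).trans (hB1 0 (by simp; positivity))
  have hKc : IsCompact {z | z ∈ closure G ∧ D.η ≤ infDist z (frontier G)} :=
    D.bdd.isCompact_closure.inter_right (isClosed_le continuous_const (continuous_infDist_pt _))
  have hKG : {z | z ∈ closure G ∧ D.η ≤ infDist z (frontier G)} ⊆ G := fun z hz ↦ by
    by_contra h
    have : z ∈ frontier G := ⟨hz.1, by rwa [D.isOpen.interior_eq]⟩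
    have h2 := hz.2
    rw [infDist_zero_of_mem this] at h2
    linarith [D.η0]
  obtain ⟨B2, hB2⟩ := hKc.exists_bound_of_continuousOn ((hds.continuousOn.inv₀ hdne).mono hKG)
  have hσR : ∀ k, ∀ z ∈ Lens D.c, ‖Γ.σ k z‖ ≤ R + 3 * Γ.M := by
    intro k z hz
    have h0 : ((0:ℝ):ℂ) ∈ Rc Γ.r0 := Γ.ofReal_mem_Rc bsp
    have h1 := Γ.lip k z (D.adm.Rc hz) _ h0
    have h2 := hR _ (frontier_subset_closure (Γ.memL k 0 bsp))
    have h3 : ‖z - (0:ℝ)‖ ≤ 3 := by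
      rw [ofReal_zero, sub_zero]
      have h5 : |z.im| < D.c * bb z.re := hz
      have h4 := Lens_Icc hcp hz
      have := bb_le z.re
      have := D.adm.le1
      have := norm_le_abs_re_add_abs_im z
      rw [abs_of_nonneg h4.1] at this
      nlinarith [h4.2, Lens_bb hcp hz]
    have h6 := norm_sub_norm_le (Γ.σ k z) (Γ.σ k (0:ℝ))
    nlinarith
  have hPb : ∀ z : ℂ, ‖z‖ ≤ R + 3 * Γ.M → ‖P.eval z‖ ≤ B1 := fun z hz ↦ hB1 z (by simpa using hz)
  set A := B1 * |B2| + (R + 3 * Γ.M + R) * B1 * (1 - D.q)⁻¹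
  have hi0 : 0 < (1 - D.q)⁻¹ := inv_pos.2 lnr
  have hcf := D.cf (g := fun z ↦ P.eval z * (dslope D.φ ζ z)⁻¹)
    (g' := fun k z ↦ (Γ.σ k z - ζ) * P.eval (Γ.σ k z) * (D.ht k z - a)⁻¹) (A := A)
    (P.differentiable.differentiableOn.mul (hds.inv hdne))
    (fun k ↦ by
      have hσd : DifferentiableOn ℂ (Γ.σ k) (Lens D.c) := (Γ.diff k).mono fun z hz ↦ D.adm.Rc hz
      refine ((hσd.sub_const ζ).mul (P.differentiable.comp_differentiableOn hσd)).mul (((D.dht k).sub_const a).inv fun z hz h0 ↦ ?_)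
      have := hden _ (D.hb k z hz).1
      rw [h0, norm_zero] at this; linarith)
    (fun k z hz h ↦ by
      have h1 := D.φσ (k := k) hz h
      have hne : Γ.σ k z ≠ ζ := fun h0 ↦ by rw [h0] at h1; linarith
      rw [(D.eq k z hz h).1, dslope_of_ne _ hne, slope_def_field, inv_div]
      ring)
    (fun z hz ↦ by
      rw [norm_mul]
      have hz1 := hPb z ((hR z (subset_closure hz)).trans lnr)
      by_cases h : D.η ≤ infDist z (frontier G)
      · have := (hB2 z ⟨subset_closure hz, h⟩).trans (le_abs_self B2)
        refine (mul_le_mul hz1 this nng hB10).trans (le_add_of_nonneg_right pvt)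
      · have h1 := D.hη z hz (not_le.1 h)
        have hne : z ≠ ζ := fun h0 ↦ by rw [h0] at h1; linarith
        rw [dslope_of_ne _ hne, slope_def_field, inv_div, norm_div, div_eq_mul_inv]
        have h2 : ‖D.φ z - D.φ ζ‖⁻¹ ≤ (1 - D.q)⁻¹ := inv_anti₀ lnr (hden _ h1.le)
        have h3 : ‖z - ζ‖ ≤ R + 3 * Γ.M + R := by
          linarith [norm_sub_le z ζ, hR z (subset_closure hz), hR ζ (subset_closure hζ)]
        calc _ ≤ B1 * ((R + 3 * Γ.M + R) * (1 - D.q)⁻¹) := by gcongr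
          _ ≤ A := by linarith [mul_nonneg hB10 (abs_nonneg B2)])
    (fun k z hz ↦ by
      rw [norm_mul, norm_mul, norm_inv]
      have h2 : ‖D.ht k z - a‖⁻¹ ≤ (1 - D.q)⁻¹ := inv_anti₀ lnr (hden _ (D.hb k z hz).1)
      have h1 := hσR k z hz
      have h3 : ‖Γ.σ k z - ζ‖ ≤ R + 3 * Γ.M + R := by linarith [norm_sub_le (Γ.σ k z) ζ, hR ζ (subset_closure hζ)]
      have h4 := hPb _ h1
      calc _ ≤ (R + 3 * Γ.M + R) * B1 * (1 - D.q)⁻¹ := by gcongr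
        _ ≤ A := by linarith [mul_nonneg hB10 (abs_nonneg B2)])
  have h1 := hcf.2.1 ζ hζ
  have hκ := D.κ_ne hζ
  rw [dslope_same, ← D.hκ2 ζ hζ, show P.eval ζ * (D.κ ζ ^ 2)⁻¹ * D.κ ζ = P.eval ζ / D.κ ζ by field_simp] at h1
  have h2 : ∀ j, Γ.Psi (fun k z ↦ (Γ.σ k z - ζ) * P.eval (Γ.σ k z) * (D.ht k z - a)⁻¹ * D.kt k z) 0 j ζ =
      I * cnj (∫ x in O01, Γ.cw P j x * D.FA a j x) := by
    intro j
    rw [← integral_conj, ← integral_const_mul]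
    refine setIntegral_congr_fun measurableSet_Ioo fun x hx ↦ ?_
    obtain ⟨e1, e2⟩ := D.ax j x hx
    have hxL : (x : ℂ) ∈ Lens D.c := Lens_ofReal hcp hx
    have hσne : Γ.σ j x - ζ ≠ 0 := fun h0 ↦ by
      have := Γ.memL j x (Ioo_subset_Icc_self hx)
      rw [sub_eq_zero.1 h0, D.isOpen.frontier_eq] at this; exact this.2 hζ
    have hn := hden _ (D.hb j _ hxL).1
    have hhne : D.ht j x - a ≠ 0 := fun h0 ↦ by rw [h0, norm_zero] at hn; linarith
    have hcon : D.ht j x * cnj (D.ht j x) = 1 := by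
      rw [mul_conj, normSq_eq_norm_sq, e1]; simp
    have hA : D.ht j x * (D.ht j x - a)⁻¹ = (1 - a * cnj (D.ht j x))⁻¹ := by
      have : D.ht j x - a = D.ht j x * (1 - a * cnj (D.ht j x)) := by linear_combination (a : ℂ) * hcon
      rw [this, mul_inv, ← mul_assoc, mul_inv_cancel₀ (fun h0 ↦ by rw [h0, norm_zero] at e1; norm_num at e1), one_mul]
    simp only [wt, xi_zero, xi', cw, FA, map_mul, map_inv₀, map_sub, map_one, conj_conj, conj_ofReal, zero_mul, ofReal_zero, add_zero, mul_one]
    rw [← hA, div_eq_iff hσne]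
    linear_combination (Γ.σ j x - ζ) * P.eval (Γ.σ j x) * (D.ht j x - a)⁻¹ * e2
  rw [fsc rfl fun j _ ↦ h2 j, ← Finset.mul_sum, ← map_sum] at h1
  have h3 : cnj (∑ j, ∫ x in O01, Γ.cw P j x * D.FA a j x) = 2 * rpi * (P.eval ζ / D.κ ζ) := by
    have := I_ne_zero
    apply mul_left_cancel₀ this
    rw [h1]; ring
  rw [← conj_conj (∑ j, ∫ x in O01, Γ.cw P j x * D.FA a j x), h3, map_mul, map_mul, conj_ofReal, map_ofNat]

lemma s_lt {c : ℝ} (hc : Γ.Adm c) : |-(c / 4)| < c := by linarith [s1_lt hc, hc.pos]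

lemma fub {F : Fin Γ.N → ℂ → ℂ} {C : ℝ} (hF : Γ.LF D.c C F) (P : Polynomial ℂ) (i j : Fin Γ.N) :
    Integrable (Function.uncurry fun x y : ℝ ↦ Γ.cw P j x * (Γ.wt F (-(D.c / 4)) i y / (Γ.σ i (xi (-(D.c / 4)) y) - Γ.σ j x)))
      ((volume.restrict (O01)).prod (volume.restrict (O01))) := by
  have hcp := D.adm.pos
  have hm := Γ.m_pos
  have hM := Γ.M_pos
  have hC := hF.C_pos
  have hs := s_lt D.adm
  obtain ⟨B, hB, hBd⟩ := cw_bd (Γ := Γ) P j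
  have hk := fun x (hx : x ∈ O01) y (hy : y ∈ O01) ↦
    ker D.adm i j (Ioo_subset_Icc_self hy) (Γ.ofReal_mem_Rc (Ioo_subset_Icc_self hx)) (Ioo_subset_Icc_self hx) (by
      rw [ofReal_im, ofReal_re, abs_zero]; have := bb_pos hx; positivity)
  have hi := int_bb (by norm_num : (-1 : ℝ) < -(3 / 4)) nnm
  have hg := (hi.integrable.mul_prod hi.integrable).const_mul (B * (2 * C * Γ.M * (Γ.m * D.c / 16)⁻¹))
  refine hg.mono' ?_ ?_
  · rw [Measure.prod_restrict]
    refine ContinuousOn.aestronglyMeasurable ?_ (measurableSet_Ioo.prod measurableSet_Ioo)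
    have hm2 : MapsTo (xi (-(D.c / 4))) (O01) (Lens D.c) := fun x hx ↦ xi_mem_Lens hs hx
    have cx : ContinuousOn (xi (-(D.c / 4))) (O01) := (continuous_xi _).continuousOn
    have c1 : ContinuousOn (Γ.wt F (-(D.c / 4)) i) (Ioo 0 1) :=
      (((hF.diff i).continuousOn.comp cx hm2).mul
      (((Γ.diff i).deriv isOpen_Rc).continuousOn.comp cx fun x hx ↦ D.adm.Rc (hm2 hx))).mul (continuous_xi' _).continuousOn
    have c2 : ContinuousOn (fun y ↦ Γ.σ i (xi (-(D.c / 4)) y)) (Ioo 0 1) :=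
      (Γ.diff i).continuousOn.comp cx fun x hx ↦ D.adm.Rc (hm2 hx)
    refine ContinuousOn.mul (((cont_cw P j).mono Ioo_subset_Icc_self).comp continuousOn_fst fun p hp ↦ hp.1) (ContinuousOn.div
      (c1.comp continuousOn_snd fun p hp ↦ hp.2)
      ((c2.comp continuousOn_snd fun p hp ↦ hp.2).sub (((cont_σ j).mono Ioo_subset_Icc_self).comp continuousOn_fst fun p hp ↦ hp.1))
      fun p hp h0 ↦ ?_)
    have h1 := (hk p.1 hp.1 p.2 hp.2).1
    rw [h0, norm_zero] at h1
    have := bb_pos hp.2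
    nlinarith [mul_pos hm hcp]
  · rw [Measure.prod_restrict]
    refine (ae_restrict_iff' (measurableSet_Ioo.prod measurableSet_Ioo)).2 (Eventually.of_forall fun p hp ↦ ?_)
    obtain ⟨x, y⟩ := p
    obtain ⟨hx : x ∈ O01, hy : y ∈ O01⟩ := hp
    have h1 := hBd x (Ioo_subset_Icc_self hx)
    have h2 := wt_bd D.adm hF (s1_lt D.adm) i hy
    obtain ⟨h3, h4⟩ := hk x hx y hy
    rw [ofReal_re] at h4
    have hbx := bb_pos hx
    have hby := bb_pos hy
    set n := ‖Γ.σ i (xi (-(D.c / 4)) y) - Γ.σ j x‖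
    set e := Γ.m * D.c / 16
    have he : 0 < e := by positivity
    have h5 : n⁻¹ ≤ e⁻¹ * (bb x ^ mh34 * bb y ^ (-(1 / 4) : ℝ)) := by
      rw [rrn hbx.le, rrn hby.le, ← mul_inv, ← mul_inv]
      refine inv_anti₀ pvt ?_
      have hn : 0 ≤ n / e := by positivity
      have hx' : bb x ≤ n / e := by rw [le_div_iff₀ he]; linarith
      have hy' : bb y ≤ n / e := by rw [le_div_iff₀ he]; linarith
      calc e * (bb x ^ (3 / 4 : ℝ) * bb y ^ qrR) ≤ e * ((n / e) ^ (3 / 4 : ℝ) * (n / e) ^ qrR) := by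
            gcongr
        _ = n := by
            rw [← rra (hbx.trans_le hx')]; norm_num
            field_simp
    rw [Function.uncurry_apply_pair, norm_mul, norm_div, div_eq_mul_inv ‖Γ.wt F (-(D.c / 4)) i y‖]
    have h6 : bb y ^ mh12 * bb y ^ (-(1 / 4) : ℝ) = bb y ^ mh34 := by
      rw [← rra hby]; norm_num
    calc _ ≤ B * ((2 * C * Γ.M * bb y ^ mh12) * (e⁻¹ * (bb x ^ mh34 * bb y ^ (-(1 / 4) : ℝ)))) := by
          gcongr
      _ = B * (2 * C * Γ.M * e⁻¹) * (bb x ^ mh34 * (bb y ^ mh12 * bb y ^ (-(1 / 4) : ℝ))) := by ring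
      _ = _ := by rw [h6]

lemma dual {ζ : ℂ} (hζ : ζ ∈ G) (ha : ‖D.φ ζ‖ ≤ 2 * D.q - 1) (P : Polynomial ℂ) {g : Fin Γ.N → ℝ → ℝ}
    (hg : ∀ i, IntegrableOn (g i) (Ioo 0 1))
    (hb : ∀ i, ∀ x ∈ O01, ‖D.kt i (xi (-(D.c / 4)) x)‖ * ‖Γ.H P (Γ.σ i (xi (-(D.c / 4)) x))‖ ≤ g i x) :
    ‖P.eval ζ‖ ≤ ‖D.κ ζ‖ * (2 * Γ.M / (1 - D.q) * ∑ i, ∫ x in O01, g i x) := by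
  have hcp := D.adm.pos
  have hM := Γ.M_pos
  have hq1 := D.q1
  obtain ⟨⟨C, hF⟩, hM1⟩ := D.FA_cf ha
  set F := D.FA (D.φ ζ)
  set s := -(D.c / 4)
  have hs : |s| < D.c := s_lt D.adm
  have h1 := D.stepB hζ ha P
  have key : (2 * rpi) ^ 2 * I * cnj (P.eval ζ / D.κ ζ) =
      ∑ i, ∫ y in O01, Γ.wt F s i y * Γ.H P (Γ.σ i (xi s y)) := by
    have hsw : ∀ i j, ∫ x in O01, ∫ y in O01, Γ.cw P j x * (Γ.wt F s i y / (Γ.σ i (xi s y) - Γ.σ j x)) =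
        ∫ y in O01, ∫ x in O01, Γ.cw P j x * (Γ.wt F s i y / (Γ.σ i (xi s y) - Γ.σ j x)) :=
      fun i j ↦ integral_integral_swap (D.fub hF P i j)
    calc _ = 2 * rpi * I * (2 * rpi * cnj (P.eval ζ / D.κ ζ)) := by ring
      _ = ∑ j, ∫ x in O01, Γ.cw P j x * ∑ i, Γ.Psi F s i (Γ.σ j x) := by
          rw [h1, Finset.mul_sum]
          refine fsc rfl fun j _ ↦ ?_
          rw [← integral_const_mul]
          refine setIntegral_congr_fun measurableSet_Ioo fun x hx ↦ ?_
          have := hM1 j x (Lens_ofReal pvt hx)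
          unfold M1 at this
          change 2 * rpi * I * (Γ.cw P j x * F j x) = Γ.cw P j x * _
          rw [sub_eq_zero.1 this]; ring
      _ = ∑ j, ∑ i, ∫ x in O01, ∫ y in O01, Γ.cw P j x * (Γ.wt F s i y / (Γ.σ i (xi s y) - Γ.σ j x)) := by
          refine fsc rfl fun j _ ↦ ?_
          refine Eq.trans ?_ (integral_finsetSum _ fun i _ ↦ (D.fub hF P i j).integral_prod_left)
          refine integral_congr_ae (Eventually.of_forall fun x ↦ ?_)
          simp only [Psi, cau, Finset.mul_sum, integral_const_mul]
      _ = ∑ i, ∑ j, ∫ y in O01, ∫ x in O01, Γ.cw P j x * (Γ.wt F s i y / (Γ.σ i (xi s y) - Γ.σ j x)) := by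
          rw [Finset.sum_comm]; simp_rw [hsw]
      _ = _ := by
          refine fsc rfl fun i _ ↦ ?_
          refine (integral_finsetSum _ fun j _ ↦ (D.fub hF P i j).integral_prod_right).symm.trans ?_
          refine integral_congr_ae (Eventually.of_forall fun y ↦ ?_)
          simp only [H, Finset.mul_sum, ← integral_const_mul]
          refine fsc rfl fun j _ ↦ integral_congr_ae (Eventually.of_forall fun x ↦ ?_)
          change Γ.cw P j x * (Γ.wt F s i y / _) = Γ.wt F s i y * (Γ.cw P j x / _)
          ring
  have hn : ‖∑ i, ∫ y in O01, Γ.wt F s i y * Γ.H P (Γ.σ i (xi s y))‖ ≤ 2 * Γ.M / (1 - D.q) * ∑ i, ∫ x in O01, g i x := by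
    rw [Finset.mul_sum]
    refine norm_sum_le_of_le _ fun i _ ↦ ?_
    rw [← integral_const_mul]
    refine norm_integral_le_of_norm_le ((hg i).const_mul _) ((ae_restrict_iff' measurableSet_Ioo).2 (Eventually.of_forall fun x hx ↦ ?_))
    have hL := xi_mem_Lens hs hx
    have h2 := (Γ.deriv_bounds i (D.adm.Rc hL)).2
    have h3 := norm_xi'_le (by linarith [D.adm.le1] : |s| ≤ 1) (Ioo_subset_Icc_self hx)
    have h4 : ‖(1 - cnj (D.φ ζ) * D.ht i (xi s x))⁻¹‖ ≤ (1 - D.q)⁻¹ := by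
      rw [norm_inv]; exact inv_anti₀ lnr (D.denA ha (D.hb i _ hL).2)
    have h0 : 0 < (1 - D.q)⁻¹ := inv_pos.2 lnr
    unfold wt
    simp only [F, FA, norm_mul]
    calc _ ≤ (1 - D.q)⁻¹ * ‖D.kt i (xi s x)‖ * Γ.M * 2 * ‖Γ.H P (Γ.σ i (xi s x))‖ := by gcongr
      _ = 2 * Γ.M / (1 - D.q) * (‖D.kt i (xi s x)‖ * ‖Γ.H P (Γ.σ i (xi s x))‖) := by ring
      _ ≤ _ := mul_le_mul_of_nonneg_left (hb i x hx) pvt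
  rw [← key, norm_mul, norm_mul, norm_I, mul_one, RCLike.norm_conj, norm_pow, norm_mul, norm_real, rnn Real.pi_pos.le] at hn
  have hκ := norm_pos_iff.2 (D.κ_ne hζ)
  have h5 : ‖P.eval ζ‖ = ‖D.κ ζ‖ * ‖P.eval ζ / D.κ ζ‖ := by rw [norm_div]; field_simp
  rw [h5]
  refine mul_le_mul_of_nonneg_left (le_trans ?_ hn) hκ.le
  refine le_mul_of_one_le_left nng ?_
  rw [show ‖(2:ℂ)‖ = 2 by simp]
  nlinarith [Real.pi_gt_three]

end Dat
end Geo

namespace Geo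
variable {G : Set ℂ} {Γ : Geo G}

noncomputable def En (Γ : Geo G) (P : Polynomial ℂ) : ℝ :=
  ∑ j, ∫ x in O01, ‖P.eval (Γ.σ j x)‖ ^ 2 * ‖deriv (Γ.σ j) x‖

lemma H_diff (P : Polynomial ℂ) {t : ℂ} (ht : t ∉ frontier G) : DifferentiableAt ℂ (Γ.H P) t := by
  have : Γ.H P = fun t ↦ ∑ j, -cau (Γ.cw P j) (fun x ↦ Γ.σ j x) t := by
    ext t
    refine fsc rfl fun j _ ↦ ?_
    rw [cau, ← integral_neg]
    congr 1; ext x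
    rw [← neg_sub, div_neg]
  rw [this]
  exact DifferentiableAt.fun_sum fun j _ ↦ (cau_diff ((cont_cw P j).integrableOn_Icc.mono_set Ioo_subset_Icc_self)
    (cont_σ j) fun x hx h ↦ ht ((show Γ.σ j x = t from h) ▸ Γ.memL j x hx)).neg

lemma H_le (Γ : Geo G) (E : ℝ) (hE : 0 < E) : ∃ C, 0 < C ∧ ∀ P, Γ.En P ≤ E → ∀ t : ℂ, ∀ d, 0 < d → (∀ z ∈ frontier G, d ≤ ‖t - z‖) →
    ‖Γ.H P t‖ ≤ C * d ^ mh12 := by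
  have hm := Γ.m_pos
  have hM := Γ.M_pos
  refine ⟨E + Γ.N * (2 * Γ.M * rpi / Γ.m) , by positivity, fun P hP t d hd h ↦ ?_⟩
  set s := d ^ (1 / 2 : ℝ)
  have hs : 0 < s := by positivity
  have hss : s * s = d := by rw [← rra hd]; norm_num
  rw [rrn hd.le]
  have key : ∀ j, ‖∫ x in O01, Γ.cw P j x / (t - Γ.σ j x)‖ ≤
      s⁻¹ * (∫ x in O01, ‖P.eval (Γ.σ j x)‖ ^ 2 * ‖deriv (Γ.σ j) x‖) + 2 * Γ.M * rpi / Γ.m * s⁻¹ := by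
    intro j
    obtain ⟨y, hy, hym⟩ := isCompact_Icc.exists_isMinOn (nonempty_Icc.2 zero_le_one)
      (f := fun x : ℝ ↦ ‖t - Γ.σ j x‖) (s := I01) (continuousOn_const.sub (cont_σ j)).norm
    set a := Γ.m / (2 * d)
    have ha : 0 < a := by positivity
    have hi : Integrable fun x : ℝ ↦ (1 + (a * (x - y)) ^ 2)⁻¹ :=
      (integrable_inv_one_add_sq.comp_mul_left' ha.ne').comp_sub_right y
    have hI : ∫ x : ℝ, (1 + (a * (x - y)) ^ 2)⁻¹ = a⁻¹ * rpi := by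
      rw [integral_sub_right_eq_self (fun x : ℝ ↦ (1 + (a * x) ^ 2)⁻¹) y,
        Measure.integral_comp_mul_left (fun x : ℝ ↦ (1 + x ^ 2)⁻¹) a, integral_univ_inv_one_add_sq, abs_of_pos pvt, smul_eq_mul]
    have hJ : ∫ x in O01, (1 + (a * (x - y)) ^ 2)⁻¹ ≤ a⁻¹ * rpi :=
      hI ▸ setIntegral_le_integral hi (Eventually.of_forall fun x ↦ by positivity)
    have hPi : IntegrableOn (fun x : ℝ ↦ ‖P.eval (Γ.σ j x)‖ ^ 2 * ‖deriv (Γ.σ j) x‖) (Ioo 0 1) :=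
      (((P.continuous.comp_continuousOn (cont_σ j)).norm.pow 2).mul (cont_σ' j).norm).integrableOn_Icc.mono_set Ioo_subset_Icc_self
    refine (norm_integral_le_of_norm_le ((hPi.const_mul s⁻¹).add (hi.integrableOn.const_mul (Γ.M * s * (1 / d ^ 2)))) ?_).trans ?_
    · refine (ae_restrict_iff' measurableSet_Ioo).2 (Eventually.of_forall fun x hx ↦ ?_)
      have hx' := Ioo_subset_Icc_self hx
      have h1 : d ≤ ‖t - Γ.σ j x‖ := h _ (Γ.memL j x hx')
      have h2 : ‖t - Γ.σ j y‖ ≤ ‖t - Γ.σ j x‖ := hym hx'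
      have h3 := Γ.colip j x (Γ.ofReal_mem_Rc hx') y (Γ.ofReal_mem_Rc hy)
      have h4 : ‖Γ.σ j x - Γ.σ j y‖ ≤ ‖t - Γ.σ j y‖ + ‖t - Γ.σ j x‖ := by
        rw [← norm_neg (t - Γ.σ j x)]; refine le_of_eq_of_le ?_ (norm_add_le _ _); congr 1; ring
      rw [← ofReal_sub, norm_real, rna] at h3
      have h5 := (Γ.deriv_bounds j (Γ.ofReal_mem_Rc hx')).2
      set X := ‖t - Γ.σ j x‖
      set p := ‖P.eval (Γ.σ j x)‖
      set δ := ‖deriv (Γ.σ j) x‖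
      have hX : 0 < X := hd.trans_le h1
      have h6 : d ^ 2 * (1 + (a * (x - y)) ^ 2) ≤ 2 * X ^ 2 := by
        have : d ^ 2 * (1 + (a * (x - y)) ^ 2) = d ^ 2 + (Γ.m * |x - y| / 2) ^ 2 := by
          rw [div_pow, mul_pow Γ.m, sq_abs]; simp only [a]; field_simp
        rw [this]
        nlinarith [pow_le_pow_left₀ hd.le h1 2, pow_le_pow_left₀ pvt (show Γ.m * |x - y| / 2 ≤ X by linarith) 2]
      have h7 : (X ^ 2)⁻¹ ≤ 2 * (1 / d ^ 2 * (1 + (a * (x - y)) ^ 2)⁻¹) := by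
        rw [one_div, ← mul_inv, ← div_eq_mul_inv, inv_le_comm₀ pvt pvt, inv_div]; linarith
      simp only [Pi.add_apply]
      rw [norm_div, cw, norm_mul, RCLike.norm_conj, norm_real, norm_norm]
      have h8 : p * δ / X ≤ s⁻¹ * (p ^ 2 * δ) + δ * s / 2 * (X ^ 2)⁻¹ := by
        have : s⁻¹ * (p ^ 2 * δ) + δ * s / 2 * (X ^ 2)⁻¹ - p * δ / X =
            δ * s⁻¹ * ((p - s / (2 * X)) ^ 2 + (s / (2 * X)) ^ 2) := by field_simp; ring
        have : 0 ≤ δ * s⁻¹ * ((p - s / (2 * X)) ^ 2 + (s / (2 * X)) ^ 2) := by positivity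
        linarith
      have h9 : δ * s / 2 * (X ^ 2)⁻¹ ≤ Γ.M * s / 2 * (2 * (1 / d ^ 2 * (1 + (a * (x - y)) ^ 2)⁻¹)) := by gcongr
      linarith
    · simp only [Pi.add_apply]
      rw [integral_add (hPi.const_mul _) (hi.integrableOn.const_mul _), integral_const_mul, integral_const_mul]
      have : Γ.M * s * (1 / d ^ 2) * (a⁻¹ * rpi) = 2 * Γ.M * rpi / Γ.m * s⁻¹ := by
        simp only [a]; rw [← hss]; field_simp
      rw [← this]; gcongr
  refine (norm_sum_le _ _).trans ((Finset.sum_le_sum fun j _ ↦ key j).trans ?_)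
  rw [Finset.sum_add_distrib, ← Finset.mul_sum, Finset.sum_const, Finset.card_univ, Fintype.card_fin, nsmul_eq_mul]
  have : s⁻¹ * Γ.En P ≤ s⁻¹ * E := by gcongr
  have h0 : s⁻¹ * Γ.En P = s⁻¹ * ∑ j, ∫ x in O01, ‖P.eval (Γ.σ j x)‖ ^ 2 * ‖deriv (Γ.σ j) x‖ := rfl
  linarith

end Geo

def Dec (f : ℕ → ℂ → ℂ) (s : Set ℂ) : Prop := ∃ C q : ℝ, 0 < C ∧ 0 < q ∧ q < 1 ∧ ∀ n, ∀ z ∈ s, ‖f n z‖ ≤ C * q ^ n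

lemma Dec.mono {f : ℕ → ℂ → ℂ} {s t : Set ℂ} (h : Dec f t) (hs : s ⊆ t) : Dec f s := by
  obtain ⟨C, q, a, b, c, d⟩ := h
  exact ⟨C, q, a, b, c, fun n z hz ↦ d n z (hs hz)⟩

lemma Dec.union {f : ℕ → ℂ → ℂ} {s t : Set ℂ} (h : Dec f s) (h' : Dec f t) : Dec f (s ∪ t) := by
  obtain ⟨C, q, a, b, c, d⟩ := h
  obtain ⟨C', q', a', b', c', d'⟩ := h'
  have hm : ∀ n, q ^ n ≤ max q q' ^ n ∧ q' ^ n ≤ max q q' ^ n := fun n ↦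
    ⟨pow_le_pow_left₀ b.le (le_max_left _ _) n, pow_le_pow_left₀ b'.le (le_max_right _ _) n⟩
  refine ⟨C + C', max q q', by positivity, by positivity, max_lt c c', fun n z hz ↦ ?_⟩
  have := hm n
  rw [add_mul]
  have e1 : 0 ≤ C * max q q' ^ n := by positivity
  have e2 : 0 ≤ C' * max q q' ^ n := by positivity
  rcases hz with hz | hz
  · have := (d n z hz).trans (mul_le_mul_of_nonneg_left this.1 a.le); linarith
  · have := (d' n z hz).trans (mul_le_mul_of_nonneg_left this.2 a'.le); linarith

lemma dec_step {f : ℕ → ℂ → ℂ} {t : ℂ} {A ρ ε : ℝ} (hε : 0 < ε) (hερ : ε ≤ ρ)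
    (hd : ∀ n, ∀ z ∈ closedBall t (3 * ρ), DifferentiableAt ℂ (f n) z) (hA : ∀ n, ∀ z ∈ closedBall t (3 * ρ), ‖f n z‖ ≤ A)
    (h : Dec f (closedBall t ε)) : Dec f (closedBall t (2 * ρ)) := by
  obtain ⟨C, q, hC, hq, hq1, hf⟩ := h
  have hρ : 0 < ρ := by linarith
  have hA0 : 0 ≤ A := (nng).trans (hA 0 t (mem_closedBall_self pvt))
  set s := √q
  have hs : 0 < s := Real.sqrt_pos.2 hq
  have hs1 : s < 1 := by rw [Real.sqrt_lt' one_pos]; simpa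
  have hss : s * s = q := Real.mul_self_sqrt hq.le
  obtain ⟨N, hN⟩ : ∃ N, s ^ N < ε / (2 * ρ) := exists_pow_lt_of_lt_one pvt hs1
  have hN' : s ^ (N + 1) * (2 * ρ / ε) ≤ 1 := by
    have : s ^ (N + 1) ≤ ε / (2 * ρ) := by rw [pow_succ]; nlinarith [pow_pos hs N]
    calc _ ≤ ε / (2 * ρ) * (2 * ρ / ε) := by gcongr
      _ = 1 := by field_simp
  set w : ℝ := (2 / 3 : ℝ) ^ ((N + 1 : ℕ) : ℝ)⁻¹
  have hw : 0 < w := by positivity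
  have hwN : w ^ (N + 1) = 2 / 3 := Real.rpow_inv_natCast_pow nnm bsp
  have hw1 : w < 1 := Real.rpow_lt_one nnm nnm pvt
  refine ⟨A * (3 / 2) + C, max s w, by positivity, by positivity, max_lt hs1 hw1, fun n z hz ↦ ?_⟩
  set k := n / (N + 1)
  have hk1 : (N + 1) * k ≤ n := Nat.mul_div_le n (N + 1)
  have hk2 : n ≤ (N + 1) * (k + 1) := (Nat.lt_mul_div_succ n (Nat.succ_pos N)).le
  have b1 : (2 / 3 : ℝ) ^ k ≤ 3 / 2 * w ^ n := by
    have := pow_le_pow_of_le_one hw.le hw1.le hk2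
    rw [pow_mul, hwN, pow_succ] at this; linarith
  have b2 : q ^ n * (2 * ρ / ε) ^ k ≤ s ^ n := by
    rw [← hss, mul_pow, mul_assoc]
    refine mul_le_of_le_one_right pvt ?_
    calc _ ≤ s ^ ((N + 1) * k) * (2 * ρ / ε) ^ k := mul_le_mul_of_nonneg_right (pow_le_pow_of_le_one hs.le hs1.le hk1) pvt
      _ = (s ^ (N + 1) * (2 * ρ / ε)) ^ k := by rw [pow_mul, mul_pow]
      _ ≤ 1 := pow_le_one₀ pvt hN'
  have m1 := pow_le_pow_left₀ hs.le (le_max_left s w) n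
  have m2 := pow_le_pow_left₀ hw.le (le_max_right s w) n
  rcases le_or_gt ‖z - t‖ ε with hze | hze
  · have h1 := hf n z (by simpa [dist_eq_norm] using hze)
    have h2 : q ^ n ≤ s ^ n := pow_le_pow_left₀ hq.le (by nlinarith) n
    have h3 : 0 ≤ A * (3 / 2) * max s w ^ n := by positivity
    nlinarith
  · have hz2 : ‖z - t‖ ≤ 2 * ρ := by simpa [dist_eq_norm] using hz
    have hc : Continuous fun z : ℂ ↦ ‖z - t‖ := by fun_prop
    set U := {z : ℂ | ε < ‖z - t‖ ∧ ‖z - t‖ < 3 * ρ}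
    have hcl : closure U ⊆ {z : ℂ | ε ≤ ‖z - t‖ ∧ ‖z - t‖ ≤ 3 * ρ} :=
      closure_minimal (fun z hz ↦ ⟨hz.1.le, hz.2.le⟩) ((isClosed_le continuous_const hc).inter (isClosed_le hc continuous_const))
    have hUo : IsOpen U := (isOpen_lt continuous_const hc).inter (isOpen_lt hc continuous_const)
    have hdg : ∀ z ∈ closure U, DifferentiableAt ℂ (fun z ↦ f n z / (z - t) ^ k) z := fun z hz ↦ by
      have h0 := hcl hz
      refine (hd n z (by simpa [dist_eq_norm] using h0.2)).div bfp (pow_ne_zero _ (norm_pos_iff.1 (hε.trans_le h0.1)))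
    have := Complex.norm_le_of_forall_mem_frontier_norm_le (U := U) (f := fun z ↦ f n z / (z - t) ^ k) (C := A / (3 * ρ) ^ k + C * q ^ n / ε ^ k)
      ((isBounded_closedBall (x := t) (r := 3 * ρ)).subset fun z hz ↦ by simpa [dist_eq_norm] using hz.2.le)
      ⟨fun z hz ↦ (hdg z (subset_closure hz)).differentiableWithinAt, fun z hz ↦ (hdg z hz).continuousAt.continuousWithinAt⟩
      (fun z hz ↦ by
        have h0 := hcl hz.1
        rw [norm_div, norm_pow]
        have e1 : 0 ≤ A / (3 * ρ) ^ k := by positivity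
        have e2 : 0 ≤ C * q ^ n / ε ^ k := by positivity
        rcases h0.1.eq_or_lt with h1 | h1
        · rw [← h1]
          have : ‖f n z‖ / ε ^ k ≤ C * q ^ n / ε ^ k := by gcongr; exact hf n z (by simp [dist_eq_norm, h1])
          linarith
        · rcases h0.2.eq_or_lt with h2 | h2
          · rw [h2]
            have : ‖f n z‖ / (3 * ρ) ^ k ≤ A / (3 * ρ) ^ k := by gcongr; exact hA n z (by simp [dist_eq_norm, h2])
            linarith
          · exact absurd ⟨h1, h2⟩ (hUo.frontier_eq ▸ hz).2)
      (z := z) (subset_closure ⟨hze, by linarith⟩)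
    have hzp : 0 < ‖z - t‖ := hε.trans hze
    rw [norm_div, norm_pow, div_le_iff₀ pvt] at this
    calc ‖f n z‖ ≤ (A / (3 * ρ) ^ k + C * q ^ n / ε ^ k) * (2 * ρ) ^ k := this.trans (by gcongr)
      _ = A * (2 / 3) ^ k + C * (q ^ n * (2 * ρ / ε) ^ k) := by
        rw [show (2 / 3 : ℝ) = (2 * ρ) / (3 * ρ) by field_simp, div_pow, div_pow]; field_simp
      _ ≤ A * (3 / 2 * max s w ^ n) + C * max s w ^ n := by gcongr <;> linarith
      _ = _ := by ring

lemma dec_compact {f : ℕ → ℂ → ℂ} {Ω K : Set ℂ} (hΩ : IsPreconnected Ω) (hd : ∀ n, ∀ z ∈ Ω, DifferentiableAt ℂ (f n) z)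
    (hb : ∀ t ∈ Ω, ∃ A ρ, 0 < ρ ∧ closedBall t (4 * ρ) ⊆ Ω ∧ ∀ n, ∀ z ∈ closedBall t (4 * ρ), ‖f n z‖ ≤ A)
    (h0 : ∃ t ∈ Ω, ∃ ε > 0, Dec f (closedBall t ε)) (hK : IsCompact K) (hKΩ : K ⊆ Ω) : Dec f K := by
  have hsub : Ω ⊆ {t | ∃ ε > 0, Dec f (closedBall t ε)} := by
    refine hΩ.subset_of_closure_inter_subset ?_ (by obtain ⟨t, h1, h2⟩ := h0; exact ⟨t, h1, h2⟩) ?_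
    · rw [Metric.isOpen_iff]
      rintro t ⟨ε, hε, h⟩
      refine ⟨ε / 2, by positivity, fun s hs ↦ ⟨ε / 2, by positivity, h.mono (closedBall_subset_closedBall' ?_)⟩⟩
      linarith [mem_ball.1 hs]
    · rintro t ⟨ht, htΩ⟩
      obtain ⟨A, ρ, hρ, h1, h2⟩ := hb t htΩ
      obtain ⟨s, ⟨ε, hε, hs⟩, hst⟩ := Metric.mem_closure_iff.1 ht ρ hρ
      have hsub : closedBall s (3 * ρ) ⊆ closedBall t (4 * ρ) := closedBall_subset_closedBall' (by rw [dist_comm]; linarith)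
      refine ⟨ρ, hρ, (dec_step (lt_min hε hρ) (min_le_right ε ρ) (fun n z hz ↦ hd n z (h1 (hsub hz))) (fun n z hz ↦ h2 n z (hsub hz))
        (hs.mono (closedBall_subset_closedBall mnl))).mono (closedBall_subset_closedBall' lnr)⟩
  refine hK.induction_on (p := Dec f) ⟨1, 1 / 2, by norm_num, by norm_num, by norm_num, by simp⟩ (fun s t h h' ↦ h'.mono h) (fun s t ↦ Dec.union) fun t ht ↦ ?_
  obtain ⟨ε, hε, h⟩ := hsub (hKΩ ht)
  exact ⟨_, mem_nhdsWithin_of_mem_nhds (closedBall_mem_nhds t hε), h⟩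

namespace Geo
variable {G : Set ℂ} {Γ : Geo G}

lemma H_far {P : Polynomial ℂ} {n : ℕ} (ho : ∀ k < n, ∑ j, ∫ x in O01, Γ.cw P j x * Γ.σ j x ^ k = 0) {R : ℝ}
    (hR : 0 < R) (hf : ∀ z ∈ frontier G, ‖z‖ ≤ R) {z : ℂ} (hz : 2 * R + 1 ≤ ‖z‖) : ‖Γ.H P z‖ ≤ (Γ.En P + Γ.N * Γ.M) * (1 / 2) ^ n := by
  have hz0 : z ≠ 0 := norm_pos_iff.1 lnr
  have hσ : ∀ j, ∀ x ∈ I01, ‖Γ.σ j x‖ ≤ R ∧ 1 ≤ ‖z - Γ.σ j x‖ := fun j x hx ↦ by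
    have h1 := hf _ (Γ.memL j x hx)
    exact ⟨h1, by linarith [norm_sub_norm_le z (Γ.σ j x)]⟩
  have hne : ∀ j, ∀ x ∈ I01, z - Γ.σ j x ≠ 0 := fun j x hx ↦ norm_pos_iff.1 (by linarith [(hσ j x hx).2])
  have hint : ∀ i j, IntegrableOn (fun x : ℝ ↦ Γ.cw P j x * (Γ.σ j x / z) ^ i / (z - Γ.σ j x)) (Ioo 0 1) := fun i j ↦
    (((cont_cw P j).mul (((cont_σ j).div_const z).pow i)).div (continuousOn_const.sub (cont_σ j)) (hne j)).integrableOn_Icc.mono_set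
      Ioo_subset_Icc_self
  have key : ∀ i ≤ n, Γ.H P z = ∑ j, ∫ x in O01, Γ.cw P j x * (Γ.σ j x / z) ^ i / (z - Γ.σ j x) := by
    intro i
    induction i with
    | zero => intro _; simp [H]
    | succ i ih =>
      intro hi
      rw [ih bom, ← sub_eq_zero, ← Finset.sum_sub_distrib, ← mul_zero (z ^ (i + 1))⁻¹, ← ho i hi, Finset.mul_sum]
      refine fsc rfl fun j _ ↦ ?_
      rw [← integral_sub (hint _ _) (hint _ _), ← integral_const_mul]
      refine setIntegral_congr_fun measurableSet_Ioo fun x hx ↦ ?_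
      have := hne j x (Ioo_subset_Icc_self hx)
      simp only [div_pow]
      field_simp
      ring
  have hPi : ∀ j, IntegrableOn (fun x : ℝ ↦ ‖P.eval (Γ.σ j x)‖ ^ 2 * ‖deriv (Γ.σ j) x‖) (Ioo 0 1) := fun j ↦
      (((P.continuous.comp_continuousOn (cont_σ j)).norm.pow 2).mul (cont_σ' j).norm).integrableOn_Icc.mono_set Ioo_subset_Icc_self
  have hM := Γ.M_pos
  have e1 : IntegrableOn (fun _ : ℝ ↦ Γ.M) (Ioo 0 1) := integrableOn_const bsp bsp
  rw [key n le_rfl]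
  calc _ ≤ ∑ j, ∫ x in O01, (‖P.eval (Γ.σ j x)‖ ^ 2 * ‖deriv (Γ.σ j) x‖ + Γ.M) * (1 / 2) ^ n := by
        refine (norm_sum_le _ _).trans (Finset.sum_le_sum fun j _ ↦ norm_integral_le_of_norm_le (((hPi j).add e1).mul_const _) ?_)
        refine (ae_restrict_iff' measurableSet_Ioo).2 (Eventually.of_forall fun x hx ↦ ?_)
        have hx' := Ioo_subset_Icc_self hx
        have h1 := hσ j x hx'
        have h5 := (Γ.deriv_bounds j (Γ.ofReal_mem_Rc hx')).2
        rw [norm_div, norm_mul, norm_pow, cw, norm_mul, RCLike.norm_conj, norm_real, norm_norm]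
        have h2 : ‖Γ.σ j x / z‖ ≤ 1 / 2 := by rw [norm_div, div_le_iff₀ lnr]; linarith
        refine (div_le_self pvt h1.2).trans ?_
        refine mul_le_mul ?_ (pow_le_pow_left₀ nng h2 n) pvt pvt
        nlinarith [sq_nonneg (‖P.eval (Γ.σ j x)‖ - 1 / 2), norm_nonneg (deriv (Γ.σ j) x)]
    _ = _ := by
        simp_rw [integral_mul_const]
        rw [← Finset.sum_mul]
        congr 1
        rw [fsc rfl fun j _ ↦ integral_add (hPi j) e1, Finset.sum_add_distrib, En]
        simp

lemma H_dec (Γ : Geo G) (hbd : Bornology.IsBounded G) (hΩ : IsPreconnected (closure G)ᶜ) {P : ℕ → Polynomial ℂ} {E : ℝ} (hE : 0 < E)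
    (hP : ∀ n, Γ.En (P n) ≤ E) (ho : ∀ n, ∀ k < n, ∑ j, ∫ x in O01, Γ.cw (P n) j x * Γ.σ j x ^ k = 0)
    {K : Set ℂ} (hK : IsCompact K) (hKΩ : K ⊆ (closure G)ᶜ) : Dec (fun n ↦ Γ.H (P n)) K := by
  obtain ⟨C, hC, hH⟩ := Γ.H_le E hE
  obtain ⟨R, hR, hRb⟩ := hbd.closure.exists_pos_norm_le
  have hfc : ∀ z ∈ frontier G, z ∈ closure G := fun z hz ↦ frontier_subset_closure hz
  refine dec_compact hΩ (fun n z hz ↦ H_diff _ fun h ↦ hz (hfc z h)) (fun t ht ↦ ?_) ⟨(2 * R + 2 : ℝ), fun h ↦ ?_, 1, one_pos, ?_⟩ hK hKΩ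
  · obtain ⟨ε, hε, hb⟩ := Metric.isOpen_iff.1 isClosed_closure.isOpen_compl t ht
    refine ⟨C * (ε / 2) ^ mh12, ε / 8, by positivity, (closedBall_subset_ball lnr).trans hb, fun n z hz ↦
      hH _ (hP n) z _ pvt fun w hw ↦ ?_⟩
    by_contra hcon
    rw [← dist_eq_norm] at hcon
    refine hb (a := w) ?_ (hfc w hw)
    have := mem_closedBall.1 hz
    rw [mem_ball]; linarith [dist_triangle w z t, dist_comm w z]
  · have := hRb _ h
    rw [norm_real, rnn pvt] at this; linarith
  · refine ⟨E + Γ.N * Γ.M, 1 / 2, by have := Γ.M_pos; positivity, by norm_num, by norm_num, fun n z hz ↦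
      (H_far (ho n) hR (fun z hz ↦ hRb z (hfc z hz)) ?_).trans (by gcongr; exact hP n)⟩
    have := mem_closedBall_iff_norm'.1 hz
    have h2 := norm_sub_norm_le ((2 * R + 2 : ℝ) : ℂ) z
    rw [norm_real, rnn pvt] at h2; linarith

end Geo

structure Corner (G : Set ℂ) (p μ : ℂ) (a C : ℝ) : Prop where
  a0 : 0 < a
  a2 : a < 2
  C0 : 0 < C
  hμ : ‖μ‖ = 1
  out : ∀ ζ : ℂ, |ζ.im| < a * rpi / 2 - C * rex ζ.re → p + μ * exp ζ ∉ closure G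
  inn : ∀ ζ : ℂ, |ζ.im| < (2 - a) * rpi / 2 - C * rex ζ.re → p - μ * exp ζ ∈ G

lemma trig {a C : ℝ} (ha : 0 < a) (ha2 : a < 2) (hC : 0 < C) : ∃ s0 η : ℝ, 0 < s0 ∧ s0 ≤ 1 ∧ 0 < η ∧ ∀ s, 0 < s → s ≤ s0 → ∀ ψ : ℝ,
    (|ψ| ≤ rpi / 2 + C * s ^ 2 → η * s ≤ rcs ψ - s * rcs ((1 + a / 2) * ψ)) ∧
    (rpi / 2 - C * s ^ 2 ≤ |ψ| → |ψ| ≤ rpi / 2 → rcs ψ + s * rcs ((1 + a / 2) * ψ) ≤ -(η * s)) := by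
  set k := 1 + a / 2 with hk
  have hk1 : 1 < k := by linarith
  have hk2 : k < 2 := by linarith
  have hπ := rpp
  set ψ1 := (rpi / 4 + k * rpi / 4) / k with hψ1
  have hψk : k * ψ1 = rpi / 4 + k * rpi / 4 := by rw [hψ1]; field_simp
  have hψ1p : 0 < ψ1 := by positivity
  have hψ1l : ψ1 < rpi / 2 := by rw [hψ1, div_lt_iff₀ lnr]; nlinarith
  set η := -rcs (k * ψ1) / 2 with hη
  have hηp : 0 < η := by
    have : rcs (k * ψ1) < 0 := Real.cos_neg_of_pi_div_two_lt_of_lt (by rw [hψk]; nlinarith) (by rw [hψk]; nlinarith)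
    linarith
  have hη1 : η ≤ 1 / 2 := by linarith [Real.neg_one_le_cos (k * ψ1)]
  have hc1 : 0 < rcs ψ1 := Real.cos_pos_of_mem_Ioo ⟨by linarith, hψ1l⟩
  obtain ⟨B, hB0, hB1, hB2, hB3⟩ : ∃ B, 0 < B ∧ B ≤ η ∧ B ≤ rpi / 2 - ψ1 ∧ B ≤ rpi / k - rpi / 2 :=
    ⟨min η (min (rpi / 2 - ψ1) (rpi / k - rpi / 2)), lt_min hηp (lt_min lnr (sub_pos.2 (by gcongr))),
      min_le_left _ _, (mnr).trans mnl, (mnr).trans mnr⟩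
  refine ⟨min (min 1 (rcs ψ1 / 2)) (B / C), η, by positivity, (mnl).trans mnl, hηp, fun s hs hs0 ψ ↦ ?_⟩
  have s1 : s ≤ 1 := hs0.trans ((mnl).trans mnl)
  have s2 : s ≤ rcs ψ1 / 2 := hs0.trans ((mnl).trans mnr)
  have s3 : C * s ≤ B := by
    have := hs0.trans mnr
    rw [le_div_iff₀ hC] at this; linarith
  have s4 : C * s ^ 2 ≤ B * s := by rw [sq, ← mul_assoc]; gcongr
  rw [← Real.cos_abs ψ, ← Real.cos_abs (k * ψ), abs_mul, abs_of_pos (show 0 < k by linarith)]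
  have hx := abs_nonneg ψ
  generalize |ψ| = x at hx
  have hkx : ψ1 ≤ x → x ≤ rpi / 2 + C * s ^ 2 → rcs (k * x) ≤ -2 * η := fun h1 h2 ↦ by
    have : rcs (k * x) ≤ rcs (k * ψ1) := by
      refine Real.cos_le_cos_of_nonneg_of_le_pi pvt ?_ (by gcongr)
      have : x ≤ rpi / k := by nlinarith
      rw [le_div_iff₀ lnr] at this; linarith
    linarith
  have hsin : rcs x = Real.sin (rpi / 2 - x) := (Real.sin_pi_div_two_sub x).symm
  constructor
  · intro h
    rcases le_or_gt x ψ1 with h1 | h1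
    · have := Real.cos_le_cos_of_nonneg_of_le_pi hx lnr h1
      nlinarith [Real.cos_le_one (k * x)]
    · have h2 := hkx h1.le h
      have h3 : -(C * s ^ 2) ≤ rcs x := by
        rcases le_or_gt x (rpi / 2) with h4 | h4
        · have := Real.cos_nonneg_of_mem_Icc (x := x) ⟨by linarith, h4⟩
          have : 0 ≤ C * s ^ 2 := by positivity
          linarith
        · have := Real.sin_le (x := x - rpi / 2) lnr
          rw [hsin, ← neg_sub, Real.sin_neg]; linarith
      nlinarith
  · intro h h'
    have h2 := hkx (by nlinarith) (h'.trans (by nlinarith [sq_nonneg s]))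
    have := Real.sin_le (x := rpi / 2 - x) lnr
    nlinarith

namespace Corner
variable {G : Set ℂ} {p μ : ℂ} {a C : ℝ} (hc : Corner G p μ a C)
include hc

lemma rep {z : ℂ} (hz : z ≠ p) : ∃ ζ : ℂ, |ζ.im| ≤ rpi ∧ z = p + μ * exp ζ := by
  have hμ : μ ≠ 0 := norm_pos_iff.1 (by rw [hc.hμ]; exact one_pos)
  refine ⟨log ((z - p) / μ), by rw [log_im]; exact abs_arg_le_pi _, ?_⟩
  rw [exp_log (div_ne_zero (sub_ne_zero.2 hz) hμ)]; field_simp; ring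

lemma norm_e (ζ : ℂ) : ‖μ * exp ζ‖ = rex ζ.re := by rw [norm_mul, hc.hμ, one_mul, norm_exp]

lemma flip {ζ : ℂ} (h : |ζ.im| ≤ rpi) : ∃ ζ' : ℂ, ζ'.re = ζ.re ∧ |ζ'.im| = rpi - |ζ.im| ∧ exp ζ' = -exp ζ := by
  rcases le_total 0 ζ.im with h1 | h1
  · refine ⟨ζ - rpi * I, by simp, ?_, by rw [exp_sub, exp_pi_mul_I]; ring⟩
    rw [abs_of_nonneg h1] at h ⊢
    rw [abs_of_nonpos (by simpa using h)]; simp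
  · refine ⟨ζ + rpi * I, by simp, ?_, by rw [exp_add, exp_pi_mul_I]; ring⟩
    rw [abs_of_nonpos h1] at h ⊢
    rw [abs_of_nonneg (by simp; linarith)]; simp; ring

lemma mem_out {ζ : ℂ} (h : |ζ.im| ≤ rpi) (hG : p - μ * exp ζ ∈ closure G) : |ζ.im| ≤ (2 - a) * rpi / 2 + C * rex ζ.re := by
  by_contra hcon
  obtain ⟨ζ', h1, h2, h3⟩ := hc.flip h
  exact hc.out ζ' (by rw [h1, h2]; linarith) (by rw [h3]; simpa [sub_eq_add_neg] using hG)

lemma mem_inn {ζ : ℂ} (h : |ζ.im| ≤ rpi) (hG : p + μ * exp ζ ∉ G) : |ζ.im| ≤ a * rpi / 2 + C * rex ζ.re := by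
  by_contra hcon
  obtain ⟨ζ', h1, h2, h3⟩ := hc.flip h
  refine hG ?_
  have := hc.inn ζ' (by rw [h1, h2]; linarith)
  rw [h3] at this; simpa using this

lemma dist_le {ζ : ℂ} {ε : ℝ} (hε : 0 < ε) (h : |ζ.im| ≤ a * rpi / 2 - C * rex ζ.re - ε) {z : ℂ} (hz : z ∈ closure G) :
    ε * rex ζ.re / 16 ≤ ‖p + μ * exp ζ - z‖ := by
  by_contra! hcon
  have hμ : μ ≠ 0 := norm_pos_iff.1 (by rw [hc.hμ]; exact one_pos)
  set w := (z - (p + μ * exp ζ)) / (μ * exp ζ) with hw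
  have hwn : ‖w‖ ≤ ε / 16 := by
    rw [hw, norm_div, hc.norm_e, div_le_iff₀ rxp, norm_sub_rev]; linarith
  have hπ := Real.pi_lt_four
  have ha := hc.a2
  have hCe : 0 < C * rex ζ.re := mul_pos hc.C0 rxp
  have ha4 : a * rpi / 2 < 4 := by nlinarith [rpp, hc.a0]
  have h1 := abs_nonneg ζ.im
  have hl := norm_log_one_add_half_le_self (z := w) lnr
  have hw1 : 1 + w ≠ 0 := fun h0 ↦ by
    have : w = -1 := by linear_combination h0
    rw [this, norm_neg, norm_one] at hwn; linarith
  have him := (abs_im_le_norm (log (1 + w))).trans hl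
  have hre := (re_le_norm (log (1 + w))).trans hl
  refine hc.out (ζ + log (1 + w)) ?_ (by
    rw [exp_add, exp_log hw1, hw]
    convert hz using 1
    field_simp [exp_ne_zero]; ring)
  rw [add_im, add_re, rea, ← mul_assoc]
  have h2 : rex (log (1 + w)).re ≤ 1 + 3 / 16 * ε := by
    refine (Real.exp_le_exp.2 (show _ ≤ 3 / 32 * ε by linarith)).trans ?_
    have := Real.abs_exp_sub_one_sub_id_le (x := 3 / 32 * ε) (by rw [abs_of_pos pvt]; linarith)
    nlinarith [(abs_le.1 this).2]
  have h3 : C * rex ζ.re * rex (log (1 + w)).re ≤ C * rex ζ.re * (1 + 3 / 16 * ε) := by gcongr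
  have := abs_add_le ζ.im (log (1 + w)).im
  nlinarith

end Corner

lemma re_exp_pow (b : ℝ) (ζ : ℂ) : (exp (((b : ℝ) : ℂ) * ζ)).re = rex (b * ζ.re) * rcs (b * ζ.im) := by
  rw [exp_re, re_ofReal_mul, im_ofReal_mul]

lemma Real.exp_half_sq (x : ℝ) : rex (x / 2) ^ 2 = rex x := by rw [← Real.exp_nat_mul]; congr 1; push_cast; ring

lemma barrier_re {a : ℝ} (ha : 0 < a) (e : ℝ) (ζ : ℂ) : (exp (((a⁻¹ : ℝ) : ℂ) * ζ) + (e : ℂ) * exp (((a⁻¹ + 1 / 2 : ℝ) : ℂ) * ζ)).re =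
    rex (a⁻¹ * ζ.re) * (rcs (ζ.im / a) + e * (rex (ζ.re / 2) * rcs ((1 + a / 2) * (ζ.im / a)))) := by
  rw [add_re, re_ofReal_mul, re_exp_pow, re_exp_pow, add_mul, rea, show (1 / 2 * ζ.re) = ζ.re / 2 by ring,
    show (a⁻¹ + 1 / 2) * ζ.im = (1 + a / 2) * (ζ.im / a) by field_simp, show a⁻¹ * ζ.im = ζ.im / a by field_simp]
  ring

namespace Geo.Dat
variable {G : Set ℂ} {Γ : Geo G} (D : Dat Γ)

lemma u_le {p μ : ℂ} {a C : ℝ} (hc : Corner G p μ a C) (hp : p ∈ frontier G) :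
    ∃ C' ρ, 0 < C' ∧ 0 < ρ ∧ ∀ z ∈ G, ‖z - p‖ < ρ → - rlg ‖D.φ z‖ ≤ C' * ‖z - p‖ ^ (2 - a)⁻¹ := by
  have hC := hc.C0
  have ha := hc.a0
  set α := 2 - a with hα
  have hα0 : 0 < α := by linarith [hc.a2]
  have hq0 : 0 < D.q := by linarith [D.q0]
  obtain ⟨s0, η, hs0, hs01, hη, hT⟩ := trig hα0 lnr (div_pos hC hα0)
  obtain ⟨ρ, hρ, hρ1, hρ2, hρ3⟩ : ∃ ρ, 0 < ρ ∧ ρ ≤ s0 ^ 2 ∧ ρ < D.η ∧ C * ρ < a * rpi / 2 := by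
    have h1 := D.η0
    have := rpp
    refine ⟨min (s0 ^ 2) (min (D.η / 2) (a * rpi / (4 * C))), by positivity, min_le_left _ _, ?_, ?_⟩
    · exact ((mnr).trans mnl).trans_lt lnr
    · calc _ ≤ C * (a * rpi / (4 * C)) := by gcongr; exact (mnr).trans mnr
        _ < _ := by rw [show C * (a * rpi / (4 * C)) = a * rpi / 4 by field_simp]; have := mul_pos ha rpp; linarith
  have hρ' : rex (rlg ρ) = ρ := rel hρ
  set W : ℂ → ℂ := fun ζ ↦ exp (((α⁻¹ : ℝ) : ℂ) * ζ) + ((-1 : ℝ) : ℂ) * exp (((α⁻¹ + 1 / 2 : ℝ) : ℂ) * ζ)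
  set Z : ℂ → ℂ := fun ζ ↦ p - μ * exp ζ
  have hZc : Continuous Z := by fun_prop
  have hZd : ∀ ζ, ‖Z ζ - p‖ = rex ζ.re := fun ζ ↦ by rw [← hc.norm_e ζ, ← norm_neg]; simp [Z]
  have hzd : ∀ ζ, infDist (Z ζ) (frontier G) ≤ rex ζ.re := fun ζ ↦
    (infDist_le_dist_of_mem hp).trans (by rw [dist_eq_norm, hZd])
  have hW : ∀ ζ : ℂ, |ζ.im| ≤ rpi → ζ.re ≤ rlg ρ → Z ζ ∈ G → |ζ.im| < rpi ∧
      η * rex (ζ.re / 2) * rex (α⁻¹ * ζ.re) ≤ (W ζ).re ∧ D.q < ‖D.φ (Z ζ)‖ := by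
    intro ζ h1 h2 h3
    have h4 := hc.mem_out h1 (subset_closure h3)
    have h5 : rex ζ.re ≤ ρ := by rw [← hρ']; exact Real.exp_le_exp.2 h2
    have h6 := Real.exp_half_sq ζ.re
    refine ⟨?_, ?_, D.hη _ h3 ((hzd ζ).trans_lt lnr)⟩
    · have : C * rex ζ.re ≤ C * ρ := by gcongr
      nlinarith
    · have := (hT (rex (ζ.re / 2)) rxp (by
        refine le_of_sq_le_sq ?_ hs0.le
        linarith) (ζ.im / α)).1 (by
          rw [abs_div, abs_of_pos hα0, div_le_iff₀ hα0, h6]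
          calc _ ≤ _ := h4
            _ = _ := by rw [← hα]; field_simp)
      simp only [W]
      rw [barrier_re hα0, mul_comm (η * _)]
      gcongr
      linarith
  set w0 := η * rex (rlg ρ / 2) * rex (α⁻¹ * rlg ρ)
  have hw0 : 0 < w0 := by positivity
  set C1 := -rlg D.q / w0
  have hlq : 0 < -rlg D.q := by linarith [Real.log_neg hq0 D.q1]
  have hC1 : 0 < C1 := by positivity
  have main : ∀ ε, 0 < ε → ε < 1 → ∀ ζ : ℂ, |ζ.im| ≤ rpi → ζ.re < rlg ρ → Z ζ ∈ G → ‖D.φ (Z ζ)‖ < 1 - ε →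
      rex (-C1 * (W ζ).re) * (1 - ε) ≤ ‖D.φ (Z ζ)‖ := by
    intro ε hε hε1 ζ h1 h2 h3 h4
    obtain ⟨η', hη', hφ'⟩ := riemann_bdry D.isOpen D.bdd D.hφ D.inj D.im hε
    set U := {ζ : ℂ | |ζ.im| < rpi ∧ ζ.re < rlg ρ ∧ Z ζ ∈ G ∧ ‖D.φ (Z ζ)‖ < 1 - ε}
    have hcl : closure U ⊆ {ζ : ℂ | |ζ.im| ≤ rpi ∧ ζ.re ≤ rlg ρ ∧ Z ζ ∈ closure G ∧ η' ≤ infDist (Z ζ) (frontier G)} := by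
      refine closure_minimal (fun ζ h ↦ ⟨h.1.le, h.2.1.le, subset_closure h.2.2.1, ?_⟩) ?_
      · by_contra! hcon
        linarith [hφ' _ h.2.2.1 hcon, h.2.2.2]
      · exact (isClosed_le continuous_im.abs continuous_const).inter ((isClosed_le continuous_re continuous_const).inter
          ((isClosed_closure.preimage hZc).inter (isClosed_le continuous_const ((continuous_infDist_pt _).comp hZc))))
    have hclG : ∀ ζ ∈ closure U, Z ζ ∈ G := fun ζ h ↦ by
      have := hcl h
      by_contra hcon
      have h0 : Z ζ ∈ frontier G := by rw [D.isOpen.frontier_eq]; exact ⟨this.2.2.1, hcon⟩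
      linarith [infDist_zero_of_mem h0, this.2.2.2]
    have hda : ∀ ζ ∈ closure U, DifferentiableAt ℂ (fun ζ ↦ exp (-C1 * W ζ) / D.φ (Z ζ)) ζ := fun ζ h ↦ by
      have hG := hclG ζ h
      refine DifferentiableAt.div bfp ((D.hφ.differentiableAt (D.isOpen.mem_nhds hG)).comp ζ bfp) ?_
      exact norm_pos_iff.1 (hq0.trans (hW ζ (hcl h).1 (hcl h).2.1 hG).2.2)
    have hn : ∀ ζ, ‖exp (-C1 * W ζ) / D.φ (Z ζ)‖ = rex (-C1 * (W ζ).re) / ‖D.φ (Z ζ)‖ := fun ζ ↦ by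
      rw [norm_div, norm_exp, ← ofReal_neg, re_ofReal_mul]
    have := Complex.norm_le_of_forall_mem_frontier_norm_le (U := U) (C := (1 - ε)⁻¹) ?_
      ⟨fun z hz ↦ (hda z (subset_closure hz)).differentiableWithinAt, fun z hz ↦ (hda z hz).continuousAt.continuousWithinAt⟩ ?_
      (z := ζ) (subset_closure ⟨(hW ζ h1 h2.le h3).1, h2, h3, h4⟩)
    · rw [hn, div_le_iff₀ (hq0.trans (hW ζ h1 h2.le h3).2.2), ← div_eq_inv_mul, le_div_iff₀ lnr] at this
      exact this
    · refine (isBounded_Icc (rlg η') (rlg ρ)).reProdIm (isBounded_Icc (-rpi) rpi) |>.subset fun ζ h ↦ ?_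
      have h5 := hcl (subset_closure h)
      exact ⟨⟨(Real.log_le_iff_le_exp hη').2 (h5.2.2.2.trans (hzd ζ)), h5.2.1⟩, abs_le.1 h5.1⟩
    · intro ζ h
      have h5 := hcl h.1
      have hG := hclG ζ h.1
      have h6 := hW ζ h5.1 h5.2.1 hG
      rw [hn]
      rcases lt_or_ge ‖D.φ (Z ζ)‖ (1 - ε) with h7 | h7
      · rcases h5.2.1.lt_or_eq with h8 | h8
        · refine absurd (mem_interior_iff_mem_nhds.2 ?_) h.2
          have := (D.hφ.continuousOn.continuousAt (D.isOpen.mem_nhds hG)).comp (f := Z) hZc.continuousAt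
          filter_upwards [continuous_im.abs.continuousAt.eventually_lt_const h6.1, continuous_re.continuousAt.eventually_lt_const h8,
            hZc.continuousAt (D.isOpen.mem_nhds hG), this.norm.eventually_lt_const h7] with x a b c d using ⟨a, b, c, d⟩
        · have h9 := h6.2.1
          rw [h8] at h9
          have h10 : rex (-C1 * (W ζ).re) ≤ D.q := by
            rw [← rel hq0]
            refine Real.exp_le_exp.2 ?_
            have : C1 * w0 = -rlg D.q := by simp only [C1]; field_simp
            nlinarith
          exact ((div_le_one (hq0.trans h6.2.2)).2 (h10.trans h6.2.2.le)).trans (one_le_inv_iff₀.2 ⟨by linarith, by linarith⟩)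
      · rw [← one_div]
        have : rex (-C1 * (W ζ).re) ≤ 1 := Real.exp_le_one_iff.2 (by nlinarith [h6.2.1, show 0 ≤ η * rex (ζ.re / 2) * rex (α⁻¹ * ζ.re) by positivity])
        exact div_le_div₀ zero_le_one this lnr h7
  refine ⟨C1 * 2, ρ, by positivity, hρ, fun z hz hzρ ↦ ?_⟩
  have hpG : p ∉ G := fun h ↦ by rw [D.isOpen.frontier_eq] at hp; exact hp.2 h
  obtain ⟨ζ, h1, h2⟩ : ∃ ζ : ℂ, |ζ.im| ≤ rpi ∧ z = Z ζ := by
    obtain ⟨ζ, h1, h2⟩ := hc.rep (z := 2 * p - z) (fun h ↦ hpG ((show z = p by linear_combination -h) ▸ hz))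
    exact ⟨ζ, h1, by simp only [Z]; linear_combination -h2⟩
  subst h2
  rw [hZd] at hzρ ⊢
  have hre : ζ.re < rlg ρ := (Real.lt_log_iff_exp_lt hρ).2 hzρ
  have h6 := hW ζ h1 hre.le hz
  have hφ0 : 0 < ‖D.φ (Z ζ)‖ := hq0.trans h6.2.2
  have hE : rex (-C1 * (W ζ).re) ≤ ‖D.φ (Z ζ)‖ := by
    by_contra! hcon
    have hE1 : rex (-C1 * (W ζ).re) ≤ 1 := Real.exp_le_one_iff.2 (by nlinarith [h6.2.1, show 0 ≤ η * rex (ζ.re / 2) * rex (α⁻¹ * ζ.re) by positivity])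
    have := main ((rex (-C1 * (W ζ).re) - ‖D.φ (Z ζ)‖) / 2) lnr lnr ζ h1 hre hz lnr
    nlinarith
  have h7 := (Real.le_log_iff_exp_le hφ0).2 hE
  have h8 : (W ζ).re ≤ 2 * rex ζ.re ^ α⁻¹ := by
    simp only [W]
    rw [barrier_re hα0, ← Real.exp_mul, mul_comm ζ.re, mul_comm]
    gcongr
    have h9 : rex (ζ.re / 2) ≤ 1 := by
      refine le_of_sq_le_sq (?_ : _ ≤ onR ^ 2) one_pos.le
      rw [Real.exp_half_sq]; nlinarith
    nlinarith [Real.cos_le_one (ζ.im / α), Real.neg_one_le_cos ((1 + α / 2) * (ζ.im / α)), rxq (ζ.re / 2)]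
  nlinarith

end Geo.Dat

lemma sqrt_le_add {x : ℝ} (hx : 0 ≤ x) : √x ≤ 1 + x := Real.sqrt_le_iff.2 ⟨by positivity, by nlinarith⟩

lemma rpow_root {x : ℝ} (hx : 0 < x) (y : ℝ) : (x * rex y) ^ mh12 = x ^ mh12 * rex (-y / 2) := by
  rw [rmr hx.le (rxp).le, ← Real.exp_mul]; congr 2; ring

set_option maxHeartbeats 1000000 in
lemma Corner.decay {G : Set ℂ} {p μ : ℂ} {a C : ℝ} (hc : Corner G p μ a C) {f : ℕ → ℂ → ℂ} {C0 δ : ℝ} (hC0 : 0 < C0) (hδ : 0 < δ)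
    (hf : ∀ n, ∀ t ∉ closure G, DifferentiableAt ℂ (f n) t)
    (hH : ∀ n t d, 0 < d → (∀ z ∈ frontier G, d ≤ ‖t - z‖) → ‖f n t‖ ≤ C0 * d ^ mh12)
    (hD : ∀ K, IsCompact K → K ⊆ (closure G)ᶜ → Dec f K) :
    ∃ C' c ρ, 0 < C' ∧ 0 < c ∧ 0 < ρ ∧ ∀ n : ℕ, 0 < n → ∀ ζ : ℂ, rex ζ.re < ρ → |ζ.im| ≤ a * rpi / 2 - δ →
      ‖f n (p + μ * exp ζ)‖ ≤ C' * rex (-ζ.re / 2) * rex (-(c * (n * rex (a⁻¹ * ζ.re)))) := by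
  have hC := hc.C0
  have ha := hc.a0
  have ha2 := hc.a2
  have hπ := rpp
  obtain ⟨s0, η, hs0, hs01, hη, hT⟩ := trig ha ha2 (div_pos hC ha)
  obtain ⟨L, hL1, hL2⟩ : ∃ L, rex (L / 2) ≤ s0 ∧ C * rex L < a * rpi / 2 := by
    have h1 : Tendsto (fun L ↦ rex (L / 2)) atBot nh0 := Real.tendsto_exp_atBot.comp (tendsto_id.atBot_div_const two_pos)
    have h2 : Tendsto (fun L ↦ C * rex L) atBot (nhds (C * 0)) := Real.tendsto_exp_atBot.const_mul C
    rw [mul_zero] at h2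
    obtain ⟨L, h3, h4⟩ := ((h1.eventually_lt_const hs0).and (h2.eventually_lt_const (show 0 < a * rpi / 2 by positivity))).exists
    exact ⟨L, h3.le, h4⟩
  set Y : ℂ → ℝ := fun ζ ↦ rcs (ζ.im / a) + 1 * (rex (ζ.re / 2) * rcs ((1 + a / 2) * (ζ.im / a)))
  set V : ℂ → ℂ := fun ζ ↦ exp (((a⁻¹ : ℝ) : ℂ) * ζ) + (onR : ℂ) * exp (((a⁻¹ + 1 / 2 : ℝ) : ℂ) * ζ)
  have hV : ∀ ζ, (V ζ).re = rex (a⁻¹ * ζ.re) * Y ζ := fun ζ ↦ barrier_re ha 1 ζ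
  have hVc : Continuous V := by fun_prop
  set W : ℂ → ℝ := fun ζ ↦ a * rpi / 2 - C * rex ζ.re
  have hWc : Continuous W := by fun_prop
  have hWl : ∀ ζ, W ζ ≤ a * rpi / 2 := fun ζ ↦ sub_le_self _ pvt
  have hs : ∀ ζ : ℂ, ζ.re ≤ L → rex (ζ.re / 2) ≤ s0 := fun ζ h ↦ (Real.exp_le_exp.2 lnr).trans hL1
  have hY2 : ∀ ζ : ℂ, ζ.re ≤ L → Y ζ ≤ 2 := fun ζ h ↦ by
    have := mul_le_of_le_one_right (rxq (ζ.re / 2)).le (Real.cos_le_one ((1 + a / 2) * (ζ.im / a)))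
    linarith [hs ζ h, Real.cos_le_one (ζ.im / a)]
  have hL0 : L ≤ 0 := by
    have := hL1.trans hs01
    rw [Real.exp_le_one_iff] at this; linarith
  have factA : ∀ ζ : ℂ, ζ.re ≤ L → |ζ.im| ≤ W ζ → a * Y ζ / 3 < W ζ - |ζ.im| := fun ζ h1 h2 ↦ by
    have e1 := hs ζ h1
    have e2 := Real.exp_half_sq ζ.re
    have e3 := rxq (ζ.re / 2)
    have h0 : 0 ≤ W ζ := (abs_nonneg _).trans h2
    have hW' : W ζ / a = rpi / 2 - C / a * rex (ζ.re / 2) ^ 2 := by rw [e2]; simp only [W]; field_simp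
    have h3 := (hT _ e3 e1 (W ζ / a)).2 (by rw [abs_of_nonneg pvt, hW']) (by
      rw [abs_of_nonneg pvt, hW']; have : 0 ≤ C / a * rex (ζ.re / 2) ^ 2 := by positivity
      linarith)
    have h4 : Y ζ = rcs (|ζ.im| / a) + rex (ζ.re / 2) * rcs ((1 + a / 2) * (|ζ.im| / a)) := by
      simp only [Y]
      rw [one_mul, ← Real.cos_abs, ← Real.cos_abs ((1 + a / 2) * _), abs_mul, abs_div, abs_of_pos ha, abs_of_pos (show 0 < 1 + a / 2 by positivity)]
    have h5 := (le_abs_self _).trans (Real.abs_cos_sub_cos_le (|ζ.im| / a) (W ζ / a))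
    have h6 := (le_abs_self _).trans (Real.abs_cos_sub_cos_le ((1 + a / 2) * (|ζ.im| / a)) ((1 + a / 2) * (W ζ / a)))
    have h7 : |ζ.im| / a ≤ W ζ / a := by gcongr
    rw [← mul_sub, abs_mul, abs_of_pos (show 0 < 1 + a / 2 by positivity)] at h6
    rw [abs_sub_comm, abs_of_nonneg (sub_nonneg.2 h7)] at h5 h6
    have h8 : Y ζ < 3 * (W ζ / a - |ζ.im| / a) := by
      rw [h4]
      have : 0 ≤ W ζ / a - |ζ.im| / a := sub_nonneg.2 h7
      have h9 : (1 + a / 2) * (W ζ / a - |ζ.im| / a) ≤ 2 * (W ζ / a - |ζ.im| / a) := by gcongr; linarith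
      have h10 := mul_le_mul_of_nonneg_left (h6.trans h9) e3.le
      have h11 := mul_le_of_le_one_left (mul_nonneg two_pos.le this) (e1.trans hs01)
      linarith [mul_pos hη e3]
    rw [← sub_div, mul_div_assoc', lt_div_iff₀ ha] at h8
    linarith
  have hzc : Continuous fun ζ : ℂ ↦ p + μ * exp ζ := by fun_prop
  have hfront : frontier G ⊆ closure G := frontier_subset_closure
  obtain ⟨CK, q, hCK, hq, hq1, hK⟩ := hD ((fun ζ : ℂ ↦ p + μ * exp ζ) '' {ζ : ℂ | ζ.re = L ∧ |ζ.im| ≤ W ζ ∧ 0 ≤ (V ζ).re}) (by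
      refine IsCompact.image (Metric.isCompact_of_isClosed_isBounded ?_ ?_) hzc
      · exact (isClosed_eq continuous_re continuous_const).inter ((isClosed_le continuous_im.abs hWc).inter
          (isClosed_le continuous_const (continuous_re.comp hVc)))
      · refine (isBounded_Icc L L).reProdIm (isBounded_Icc (-(a * rpi / 2)) (a * rpi / 2)) |>.subset fun ζ h ↦ ⟨⟨h.1.ge, h.1.le⟩, abs_le.1 (h.2.1.trans (hWl ζ))⟩) (by
      rintro _ ⟨ζ, ⟨h1, h2, h3⟩, rfl⟩
      rw [hV] at h3
      have := factA ζ h1.le h2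
      have : 0 ≤ Y ζ := nonneg_of_mul_nonneg_right h3 rxp
      exact hc.out ζ (by have : 0 ≤ a * Y ζ := by positivity
                         simp only [W] at *; linarith))
  set c1 := -rlg q / 2
  have hc1 : 0 < c1 := by have := Real.log_neg hq hq1; simp only [c1]; linarith
  set A := (1 - a⁻¹) / 2
  set b := a / 48
  have hb : 0 < b := by positivity
  set B1 := C0 * b ^ mh12 * rex c1 + CK * rex (A * L)
  have hB1 : 0 < B1 := by positivity
  have main : ∀ n : ℕ, 0 < n → ∀ ζ : ℂ, ζ.re < L → |ζ.im| < W ζ → 1 / n < (V ζ).re →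
      ‖f n (p + μ * exp ζ)‖ * (rex (A * ζ.re) * rex (c1 * n * (V ζ).re)) ≤ B1 * √n := by
    intro n hn ζ h1 h2 h3
    have hn' : zrR < n := Nat.cast_pos.2 hn
    have hn1 : 1 ≤ √(n : ℝ) := Real.one_le_sqrt.2 (Nat.one_le_cast.2 hn)
    have hn0 : zrR < 1 / n := by positivity
    set U := {ζ : ℂ | ζ.re < L ∧ |ζ.im| < W ζ ∧ 1 / n < (V ζ).re}
    have hcl : closure U ⊆ {ζ : ℂ | ζ.re ≤ L ∧ |ζ.im| ≤ W ζ ∧ 1 / n ≤ (V ζ).re} := by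
      refine closure_minimal (fun ζ h ↦ ⟨h.1.le, h.2.1.le, h.2.2.le⟩) ?_
      exact (isClosed_le continuous_re continuous_const).inter ((isClosed_le continuous_im.abs hWc).inter
          (isClosed_le continuous_const (continuous_re.comp hVc)))
    have hYp : ∀ ζ ∈ closure U, 0 < Y ζ := fun ζ h ↦ by
      have := (hcl h).2.2
      rw [hV] at this
      exact pos_of_mul_pos_right (hn0.trans_le this) (rxp).le
    have hlt : ∀ ζ ∈ closure U, a * Y ζ / 3 < W ζ - |ζ.im| ∧ |ζ.im| < W ζ := fun ζ h ↦ by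
      have h4 := factA ζ (hcl h).1 (hcl h).2.1
      have h5 := mul_pos ha (hYp ζ h)
      exact ⟨h4, by linarith⟩
    have hn2 : ∀ ζ, ‖f n (p + μ * exp ζ) * (exp (A * ζ) * exp (c1 * n * V ζ))‖ =
        ‖f n (p + μ * exp ζ)‖ * (rex (A * ζ.re) * rex (c1 * n * (V ζ).re)) := fun ζ ↦ by
      rw [norm_mul, norm_mul, norm_exp, norm_exp, re_ofReal_mul, show ((c1 * n : ℂ)) = ((c1 * n : ℝ) : ℂ) by push_cast; rfl, re_ofReal_mul]
    have hda : ∀ ζ ∈ closure U, DifferentiableAt ℂ (fun ζ ↦ f n (p + μ * exp ζ) * (exp (A * ζ) * exp (c1 * n * V ζ))) ζ := fun ζ h ↦ by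
      refine DifferentiableAt.mul (DifferentiableAt.comp ζ (hf n _ (hc.out ζ (hlt ζ h).2)) bfp) bfp
    rw [← hn2]
    refine Complex.norm_le_of_forall_mem_frontier_norm_le (U := U) ?_
      ⟨fun z hz ↦ (hda z (subset_closure hz)).differentiableWithinAt, fun z hz ↦ (hda z hz).continuousAt.continuousWithinAt⟩ ?_
      (subset_closure ⟨h1, h2, h3⟩)
    · refine (isBounded_Icc (a * rlg (1 / n / 2)) L).reProdIm (isBounded_Icc (-(a * rpi / 2)) (a * rpi / 2)) |>.subset
        fun ζ h ↦ ⟨⟨?_, h.1.le⟩, abs_le.1 (h.2.1.le.trans (hWl ζ))⟩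
      · have h4 := h.2.2
        rw [hV] at h4
        have h5 : 1 / (n : ℝ) / 2 ≤ rex (a⁻¹ * ζ.re) := by
          linarith [mul_le_mul_of_nonneg_left (hY2 ζ h.1.le) (rxq (a⁻¹ * ζ.re)).le]
        have h6 := (Real.log_le_iff_le_exp pvt).2 h5
        rw [← div_eq_inv_mul, le_div_iff₀ ha] at h6; rw [mul_comm]; exact h6
    · intro ζ h
      have h5 := hcl h.1
      have h6 := hlt ζ h.1
      rw [hn2]
      have hR : 0 < rex (A * ζ.re) := rxq _
      rcases h5.1.lt_or_eq with h8 | h8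
      · rcases h5.2.2.lt_or_eq with h9 | h9
        · refine absurd (mem_interior_iff_mem_nhds.2 ?_) h.2
          filter_upwards [continuous_re.continuousAt.eventually_lt_const h8, continuous_im.abs.continuousAt.eventually_lt hWc.continuousAt h6.2,
            (continuous_re.comp hVc).continuousAt.eventually_const_lt h9] with x a b c using ⟨a, b, c⟩
        · have h10 : b / n * rex (2 * A * ζ.re) = a * Y ζ / 3 * rex ζ.re / 16 := by
            have e : rex (2 * A * ζ.re) = rex ζ.re / rex (a⁻¹ * ζ.re) := by rw [← Real.exp_sub]; congr 1; simp only [A]; ring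
            have : onR / n = _ := h9.trans (hV ζ)
            rw [e, show b / (n : ℝ) = b * (1 / n) by ring, this]
            simp only [b]; field_simp; ring
          have h11 := hH n (p + μ * exp ζ) (b / n * rex (2 * A * ζ.re)) pvt fun z hz ↦ by
            rw [h10]; exact hc.dist_le (by have := hYp ζ h.1; positivity) (by simp only [W] at h6; linarith [h6.1]) (hfront hz)
          rw [rpow_root pvt, Real.div_rpow hb.le hn'.le, rrn hn'.le, div_inv_eq_mul, ← Real.sqrt_eq_rpow] at h11
          rw [← h9, show c1 * n * (1 / (n : ℝ)) = c1 by field_simp]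
          calc _ ≤ C0 * (b ^ mh12 * √n * rex (-(2 * A * ζ.re) / 2)) * (rex (A * ζ.re) * rex c1) := by gcongr
            _ = C0 * b ^ mh12 * rex c1 * √n * (rex (-(2 * A * ζ.re) / 2) * rex (A * ζ.re)) := by ring
            _ = C0 * b ^ mh12 * rex c1 * √n := by rw [← rea]; ring_nf; simp
            _ ≤ _ := by gcongr; simp only [B1]; have : 0 < CK * rex (A * L) := by positivity
                        linarith
      · have h10 : (V ζ).re ≤ 2 := by
          rw [hV]
          have : rex (a⁻¹ * ζ.re) ≤ 1 := Real.exp_le_one_iff.2 (mul_nonpos_of_nonneg_of_nonpos pvt lnr)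
          exact (mul_le_of_le_one_left (hYp ζ h.1).le this).trans (hY2 ζ h5.1)
        have h11 := hK n _ ⟨ζ, ⟨h8, h5.2.1, hn0.le.trans h5.2.2⟩, rfl⟩
        have h12 : q ^ n * rex (c1 * n * 2) = 1 := by
          rw [← Real.rpow_natCast, Real.rpow_def_of_pos hq, ← rea]; simp only [c1]; ring_nf; simp
        calc _ ≤ CK * q ^ n * (rex (A * L) * rex (c1 * n * 2)) := by
              rw [h8]; gcongr
          _ = CK * rex (A * L) * (q ^ n * rex (c1 * n * 2)) := by ring
          _ ≤ _ := by
            rw [h12]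
            refine mul_le_mul ?_ hn1 zero_le_one hB1.le
            simp only [B1]; have : 0 < C0 * b ^ mh12 * rex c1 := by positivity
            linarith
  set g := δ / (rpi * a)
  have hg : 0 < g := by positivity
  set c := c1 * g / 2
  have hcp : 0 < c := by positivity
  set B2 := C0 * (δ / 32) ^ mh12 * rex c1
  have hB2 : 0 < B2 := by positivity
  refine ⟨B1 * (1 + 1 / c) + B2, c, min (rex L) (min (g ^ 2) (δ / (2 * C))), by positivity, hcp, by positivity, fun n hn ζ h1 h2 ↦ ?_⟩
  have hn' : zrR < n := Nat.cast_pos.2 hn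
  have hL' : ζ.re < L := Real.exp_lt_exp.1 (h1.trans_le mnl)
  have hg' : rex (ζ.re / 2) < g := by
    refine lt_of_pow_lt_pow_left₀ 2 hg.le ?_
    rw [Real.exp_half_sq]; exact h1.trans_le ((mnr).trans mnl)
  have hδ' : C * rex ζ.re < δ / 2 := by
    have := h1.trans_le ((mnr).trans mnr)
    rw [lt_div_iff₀ pvt] at this; linarith
  set E := rex (a⁻¹ * ζ.re)
  have hE : 0 < E := rxq _
  have hYg : g ≤ Y ζ := by
    have h3 : |ζ.im / a| ≤ rpi / 2 - δ / a := by
      rw [abs_div, abs_of_pos ha, div_le_iff₀ ha, sub_mul, div_mul_cancel₀ _ ha.ne']; linarith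
    have h3' : 0 < δ / a := by positivity
    have h4 := Real.mul_le_sin (x := rpi / 2 - |ζ.im / a|) lnr (by linarith [abs_nonneg (ζ.im / a)])
    rw [Real.sin_pi_div_two_sub, Real.cos_abs] at h4
    have h5 : 2 * g ≤ 2 / rpi * (rpi / 2 - |ζ.im / a|) := by
      rw [show 2 * g = 2 / rpi * (δ / a) by simp only [g]; field_simp]; gcongr; linarith
    simp only [Y]
    linarith [mul_nonneg (rxq (ζ.re / 2)).le (neg_le_iff_add_nonneg.1 (Real.neg_one_le_cos ((1 + a / 2) * (ζ.im / a))))]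
  have hv : g * E ≤ (V ζ).re := by rw [hV, mul_comm]; gcongr
  have hX : 0 < rex (-ζ.re / 2) := rxq _
  have hX2 : 0 < rex (-(c * (n * E))) := rxq _
  rw [mul_assoc, add_mul]
  rcases lt_or_ge (1 / (n : ℝ)) (V ζ).re with h3 | h3
  · have h4 := main n hn ζ hL' (by simp only [W]; linarith) h3
    have h5 : rex (2 * c * (n * E)) ≤ rex (c1 * n * (V ζ).re) := Real.exp_le_exp.2 (by
      rw [show 2 * c * (n * E) = c1 * n * (g * E) by simp only [c]; ring]; gcongr)
    have h6 : √(n * E) ≤ (1 + 1 / c) * rex (c * (n * E)) := by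
      have : √(n * E) ≤ 1 + n * E := sqrt_le_add pvt
      have h7 := Real.add_one_le_exp (c * (n * E))
      have h8 : (1 + 1 / c) * (c * (n * E) + 1) ≤ (1 + 1 / c) * rex (c * (n * E)) := by gcongr
      have h9 : (1 + 1 / c) * (c * (n * E) + 1) = 1 + n * E + (c * (n * E) + 1 / c) := by field_simp; ring
      have : 0 < c * (n * E) + 1 / c := by positivity
      linarith
    have h7 : rex (A * ζ.re) * √E = rex (ζ.re / 2) := by
      rw [Real.sqrt_eq_rpow, ← Real.exp_mul, ← rea]; congr 1; simp only [A]; ring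
    have h8 : ‖f n (p + μ * exp ζ)‖ * (rex (ζ.re / 2) * rex (2 * c * (n * E))) ≤ B1 * ((1 + 1 / c) * rex (c * (n * E))) := by
      rw [← h7]
      calc _ = ‖f n (p + μ * exp ζ)‖ * (rex (A * ζ.re) * rex (2 * c * (n * E))) * √E := by ring
        _ ≤ ‖f n (p + μ * exp ζ)‖ * (rex (A * ζ.re) * rex (c1 * n * (V ζ).re)) * √E := by gcongr
        _ ≤ B1 * √n * √E := mul_le_mul_of_nonneg_right h4 (Real.sqrt_nonneg _)
        _ = B1 * √(n * E) := by rw [Real.sqrt_mul hn'.le, mul_assoc]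
        _ ≤ _ := mul_le_mul_of_nonneg_left h6 hB1.le
    rw [← le_div_iff₀ pvt] at h8
    refine h8.trans (le_trans (le_of_eq ?_) (le_add_of_nonneg_right pvt))
    rw [show -ζ.re / 2 = -(ζ.re / 2) by ring, show 2 * c * (n * E) = c * (n * E) + c * (n * E) by ring, rea, Real.exp_neg, Real.exp_neg]
    field_simp
  · have h4 := hH n (p + μ * exp ζ) (δ / 32 * rex ζ.re) pvt fun z hz ↦ by
      have := hc.dist_le (ζ := ζ) (half_pos hδ) lnr (hfront hz)
      linarith
    rw [rpow_root pvt] at h4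
    have h5 : 1 ≤ rex c1 * rex (-(c * (n * E))) := by
      rw [← rea, Real.one_le_exp_iff]
      have : n * (g * E) ≤ 1 := by rw [le_div_iff₀ hn'] at h3; linarith [mul_le_mul_of_nonneg_left hv hn'.le]
      have := mul_le_mul_of_nonneg_left this hc1.le
      simp only [c]; linarith
    have : 0 ≤ B1 * (1 + 1 / c) * (rex (-ζ.re / 2) * rex (-(c * (n * E)))) := by positivity
    refine h4.trans (le_trans ?_ (le_add_of_nonneg_left this))
    simp only [B2]
    refine (le_mul_of_one_le_right pvt h5).trans (le_of_eq (by ring))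

lemma Corner.cone {G : Set ℂ} {p μ : ℂ} {a C κ : ℝ} (hc : Corner G p μ a C) (hκ : 0 < κ) :
    ∃ δ ρ, 0 < δ ∧ 0 < ρ ∧ ∀ ζ : ℂ, |ζ.im| ≤ rpi → rex ζ.re < ρ → p + μ * exp ζ ∉ G →
      (∀ z ∈ frontier G, κ * rex ζ.re ≤ ‖p + μ * exp ζ - z‖) → |ζ.im| ≤ a * rpi / 2 - δ := by
  have hC := hc.C0
  have ha := hc.a0
  have h2a : 0 < (2 - a) * rpi / 2 := by have := hc.a2; have := rpp; have : 0 < 2 - a := (by linarith); positivity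
  set δ := min (κ / 4) ((2 - a) * rpi / 2)
  have hδ : 0 < δ := lt_min pvt h2a
  have hδ1 : δ ≤ κ / 4 := min_le_left _ _
  have hδ2 : δ ≤ (2 - a) * rpi / 2 := min_le_right _ _
  refine ⟨δ, δ / C, hδ, by positivity, fun ζ h1 h2 h3 h4 ↦ ?_⟩
  rw [lt_div_iff₀ hC] at h2
  by_contra! hcon
  have h5 := hc.mem_inn h1 h3
  have haπ := mul_pos ha rpp
  obtain ⟨θ, hθ1, hθ2⟩ : ∃ θ : ℝ, |ζ.im + θ| = a * rpi / 2 + δ ∧ |θ| ≤ 2 * δ := by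
    rcases le_total 0 ζ.im with h6 | h6
    · rw [abs_of_nonneg h6] at hcon h5
      exact ⟨a * rpi / 2 + δ - ζ.im, by rw [add_sub_cancel, abs_of_pos lnr], abs_le.2 ⟨by linarith, by linarith⟩⟩
    · rw [abs_of_nonpos h6] at hcon h5
      exact ⟨-(a * rpi / 2 + δ) - ζ.im, by rw [add_sub_cancel, abs_neg, abs_of_pos lnr], abs_le.2 ⟨by linarith, by linarith⟩⟩
  have h7 : p + μ * exp (ζ + θ * I) ∉ G := fun hz ↦ by
    have hsub : ball (p + μ * exp ζ) (κ * rex ζ.re) ⊆ G := by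
      refine sub_of_frontier (convex_ball _ _).isPreconnected ⟨_, ?_, hz⟩ fun z hz hzf ↦ ?_
      · rw [mem_ball, dist_eq_norm, exp_add, show p + μ * (exp ζ * exp (θ * I)) - (p + μ * exp ζ) = μ * exp ζ * (exp (I * θ) - 1) by rw [mul_comm I]; ring,
          norm_mul, hc.norm_e, mul_comm]
        have := (Real.norm_exp_I_mul_ofReal_sub_one_le (x := θ)).trans (hθ2)
        exact mul_lt_mul_of_pos_right lnr rxp
      · rw [mem_ball, dist_comm, dist_eq_norm] at hz
        exact hz.not_ge (h4 z hzf)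
    exact h3 (hsub (mem_ball_self (mul_pos hκ rxp)))
  have h8 := hc.mem_inn (ζ := ζ + θ * I) (by simp [hθ1]; linarith) h7
  simp [hθ1] at h8
  linarith

namespace Geo
variable {G : Set ℂ} {Γ : Geo G}

lemma end_le {c : ℝ} (hc : Γ.Adm c) (k : Fin Γ.N) {e x : ℝ} (he : e ∈ I01) (hx : x ∈ O01) (h : |x - e| ≤ 2 * bb x)
    {w : ℂ} (hw : w ∈ Lens c) (hwx : |w.re - x| ≤ bb x / 6) : ‖Γ.σ k w - Γ.σ k e‖ ≤ 4 * Γ.M * bb x := by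
  refine (Γ.lip k _ (hc.Rc hw) _ (Γ.ofReal_mem_Rc he)).trans ?_
  have hw1 : w.re ∈ I01 := Ioo_subset_Icc_self (of_bb_pos (Lens_bb hc.pos hw))
  have h1 := (le_abs_self _).trans (bb_lip2 w.re x hw1 (Ioo_subset_Icc_self hx))
  have h2 : |w.im| ≤ bb w.re := (le_of_lt hw).trans (mul_le_of_le_one_left (Lens_bb hc.pos hw).le hc.le1)
  have h3 := norm_le_abs_re_add_abs_im (w - e)
  have h4 := abs_sub_le w.re x e
  simp only [sub_re, ofReal_re, sub_im, ofReal_im, sub_zero] at h3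
  have : ‖w - e‖ ≤ 4 * bb x := by linarith [bb_pos hx]
  linarith [mul_le_mul_of_nonneg_left this Γ.M_pos.le]

lemma Dat.kt_end (D : Dat Γ) (k : Fin Γ.N) {e a C lam : ℝ} {μ : ℂ} (he : e ∈ I01) (hc : Corner G (Γ.σ k e) μ a C) (hla : lam ≤ a) :
    ∃ K, 0 < K ∧ ∀ x ∈ O01, |x - e| ≤ 2 * bb x → ‖D.kt k (xi (-(D.c / 4)) x)‖ ≤ K * bb x ^ ((2 - lam)⁻¹ / 2 - 1 / 2) := by
  obtain ⟨C', ρ, hC', hρ, hu⟩ := D.u_le hc (Γ.memL k e he)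
  obtain ⟨B, hB, hb, -⟩ := D.bound
  have hcp := D.adm.pos
  have hM := Γ.M_pos
  have hm := Γ.m_pos
  have hq : 0 < D.q := by linarith [D.q0]
  have ha2 := hc.a2
  set ε := (2 - lam)⁻¹
  have hε : 0 < ε := by apply inv_pos.2; linarith
  set A := 108 / (D.c * D.q * Γ.m) * (C' * (4 * Γ.M) ^ (2 - a)⁻¹)
  have hA : 0 < A := by positivity
  refine ⟨√A + B * (ρ / (4 * Γ.M)) ^ (-(ε / 2)), by positivity, fun x hx h ↦ ?_⟩
  have hbp := bb_pos hx
  have hL := xi_mem_Lens (c := D.c / 2) (s := -(D.c / 4)) (by rw [abs_neg, abs_of_pos pvt]; linarith) hx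
  rw [add_mul]
  rcases lt_or_ge (4 * Γ.M * bb x) ρ with h1 | h1
  · have h2 := D.kb k _ hL (C' * (4 * Γ.M * bb x) ^ (2 - a)⁻¹) pvt fun w hw hwi hwr ↦ by
      rw [xi_re] at hwr
      have h3 := end_le D.adm k he hx h hw hwr
      refine (hu _ (D.σ_G hw hwi) (h3.trans_lt h1)).trans ?_
      gcongr
    rw [xi_re, rmr pvt hbp.le] at h2
    have h3 : bb x ^ (2 - a)⁻¹ ≤ bb x ^ ε := Real.rpow_le_rpow_of_exponent_ge hbp (by linarith [bb_le x]) (by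
      simp only [ε]; gcongr)
    have h4 : ‖D.kt k (xi (-(D.c / 4)) x)‖ ^ 2 ≤ A * (bb x ^ (ε / 2 - 1 / 2)) ^ 2 := by
      refine h2.trans ?_
      rw [← Real.rpow_natCast (bb x ^ _), ← Real.rpow_mul hbp.le, show (ε / 2 - 1 / 2) * ((2 : ℕ) : ℝ) = ε - 1 by push_cast; ring,
        Real.rpow_sub_one hbp.ne', mul_div_assoc']
      refine div_le_div_of_nonneg_right ?_ hbp.le
      simp only [A]
      calc _ = 108 / (D.c * D.q * Γ.m) * (C' * (4 * Γ.M) ^ (2 - a)⁻¹) * bb x ^ (2 - a)⁻¹ := by ring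
        _ ≤ _ := by gcongr
    refine le_trans ?_ (le_add_of_nonneg_right pvt)
    refine le_of_sq_le_sq (h4.trans_eq ?_) pvt
    rw [mul_pow, Real.sq_sqrt hA.le]
  · refine le_trans ?_ (le_add_of_nonneg_left pvt)
    refine (hb k _ hL).trans ?_
    rw [xi_re, show mh12 = -(ε / 2) + (ε / 2 - 1 / 2) by ring, rra hbp, mul_assoc]
    gcongr B * (?_ * _)
    refine Real.rpow_le_rpow_of_nonpos pvt ?_ lnr
    rw [div_le_iff₀ pvt]; linarith

lemma H_end {c : ℝ} (hc : Γ.Adm c) {f : ℕ → ℂ → ℂ} {C0 : ℝ} (hC0 : 0 < C0)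
    (hf : ∀ n, ∀ t ∉ closure G, DifferentiableAt ℂ (f n) t)
    (hH : ∀ n t d, 0 < d → (∀ z ∈ frontier G, d ≤ ‖t - z‖) → ‖f n t‖ ≤ C0 * d ^ mh12)
    (hD : ∀ K, IsCompact K → K ⊆ (closure G)ᶜ → Dec f K)
    (k : Fin Γ.N) {e a C lam : ℝ} {μ : ℂ} (he : e ∈ I01) (hco : Corner G (Γ.σ k e) μ a C) (hl : 0 < lam) (hla : lam ≤ a) :
    ∃ K κ, 0 < K ∧ 0 < κ ∧ ∀ n : ℕ, 0 < n → ∀ x ∈ O01, bb x ≤ |x - e| → |x - e| ≤ 2 * bb x →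
      ‖f n (Γ.σ k (xi (-(c / 4)) x))‖ ≤ K * bb x ^ mh12 * rex (-(κ * (n * bb x ^ lam⁻¹))) := by
  have hcp := hc.pos
  have hM := Γ.M_pos
  have hm := Γ.m_pos
  have ha := hco.a0
  have habs : |-(c / 4)| = c / 4 := by rw [abs_neg, abs_of_pos pvt]
  have hxL : ∀ x ∈ O01, xi (-(c / 4)) x ∈ Lens c := fun x hx ↦ xi_mem_Lens (by rw [habs]; linarith) hx
  have hout : ∀ x ∈ O01, Γ.σ k (xi (-(c / 4)) x) ∉ closure G := fun x hx ↦
    Γ.down k _ (Lens_mono hcp hc.le (hxL x hx)) (by rw [xi_im]; have := bb_pos hx; nlinarith)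
  obtain ⟨δ, ρ1, hδ, hρ1, hcone⟩ := hco.cone (κ := c / 64 * (Γ.m / Γ.M)) pvt
  obtain ⟨C', c', ρ2, hC', hc', hρ2, hdec⟩ := hco.decay hC0 hδ hf hH hD
  set b0 := min ρ1 ρ2 / (4 * Γ.M)
  have hb0 : 0 < b0 := by positivity
  obtain ⟨C2, q, hC2, hq, hq1, hfar⟩ := hD ((fun x ↦ Γ.σ k (xi (-(c / 4)) x)) '' (Icc 0 1 ∩ {x | b0 ≤ bb x})) (by
      refine IsCompact.image_of_continuousOn ?_ ((cont_σxi k (by rw [habs]; linarith [hc.le])).mono inter_subset_left)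
      exact isCompact_Icc.inter_right (isClosed_le continuous_const (by unfold bb; fun_prop))) (by
      rintro _ ⟨x, ⟨h1, h2⟩, rfl⟩
      exact hout x (of_bb_pos (hb0.trans_le h2)))
  set m' := min Γ.m 1
  have hm' : 0 < m' := lt_min hm one_pos
  have hlq : 0 < -rlg q := by linarith [Real.log_neg hq hq1]
  refine ⟨C' * Γ.m ^ mh12 + C2, min (c' * m' ^ lam⁻¹) (-rlg q), by positivity, by positivity, fun n hn x hx h1 h2 ↦ ?_⟩
  have hb := bb_pos hx
  have hb1 : bb x ≤ 1 := by linarith [bb_le x]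
  have hn' : zrR < n := Nat.cast_pos.2 hn
  rw [add_mul, add_mul]
  have hκ : ∀ y, min (c' * m' ^ lam⁻¹) (-rlg q) ≤ y → rex (-(y * (n * bb x ^ lam⁻¹))) ≤
    rex (-(min (c' * m' ^ lam⁻¹) (-rlg q) * (n * bb x ^ lam⁻¹))) := fun y hy ↦ by gcongr
  rcases lt_or_ge (bb x) b0 with h3 | h3
  · refine le_trans ?_ (le_add_of_nonneg_right pvt)
    refine le_trans ?_ (mul_le_mul_of_nonneg_left (hκ _ mnl) pvt)
    set t := Γ.σ k (xi (-(c / 4)) x) with ht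
    have hr1 : ‖t - Γ.σ k e‖ ≤ 4 * Γ.M * bb x := end_le hc k he hx h2 (hxL x hx) (by rw [xi_re, sub_self, abs_zero]; positivity)
    have hr2 : Γ.m * bb x ≤ ‖t - Γ.σ k e‖ := by
      refine le_trans ?_ (Γ.colip k _ (hc.Rc (hxL x hx)) _ (Γ.ofReal_mem_Rc he))
      gcongr
      refine h1.trans (le_trans (le_of_eq ?_) (abs_re_le_norm _))
      rw [sub_re, xi_re, ofReal_re]
    obtain ⟨ζ, hζ1, hζ2⟩ := hco.rep (z := t) (fun h ↦ by rw [h, sub_self, norm_zero] at hr2; have := mul_pos hm hb; linarith)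
    have hζe : ‖t - Γ.σ k e‖ = rex ζ.re := by rw [hζ2, add_sub_cancel_left, hco.norm_e]
    rw [hζe] at hr1 hr2
    have hr3 : rex ζ.re < min ρ1 ρ2 := by
      rw [lt_div_iff₀ pvt] at h3; linarith
    have h4 := hcone ζ hζ1 (hr3.trans_le mnl) (by rw [← hζ2]; exact fun h ↦ hout x hx (subset_closure h)) fun z hz ↦ by
      rw [← hζ2]
      obtain ⟨j, y, hy, rfl⟩ := Γ.cover z hz
      refine le_trans ?_ (ker hc k j (Ioo_subset_Icc_self hx) (Γ.ofReal_mem_Rc hy) (by simpa using hy) (by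
        have : 0 ≤ bb y := mul_nonneg hy.1 (by linarith [hy.2])
        simpa using by positivity)).1
      calc _ ≤ c / 64 * (Γ.m / Γ.M) * (4 * Γ.M * bb x) := by gcongr
        _ = _ := by field_simp; norm_num
    have h5 := hdec n hn ζ (hr3.trans_le mnr) h4
    rw [← hζ2] at h5
    refine h5.trans ?_
    have h6 : rex (-ζ.re / 2) ≤ Γ.m ^ mh12 * bb x ^ mh12 := by
      rw [← rmr hm.le hb.le, show -ζ.re / 2 = ζ.re * (-(1 / 2)) by ring, Real.exp_mul]
      exact Real.rpow_le_rpow_of_nonpos pvt hr2 nnm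
    have h7 : m' ^ lam⁻¹ * bb x ^ lam⁻¹ ≤ rex (a⁻¹ * ζ.re) := by
      rw [← rmr hm'.le hb.le, mul_comm a⁻¹, Real.exp_mul]
      have h8 : m' * bb x ≤ 1 := mul_le_one₀ mnr hb.le hb1
      calc _ ≤ (m' * bb x) ^ a⁻¹ := by
            exact Real.rpow_le_rpow_of_exponent_ge pvt h8 (by gcongr)
        _ ≤ _ := by
          refine Real.rpow_le_rpow pvt (le_trans ?_ hr2) pvt
          gcongr; exact min_le_left _ _
    rw [mul_assoc C' (Γ.m ^ _)]
    gcongr ?_ * ?_ * rex (-?_)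
    calc _ = c' * (n * (m' ^ lam⁻¹ * bb x ^ lam⁻¹)) := by ring
      _ ≤ _ := by gcongr
  · refine le_trans ?_ (le_add_of_nonneg_left pvt)
    refine le_trans ?_ (mul_le_mul_of_nonneg_left (hκ _ mnr) pvt)
    refine (hfar n _ ⟨x, ⟨Ioo_subset_Icc_self hx, h3⟩, rfl⟩).trans ?_
    rw [← Real.rpow_natCast, Real.rpow_def_of_pos hq, mul_assoc]
    gcongr C2 * ?_
    have h4 : 1 ≤ bb x ^ mh12 := Real.one_le_rpow_of_pos_of_le_one_of_nonpos hb hb1 nnm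
    have h5 : bb x ^ lam⁻¹ ≤ 1 := Real.rpow_le_one hb.le hb1 pvt
    refine le_trans (Real.exp_le_exp.2 ?_) (le_mul_of_one_le_left (rxp).le h4)
    have := mul_le_mul_of_nonneg_left h5 (mul_pos hlq hn').le
    linarith

end Geo

lemma prof {s p : ℝ} (hs : -1 < s) (hp : 0 < p) : ∃ A, 0 < A ∧ ∀ b, 0 < b → ∀ f : ℝ → ℝ, (f = fun x ↦ x ^ s * rex (-b * x ^ p)) →
    (IntegrableOn f (Ioo 0 1) ∧ ∫ x in O01, f x ≤ A * b ^ (-(s + 1) / p)) ∧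
    (IntegrableOn (fun x ↦ f (1 - x)) (Ioo 0 1) ∧ ∫ x in O01, f (1 - x) ≤ A * b ^ (-(s + 1) / p)) := by
  refine ⟨1 / p * Real.Gamma ((s + 1) / p), mul_pos pvt (Real.Gamma_pos_of_pos (div_pos lnr hp)), fun b hb f hf ↦ ?_⟩
  have h1 : IntegrableOn f (Ioi 0) := by rw [hf]; exact integrableOn_rpow_mul_exp_neg_mul_rpow hs hp hb
  have h2 := h1.mono_set (Ioo_subset_Ioi_self : O01 ⊆ _)
  have h3 : ∫ x in O01, f x ≤ 1 / p * Real.Gamma ((s + 1) / p) * b ^ (-(s + 1) / p) := by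
    have h4 := integral_rpow_mul_exp_neg_mul_rpow hp hs hb
    rw [← hf] at h4
    refine (setIntegral_mono_set h1 ?_ (Eventually.of_forall Ioo_subset_Ioi_self)).trans (by rw [h4]; apply le_of_eq; ring)
    refine (ae_restrict_mem measurableSet_Ioi).mono fun x hx ↦ ?_
    rw [hf]; exact mul_nonneg (Real.rpow_nonneg (le_of_lt hx) _) (rxp).le
  have h4 := ((intervalIntegrable_iff_integrableOn_Ioo_of_le zero_le_one).2 h2).comp_sub_left 1
  have h5 := intervalIntegral.integral_comp_sub_left f 1 (a := 0) (b := 1)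
  simp only [sub_self, sub_zero] at h4 h5
  rw [intervalIntegral.integral_of_le zero_le_one, intervalIntegral.integral_of_le zero_le_one, integral_Ioc_eq_integral_Ioo, integral_Ioc_eq_integral_Ioo] at h5
  exact ⟨⟨h2, h3⟩, (intervalIntegrable_iff_integrableOn_Ioo_of_le zero_le_one).1 h4.symm, by rw [h5]; exact h3⟩

namespace Geo
variable {G : Set ℂ} {Γ : Geo G}

lemma Dat.final (D : Dat Γ) (hΩ : IsPreconnected (closure G)ᶜ) {P : ℕ → Polynomial ℂ} {E : ℝ} (hE : 0 < E)
    (hP : ∀ n, Γ.En (P n) ≤ E) (ho : ∀ n, ∀ k < n, ∑ j, ∫ x in O01, Γ.cw (P n) j x * Γ.σ j x ^ k = 0)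
    {lam : ℝ} (h0 : 0 < lam) (h2 : lam < 2) (hco : ∀ p ∈ J Γ, ∃ μ a C, Corner G p μ a C ∧ lam ≤ a) :
    ∃ C, 0 < C ∧ ∀ n : ℕ, 0 < n → ∀ ζ ∈ G, ‖D.φ ζ‖ ≤ 2 * D.q - 1 →
      ‖(P n).eval ζ‖ ≤ ‖D.κ ζ‖ * (C * (n : ℝ) ^ (-(lam / (4 - 2 * lam)))) := by
  obtain ⟨C0, hC0, hH⟩ := Γ.H_le E hE
  set s := (2 - lam)⁻¹ / 2 - 1
  have hs : -1 < s := by have : 0 < (2 - lam)⁻¹ := inv_pos.2 lnr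
                         simp only [s]; linarith
  obtain ⟨A, hA, hA'⟩ := prof hs (inv_pos.2 h0)
  have hA := fun b hb ↦ hA' b hb _ rfl
  have key : ∀ k (e : ℝ), e ∈ I01 → Γ.σ k e ∈ J Γ → ∃ K κ, 0 < K ∧ 0 < κ ∧ ∀ n : ℕ, 0 < n → ∀ x ∈ O01,
      bb x ≤ |x - e| → |x - e| ≤ 2 * bb x → ‖D.kt k (xi (-(D.c / 4)) x)‖ * ‖Γ.H (P n) (Γ.σ k (xi (-(D.c / 4)) x))‖ ≤
        K * (|x - e| ^ s * rex (-(κ * n) * |x - e| ^ lam⁻¹)) := by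
    intro k e he hJ
    obtain ⟨μ, a, C, hc, hla⟩ := hco _ hJ
    obtain ⟨K1, hK1, h1⟩ := D.kt_end k he hc hla
    obtain ⟨K2, κ, hK2, hκ, h2⟩ := H_end D.adm hC0 (f := fun n ↦ Γ.H (P n)) (fun n t ht ↦ H_diff _ fun h ↦ ht (frontier_subset_closure h))
      (fun n ↦ hH _ (hP n)) (fun K hK hKΩ ↦ Γ.H_dec D.bdd hΩ hE hP ho hK hKΩ) k he hc h0 hla
    refine ⟨K1 * K2 * 2, κ * (2⁻¹ : ℝ) ^ lam⁻¹, by positivity, by positivity, fun n hn x hx hx1 hx2 ↦ ?_⟩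
    have hb := bb_pos hx
    refine (mul_le_mul (h1 x hx hx2) (h2 n hn x hx hx1 hx2) nng pvt).trans ?_
    set u := |x - e|
    have hu : 0 < u := hb.trans_le hx1
    have h3 : bb x ^ s ≤ 2 * u ^ s := by
      rcases le_or_gt 0 s with h | h
      · have := Real.rpow_le_rpow hb.le hx1 h
        have : 0 < u ^ s := by positivity
        linarith
      · calc _ ≤ (u * 2⁻¹) ^ s := Real.rpow_le_rpow_of_nonpos pvt lnr h.le
          _ = u ^ s * 2 ^ (-s) := by rw [rmr hu.le nnm, Real.inv_rpow two_pos.le, rrn two_pos.le]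
          _ ≤ u ^ s * 2 ^ onR := by gcongr <;> linarith
          _ = _ := by rw [Real.rpow_one, mul_comm]
    have h4 : (2⁻¹ : ℝ) ^ lam⁻¹ * u ^ lam⁻¹ ≤ bb x ^ lam⁻¹ := by
      rw [← rmr nnm hu.le]; gcongr; linarith
    calc _ = K1 * K2 * (bb x ^ ((2 - lam)⁻¹ / 2 - 1 / 2) * bb x ^ mh12) * rex (-(κ * (n * bb x ^ lam⁻¹))) := by ring
      _ = K1 * K2 * bb x ^ s * rex (-(κ * (n * bb x ^ lam⁻¹))) := by rw [← rra hb]; congr 3; simp only [s]; ring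
      _ ≤ K1 * K2 * (2 * u ^ s) * rex (-(κ * (n * ((2⁻¹ : ℝ) ^ lam⁻¹ * u ^ lam⁻¹)))) := by gcongr
      _ = _ := by ring_nf
  choose K0 κ0 hK0 hκ0 h3 using fun k ↦ key k 0 bsp (by simpa using mem_J0 k)
  choose K1 κ1 hK1 hκ1 h4 using fun k ↦ key k 1 bsp (by simpa using mem_J1 k)
  set t := -(s + 1) / lam⁻¹
  have ht : t = -(lam / (4 - 2 * lam)) := by
    have : (2 - lam) ≠ 0 := by linarith
    simp only [t, s]
    rw [show 4 - 2 * lam = 2 * (2 - lam) by ring]; field_simp; ring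
  have hM := Γ.M_pos
  have hq : 0 < 1 - D.q := by linarith [D.q1]
  set S := ∑ k, (K0 k * (A * κ0 k ^ t) + K1 k * (A * κ1 k ^ t))
  have hS : 0 ≤ S := Finset.sum_nonneg fun k _ ↦ by have := hK0 k; have := hK1 k; have := hκ0 k; have := hκ1 k; positivity
  refine ⟨2 * Γ.M / (1 - D.q) * S + 1, by positivity, fun n hn ζ hζ hφ ↦ ?_⟩
  have hn' : zrR < n := Nat.cast_pos.2 hn
  have hI0 := fun k ↦ (hA (κ0 k * n) (mul_pos (hκ0 k) hn')).1
  have hI1 := fun k ↦ (hA (κ1 k * n) (mul_pos (hκ1 k) hn')).2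
  refine (D.dual hζ hφ (P n) (g := fun k x ↦ K0 k * (x ^ s * rex (-(κ0 k * n) * x ^ lam⁻¹)) +
    K1 k * ((1 - x) ^ s * rex (-(κ1 k * n) * (1 - x) ^ lam⁻¹))) (fun k ↦ ((hI0 k).1.const_mul _).add ((hI1 k).1.const_mul _)) ?_).trans ?_
  · intro k x hx
    have h5 := bb_pos hx
    have e0 : 0 ≤ K0 k * (x ^ s * rex (-(κ0 k * n) * x ^ lam⁻¹)) :=
      mul_nonneg (hK0 k).le (mul_nonneg (Real.rpow_nonneg hx.1.le _) (rxp).le)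
    have e1 : 0 ≤ K1 k * ((1 - x) ^ s * rex (-(κ1 k * n) * (1 - x) ^ lam⁻¹)) :=
      mul_nonneg (hK1 k).le (mul_nonneg (Real.rpow_nonneg (by linarith [hx.2]) _) (rxp).le)
    have h0 := h3 k n hn x hx
    have h1 := h4 k n hn x hx
    rw [sub_zero, abs_of_pos hx.1] at h0
    rw [abs_sub_comm, abs_of_pos (sub_pos.2 hx.2)] at h1
    rcases le_total x (1 / 2) with h | h
    · have := h0 (by unfold bb; nlinarith [hx.1]) (by unfold bb; nlinarith [hx.1])
      linarith
    · have := h1 (by unfold bb; nlinarith [hx.2]) (by unfold bb; nlinarith [hx.2])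
      linarith
  · rw [← ht]
    gcongr ‖_‖ * ?_
    have : ∑ i, ∫ x in O01, (K0 i * (x ^ s * rex (-(κ0 i * n) * x ^ lam⁻¹)) +
        K1 i * ((1 - x) ^ s * rex (-(κ1 i * n) * (1 - x) ^ lam⁻¹))) ≤ S * (n : ℝ) ^ t := by
      rw [Finset.sum_mul]
      refine Finset.sum_le_sum fun k _ ↦ ?_
      rw [integral_add ((hI0 k).1.const_mul _) ((hI1 k).1.const_mul _), integral_const_mul, integral_const_mul, add_mul]
      have e0 := mul_le_mul_of_nonneg_left (hI0 k).2 (hK0 k).le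
      have e1 := mul_le_mul_of_nonneg_left (hI1 k).2 (hK1 k).le
      rw [rmr (hκ0 k).le hn'.le] at e0
      rw [rmr (hκ1 k).le hn'.le] at e1
      simp only [t] at *
      linarith
    have hnt : 0 < (n : ℝ) ^ t := by positivity
    calc _ ≤ 2 * Γ.M / (1 - D.q) * (S * (n : ℝ) ^ t) := by gcongr
      _ ≤ _ := by linarith

end Geo

lemma conv_sector {A B K : ℝ} (hK : 0 < K) : Convex ℝ {ζ : ℂ | A + K * rex ζ.re < ζ.im ∧ ζ.im < B - K * rex ζ.re} := by
  have key : ∀ x y : ℂ, ∀ a b : ℝ, 0 ≤ a → 0 ≤ b → a + b = 1 → K * rex (a * x.re + b * y.re) ≤ a * (K * rex x.re) + b * (K * rex y.re) :=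
    fun x y a b ha hb hab ↦ by
      have := convexOn_exp.2 (mem_univ x.re) (mem_univ y.re) ha hb hab
      simp only [smul_eq_mul] at this
      linarith [mul_le_mul_of_nonneg_left this hK.le]
  intro x hx y hy a b ha hb hab
  have := key x y a b ha hb hab
  have hx1 := hx.1; have hx2 := hx.2; have hy1 := hy.1; have hy2 := hy.2
  show _ ∧ _
  simp only [add_re, add_im, smul_re, smul_im, smul_eq_mul]
  rcases ha.eq_or_lt with rfl | ha
  · obtain rfl : b = 1 := by linarith
    simp only [zero_mul, one_mul, zero_add]; exact ⟨hy1, hy2⟩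
  have ex : a * A + b * A = A := by rw [← add_mul, hab, one_mul]
  have ey : a * B + b * B = B := by rw [← add_mul, hab, one_mul]
  constructor <;> nlinarith [mul_lt_mul_of_pos_left hx1 ha, mul_lt_mul_of_pos_left hx2 ha, mul_le_mul_of_nonneg_left hy1.le hb, mul_le_mul_of_nonneg_left hy2.le hb]

lemma sector_lim {G : Set ℂ} (hG : IsOpen G) {p : ℂ} {A B K : ℝ} (hAB : A ≤ B) (hK : 0 < K)
    (hS : ∀ ζ : ℂ, A + K * rex ζ.re < ζ.im → ζ.im < B - K * rex ζ.re → p + exp ζ ∉ frontier G) :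
    ((∀ ζ : ℂ, A + K * rex ζ.re < ζ.im → ζ.im < B - K * rex ζ.re → p + exp ζ ∈ G) ∧
      Tendsto (fun r : ℝ ↦ ∫ θ in A..B, indicator {θ : ℝ | p + r * exp (θ * I) ∈ G} (fun _ ↦ onR) θ) (nhdsWithin 0 (Ioi 0)) (nhds (B - A))) ∨
    ((∀ ζ : ℂ, A + K * rex ζ.re < ζ.im → ζ.im < B - K * rex ζ.re → p + exp ζ ∉ closure G) ∧
      Tendsto (fun r : ℝ ↦ ∫ θ in A..B, indicator {θ : ℝ | p + r * exp (θ * I) ∈ G} (fun _ ↦ onR) θ) (nhdsWithin 0 (Ioi 0)) nh0) := by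
  set S := {ζ : ℂ | A + K * rex ζ.re < ζ.im ∧ ζ.im < B - K * rex ζ.re}
  have hconv : Convex ℝ S := conv_sector hK
  have hpre : IsPreconnected ((fun ζ ↦ p + exp ζ) '' S) := hconv.isPreconnected.image _ bfp
  have hlim : ∀ v : ℝ, (∀ ζ ∈ S, indicator G (fun _ ↦ onR) (p + exp ζ) = v) →
      Tendsto (fun r : ℝ ↦ ∫ θ in A..B, indicator {θ : ℝ | p + r * exp (θ * I) ∈ G} (fun _ ↦ onR) θ) (nhdsWithin 0 (Ioi 0)) (nhds ((B - A) * v)) := by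
    intro v hv
    have h1 : ∫ θ in A..B, v = (B - A) * v := by simp
    rw [← h1]
    refine intervalIntegral.tendsto_integral_filter_of_dominated_convergence (fun _ ↦ 1) ?_ ?_ bsp ?_
    · refine Eventually.of_forall fun r ↦ (measurable_const.indicator ?_).aestronglyMeasurable
      exact (hG.preimage (by fun_prop : Continuous fun θ : ℝ ↦ p + r * exp (θ * I))).measurableSet
    · refine Eventually.of_forall fun r ↦ Eventually.of_forall fun θ _ ↦ ?_
      refine (norm_indicator_le_norm_self _ _).trans bsp
    · have hB : ∀ᵐ θ : ℝ, θ ≠ B := by simp [ae_iff, measure_singleton]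
      filter_upwards [hB] with θ hθB hθ
      rw [uIoc_of_le hAB] at hθ
      have hθ' : θ < B := hθ.2.lt_of_ne hθB
      refine tendsto_const_nhds.congr' ?_
      have h2 : Tendsto (fun r : ℝ ↦ K * r) (nhdsWithin 0 (Ioi 0)) (nhds (K * 0)) := (tendsto_id.mono_left nhdsWithin_le_nhds).const_mul K
      rw [mul_zero] at h2
      filter_upwards [h2.eventually_lt_const (sub_pos.2 hθ.1), h2.eventually_lt_const (sub_pos.2 hθ'), self_mem_nhdsWithin] with r h3 h4 h5
      have h5 : 0 < r := h5
      have h6 := hv (rlg r + θ * I) (by constructor <;> simp [rel h5] <;> linarith)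
      rw [exp_add, ← ofReal_exp, rel h5] at h6
      exact h6.symm
  by_cases h : ((fun ζ ↦ p + exp ζ) '' S ∩ G).Nonempty
  · left
    have h1 := sub_of_frontier hpre h (by rintro _ ⟨ζ, hζ, rfl⟩; exact hS ζ hζ.1 hζ.2)
    have h2 : ∀ ζ ∈ S, p + exp ζ ∈ G := fun ζ hζ ↦ h1 ⟨ζ, hζ, rfl⟩
    refine ⟨fun ζ a b ↦ h2 ζ ⟨a, b⟩, ?_⟩
    have := hlim 1 fun ζ hζ ↦ indicator_of_mem (h2 ζ hζ) _
    rwa [mul_one] at this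
  · right
    have h2 : ∀ ζ ∈ S, p + exp ζ ∉ G := fun ζ hζ hz ↦ h ⟨_, ⟨ζ, hζ, rfl⟩, hz⟩
    refine ⟨fun ζ a b hz ↦ hS ζ a b ?_, ?_⟩
    · rw [hG.frontier_eq]; exact ⟨hz, h2 ζ ⟨a, b⟩⟩
    · have := hlim 0 fun ζ hζ ↦ indicator_of_notMem (h2 ζ hζ) _
      rwa [mul_zero] at this

lemma corner_aux {G : Set ℂ} {p : ℂ} {A B K l : ℝ} (hK : 0 < K) (hl : l ∈ Ioo zrR 2) (hAB : B - A = l * rpi)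
    (ho : ∀ ζ : ℂ, A + K * rex ζ.re < ζ.im → ζ.im < B - K * rex ζ.re → p + exp ζ ∉ closure G)
    (hi : ∀ ζ : ℂ, B + K * rex ζ.re < ζ.im → ζ.im < A + 2 * rpi - K * rex ζ.re → p + exp ζ ∈ G) :
    ∃ μ, Corner G p μ l K ∧ exp (B * I) = μ * exp ((l * rpi / 2 : ℝ) * I) ∧ exp (A * I) = μ * exp (-(l * rpi / 2 : ℝ) * I) := by
  refine ⟨exp (((A + B) / 2 : ℝ) * I), ⟨hl.1, hl.2, hK, norm_exp_ofReal_mul_I _, ?_, ?_⟩, ?_, ?_⟩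
  · intro ζ hζ
    rw [abs_lt] at hζ
    rw [← exp_add, add_comm _ ζ]
    apply ho <;> simp <;> linarith
  · intro ζ hζ
    rw [abs_lt] at hζ
    have : -(exp (((A + B) / 2 : ℝ) * I) * exp ζ) = exp (ζ + ((A + B) / 2 + rpi : ℝ) * I) := by
      push_cast; rw [add_mul, ← add_assoc, exp_add, exp_add, exp_pi_mul_I]; ring
    rw [sub_eq_add_neg, this]
    apply hi <;> simp <;> linarith
  · rw [← exp_add, ← hAB]; push_cast; ring_nf
  · rw [← exp_add, ← hAB]; push_cast; ring_nf

lemma corner_of {G : Set ℂ} (hG : IsOpen G) {p a1 a2 : ℂ} {ρ C l : ℝ} (hρ : 0 < ρ) (h1 : ‖a1‖ = 1) (h2 : ‖a2‖ = 1)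
    (hl : l ∈ Ioo zrR 2) (hang : HasCornerAngle G p ((2 - l) * rpi))
    (hL : ∀ z ∈ frontier G, z ≠ p → ‖z - p‖ < ρ → ∃ ζ : ℂ, |ζ.im| ≤ C * rex ζ.re ∧ (z = p + a1 * exp ζ ∨ z = p + a2 * exp ζ)) :
    ∃ μ K, Corner G p μ l K ∧ ((a1 = μ * exp ((l * rpi / 2 : ℝ) * I) ∧ a2 = μ * exp (-(l * rpi / 2 : ℝ) * I)) ∨
      (a2 = μ * exp ((l * rpi / 2 : ℝ) * I) ∧ a1 = μ * exp (-(l * rpi / 2 : ℝ) * I))) := by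
  have hπ := rpp
  have n1 : a1 ≠ 0 := by rintro rfl; simp at h1
  wlog hβ : 0 ≤ arg (a2 / a1) generalizing a1 a2
  · have n2 : a2 ≠ 0 := by rintro rfl; simp at h2
    obtain ⟨μ, K, hc, h⟩ := this h2 h1 (fun z a b c ↦ (hL z a b c).imp fun ζ h ↦ ⟨h.1, h.2.symm⟩) n2 (by
      rw [← inv_div, arg_inv]; split_ifs with h
      · exact hπ.le
      · push Not at hβ; linarith)
    exact ⟨μ, K, hc, h.symm⟩
  set β := arg (a2 / a1)
  set α := arg a1
  have hβπ : β ≤ rpi := arg_le_pi _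
  have e1 : exp (α * I) = a1 := by have := norm_mul_exp_arg_mul_I a1; rwa [h1, ofReal_one, one_mul] at this
  have e2 : exp ((α + β : ℝ) * I) = a2 := by
    have := norm_mul_exp_arg_mul_I (a2 / a1)
    rw [norm_div, h1, h2, div_one, ofReal_one, one_mul] at this
    push_cast; rw [add_mul, exp_add, e1, this]; field_simp
  clear_value α β
  set K := max C (rpi / ρ)
  have hK : 0 < K := (div_pos hπ hρ).trans_le (le_max_right _ _)
  have sec : ∀ A B : ℝ, B - A ≤ 2 * rpi → (∀ n : ℤ, ∀ γ : ℝ, γ = α ∨ γ = α + β → A < γ + n * (2 * rpi) → γ + n * (2 * rpi) < B → False) →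
      ∀ ζ : ℂ, A + K * rex ζ.re < ζ.im → ζ.im < B - K * rex ζ.re → p + exp ζ ∉ frontier G := by
    intro A B hAB hn ζ ha hb hf
    obtain ⟨ζ', h3, h4⟩ := hL _ hf (by simp [exp_ne_zero]) (by
      rw [add_sub_cancel_left, norm_exp]
      have : rpi / ρ * rex ζ.re ≤ K * rex ζ.re := by gcongr; exact le_max_right _ _
      have h5 : rpi * (rex ζ.re / ρ) < rpi * 1 := by rw [← mul_div_assoc, ← div_mul_eq_mul_div]; linarith
      exact (div_lt_one hρ).1 (lt_of_mul_lt_mul_left h5 hπ.le))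
    have h5 : ∃ γ : ℝ, (γ = α ∨ γ = α + β) ∧ exp ζ = exp (ζ' + γ * I) := by
      rcases h4 with h4 | h4
      · exact ⟨α, .inl rfl, by rw [exp_add, e1, mul_comm]; exact add_left_cancel h4⟩
      · exact ⟨α + β, .inr rfl, by rw [exp_add, e2, mul_comm]; exact add_left_cancel h4⟩
    obtain ⟨γ, hγ, h5⟩ := h5
    obtain ⟨n, h6⟩ := exp_eq_exp_iff_exists_int.1 h5
    have h7 : ζ.re = ζ'.re := by rw [h6]; simp
    have h8 : ζ.im = ζ'.im + γ + n * (2 * rpi) := by rw [h6]; simp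
    have h9 : C * rex ζ.re ≤ K * rex ζ.re := by gcongr; exact le_max_left _ _
    rw [← h7, abs_le] at h3
    exact hn n γ hγ lnr lnr
  have int : ∀ n : ℤ, ¬ (0 < n * (2 * rpi) ∧ n * (2 * rpi) < 2 * rpi) := by
    rintro n ⟨h3, h4⟩
    have h5 : zrR < n := by by_contra h; push Not at h; linarith [mul_nonpos_of_nonpos_of_nonneg h (by positivity : 0 ≤ 2 * rpi)]
    have h6 : (n : ℝ) < 1 := by by_contra h; push Not at h; linarith [mul_le_mul_of_nonneg_right h (by positivity : 0 ≤ 2 * rpi)]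
    have : 0 < n := by exact_mod_cast h5
    have : n < 1 := by exact_mod_cast h6
    omega
  set f : ℝ → ℝ → ℝ := fun r ↦ indicator {θ : ℝ | p + r * exp (θ * I) ∈ G} (fun _ ↦ onR)
  have hm : ∀ r : ℝ, MeasurableSet {θ : ℝ | p + r * exp (θ * I) ∈ G} := fun r ↦
    (hG.preimage (by fun_prop : Continuous fun θ : ℝ ↦ p + r * exp (θ * I))).measurableSet
  have hii : ∀ r a b, IntervalIntegrable (f r) volume a b := fun r a b ↦ by
    refine intervalIntegrable_const (c := onR).mono_fun (measurable_const.indicator (hm r)).aestronglyMeasurable (Eventually.of_forall fun θ ↦ ?_)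
    exact norm_indicator_le_norm_self _ _
  have hvol : ∀ r : ℝ, (volume {θ : ℝ | θ ∈ Ico 0 (2 * rpi) ∧ p + (r : ℂ) * exp ((θ : ℂ) * I) ∈ G}).toReal =
      (∫ θ in α..α + β, f r θ) + ∫ θ in α + β..α + 2 * rpi, f r θ := by
    intro r
    have hp : Function.Periodic (f r) (2 * rpi) := fun θ ↦ by
      have : exp ((θ + 2 * rpi : ℝ) * I) = exp (θ * I) := by push_cast; rw [add_mul, exp_periodic]
      refine indicator_eq_indicator ?_ rfl
      show _ ∈ G ↔ _ ∈ G; rw [this]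
    rw [intervalIntegral.integral_add_adjacent_intervals (hii _ _ _) (hii _ _ _), hp.intervalIntegral_add_eq α 0, zero_add,
      intervalIntegral.integral_of_le pvt, ← integral_Ico_eq_integral_Ioc, integral_indicator_const _ (hm r), smul_eq_mul, mul_one,
      Measure.real, Measure.restrict_apply (hm r), inter_comm]
    rfl
  have hang' := hang.congr hvol
  have s1 := sector_lim hG (p := p) (A := α) (B := α + β) lnr hK (sec _ _ lnr (by
    rintro n γ (rfl | rfl) h3 h4
    · exact int n ⟨by linarith, by linarith⟩
    · exact int (-n) ⟨by push_cast; linarith, by push_cast; linarith⟩))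
  have s2 := sector_lim hG (p := p) (A := α + β) (B := α + 2 * rpi) lnr hK (sec _ _ lnr (by
    rintro n γ (rfl | rfl) h3 h4
    · exact int n ⟨by linarith, by linarith⟩
    · exact int n ⟨by linarith, by linarith⟩))
  have l0 := mul_pos hl.1 hπ
  have l2 := mul_pos (sub_pos.2 hl.2) hπ
  rcases s1 with ⟨i1, t1⟩ | ⟨i1, t1⟩ <;> rcases s2 with ⟨i2, t2⟩ | ⟨i2, t2⟩ <;> have := tendsto_nhds_unique hang' (t1.add t2)
  · linarith
  · obtain ⟨μ, hc, h3, h4⟩ := corner_aux (A := α + β) (B := α + 2 * rpi) hK hl lnr i2 (fun ζ h3 h4 ↦ by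
      have := i1 (ζ - (2 * rpi) * I) (by simp; linarith) (by simp; linarith)
      rwa [exp_sub, exp_two_pi_mul_I, div_one] at this)
    refine ⟨μ, K, hc, .inl ⟨?_, by rw [← e2, h4]⟩⟩
    rw [← e1, ← h3]; push_cast; rw [add_mul, exp_periodic]
  · obtain ⟨μ, hc, h3, h4⟩ := corner_aux (A := α) (B := α + β) hK hl lnr i1 i2
    exact ⟨μ, K, hc, .inr ⟨by rw [← e2, h3], by rw [← e1, h4]⟩⟩
  · linarith

lemma germ {h : ℂ → ℂ} {U : Set ℂ} (hU : U ∈ nhds 0) (hh : DifferentiableOn ℂ h U) (hd : deriv h 0 ≠ 0) :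
    ∃ C, 0 < C ∧ ∀ᶠ z in nhds zrC, ∃ w, ‖w‖ ≤ C * ‖z‖ ∧ h z = h 0 + deriv h 0 * z * exp w := by
  set f : ℂ → ℂ := fun z ↦ dslope h 0 z / deriv h 0
  have hf : DifferentiableAt ℂ f 0 := (((differentiableOn_dslope hU).2 hh).differentiableAt hU).div_const _
  have f0 : f 0 = 1 := by simp [f, hd]
  have hl : DifferentiableAt ℂ (fun z ↦ log (f z)) 0 := hf.clog (by simp [f0, slitPlane])
  obtain ⟨C, hC, hb⟩ := hl.isBigO_sub.exists_pos
  refine ⟨C, hC, ?_⟩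
  filter_upwards [hb.bound, hf.continuousAt.eventually_ne (by rw [f0]; exact one_ne_zero)] with z h1 h2
  refine ⟨log (f z), by simpa [f0] using h1, ?_⟩
  rw [exp_log h2]
  have := sub_smul_dslope h 0 z
  simp only [f, sub_zero, smul_eq_mul] at this ⊢
  rw [mul_assoc, ← mul_div_assoc, this]; field_simp; ring

lemma clE {G : Set ℂ} {p μ : ℂ} {l K : ℝ} (hc : Corner G p μ l K) {h : ℂ → ℂ} (h0 : h 0 = p) {d : ℂ} (hd : d ≠ 0) {C : ℝ}
    (hg : ∀ᶠ z in nhds zrC, ∃ w, ‖w‖ ≤ C * ‖z‖ ∧ h z = h 0 + d * z * exp w) {s : ℝ} (hs : s = 1 ∨ s = -1)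
    (ha : d = ‖d‖ * (μ * exp ((s * (l * rpi / 2) : ℝ) * I))) {c : ℝ} (hc0 : 0 < c) :
    (∃ z ∈ Lens c, ∃ ζ : ℂ, |ζ.im| < l * rpi / 2 - K * rex ζ.re ∧ h z = p + μ * exp ζ) ∧ ∃ z ∈ Lens c, h z ∈ G := by
  have hπ := rpp
  have hlπ := mul_pos hc.a0 hπ
  have hlπ' := mul_pos (sub_pos.2 hc.a2) hπ
  have hdp := norm_pos_iff.2 hd
  obtain ⟨φ, hφ, hφc, hφ1, hφ2, hφ3⟩ : ∃ φ, 0 < φ ∧ φ < c / 4 ∧ φ < 1 ∧ φ < l * rpi / 2 ∧ φ < (2 - l) * rpi / 2 := by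
    obtain ⟨φ, h1, h2⟩ := exists_between (show 0 < min (c / 4) (min 1 (min (l * rpi / 2) ((2 - l) * rpi / 2))) by positivity)
    simp only [lt_min_iff] at h2
    exact ⟨φ, h1, h2.1, h2.2.1, h2.2.2.1, h2.2.2.2⟩
  have key : ∀ t : ℝ, t = 1 ∨ t = -1 → ∃ z ∈ Lens c, ∃ ζ : ℂ, h z = p + μ * exp ζ ∧ |ζ.im - (s * (l * rpi / 2) + t * φ)| + K * rex ζ.re < φ := by
    intro t ht
    have c1 : Tendsto (fun x : ℝ ↦ C * x + K * (‖d‖ * x * rex (C * x))) nh0 (nhds (C * 0 + K * (‖d‖ * 0 * rex (C * 0)))) :=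
      Continuous.tendsto bfp 0
    have c2 : Tendsto (fun x : ℝ ↦ (x : ℂ) * exp ((t * φ : ℝ) * I)) nh0 (nhds ((zrR : ℂ) * exp ((t * φ : ℝ) * I))) :=
      Continuous.tendsto bfp 0
    rw [ofReal_zero, zero_mul] at c2
    have := ((c1.eventually_lt_const (u := φ) (by simpa using hφ)).and ((c2.eventually hg).and (eventually_lt_nhds (show zrR < 1 / 2 by norm_num)))).filter_mono (nhdsWithin_le_nhds (s := Ioi 0))
    obtain ⟨x, ⟨hx1, ⟨w, hw, he⟩, hx2⟩, hx0⟩ := (this.and self_mem_nhdsWithin).exists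
    have hx0 : 0 < x := hx0
    rw [norm_mul, norm_exp_ofReal_mul_I, mul_one, norm_real, rnn hx0.le] at hw
    have ab : |t * φ| = φ := by rcases ht with rfl | rfl <;> simp [abs_of_pos hφ]
    refine ⟨x * exp ((t * φ : ℝ) * I), ?_, rlg (‖d‖ * x) + (s * (l * rpi / 2) + t * φ : ℝ) * I + w, ?_, ?_⟩
    · show |(_ : ℝ)| < _
      rw [re_ofReal_mul, im_ofReal_mul, exp_ofReal_mul_I_re, exp_ofReal_mul_I_im, abs_mul, abs_of_pos hx0]
      have h1 : |Real.sin (t * φ)| ≤ φ := (Real.abs_sin_le_abs).trans_eq ab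
      have h2 : 1 / 2 ≤ rcs (t * φ) := by
        have := Real.one_sub_sq_div_two_le_cos (x := t * φ)
        rw [← sq_abs, ab] at this; nlinarith
      have h3 : x * (1 / 2) ≤ x * rcs (t * φ) := by gcongr
      have h4 : x * rcs (t * φ) ≤ x := mul_le_of_le_one_right hx0.le (Real.cos_le_one _)
      have h5 : x * (1 / 2) * (1 / 2) ≤ bb (x * rcs (t * φ)) := mul_le_mul h3 lnr nnm lnr
      have h6 : x * |Real.sin (t * φ)| ≤ x * φ := by gcongr
      have h7 : x * φ < x * (c / 4) := by gcongr
      linarith [mul_le_mul_of_nonneg_left h5 hc0.le]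
    · rw [he, h0, exp_add, exp_add, ← ofReal_exp, rel pvt]
      conv_lhs => rw [ha]
      push_cast; rw [add_mul, exp_add]; ring
    · have h1 := (abs_im_le_norm w).trans hw
      have h2 := (re_le_norm w).trans hw
      have h3 : rex (rlg (‖d‖ * x) + w.re) ≤ ‖d‖ * x * rex (C * x) := by
        rw [rea, rel pvt]; gcongr
      simp only [add_im, add_re, ofReal_im, ofReal_re, re_ofReal_mul, im_ofReal_mul, I_re, I_im]
      rw [show 0 + (s * (l * rpi / 2) + t * φ) * 1 + w.im - (s * (l * rpi / 2) + t * φ) = w.im by ring, mul_zero, add_zero]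
      linarith [mul_le_mul_of_nonneg_left h3 hc.C0.le]
  constructor
  · obtain ⟨z, hz, ζ, h1, h2⟩ := key (-s) (by rcases hs with rfl | rfl <;> simp)
    refine ⟨z, hz, ζ, ?_, h1⟩
    have h3 := abs_le.1 (le_refl |ζ.im - (s * (l * rpi / 2) + -s * φ)|)
    rw [abs_lt]
    rcases hs with rfl | rfl <;> constructor <;> linarith [h3.1, h3.2]
  · obtain ⟨z, hz, ζ, h1, h2⟩ := key s hs
    refine ⟨z, hz, ?_⟩
    have := hc.inn (ζ - (s * rpi : ℝ) * I) (by
      have h3 := abs_le.1 (le_refl |ζ.im - (s * (l * rpi / 2) + s * φ)|)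
      rw [abs_lt]
      have h4 : rex (ζ - (s * rpi : ℝ) * I).re = rex ζ.re := by simp
      have h5 : (ζ - (s * rpi : ℝ) * I).im = ζ.im - s * rpi := by simp
      rw [h4, h5]
      rcases hs with rfl | rfl <;> constructor <;> linarith [h3.1, h3.2])
    have h6 : exp ((s * rpi : ℝ) * I) = -1 := by rcases hs with rfl | rfl <;> simp [exp_neg, exp_pi_mul_I]
    rw [exp_sub, h6, div_neg, div_one, mul_neg, sub_neg_eq_add, ← h1] at this
    exact this

structure Pre (G : Set ℂ) (lam : ℝ) where
  N : ℕ
  σ : Fin N → Bool → ℂ → ℂ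
  rev : ∀ k b z, σ k b (1 - z) = σ k (!b) z
  r0 : ℝ
  m : ℝ
  M : ℝ
  r0_pos : 0 < r0
  m_pos : 0 < m
  m_le : m ≤ M
  diff : ∀ k b, DifferentiableOn ℂ (σ k b) (Rc r0)
  colip : ∀ k b, ∀ z ∈ Rc r0, ∀ w ∈ Rc r0, m * ‖z - w‖ ≤ ‖σ k b z - σ k b w‖
  lip : ∀ k b, ∀ z ∈ Rc r0, ∀ w ∈ Rc r0, ‖σ k b z - σ k b w‖ ≤ M * ‖z - w‖
  memL : ∀ k b, ∀ x ∈ I01, σ k b x ∈ frontier G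
  cover : ∀ z ∈ frontier G, ∃ k, ∃ x ∈ I01, σ k true x = z
  disj : ∀ j k b b', j ≠ k → ∀ x ∈ O01, ∀ y ∈ I01, σ j b x ≠ σ k b' y
  inj0 : ∀ j k b, σ j b 0 = σ k b 0 → j = k
  ang : ∀ k b, ∃ l ∈ Ioo zrR 2, lam ≤ l ∧ HasCornerAngle G (σ k b 0) ((2 - l) * rpi)

namespace Pre
variable {G : Set ℂ} {lam : ℝ} (P : Pre G lam)

lemma mR {x : ℝ} (hx : x ∈ I01) : (x : ℂ) ∈ Rc P.r0 := by
  have := P.r0_pos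
  refine ⟨?_, ?_, ?_⟩ <;> simp <;> linarith [hx.1, hx.2]

lemma mR0 : zrC ∈ Rc P.r0 := by simpa using P.mR (x := 0) bsp

lemma dA (k b) {z : ℂ} (hz : z ∈ Rc P.r0) : DifferentiableAt ℂ (P.σ k b) z := (P.diff k b).differentiableAt (isOpen_Rc.mem_nhds hz)

lemma dne (k b) {z : ℂ} (hz : z ∈ Rc P.r0) : deriv (P.σ k b) z ≠ 0 := by
  refine deriv_ne_zero_of_injOn isOpen_Rc (P.diff k b) (fun z hz w hw h ↦ ?_) hz
  have := P.colip k b z hz w hw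
  rw [h, sub_self, norm_zero] at this
  have h1 : ‖z - w‖ ≤ 0 := by by_contra h; push Not at h; linarith [mul_pos P.m_pos h]
  exact sub_eq_zero.1 (norm_le_zero_iff.1 h1)

lemma rev' (k b) (x : ℝ) : P.σ k b ((1 - x : ℝ) : ℂ) = P.σ k (!b) x := by rw [← P.rev]; push_cast; rfl

lemma ends {k b j b'} {x : ℝ} (hx : x ∈ I01) (h : P.σ k b x = P.σ j b' 0) : x = 0 ∨ x = 1 := by
  by_contra hc
  push Not at hc
  have hx' : x ∈ O01 := ⟨hx.1.lt_of_ne' hc.1, hx.2.lt_of_ne hc.2⟩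
  by_cases hk : k = j
  · subst hk
    have inj : ∀ y ∈ I01, P.σ k b x = P.σ k b y → x = y := fun y hy h ↦ by
      have := P.colip k b x (P.mR hx) y (P.mR hy)
      rw [h, sub_self, norm_zero, ← ofReal_sub, norm_real] at this
      have h1 : ‖x - y‖ ≤ 0 := by by_contra h; push Not at h; linarith [mul_pos P.m_pos h]
      exact sub_eq_zero.1 (norm_le_zero_iff.1 h1)
    by_cases hb : b' = b
    · subst hb; exact hc.1 (inj 0 bsp (by simpa using h))
    · have hb : b' = !b := by cases b <;> cases b' <;> simp_all
      rw [hb, ← P.rev, sub_zero] at h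
      exact hc.2 (inj 1 bsp (by simpa using h))
  · exact P.disj k j b b' hk x hx' 0 bsp (by simpa using h)

lemma arc_near (k j b') : ∀ᶠ z in nhds (P.σ j b' 0), ∀ x ∈ I01, P.σ k true x = z →
    ∃ b, P.σ k b 0 = P.σ j b' 0 ∧ ∃ y ∈ I01, P.σ k b y = z := by
  by_cases h : ∃ b, P.σ k b 0 = P.σ j b' 0
  · obtain ⟨b, hb⟩ := h
    refine Eventually.of_forall fun z x hx hz ↦ ⟨b, hb, ?_⟩
    cases b
    · exact ⟨1 - x, ⟨by linarith [hx.2], by linarith [hx.1]⟩, by rw [P.rev']; exact hz⟩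
    · exact ⟨x, hx, hz⟩
  · have hcl : IsClosed ((fun x : ℝ ↦ P.σ k true x) '' I01) :=
      (isCompact_Icc.image_of_continuousOn fun x hx ↦ ((P.dA k true (P.mR hx)).continuousAt.comp continuous_ofReal.continuousAt).continuousWithinAt).isClosed
    have hn : P.σ j b' 0 ∉ (fun x : ℝ ↦ P.σ k true x) '' I01 := by
      rintro ⟨x, hx, hx'⟩
      rcases P.ends hx hx' with rfl | rfl
      · exact h ⟨true, by simpa using hx'⟩
      · exact h ⟨false, by rw [← hx']; simpa using (P.rev k true 0).symm⟩
    filter_upwards [hcl.isOpen_compl.mem_nhds hn] with z hz x hx hz'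
    exact absurd ⟨x, hx, hz'⟩ hz

noncomputable def d (k : Fin P.N) (b : Bool) : ℂ := deriv (P.σ k b) 0
noncomputable def dr (k : Fin P.N) (b : Bool) : ℂ := (‖P.d k b‖ : ℂ)⁻¹ * P.d k b

lemma d_pos (k b) : 0 < ‖P.d k b‖ := norm_pos_iff.2 (P.dne k b P.mR0)

lemma d_eq (k b) : P.d k b = ‖P.d k b‖ * P.dr k b := by
  rw [dr, mul_inv_cancel_left₀]; exact_mod_cast (P.d_pos k b).ne'

lemma dr_norm (k b) : ‖P.dr k b‖ = 1 := by
  rw [dr, norm_mul, norm_inv, norm_real, norm_norm, inv_mul_cancel₀ (P.d_pos k b).ne']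

lemma end_near (k b) : ∃ C, 0 < C ∧ ∀ᶠ z in nhds (P.σ k b 0), ∀ x ∈ I01, P.σ k b x = z → z ≠ P.σ k b 0 →
    ∃ ζ : ℂ, |ζ.im| ≤ C * rex ζ.re ∧ z = P.σ k b 0 + P.dr k b * exp ζ := by
  obtain ⟨C, hC, hg⟩ := germ (isOpen_Rc.mem_nhds P.mR0) (P.diff k b) (P.dne k b P.mR0)
  change ∀ᶠ z in nhds zrC, ∃ w, ‖w‖ ≤ C * ‖z‖ ∧ P.σ k b z = P.σ k b 0 + P.d k b * z * exp w at hg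
  obtain ⟨δ, hδ, hg⟩ := Metric.eventually_nhds_iff.1 hg
  have hd := P.d_pos k b
  have hm := P.m_pos
  refine ⟨C * rex 1 / ‖P.d k b‖, by positivity, ?_⟩
  filter_upwards [ball_mem_nhds _ (show 0 < P.m * min δ (1 / C) by positivity)] with z hz x hx hxz hne
  subst hxz
  rw [mem_ball, dist_eq_norm] at hz
  have h1 := lt_of_mul_lt_mul_left ((P.colip k b x (P.mR hx) 0 P.mR0).trans_lt hz) hm.le
  have hx0 : 0 < x := hx.1.lt_of_ne (by rintro rfl; simp at hne)
  rw [sub_zero, norm_real, rnn hx0.le, lt_min_iff, lt_div_iff₀ hC] at h1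
  obtain ⟨w, hw, he⟩ := hg (y := x) (by rw [dist_eq_norm, sub_zero, norm_real, rnn hx0.le]; exact h1.1)
  rw [norm_real, rnn hx0.le] at hw
  refine ⟨rlg (‖P.d k b‖ * x) + w, ?_, ?_⟩
  · rw [add_im, add_re, ofReal_im, ofReal_re, zero_add, rea, rel pvt]
    have h2 := (abs_im_le_norm w).trans hw
    have h3 := (abs_le.1 ((abs_re_le_norm w).trans hw)).1
    have h4 : C * x * 1 ≤ C * x * rex (1 + w.re) := by gcongr; exact Real.one_le_exp lnr
    calc |w.im| ≤ C * x * rex (1 + w.re) := by linarith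
      _ = _ := by rw [rea]; field_simp
  · rw [exp_add, ← ofReal_exp, rel pvt, he]
    conv_lhs => rw [d_eq]
    push_cast; ring

lemma corner (hG : IsOpen G) (i b0) : ∃ μ l K, Corner G (P.σ i b0 0) μ l K ∧ lam ≤ l ∧
    (∀ k b, P.σ k b 0 = P.σ i b0 0 → ∃ s : ℝ, (s = 1 ∨ s = -1) ∧ P.dr k b = μ * exp ((s * (l * rpi / 2) : ℝ) * I)) ∧
    ∀ k b k' b', P.σ k b 0 = P.σ i b0 0 → P.σ k' b' 0 = P.σ i b0 0 → P.dr k b = P.dr k' b' → k = k' ∧ b = b' := by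
  obtain ⟨l, hl, hlam, hang⟩ := P.ang i b0
  obtain ⟨k2, b2, he2, hall⟩ : ∃ k2 b2, P.σ k2 b2 0 = P.σ i b0 0 ∧ ∀ k b, P.σ k b 0 = P.σ i b0 0 → (k = i ∧ b = b0) ∨ (k = k2 ∧ b = b2) := by
    by_cases h : ∃ k, P.σ k (!b0) 0 = P.σ i b0 0
    · obtain ⟨k2, h2⟩ := h
      refine ⟨k2, !b0, h2, fun k b hk ↦ ?_⟩
      rcases Bool.eq_or_eq_not b b0 with rfl | rfl
      · exact .inl ⟨P.inj0 _ _ _ hk, rfl⟩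
      · exact .inr ⟨P.inj0 _ _ _ (hk.trans h2.symm), rfl⟩
    · refine ⟨i, b0, rfl, fun k b hk ↦ ?_⟩
      rcases Bool.eq_or_eq_not b b0 with rfl | rfl
      · exact .inl ⟨P.inj0 _ _ _ hk, rfl⟩
      · exact absurd ⟨k, hk⟩ h
  obtain ⟨C1, h1, n1⟩ := P.end_near i b0
  obtain ⟨C2, h2, n2⟩ := P.end_near k2 b2
  rw [he2] at n2
  obtain ⟨ρ, hρ, hn⟩ := Metric.eventually_nhds_iff.1 ((n1.and n2).and (eventually_all.2 fun k ↦ P.arc_near k i b0))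
  obtain ⟨μ, K, hc, hdir⟩ := corner_of hG (C := max C1 C2) hρ (P.dr_norm i b0) (P.dr_norm k2 b2) hl hang (by
    intro z hz hne hzp
    obtain ⟨⟨m1, m2⟩, m3⟩ := hn (y := z) (by rwa [dist_eq_norm])
    obtain ⟨k, x, hx, rfl⟩ := P.cover z hz
    obtain ⟨b, hb, y, hy, hyz⟩ := m3 k x hx rfl
    rcases hall k b hb with ⟨rfl, rfl⟩ | ⟨rfl, rfl⟩
    · obtain ⟨ζ, h3, h4⟩ := m1 y hy hyz hne
      exact ⟨ζ, h3.trans (by gcongr; exact le_max_left _ _), .inl h4⟩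
    · obtain ⟨ζ, h3, h4⟩ := m2 y hy hyz hne
      exact ⟨ζ, h3.trans (by gcongr; exact le_max_right _ _), .inr h4⟩)
  have hne : P.dr i b0 ≠ P.dr k2 b2 := by
    intro h
    have hμ : μ ≠ 0 := by rintro rfl; simpa using hc.hμ
    have : μ * exp ((l * rpi / 2 : ℝ) * I) = μ * exp (-(l * rpi / 2 : ℝ) * I) := by
      rcases hdir with ⟨a, b⟩ | ⟨a, b⟩
      · rw [← a, ← b, h]
      · rw [← a, ← b, h]
    obtain ⟨n, hn⟩ := exp_eq_exp_iff_exists_int.1 (mul_left_cancel₀ hμ this)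
    have h4 := congrArg im hn
    simp at h4
    have h5 : l * rpi = (2 * n) * rpi := by linarith
    have h6 : l = (2 * n : ℤ) := by push_cast; exact mul_right_cancel₀ Real.pi_pos.ne' h5
    have h7 := hl.1; have h8 := hl.2
    rw [h6] at h7 h8
    have : 0 < 2 * n := by exact_mod_cast h7
    have : 2 * n < 2 := by exact_mod_cast h8
    omega
  refine ⟨μ, l, K, hc, hlam, fun k b hk ↦ ?_, fun k b k' b' hk hk' hd ↦ ?_⟩
  · have e1 : ((1 * (l * rpi / 2) : ℝ) : ℂ) = (l * rpi / 2 : ℝ) := by rw [one_mul]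
    have e2 : ((-1 * (l * rpi / 2) : ℝ) : ℂ) = -(l * rpi / 2 : ℝ) := by push_cast; ring
    rcases hall k b hk with ⟨rfl, rfl⟩ | ⟨rfl, rfl⟩ <;> rcases hdir with ⟨a, b⟩ | ⟨a, b⟩
    · exact ⟨1, .inl rfl, by rw [e1]; exact a⟩
    · exact ⟨-1, .inr rfl, by rw [e2]; exact b⟩
    · exact ⟨-1, .inr rfl, by rw [e2]; exact b⟩
    · exact ⟨1, .inl rfl, by rw [e1]; exact a⟩
  · rcases hall k b hk with ⟨rfl, rfl⟩ | ⟨rfl, rfl⟩ <;> rcases hall k' b' hk' with ⟨rfl, rfl⟩ | ⟨rfl, rfl⟩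
    · exact ⟨rfl, rfl⟩
    · exact absurd hd hne
    · exact absurd hd.symm hne
    · exact ⟨rfl, rfl⟩

end Pre

lemma cpt_lower {X : Type*} [TopologicalSpace X] {K : Set X} (hK : IsCompact K) {f g : X → ℝ} (hf : ∀ x ∈ K, 0 ≤ f x)
    (h : ∀ x ∈ K, ∃ m, 0 < m ∧ ∀ᶠ y in nhdsWithin x K, m * f y ≤ g y) : ∃ m, 0 < m ∧ ∀ y ∈ K, m * f y ≤ g y := by
  obtain ⟨m, hm, H⟩ := hK.induction_on (p := fun S ↦ ∃ m, 0 < m ∧ ∀ y ∈ S, y ∈ K → m * f y ≤ g y) ⟨1, one_pos, by simp⟩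
    (fun s t hst ⟨m, hm, H⟩ ↦ ⟨m, hm, fun y hy ↦ H y (hst hy)⟩)
    (fun s t ⟨m, hm, H⟩ ⟨m', hm', H'⟩ ↦ ⟨min m m', lt_min hm hm', fun y hy hyK ↦ hy.elim
      (fun hy ↦ (mul_le_mul_of_nonneg_right mnl (hf y hyK)).trans (H y hy hyK))
      (fun hy ↦ (mul_le_mul_of_nonneg_right mnr (hf y hyK)).trans (H' y hy hyK))⟩)
    (fun x hx ↦ by
      obtain ⟨m, hm, H⟩ := h x hx
      exact ⟨_, inter_mem H self_mem_nhdsWithin, m, hm, fun y hy _ ↦ hy.1⟩)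
  exact ⟨m, hm, fun y hy ↦ H y hy hy⟩

lemma ev_pos {X : Type*} {K : Set X} {f g : X → ℝ} (hf : ∀ x ∈ K, 0 ≤ f x) (h : ∃ m, 0 < m ∧ ∀ y ∈ K, m * f y ≤ g y) :
    ∀ᶠ m in nhdsWithin zrR (Ioi 0), ∀ y ∈ K, m * f y ≤ g y := by
  obtain ⟨m, hm, H⟩ := h
  filter_upwards [Ioc_mem_nhdsGT hm] with t ht y hy
  exact (mul_le_mul_of_nonneg_right ht.2 (hf y hy)).trans (H y hy)

lemma bb_nonneg {x : ℝ} (hx : x ∈ I01) : 0 ≤ bb x := mul_nonneg hx.1 (by linarith [hx.2])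

lemma Lens_rev {c : ℝ} {z : ℂ} (hz : z ∈ Lens c) : 1 - z ∈ Lens c := by
  have hz : |z.im| < c * bb z.re := hz
  show |(_ : ℝ)| < _
  simp only [sub_im, one_im, sub_re, one_re, bb, zero_sub, abs_neg] at hz ⊢
  linarith

namespace Pre
variable {G : Set ℂ} {lam : ℝ} (P : Pre G lam)

lemma contR (k b) : ContinuousOn (fun x : ℝ ↦ P.σ k b x) (Icc 0 1) := fun _ hx ↦
  ((P.dA k b (P.mR hx)).continuousAt.comp continuous_ofReal.continuousAt).continuousWithinAt

lemma end_of (k b) {x0 : ℝ} (h0 : x0 = 0 ∨ x0 = 1) : ∃ b', P.σ k b' 0 = P.σ k b x0 ∧ ∀ ε > 0, ∀ᶠ x in nhdsWithin x0 (I01),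
    ∃ u : ℝ, 0 ≤ u ∧ bb x ≤ u ∧ ‖P.σ k b x - P.σ k b' 0 - P.d k b' * u‖ ≤ ε * u := by
  have D : ∀ b', ∀ ε > 0, ∀ᶠ u : ℝ in nhds 0, ‖P.σ k b' u - P.σ k b' 0 - P.d k b' * u‖ ≤ ε * ‖u‖ := fun b' ε hε ↦ by
    have h1 := (hasDerivAt_iff_isLittleO.1 (P.dA k b' P.mR0).hasDerivAt).def hε
    have h2 : Tendsto (fun u : ℝ ↦ (u : ℂ)) nh0 nh0 := by simpa using continuous_ofReal.tendsto 0
    filter_upwards [h2.eventually h1] with u hu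
    simpa [d, mul_comm] using hu
  rcases h0 with rfl | rfl
  · refine ⟨b, by simp, fun ε hε ↦ ?_⟩
    filter_upwards [nhdsWithin_le_nhds (D b ε hε), self_mem_nhdsWithin] with x hx hx2
    rw [rnn hx2.1] at hx
    exact ⟨x, hx2.1, mul_le_of_le_one_right hx2.1 (by linarith [hx2.1]), hx⟩
  · refine ⟨!b, by rw [← P.rev]; simp, fun ε hε ↦ ?_⟩
    have h2 : Tendsto (fun x : ℝ ↦ 1 - x) (nhds 1) nh0 := by simpa using (by fun_prop : Continuous fun x : ℝ ↦ 1 - x).tendsto 1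
    filter_upwards [nhdsWithin_le_nhds (h2.eventually (D (!b) ε hε)), self_mem_nhdsWithin] with x hx hx2
    have hx3 : 0 ≤ 1 - x := by linarith [hx2.2]
    rw [rnn hx3, P.rev', Bool.not_not] at hx
    exact ⟨1 - x, hx3, mul_le_of_le_one_left hx3 hx2.2, hx⟩

lemma sep (hG : IsOpen G) : ∀ᶠ m in nhdsWithin zrR (Ioi 0), ∀ j k b b', j ≠ k → ∀ q ∈ I01 ×ˢ I01,
    m * bb q.1 ≤ ‖P.σ j b q.1 - P.σ k b' q.2‖ := by
  simp only [eventually_all]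
  intro j k b b' hjk
  have hnn : ∀ q ∈ I01 ×ˢ I01, 0 ≤ bb q.1 := fun q hq ↦ bb_nonneg hq.1
  refine ev_pos hnn (cpt_lower (isCompact_Icc.prod isCompact_Icc) hnn ?_)
  rintro ⟨x0, y0⟩ ⟨hx0, hy0⟩
  dsimp only at hx0 hy0
  rw [nhdsWithin_prod_eq]
  by_cases he : P.σ j b x0 = P.σ k b' y0
  · have hx : x0 = 0 ∨ x0 = 1 := by
      by_contra hc; push Not at hc
      exact P.disj j k b b' hjk x0 ⟨hx0.1.lt_of_ne' hc.1, hx0.2.lt_of_ne hc.2⟩ y0 hy0 he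
    have hy : y0 = 0 ∨ y0 = 1 := by
      by_contra hc; push Not at hc
      exact P.disj k j b' b hjk.symm y0 ⟨hy0.1.lt_of_ne' hc.1, hy0.2.lt_of_ne hc.2⟩ x0 hx0 he.symm
    obtain ⟨b1, e1, n1⟩ := P.end_of j b hx
    obtain ⟨b2, e2, n2⟩ := P.end_of k b' hy
    have e12 : P.σ k b2 0 = P.σ j b1 0 := by rw [e1, e2, he]
    obtain ⟨-, -, -, -, -, -, hd⟩ := P.corner hG j b1
    have hκ : 0 < ‖P.dr j b1 - P.dr k b2‖ := norm_pos_iff.2 (sub_ne_zero.2 fun h ↦ hjk (hd _ _ _ _ rfl e12 h).1)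
    set κ := ‖P.dr j b1 - P.dr k b2‖
    have d1 := P.d_pos j b1
    have d2 := P.d_pos k b2
    refine ⟨κ * ‖P.d j b1‖ / 8, by positivity, ?_⟩
    filter_upwards [(n1 (κ * ‖P.d j b1‖ / 8) pvt).prod_mk (n2 (κ * ‖P.d k b2‖ / 8) pvt)]
    rintro ⟨x, y⟩ ⟨⟨u, hu, hxu, h1⟩, v, hv, -, h2⟩
    dsimp only at *
    rw [e12] at h2
    set s := ‖P.d j b1‖ * u
    set t := ‖P.d k b2‖ * v
    have hs : 0 ≤ s := by positivity
    have ht : 0 ≤ t := by positivity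
    set a := P.dr j b1
    set a' := P.dr k b2
    have es : P.d j b1 * u = s * a := by rw [d_eq]; push_cast [s]; ring
    have et : P.d k b2 * v = t * a' := by rw [d_eq]; push_cast [t]; ring
    rw [es] at h1; rw [et] at h2
    have n3 : ‖(s : ℂ) * a‖ = s := by rw [norm_mul, dr_norm, norm_real, rnn hs, mul_one]
    have n4 : ‖(t : ℂ) * a'‖ = t := by rw [norm_mul, dr_norm, norm_real, rnn ht, mul_one]
    have n5 := abs_norm_sub_norm_le ((s : ℂ) * a) (t * a')
    rw [n3, n4] at n5
    have n6 : s * κ ≤ ‖(s : ℂ) * a - t * a'‖ + |s - t| := by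
      have : (s : ℂ) * (a - a') = (s * a - t * a') - ((s - t : ℝ) : ℂ) * a' := by push_cast; ring
      have h := congrArg norm this
      rw [norm_mul, norm_real, rnn hs] at h
      rw [h]
      refine (norm_sub_le _ _).trans (by rw [norm_mul, norm_real, P.dr_norm, mul_one]; rfl)
    have n7 : t * κ ≤ ‖(s : ℂ) * a - t * a'‖ + |s - t| := by
      have : (t : ℂ) * (a - a') = (s * a - t * a') - ((s - t : ℝ) : ℂ) * a := by push_cast; ring
      have h := congrArg norm this
      rw [norm_mul, norm_real, rnn ht] at h
      rw [h]
      refine (norm_sub_le _ _).trans (by rw [norm_mul, norm_real, P.dr_norm, mul_one]; rfl)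
    have n8 : ‖(s : ℂ) * a - t * a'‖ ≤ ‖P.σ j b x - P.σ k b' y‖ + (κ * ‖P.d j b1‖ / 8 * u + κ * ‖P.d k b2‖ / 8 * v) := by
      have : (s : ℂ) * a - t * a' = (P.σ j b x - P.σ k b' y) + ((P.σ k b' y - P.σ j b1 0 - t * a') - (P.σ j b x - P.σ j b1 0 - s * a)) := by ring
      rw [this]
      refine (norm_add_le _ _).trans (by gcongr; exact (norm_sub_le _ _).trans lnr)
    have n9 : κ * ‖P.d j b1‖ / 8 * bb x ≤ κ * ‖P.d j b1‖ / 8 * u := by gcongr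
    have n10 : κ * ‖P.d j b1‖ / 8 * u = s * κ / 8 := by ring
    have n11 : κ * ‖P.d k b2‖ / 8 * v = t * κ / 8 := by ring
    rw [n10, n11] at n8
    rw [n10] at n9
    linarith [mul_nonneg ht hκ.le]
  · have hp := norm_pos_iff.2 (sub_ne_zero.2 he)
    refine ⟨‖P.σ j b x0 - P.σ k b' y0‖ / 2, by positivity, ?_⟩
    have c1 := (((P.contR j b x0 hx0).tendsto.comp tendsto_fst).sub ((P.contR k b' y0 hy0).tendsto.comp tendsto_snd)).norm
    filter_upwards [c1.eventually_const_lt (half_lt_self hp)] with q hq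
    refine le_trans ?_ hq.le
    exact mul_le_of_le_one_right pvt ((bb_le _).trans nnm)

end Pre

lemma Geo.ext_conn {G : Set ℂ} (Γ : Geo G) (hG : IsOpen G) (hne : G.Nonempty) (hL : IsPreconnected (frontier G))
    (hO : ∀ p, ∃ O, IsPreconnected O ∧ O ⊆ (closure G)ᶜ ∧ ∀ k, (Γ.σ k 0 = p ∨ Γ.σ k 1 = p) → ∃ z ∈ Lens Γ.c0, Γ.σ k z ∈ O) :
    IsPreconnected (closure G)ᶜ := by
  rw [isPreconnected_iff_subset_of_disjoint]
  intro u v hu hv huv hdis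
  have dis : ∀ z, z ∉ closure G → z ∈ u → z ∈ v → False := fun z a b c ↦ notMem_empty z (hdis ▸ ⟨a, b, c⟩)
  set ℓ : Fin Γ.N → Set ℂ := fun k ↦ Γ.σ k '' (Lens Γ.c0 ∩ {z | z.im < 0})
  have hℓΩ : ∀ k, ℓ k ⊆ (closure G)ᶜ := by rintro k _ ⟨z, hz, rfl⟩; exact Γ.down k z hz.1 hz.2
  have hℓ : ∀ k, IsPreconnected (ℓ k) := fun k ↦ ((convex_Lens Γ.c0_pos).inter (convex_halfSpace_im_lt 0)).isPreconnected.image _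
    fun z hz ↦ (Γ.diffAt k (Γ.Lens_Rc hz.1)).continuousAt.continuousWithinAt
  have hin : ∀ k, ∀ z ∈ Lens Γ.c0, Γ.σ k z ∉ closure G → Γ.σ k z ∈ ℓ k := fun k z hz h ↦ by
    refine ⟨z, ⟨hz, ?_⟩, rfl⟩
    by_contra hi
    have hi : 0 ≤ z.im := not_lt.1 hi
    rcases hi.eq_or_lt with hi | hi
    · have h1 : z = z.re := by apply cxe <;> simp [hi]
      rw [h1] at h
      exact h (frontier_subset_closure (Γ.memL k _ (Ioo_subset_Icc_self (of_bb_pos (Lens_bb Γ.c0_pos hz)))))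
    · exact h (subset_closure (Γ.up k z hz hi))
  have hne' : ∀ k, (ℓ k).Nonempty := fun k ↦ by
    obtain ⟨O, -, hO, h⟩ := hO (Γ.σ k 0)
    obtain ⟨z, hz, hz'⟩ := h k (.inl rfl)
    exact ⟨_, hin k z hz (hO hz')⟩
  have split : ∀ t, IsPreconnected t → t ⊆ (closure G)ᶜ → t ⊆ u ∨ t ⊆ v := fun t ht hs ↦
    (isPreconnected_iff_subset_of_disjoint.1 ht) u v hu hv (hs.trans huv) (subset_empty_iff.1 fun z hz ↦ dis z (hs hz.1) hz.2.1 hz.2.2)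
  have main : ∀ u v : Set ℂ, IsOpen u → IsOpen v → (closure G)ᶜ ⊆ u ∪ v → (∀ z, z ∉ closure G → z ∈ u → z ∈ v → False) → (∀ k, ℓ k ⊆ v) → (closure G)ᶜ ⊆ v := by
    intro u v hu hv huv dis hk
    by_contra hnv
    obtain ⟨q, hq, hqv⟩ := not_subset.1 hnv
    set U := (closure G)ᶜ ∩ u
    have hUo : IsOpen U := isClosed_closure.isOpen_compl.inter hu
    have key : ∀ z ∈ (J Γ)ᶜ, z ∉ frontier U := by
      intro z hz hf
      rw [hUo.frontier_eq] at hf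
      have nb : ∀ s ∈ nhds z, ∃ w ∈ s, w ∈ U := fun s hs ↦ (mem_closure_iff_nhds.1 hf.1 s hs)
      by_cases hzc : z ∈ closure G
      · by_cases hzG : z ∈ G
        · obtain ⟨w, hw, hwU⟩ := nb G (hG.mem_nhds hzG)
          exact hwU.1 (subset_closure hw)
        · obtain ⟨k, x, hx, rfl⟩ := Γ.cover z (by rw [hG.frontier_eq]; exact ⟨hzc, hzG⟩)
          have hx' : x ∈ O01 := by
            refine ⟨hx.1.lt_of_ne ?_, hx.2.lt_of_ne ?_⟩ <;> rintro rfl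
            · exact hz (by simpa using Γ.mem_J0 k)
            · exact hz (by simpa using Γ.mem_J1 k)
          have hd : deriv (Γ.σ k) x ≠ 0 := fun h ↦ by
            have := (Γ.deriv_bounds k (Γ.ofReal_mem_Rc hx)).1
            rw [h, norm_zero] at this; linarith [Γ.m_pos]
          have hs := ((Γ.diff k).analyticAt (isOpen_Rc.mem_nhds (Γ.ofReal_mem_Rc hx))).hasStrictDerivAt.map_nhds_eq hd
          obtain ⟨w, ⟨y, hy, rfl⟩, hwU⟩ := nb (Γ.σ k '' Lens Γ.c0) (by rw [← hs]; exact image_mem_map (isOpen_Lens.mem_nhds (Lens_ofReal Γ.c0_pos hx')))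
          exact dis _ hwU.1 hwU.2 (hk k (hin k y hy hwU.1))
      · rcases huv hzc with h | h
        · exact hf.2 ⟨hzc, h⟩
        · obtain ⟨w, hw, hwU⟩ := nb v (hv.mem_nhds h)
          exact dis w hwU.1 hwU.2 hw
    have hcon : IsPreconnected (J Γ)ᶜ := (Γ.J_finite.countable.isConnected_compl_of_one_lt_rank bsp).isPreconnected
    have hden := Γ.J_finite.countable.dense_compl ℝ
    have hq' : q ∈ U := ⟨hq, (huv hq).resolve_right hqv⟩
    have hsub := sub_of_frontier hcon (by rw [inter_comm]; exact hden.inter_open_nonempty U hUo ⟨q, hq'⟩) key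
    obtain ⟨w, hw, hwJ⟩ := hden.inter_open_nonempty G hG hne
    exact (hsub hwJ).1 (subset_closure hw)
  by_contra hcon
  push Not at hcon
  obtain ⟨a, ha⟩ := not_forall.1 fun h ↦ hcon.2 (main u v hu hv huv dis h)
  obtain ⟨b, hb⟩ := not_forall.1 fun h ↦ hcon.1 (main v u hv hu (by rwa [union_comm]) (fun z h1 h2 h3 ↦ dis z h1 h3 h2) h)
  have ha := (split _ (hℓ a) (hℓΩ a)).resolve_right ha
  have hb := (split _ (hℓ b) (hℓΩ b)).resolve_left hb
  have hcl : ∀ w : Set ℂ, IsClosed (⋃ k, ⋃ (_ : ℓ k ⊆ w), (fun x : ℝ ↦ Γ.σ k x) '' I01) := fun w ↦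
    isClosed_iUnion_of_finite fun k ↦ isClosed_iUnion_of_finite fun _ ↦ (isCompact_Icc.image_of_continuousOn fun x hx ↦
      ((Γ.diffAt k (Γ.ofReal_mem_Rc hx)).continuousAt.comp continuous_ofReal.continuousAt).continuousWithinAt).isClosed
  have m0 : zrR ∈ I01 := by simp
  obtain ⟨p, -, hpu, hpv⟩ := isPreconnected_closed_iff.1 hL _ _ (hcl u) (hcl v) (fun z hz ↦ by
      obtain ⟨k, x, hx, rfl⟩ := Γ.cover z hz
      rcases split _ (hℓ k) (hℓΩ k) with h | h
      · exact .inl (mem_iUnion₂.2 ⟨k, h, x, hx, rfl⟩)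
      · exact .inr (mem_iUnion₂.2 ⟨k, h, x, hx, rfl⟩))
    ⟨_, Γ.memL a 0 m0, mem_iUnion₂.2 ⟨a, ha, 0, m0, rfl⟩⟩ ⟨_, Γ.memL b 0 m0, mem_iUnion₂.2 ⟨b, hb, 0, m0, rfl⟩⟩
  obtain ⟨j, hj, x, hx, hjp⟩ := mem_iUnion₂.1 hpu
  obtain ⟨k, hk, y, hy, hkp⟩ := mem_iUnion₂.1 hpv
  dsimp only at hjp hkp
  have hjk : j ≠ k := by
    rintro rfl
    obtain ⟨z, hz⟩ := hne' j
    exact dis z (hℓΩ j hz) (hj hz) (hk hz)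
  have ends : ∀ i i', i ≠ i' → ∀ x ∈ I01, ∀ y ∈ I01, Γ.σ i x = p → Γ.σ i' y = p → Γ.σ i 0 = p ∨ Γ.σ i 1 = p := by
    intro i i' hi x hx y hy h1 h2
    have h3 := Γ.sep i i' hi x hx y hy
    rw [h1, h2, sub_self, norm_zero] at h3
    by_contra hc
    push Not at hc
    have hx' : x ∈ O01 := by
      refine ⟨hx.1.lt_of_ne ?_, hx.2.lt_of_ne ?_⟩ <;> rintro rfl
      · exact hc.1 (by simpa using h1)
      · exact hc.2 (by simpa using h1)
    linarith [mul_pos Γ.m_pos (bb_pos hx')]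
  obtain ⟨O, hOc, hOs, hOh⟩ := hO p
  obtain ⟨z, hz, hzO⟩ := hOh j (ends j k hjk x hx y hy hjp hkp)
  obtain ⟨w, hw, hwO⟩ := hOh k (ends k j hjk.symm y hy x hx hkp hjp)
  rcases split O hOc hOs with h | h
  · exact dis _ (hOs hwO) (h hwO) (hk (hin k w hw (hOs hwO)))
  · exact dis _ (hOs hzO) (hj (hin j z hz (hOs hzO))) (h hzO)

theorem Pre.geo {G : Set ℂ} {lam : ℝ} (P : Pre G lam) (hG : IsOpen G) (hne : G.Nonempty) (hL : IsPreconnected (frontier G)) :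
    ∃ (Γ : Geo G) (e : Fin Γ.N ≃ Fin P.N), (∀ k, ∃ b, Γ.σ k = P.σ (e k) b) ∧ IsPreconnected (closure G)ᶜ ∧
      ∀ p ∈ Geo.J Γ, ∃ μ a C, Corner G p μ a C ∧ lam ≤ a := by
  obtain ⟨m1, ⟨hsep, hm1⟩, -⟩ := (((P.sep hG).and (Ioc_mem_nhdsGT P.m_pos)).and self_mem_nhdsWithin).exists
  have hM : 0 < P.M := P.m_pos.trans_le P.m_le
  have hm0 : 0 < m1 := hm1.1
  have hr := P.r0_pos
  obtain ⟨c, hc, hc1, hcr, hcM⟩ : ∃ c, 0 < c ∧ c ≤ 1 ∧ c ≤ P.r0 ∧ P.M * c ≤ m1 :=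
    ⟨min 1 (min P.r0 (m1 / P.M)), by positivity, min_le_left _ _, (mnr).trans mnl, by
      rw [mul_comm, ← le_div_iff₀ hM]; exact (mnr).trans mnr⟩
  have LR : ∀ z ∈ Lens c, z ∈ Rc P.r0 := fun z hz ↦ by
    have h1 := of_bb_pos (Lens_bb hc hz)
    have h2 : |z.im| < c * bb z.re := hz
    have h3 : c * bb z.re ≤ c := mul_le_of_le_one_right hc.le ((bb_le _).trans nnm)
    exact ⟨by linarith [h1.1], by linarith [h1.2], by linarith⟩
  have nf : ∀ k b, ∀ z ∈ Lens c, z.im ≠ 0 → P.σ k b z ∉ frontier G := by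
    intro k b z hz hi hf
    obtain ⟨j, y, hy, hjy⟩ := P.cover _ hf
    have hx := Ioo_subset_Icc_self (of_bb_pos (Lens_bb hc hz))
    by_cases hk : k = j
    · subst hk
      obtain ⟨y', hy', h'⟩ : ∃ y' ∈ I01, P.σ k b y' = P.σ k b z := by
        cases b
        · exact ⟨1 - y, ⟨by linarith [hy.2], by linarith [hy.1]⟩, by rw [P.rev']; exact hjy⟩
        · exact ⟨y, hy, hjy⟩
      have h1 := P.colip k b y' (P.mR hy') z (LR z hz)
      rw [h', sub_self, norm_zero] at h1
      have h2 : ‖(y' : ℂ) - z‖ ≤ 0 := by by_contra h; push Not at h; linarith [mul_pos P.m_pos h]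
      rw [← sub_eq_zero.1 (norm_le_zero_iff.1 h2)] at hi
      exact hi (ofReal_im _)
    · have h1 := hsep k j b true hk (z.re, y) ⟨hx, hy⟩
      have h2 := P.lip k b z.re (P.mR hx) z (LR z hz)
      rw [← hjy] at h2
      have h3 : ‖(z.re : ℂ) - z‖ = |z.im| := by
        rw [show (z.re : ℂ) - z = (-z.im : ℝ) * I by apply cxe <;> simp, norm_mul, norm_I, mul_one, norm_real, rna, abs_neg]
      have h4 : |z.im| < c * bb z.re := hz
      rw [h3] at h2
      have h5 := mul_lt_mul_of_pos_left h4 hM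
      have h6 := mul_le_mul_of_nonneg_right hcM (bb_nonneg hx)
      dsimp only at h1
      linarith
  have half : ∀ k b, ∀ H : Set ℂ, Convex ℝ H → H ⊆ {z | z.im ≠ 0} → (∃ z ∈ Lens c ∩ H, P.σ k b z ∈ G) → ∀ z ∈ Lens c ∩ H, P.σ k b z ∈ G := by
    rintro k b H hH hH0 ⟨z, hz, hzG⟩ w hw
    have h1 : IsPreconnected (P.σ k b '' (Lens c ∩ H)) := ((convex_Lens hc).inter hH).isPreconnected.image _
      fun z hz ↦ (P.dA k b (LR z hz.1)).continuousAt.continuousWithinAt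
    refine sub_of_frontier h1 ⟨_, ⟨z, hz, rfl⟩, hzG⟩ ?_ ⟨w, hw, rfl⟩
    rintro _ ⟨z, hz, rfl⟩
    exact nf k b z hz.1 (hH0 hz.2)
  have cor : ∀ i b0, ∃ μ l K, Corner G (P.σ i b0 0) μ l K ∧ lam ≤ l ∧ ∀ k b, P.σ k b 0 = P.σ i b0 0 →
      (∃ z ∈ Lens c, ∃ ζ : ℂ, |ζ.im| < l * rpi / 2 - K * rex ζ.re ∧ P.σ k b z = P.σ i b0 0 + μ * exp ζ) ∧ ∃ z ∈ Lens c, P.σ k b z ∈ G := by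
    intro i b0
    obtain ⟨μ, l, K, h1, h2, h3, -⟩ := P.corner hG i b0
    refine ⟨μ, l, K, h1, h2, fun k b hk ↦ ?_⟩
    obtain ⟨s, hs, h4⟩ := h3 k b hk
    obtain ⟨C, -, hg⟩ := germ (isOpen_Rc.mem_nhds P.mR0) (P.diff k b) (P.dne k b P.mR0)
    exact clE h1 hk (P.dne k b P.mR0) hg hs (by rw [← h4]; exact P.d_eq k b) hc
  have real0 : ∀ k b, ∀ z ∈ Lens c, z.im = 0 → P.σ k b z ∈ frontier G := fun k b z hz h ↦ by
    have h1 : z = z.re := by apply cxe <;> simp [h]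
    rw [h1]; exact P.memL k b _ (Ioo_subset_Icc_self (of_bb_pos (Lens_bb hc hz)))
  have frG : ∀ z ∈ frontier G, z ∉ G := fun z hz ↦ by rw [hG.frontier_eq] at hz; exact hz.2
  have up : (({z : ℂ | 0 < z.im}) ⊆ {z : ℂ | z.im ≠ 0}) := fun z (hz : 0 < z.im) ↦ hz.ne'
  have dn : (({z : ℂ | z.im < 0}) ⊆ {z : ℂ | z.im ≠ 0}) := fun z (hz : z.im < 0) ↦ hz.ne
  have side : ∀ k, ∃ b, (∀ z ∈ Lens c, 0 < z.im → P.σ k b z ∈ G) ∧ ∀ z ∈ Lens c, z.im < 0 → P.σ k b z ∉ closure G := by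
    intro k
    obtain ⟨μ, l, K, h1, -, h2⟩ := cor k true
    obtain ⟨⟨z, hz, ζ, hζ, hzo⟩, w, hw, hwG⟩ := h2 k true rfl
    have hzc : P.σ k true z ∉ closure G := by rw [hzo]; exact h1.out ζ hζ
    have hz0 : z.im ≠ 0 := fun h ↦ hzc (frontier_subset_closure (real0 k true z hz h))
    have hw0 : w.im ≠ 0 := fun h ↦ frG _ (real0 k true w hw h) hwG
    have out : ∀ H : Set ℂ, Convex ℝ H → H ⊆ {z | z.im ≠ 0} → z ∈ H → ∀ y ∈ Lens c, y ∈ H → P.σ k true y ∉ closure G := by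
      intro H a1 a2 a3 y hy hyH hyc
      have : P.σ k true y ∈ G := by
        by_contra h
        exact nf k true y hy (a2 hyH) (by rw [hG.frontier_eq]; exact ⟨hyc, h⟩)
      exact hzc (subset_closure (half k true H a1 a2 ⟨y, ⟨hy, hyH⟩, this⟩ z ⟨hz, a3⟩))
    have cu := convex_halfSpace_im_gt 0
    have cd := convex_halfSpace_im_lt 0
    rcases lt_or_gt_of_ne hw0 with hw1 | hw1
    · have a1 := half k true _ cd dn ⟨w, ⟨hw, hw1⟩, hwG⟩
      have hz1 : 0 < z.im := (lt_or_gt_of_ne hz0).resolve_left fun h ↦ hzc (subset_closure (a1 z ⟨hz, h⟩))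
      refine ⟨false, fun y hy hyi ↦ ?_, fun y hy hyi ↦ ?_⟩
      · have := a1 (1 - y) ⟨Lens_rev hy, by show (1 - y).im < 0; simpa using hyi⟩
        rwa [P.rev] at this
      · have := out _ cu up hz1 (1 - y) (Lens_rev hy) (by show 0 < (1 - y).im; simpa using hyi)
        rwa [P.rev] at this
    · have a1 := half k true _ cu up ⟨w, ⟨hw, hw1⟩, hwG⟩
      have hz1 : z.im < 0 := (lt_or_gt_of_ne hz0).resolve_right fun h ↦ hzc (subset_closure (a1 z ⟨hz, h⟩))
      exact ⟨true, fun y hy hyi ↦ a1 y ⟨hy, hyi⟩, fun y hy hyi ↦ out _ cd dn hz1 y hy hyi⟩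
  choose B hB using side
  let Γ : Geo G := ⟨P.N, fun k ↦ P.σ k (B k), P.r0, c, m1, P.M, hr, hc, hc1, hcr, hm0, hm1.2.trans P.m_le, fun k ↦ P.diff k _,
    fun k z hz w hw ↦ (mul_le_mul_of_nonneg_right hm1.2 nng).trans (P.colip k _ z hz w hw), fun k ↦ P.lip k _, fun k ↦ (hB k).1, fun k ↦ (hB k).2,
    fun k ↦ P.memL k _, fun z hz ↦ by
      obtain ⟨k, x, hx, h⟩ := P.cover z hz
      refine ⟨k, ?_⟩
      cases B k
      · exact ⟨1 - x, ⟨by linarith [hx.2], by linarith [hx.1]⟩, by rw [P.rev']; exact h⟩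
      · exact ⟨x, hx, h⟩, fun j k hjk x hx y hy ↦ hsep j k _ _ hjk (x, y) ⟨hx, hy⟩⟩
  have h1 : ∀ k, P.σ k (B k) 1 = P.σ k (!B k) 0 := fun k ↦ by simpa using P.rev k (B k) 0
  refine ⟨Γ, Equiv.refl _, fun k ↦ ⟨B k, rfl⟩, Γ.ext_conn hG hne hL fun p ↦ ?_, ?_⟩
  · by_cases hp : ∃ i b0, P.σ i b0 0 = p
    · obtain ⟨i, b0, rfl⟩ := hp
      obtain ⟨μ, l, K, h2, -, h3⟩ := cor i b0
      refine ⟨(fun ζ ↦ P.σ i b0 0 + μ * exp ζ) '' {ζ : ℂ | -(l * rpi / 2) + K * rex ζ.re < ζ.im ∧ ζ.im < l * rpi / 2 - K * rex ζ.re},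
        (conv_sector h2.C0).isPreconnected.image _ bfp, ?_, ?_⟩
      · rintro _ ⟨ζ, hζ, rfl⟩
        exact h2.out ζ (abs_lt.2 ⟨by linarith [hζ.1], hζ.2⟩)
      · rintro k (hk | hk)
        · obtain ⟨⟨z, hz, ζ, hζ, e⟩, -⟩ := h3 k (B k) hk
          exact ⟨z, hz, ζ, ⟨by linarith [(abs_lt.1 hζ).1], (abs_lt.1 hζ).2⟩, e.symm⟩
        · obtain ⟨⟨z, hz, ζ, hζ, e⟩, -⟩ := h3 k (!B k) ((h1 k).symm.trans hk)
          exact ⟨1 - z, Lens_rev hz, ζ, ⟨by linarith [(abs_lt.1 hζ).1], (abs_lt.1 hζ).2⟩, e.symm.trans (P.rev k (B k) z).symm⟩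
    · push Not at hp
      exact ⟨∅, isPreconnected_empty, empty_subset _, fun k hk ↦ (hk.elim (hp k _) fun h ↦ hp k (!B k) ((h1 k).symm.trans h)).elim⟩
  · intro p hp
    obtain ⟨k, hk⟩ := mem_iUnion.1 hp
    have : ∃ b, p = P.σ k b 0 := by
      rcases hk with hk | hk
      · exact ⟨_, hk⟩
      · exact ⟨!B k, (show p = P.σ k (B k) 1 from hk).trans (h1 k)⟩
    obtain ⟨b, rfl⟩ := this
    obtain ⟨μ, l, K, h2, h3, -⟩ := cor k b
    exact ⟨μ, l, K, h2, h3⟩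

lemma arclen_deriv {γ : ℝ → ℂ} {l : ℝ} (hu : ∀ s t : ℝ, s ≤ t → t ≤ s + l → eVariationOn γ (Icc s t) = ENNReal.ofReal (t - s))
    {σ : ℂ → ℂ} {g : ℝ → ℝ} (hc : ContinuousOn g (Icc 0 1)) (hm : StrictMonoOn g (Icc 0 1)) (hl : g 1 ≤ g 0 + l)
    (hg : ∀ x ∈ I01, γ (g x) = σ x) {x : ℝ} (hx : x ∈ O01) (hd : AnalyticAt ℂ σ x) :
    HasDerivWithinAt g ‖deriv σ x‖ (Ioi x) x := by
  have hs := hd.hasStrictDerivAt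
  set d := deriv σ x
  rw [hasDerivWithinAt_iff_isLittleO, Asymptotics.isLittleO_iff]
  intro ε hε
  have h1 := hs.isLittleO.bound hε
  have h2 : Tendsto (fun p : ℝ × ℝ ↦ ((p.1 : ℂ), (p.2 : ℂ))) (nhds (x, x)) (nhds ((x : ℂ), (x : ℂ))) :=
    (Continuous.prodMk bfp bfp).tendsto _
  obtain ⟨δ, hδ, H⟩ := Metric.eventually_nhds_iff.1 (h2.eventually h1)
  filter_upwards [Ioo_mem_nhdsGT (lt_min (lt_add_of_pos_right x hδ) hx.2)] with y hy
  have hyδ := hy.2.trans_le mnl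
  have hy1 := hy.2.trans_le mnr
  have key : ∀ a ∈ Icc x y, ∀ b ∈ Icc x y, ‖σ a - σ b - ((a : ℂ) - b) * d‖ ≤ ε * |a - b| := fun a ha b hb ↦ by
    have := @H (a, b) (by
      rw [Prod.dist_eq, Real.dist_eq, Real.dist_eq]
      exact max_lt (abs_lt.2 ⟨by linarith [ha.1], by linarith [ha.2]⟩) (abs_lt.2 ⟨by linarith [hb.1], by linarith [hb.2]⟩))
    simpa [← ofReal_sub, norm_real] using this
  have hsub : Icc x y ⊆ Icc 0 1 := Icc_subset_Icc hx.1.le hy1.le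
  have hxm : x ∈ I01 := ⟨hx.1.le, hx.2.le⟩
  have hym := hsub (right_mem_Icc.2 hy.1.le)
  have hgle : g x ≤ g y := (hm hxm hym hy.1).le
  have hv : eVariationOn (fun u : ℝ ↦ σ u) (Icc x y) = ENNReal.ofReal (g y - g x) := by
    rw [← hu _ _ hgle (by linarith [hm.monotoneOn (left_mem_Icc.2 zero_le_one) hxm hxm.1, hm.monotoneOn hym (right_mem_Icc.2 zero_le_one) hym.2]),
      ← (hc.mono hsub).image_Icc_of_monotoneOn hy.1.le (hm.monotoneOn.mono hsub), ← eVariationOn.comp_eq_of_monotoneOn _ _ (hm.monotoneOn.mono hsub)]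
    exact eVariationOn.eq_of_eqOn fun u hu ↦ (hg u (hsub hu)).symm
  have hab : ∀ a b : ℝ, ‖((a : ℂ) - b) * d‖ = |a - b| * ‖d‖ := fun a b ↦ by rw [norm_mul, ← ofReal_sub, norm_real, rna]
  have hlo : ‖σ y - σ x‖ ≤ g y - g x := by
    have := eVariationOn.edist_le (fun u : ℝ ↦ σ u) (right_mem_Icc.2 hy.1.le) (left_mem_Icc.2 hy.1.le)
    rwa [hv, edist_dist, ENNReal.ofReal_le_ofReal_iff lnr, dist_eq_norm] at this
  have hhi : g y - g x ≤ (‖d‖ + ε) * (y - x) := by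
    have hK : LipschitzOnWith (‖d‖ + ε).toNNReal (fun u : ℝ ↦ σ u) (Icc x y) := .of_dist_le_mul fun a ha b hb ↦ by
      have := norm_le_norm_add_norm_sub' (σ a - σ b) (((a : ℂ) - b) * d)
      have h3 := key a ha b hb
      rw [hab] at this
      rw [dist_eq_norm, Real.dist_eq, Real.coe_toNNReal _ pvt]
      linarith
    have := hK.comp_eVariationOn_le (mapsTo_id _)
    have h5 := (monotoneOn_id (s := Icc x y)).eVariationOn_eq (left_mem_Icc.2 hy.1.le) (right_mem_Icc.2 hy.1.le)
    rw [inter_self] at h5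
    rw [h5] at this
    rw [Function.comp_id, hv, ← ENNReal.ofReal_coe_nnreal, Real.coe_toNNReal _ pvt, ← ENNReal.ofReal_mul pvt] at this
    exact (ENNReal.ofReal_le_ofReal_iff (mul_nonneg pvt (by simp [hy.1.le]))).1 this
  have h3 := key y (right_mem_Icc.2 hy.1.le) x (left_mem_Icc.2 hy.1.le)
  have h4 := norm_le_norm_add_norm_sub (σ y - σ x) (((y : ℂ) - x) * d)
  rw [hab, abs_of_pos (sub_pos.2 hy.1)] at h4
  rw [abs_of_pos (sub_pos.2 hy.1)] at h3
  rw [smul_eq_mul, rna, rna, abs_of_pos (sub_pos.2 hy.1), abs_le]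
  constructor <;> nlinarith

lemma arclen {γ : ℝ → ℂ} (hγ : Continuous γ) {l : ℝ} (hu : ∀ s t : ℝ, s ≤ t → t ≤ s + l → eVariationOn γ (Icc s t) = ENNReal.ofReal (t - s))
    {σ : ℂ → ℂ} {g : ℝ → ℝ} (hc : ContinuousOn g (Icc 0 1)) (hm : StrictMonoOn g (Icc 0 1)) (hl : g 1 ≤ g 0 + l)
    (hg : ∀ x ∈ I01, γ (g x) = σ x) (hd : ∀ x ∈ I01, AnalyticAt ℂ σ x) {f : ℂ → ℂ} (hf : Continuous f) :
    ∫ x in zrR..1, f (σ x) * ‖deriv σ x‖ = ∫ u in g 0..g 1, f (γ u) := by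
  rw [← intervalIntegral.integral_deriv_smul_comp'' (f' := fun x ↦ ‖deriv σ x‖) (by rwa [uIcc_of_le zero_le_one]) (fun x hx ↦ by
    rw [min_eq_left zero_le_one, max_eq_right zero_le_one] at hx
    exact arclen_deriv hu hc hm hl hg hx (hd x ⟨hx.1.le, hx.2.le⟩)) (by
    rw [uIcc_of_le zero_le_one]
    exact fun x hx ↦ ((hd x hx).deriv.continuousAt.comp continuous_ofReal.continuousAt).norm.continuousWithinAt) bfp]
  refine intervalIntegral.integral_congr fun x hx ↦ ?_
  rw [uIcc_of_le zero_le_one] at hx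
  simp [hg x hx, mul_comm]

def Cf (σ : ℂ → ℂ) : Prop := ∃ U, IsOpen U ∧ Complex.ofReal '' I01 ⊆ U ∧ DifferentiableOn ℂ σ U ∧ InjOn σ U

lemma Cf.an {σ : ℂ → ℂ} (h : Cf σ) {x : ℝ} (hx : x ∈ I01) : AnalyticAt ℂ σ x := by
  obtain ⟨U, h1, h2, h3, -⟩ := h
  exact h3.analyticAt (h1.mem_nhds (h2 ⟨x, hx, rfl⟩))

lemma Cf.cont {σ : ℂ → ℂ} (h : Cf σ) : ContinuousOn (fun x : ℝ ↦ σ x) (Icc 0 1) := fun _ hx ↦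
  ((h.an hx).continuousAt.comp continuous_ofReal.continuousAt).continuousWithinAt

lemma Cf.inj {σ : ℂ → ℂ} (h : Cf σ) : InjOn (fun x : ℝ ↦ σ x) (Icc 0 1) := by
  obtain ⟨U, h1, h2, h3, h4⟩ := h
  exact fun x hx y hy e ↦ ofReal_injective (h4 (h2 ⟨x, hx, rfl⟩) (h2 ⟨y, hy, rfl⟩) e)

lemma Cf.aff {σ : ℂ → ℂ} (h : Cf σ) {a b : ℝ} (hb : b ≠ 0) (hab : ∀ x ∈ I01, a + b * x ∈ I01) :
    Cf fun z ↦ σ (a + b * z) := by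
  obtain ⟨U, h1, h2, h3, h4⟩ := h
  refine ⟨(fun z : ℂ ↦ a + b * z) ⁻¹' U, h1.preimage bfp, ?_, h3.comp bfp (mapsTo_preimage _ _), fun z hz w hw e ↦ ?_⟩
  · rintro _ ⟨x, hx, rfl⟩
    exact h2 ⟨_, hab x hx, by push_cast; rfl⟩
  · simpa [hb] using h4 hz hw e

lemma Cf.rev {σ : ℂ → ℂ} (h : Cf σ) : Cf fun z ↦ σ (1 - z) := by
  simpa [sub_eq_add_neg] using h.aff (a := 1) (b := -1) nnm fun x hx ↦ ⟨by linarith [hx.2], by linarith [hx.1]⟩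

def IsArc (γ : ℝ → ℂ) (s t : ℝ) (σ : ℂ → ℂ) : Prop := Cf σ ∧ ∃ g : ℝ → ℝ, ContinuousOn g (Icc 0 1) ∧
  StrictMonoOn g (Icc 0 1) ∧ g 0 = s ∧ g 1 = t ∧ ∀ x ∈ I01, γ (g x) = σ x

lemma arc_lift {γ : ℝ → ℂ} (hγ : Continuous γ) {s t : ℝ} (hinj : InjOn γ (Icc s t)) {σ : ℂ → ℂ} (hσ : Cf σ)
    (hmap : ∀ x ∈ I01, σ x ∈ γ '' Icc s t) : ∃ g : ℝ → ℝ, ContinuousOn g (Icc 0 1) ∧ InjOn g (Icc 0 1) ∧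
    MapsTo g (Icc 0 1) (Icc s t) ∧ ∀ x ∈ I01, γ (g x) = σ x := by
  choose! g hg h using hmap
  refine ⟨g, ?_, fun x hx y hy e ↦ hσ.inj hx hy (by simp only [← h _ hx, ← h _ hy, e]), hg, h⟩
  have hE : Topology.IsClosedEmbedding ((Icc s t).domRestrict γ) := (hγ.comp continuous_subtype_val).isClosedEmbedding hinj.injective
  rw [continuousOn_iff_continuous_domRestrict]
  refine continuous_subtype_val.comp (hE.isInducing.continuous_iff (f := MapsTo.restrict g _ _ hg).2 ?_)
  refine (continuousOn_iff_continuous_domRestrict.1 hσ.cont).congr fun x ↦ ?_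
  exact (h x x.2).symm

lemma arc_of {γ : ℝ → ℂ} (hγ : Continuous γ) {s t : ℝ} (hinj : InjOn γ (Icc s t)) {σ : ℂ → ℂ} (hσ : Cf σ)
    (hmap : ∀ x ∈ I01, σ x ∈ γ '' Icc s t) (he : ∀ x : ℝ, x = 0 ∨ x = 1 → ∀ u ∈ Ioo s t, γ u ≠ σ x) : ∃ σ', IsArc γ s t σ' := by
  have key : ∀ σ, Cf σ → (∀ x ∈ I01, σ x ∈ γ '' Icc s t) → (∀ x : ℝ, x = 0 ∨ x = 1 → ∀ u ∈ Ioo s t, γ u ≠ σ x) → γ s = σ zrR → IsArc γ s t σ := by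
    intro σ hσ hmap he h0
    obtain ⟨g, h1, h2, h3, h4⟩ := arc_lift hγ hinj hσ hmap
    have m0 : zrR ∈ I01 := by simp
    have m1 : onR ∈ I01 := by simp
    have hst := (h3 m0).1.trans (h3 m0).2
    have g0 : g 0 = s := hinj (h3 m0) (left_mem_Icc.2 hst) (by rw [h4 _ m0, h0])
    have g1 : g 1 = t := by
      by_contra hne
      refine he 1 (.inr rfl) (g 1) ⟨lt_of_le_of_ne (h3 m1).1 fun h ↦ ?_, lt_of_le_of_ne (h3 m1).2 hne⟩ (h4 _ m1)
      exact zero_ne_one (h2 m0 m1 (g0.trans h))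
    exact ⟨hσ, g, h1, h1.strictMonoOn_of_injOn_Icc zero_le_one (by rwa [g0, g1]) h2, g0, g1, h4⟩
  have hs : γ s = σ zrR ∨ γ s = σ onR := by
    obtain ⟨g, h1, h2, h3, h4⟩ := arc_lift hγ hinj hσ hmap
    have hE : ∀ x : ℝ, x = 0 ∨ x = 1 → x ∈ I01 := by rintro x (rfl | rfl) <;> simp
    have hv : ∀ x : ℝ, x = 0 ∨ x = 1 → γ s ≠ σ x → g x = t := fun x hx hn ↦ by
      by_contra hne
      refine he x hx (g x) ⟨lt_of_le_of_ne (h3 (hE x hx)).1 fun h ↦ hn ?_, lt_of_le_of_ne (h3 (hE x hx)).2 hne⟩ (h4 _ (hE x hx))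
      rw [h, h4 _ (hE x hx)]
    by_contra! hn
    exact zero_ne_one (h2 (hE 0 (.inl rfl)) (hE 1 (.inr rfl)) ((hv 0 (.inl rfl) hn.1).trans (hv 1 (.inr rfl) hn.2).symm))
  rcases hs with h | h
  · exact ⟨σ, key σ hσ hmap he h⟩
  · refine ⟨_, key _ hσ.rev (fun x hx ↦ ?_) (fun x hx ↦ ?_) (by simpa using h)⟩
    · simpa using hmap (1 - x) ⟨by linarith [hx.2], by linarith [hx.1]⟩
    · simpa using he (1 - x) (hx.symm.imp (by rintro rfl; norm_num) (by rintro rfl; norm_num))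

lemma arc_gap {γ : ℝ → ℂ} (hγ : Continuous γ) {l : ℝ} (hl : 0 < l) (hper : Function.Periodic γ l)
    (hi : ∀ x y, γ x = γ y → |x - y| < l → x = y) {J : Set ℂ} (hJ : IsClosed J) {s t : ℝ} (htl : t < s + l)
    (hs : γ s ∈ J) (ht : γ t ∈ J) (hJn : ∀ u ∈ Ioo s t, γ u ∉ J) {τ : ℂ → ℂ} (hτ : Cf τ) (hτγ : ∀ x ∈ I01, τ x ∈ range γ)
    (h0 : τ zrR ∈ J) (h1 : τ onR ∈ J) {u x0 : ℝ} (hu : u ∈ Ioo s t) (hx0 : x0 ∈ I01) (hux : γ u = τ x0) :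
    ∃ σ, IsArc γ s t σ := by
  have hcl := hτ.cont.preimage_isClosed_of_isClosed isClosed_Icc hJ
  have hn := hux ▸ hJn u hu
  obtain ⟨a, ha, ha'⟩ := ((isCompact_Icc (a := 0) (b := x0)).inter_right hcl).exists_isGreatest ⟨0, ⟨le_rfl, hx0.1⟩, by simp, h0⟩
  obtain ⟨b, hb, hb'⟩ := ((isCompact_Icc (a := x0) (b := 1)).inter_right hcl).exists_isLeast ⟨1, ⟨hx0.2, le_rfl⟩, by simp, h1⟩
  have hax : a < x0 := lt_of_le_of_ne ha.1.2 fun h ↦ hn (h ▸ ha.2.2)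
  have hxb : x0 < b := lt_of_le_of_ne hb.1.1 fun h ↦ hn (h ▸ hb.2.2)
  have hsub : Icc a b ⊆ Icc 0 1 := Icc_subset_Icc ha.1.1 hb.1.2
  have hno : ∀ x ∈ Ioo a b, τ x ∉ J := fun x hx h ↦ by
    have hx1 := hsub (Ioo_subset_Icc_self hx)
    rcases le_total x x0 with h2 | h2
    · exact hx.1.not_ge (ha' ⟨⟨hx1.1, h2⟩, hx1, h⟩)
    · exact hx.2.not_ge (hb' ⟨⟨h2, hx1.2⟩, hx1, h⟩)
  have hst := hu.1.trans hu.2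
  have hA : IsClosed (γ '' Icc s t) := (isCompact_Icc.image hγ).isClosed
  have hpre : IsPreconnected ((fun x : ℝ ↦ τ x) '' Ioo a b) :=
    isPreconnected_Ioo.image _ (hτ.cont.mono (Ioo_subset_Icc_self.trans hsub))
  have hin : ∀ x ∈ Ioo a b, τ x ∈ γ '' Icc s t := by
    intro x hx
    have hcov : (fun x : ℝ ↦ τ x) '' Ioo a b ⊆ γ '' Icc s t ∪ γ '' Icc t (s + l) := by
      rintro _ ⟨y, hy, rfl⟩
      rw [← image_union, Icc_union_Icc_eq_Icc hst.le htl.le, hper.image_Icc hl]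
      exact hτγ y (hsub (Ioo_subset_Icc_self hy))
    refine (hcov ⟨x, hx, rfl⟩).resolve_right fun h ↦ ?_
    obtain ⟨_, ⟨y, hy, rfl⟩, ⟨v, hv, e⟩, w, hw, e'⟩ := isPreconnected_closed_iff.1 hpre _ _ hA (isCompact_Icc.image hγ).isClosed hcov
      ⟨_, ⟨x0, ⟨hax, hxb⟩, rfl⟩, u, ⟨hu.1.le, hu.2.le⟩, hux⟩ ⟨_, ⟨x, hx, rfl⟩, h⟩
    refine hno y hy ?_
    simp only [← e] at e' ⊢
    rcases eq_or_lt_of_le (show w - v ≤ l by linarith [hw.2, hv.1]) with h2 | h2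
    · rwa [show v = s by linarith [hw.2, hv.1]]
    · have := hi w v e' (abs_lt.2 ⟨by linarith [hw.1, hv.2], h2⟩)
      rwa [show v = t by linarith [hw.1, hv.2]]
  have hin' : Icc a b ⊆ Icc a b ∩ (fun x : ℝ ↦ τ x) ⁻¹' (γ '' Icc s t) := by
    have := closure_minimal (fun x hx ↦ ⟨Ioo_subset_Icc_self hx, hin x hx⟩ : Ioo a b ⊆ Icc a b ∩ (fun x : ℝ ↦ τ x) ⁻¹' (γ '' Icc s t)) ((hτ.cont.mono hsub).preimage_isClosed_of_isClosed isClosed_Icc hA)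
    rwa [closure_Ioo (hax.trans hxb).ne] at this
  have hab : ∀ x ∈ I01, a + (b - a) * x ∈ Icc a b := fun x hx ↦ ⟨by nlinarith [hx.1], by nlinarith [hx.2]⟩
  refine arc_of hγ (fun x hx y hy e ↦ hi x y e (abs_lt.2 ⟨by linarith [hx.1, hy.2], by linarith [hx.2, hy.1]⟩))
    (hτ.aff (a := a) (b := b - a) lnr fun x hx ↦ hsub (hab x hx)) (fun x hx ↦ ?_) (fun x hx v hv e ↦ ?_)
  · exact_mod_cast (hin' (hab x hx)).2
  · refine hJn v hv (e ▸ ?_)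
    rcases hx with rfl | rfl
    · simpa using ha.2.2
    · simpa using hb.2.2

lemma Cf.bounds {σ : ℂ → ℂ} (h : Cf σ) : ∀ᶠ r in nhdsWithin zrR (Ioi 0), DifferentiableOn ℂ σ (Rc r) ∧
    ∀ z ∈ Rc r, ∀ w ∈ Rc r, r * ‖z - w‖ ≤ ‖σ z - σ w‖ ∧ r * ‖σ z - σ w‖ ≤ ‖z - w‖ := by
  obtain ⟨U, hU, hS, hd, hi⟩ := h
  have hSc : IsCompact (Complex.ofReal '' I01) := isCompact_Icc.image continuous_ofReal
  obtain ⟨δ, hδ, hK⟩ := hSc.exists_cthickening_subset_open hU hS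
  set K := cthickening δ (Complex.ofReal '' I01)
  have hKc : IsCompact K := hSc.cthickening
  have han : ∀ z ∈ K, AnalyticAt ℂ σ z := fun z hz ↦ hd.analyticAt (hU.mem_nhds (hK hz))
  have gen : ∀ f g : ℂ × ℂ → ℝ, ∀ p ∈ K ×ˢ K, 0 ≤ f p → 0 < g p → ContinuousWithinAt f (K ×ˢ K) p → ContinuousWithinAt g (K ×ˢ K) p →
      ∃ m, 0 < m ∧ ∀ᶠ y in nhdsWithin p (K ×ˢ K), m * f y ≤ g y := fun f g p _ hf hg cf cg ↦ by
    refine ⟨g p / (f p + 1), by positivity, ((cf.const_mul (g p / (f p + 1))).eventually_lt cg ?_).mono fun _ ↦ le_of_lt⟩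
    show g p / (f p + 1) * f p < g p
    rw [div_mul_eq_mul_div, div_lt_iff₀ pvt]
    linarith
  have c1 : ∀ p, ContinuousWithinAt (fun p : ℂ × ℂ ↦ ‖p.1 - p.2‖) (K ×ˢ K) p := fun p ↦ by fun_prop
  have c2 : ∀ p ∈ K ×ˢ K, ContinuousWithinAt (fun p : ℂ × ℂ ↦ ‖σ p.1 - σ p.2‖) (K ×ˢ K) p := fun p hp ↦
    (((han _ hp.1).continuousAt.comp continuous_fst.continuousAt).sub ((han _ hp.2).continuousAt.comp continuous_snd.continuousAt)).norm.continuousWithinAt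
  have loc : ∀ z ∈ K, 0 < ‖deriv σ z‖ ∧ ∀ᶠ y in nhdsWithin (z, z) (K ×ˢ K), ‖deriv σ z‖ / 2 * ‖y.1 - y.2‖ ≤ ‖σ y.1 - σ y.2‖ ∧
      (2 * ‖deriv σ z‖)⁻¹ * ‖σ y.1 - σ y.2‖ ≤ ‖y.1 - y.2‖ := fun z hz ↦ by
    have hp := norm_pos_iff.2 (deriv_ne_zero_of_injOn hU hd hi (hK hz))
    refine ⟨hp, nhdsWithin_le_nhds (((han z hz).hasStrictDerivAt.isLittleO.bound (half_pos hp)).mono fun y hy ↦ ?_)⟩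
    simp only [ContinuousLinearMap.toSpanSingleton_apply, smul_eq_mul] at hy
    have h1 := norm_le_norm_add_norm_sub (σ y.1 - σ y.2) ((y.1 - y.2) * deriv σ z)
    have h2 := norm_le_norm_add_norm_sub' (σ y.1 - σ y.2) ((y.1 - y.2) * deriv σ z)
    rw [norm_mul] at h1 h2
    refine ⟨by linarith, ?_⟩
    rw [inv_mul_le_iff₀ pvt]
    nlinarith [norm_nonneg (y.1 - y.2)]
  have e1 := ev_pos (K := K ×ˢ K) (fun p _ ↦ norm_nonneg (p.1 - p.2)) (cpt_lower (g := fun p ↦ ‖σ p.1 - σ p.2‖) (hKc.prod hKc) (fun p _ ↦ norm_nonneg _) fun p hp ↦ by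
    rcases eq_or_ne p.1 p.2 with h | h
    · obtain ⟨z, w⟩ := p
      obtain rfl : z = w := h
      exact ⟨_, half_pos (loc z hp.1).1, (loc z hp.1).2.mono fun _ h ↦ h.1⟩
    · exact gen _ _ p hp nng (norm_pos_iff.2 (sub_ne_zero.2 fun e ↦ h (hi (hK hp.1) (hK hp.2) e))) (c1 p) (c2 p hp))
  have e2 := ev_pos (K := K ×ˢ K) (fun p _ ↦ norm_nonneg (σ p.1 - σ p.2)) (cpt_lower (g := fun p ↦ ‖p.1 - p.2‖) (hKc.prod hKc) (fun p _ ↦ norm_nonneg _) fun p hp ↦ by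
    rcases eq_or_ne p.1 p.2 with h | h
    · obtain ⟨z, w⟩ := p
      obtain rfl : z = w := h
      have := (loc z hp.1).1
      exact ⟨_, by positivity, (loc z hp.1).2.mono fun _ h ↦ h.2⟩
    · exact gen _ _ p hp nng (norm_pos_iff.2 (sub_ne_zero.2 h)) (c2 p hp) (c1 p))
  filter_upwards [e1, e2, Ioc_mem_nhdsGT (half_pos hδ)] with r h1 h2 hr
  have hsub : Rc r ⊆ K := fun z hz ↦ by
    obtain ⟨a1, a2, a3⟩ := hz
    refine mem_cthickening_of_dist_le z _ δ _ ⟨max 0 (min 1 z.re), ⟨le_max_left _ _, max_le zero_le_one mnl⟩, rfl⟩ ?_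
    rw [dist_eq_norm]
    refine (norm_le_abs_re_add_abs_im _).trans ?_
    simp only [sub_re, ofReal_re, sub_im, ofReal_im, sub_zero]
    have : |z.re - max 0 (min 1 z.re)| ≤ r := abs_le.2 (by constructor <;> grind)
    linarith [hr.2]
  exact ⟨hd.mono (hsub.trans hK), fun z hz w hw ↦ ⟨h1 (z, w) ⟨hsub hz, hsub hw⟩, h2 (z, w) ⟨hsub hz, hsub hw⟩⟩⟩

lemma sorted_nodes {T : Set ℝ} (hT : T.Finite) {p q : ℝ} (hp : p ∈ T) (hq : q ∈ T) (h : ∀ x ∈ T, p ≤ x ∧ x ≤ q) :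
    ∃ (N : ℕ) (a : ℕ → ℝ), a 0 = p ∧ a N = q ∧ (∀ i j, i < j → j ≤ N → a i < a j) ∧ (∀ i ≤ N, a i ∈ T) ∧
      ∀ i < N, ∀ x ∈ Ioo (a i) (a (i + 1)), x ∉ T := by
  set F := hT.toFinset
  have hF : ∀ x, x ∈ F ↔ x ∈ T := fun x ↦ hT.mem_toFinset
  have hpos : 0 < F.card := Finset.card_pos.2 ⟨p, (hF p).2 hp⟩
  set e := F.orderEmbOfFin rfl
  have he : ∀ x ∈ T, ∃ i, e i = x := fun x hx ↦ by
    have : x ∈ (F : Set ℝ) := (hF x).2 hx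
    rwa [← F.range_orderEmbOfFin rfl] at this
  have hm : ∀ i, e i ∈ T := fun i ↦ (hF _).1 (F.orderEmbOfFin_mem rfl i)
  have ha : ∀ i (hi : i < F.card), (fun n ↦ if h : n < F.card then e ⟨n, h⟩ else 0) i = e ⟨i, hi⟩ := fun i hi ↦ dif_pos hi
  refine ⟨F.card - 1, fun n ↦ if h : n < F.card then e ⟨n, h⟩ else 0, ?_, ?_, fun i j hij hj ↦ ?_, fun i hi ↦ ?_, fun i hi x hx hxT ↦ ?_⟩
  · rw [ha 0 hpos]
    obtain ⟨i, hi⟩ := he p hp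
    exact le_antisymm (hi ▸ e.monotone (Fin.mk_le_of_le_val (Nat.zero_le _))) (h _ (hm _)).1
  · rw [ha _ bom]
    obtain ⟨i, hi⟩ := he q hq
    exact le_antisymm (h _ (hm _)).2 (hi ▸ e.monotone (Fin.le_def.2 (by have := i.2; simp; omega)))
  · rw [ha i bom, ha j bom]
    exact e.strictMono hij
  · rw [ha i bom]
    exact hm _
  · rw [ha i bom, ha (i + 1) bom] at hx
    obtain ⟨j, rfl⟩ := he x hxT
    have h1 := e.lt_iff_lt.1 hx.1
    have h2 := e.lt_iff_lt.1 hx.2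
    simp only [Fin.lt_def] at h1 h2
    omega

lemma JordanDomain.inj_mod (D : JordanDomain) (x y : ℝ) (h : D.γ x = D.γ y) (hxy : |x - y| < D.l) : x = y := by
  have hl := D.l_pos
  have e : ∀ x, D.γ (toIcoMod hl 0 x) = D.γ x := fun x ↦ D.γ_periodic.sub_zsmul_eq _
  have := D.γ_injOn (toIcoMod_mem_Ico' hl x) (toIcoMod_mem_Ico' hl y) (by rw [e, e, h])
  simp only [toIcoMod, zsmul_eq_mul] at this
  have h2 : x - y = ((toIcoDiv hl 0 x - toIcoDiv hl 0 y : ℤ) : ℝ) * D.l := by push_cast; linarith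
  rw [h2, abs_mul, abs_of_pos hl, mul_lt_iff_lt_one_left hl, ← Int.cast_abs, ← Int.cast_one, Int.cast_lt, Int.abs_lt_one_iff] at hxy
  rw [hxy] at h2
  simpa [sub_eq_zero] using h2

lemma JordanDomain.range (D : JordanDomain) : range D.γ = frontier D.G := by
  rw [← D.γ_boundary]
  refine Subset.antisymm ?_ (image_subset_range _ _)
  rintro _ ⟨x, rfl⟩
  obtain ⟨y, hy, e⟩ := D.γ_periodic.exists_mem_Ico₀ D.l_pos x
  exact ⟨y, hy, e.symm⟩

lemma exists_gap (a : ℕ → ℝ) {u : ℝ} (h0 : a 0 ≤ u) : ∀ n, 0 < n → u ≤ a n → ∃ k < n, u ∈ Icc (a k) (a (k + 1))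
  | 0, h, _ => absurd h (lt_irrefl _)
  | n + 1, _, h => by
    rcases le_total (a n) u with h1 | h1
    · exact ⟨n, n.lt_succ_self, h1, h⟩
    · rcases n.eq_zero_or_pos with rfl | hn
      · exact ⟨0, one_pos, h0, h⟩
      · obtain ⟨k, hk, H⟩ := exists_gap a h0 n hn h1
        exact ⟨k, hk.trans n.lt_succ_self, H⟩

lemma arcs_exist (D : JordanDomain) (B : PiecewiseAnalyticBoundary D) : ∃ (N : ℕ) (a : ℕ → ℝ) (s : ℕ → ℂ → ℂ), 0 < N ∧ a N = a 0 + D.l ∧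
    (∀ i j, i < j → j ≤ N → a i < a j) ∧ (∀ i ≤ N, ∃ j, D.γ (a i) = B.τ j 1) ∧ ∀ k < N, IsArc D.γ (a k) (a (k + 1)) (s k) := by
  have hC : ∀ i, Cf (B.τ i) := fun i ↦ ⟨B.U i, B.U_open i, B.seg_sub i, B.analytic i, B.inj i⟩
  have hl := D.l_pos
  set J := Set.range fun i ↦ B.τ i 1
  have hJf : J.Finite := finite_range _
  have hJ0 : ∀ i, B.τ i 0 ∈ J := fun i ↦ by
    refine ⟨⟨(i + (B.m - 1)) % B.m, Nat.mod_lt _ B.m_pos⟩, (B.junction _).trans ?_⟩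
    congr 2
    simp only [Nat.mod_add_mod]
    have := i.2
    rw [show (i : ℕ) + (B.m - 1) + 1 = i + B.m by omega, Nat.add_mod_right, Nat.mod_eq_of_lt this]
  have hfr : ∀ i, ∀ x ∈ I01, B.τ i x ∈ Set.range D.γ := fun i x hx ↦ by
    rw [D.range, ← B.cover]
    exact mem_iUnion.2 ⟨i, _, ⟨x, hx, rfl⟩, rfl⟩
  let i0 : Fin B.m := ⟨0, B.m_pos⟩
  have hne : B.τ i0 zrR ≠ B.τ i0 onR := fun e ↦ zero_ne_one ((hC i0).inj bsp bsp e)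
  simp only [ofReal_zero, ofReal_one] at hne
  obtain ⟨t0, ht0⟩ := hfr i0 1 bsp
  have h0r := hfr i0 0 bsp
  rw [← D.γ_periodic.image_Icc hl t0] at h0r
  obtain ⟨t1, ht1, e1⟩ := h0r
  simp only [ofReal_zero, ofReal_one] at e1 ht0
  have h1 : t0 < t1 := lt_of_le_of_ne ht1.1 fun h ↦ hne (by rw [← e1, ← ht0, h])
  have h2 : t1 < t0 + D.l := lt_of_le_of_ne ht1.2 fun h ↦ hne (by rw [← e1, ← ht0, h, D.γ_periodic])
  have hT : (Icc t0 (t0 + D.l) ∩ D.γ ⁻¹' J).Finite := by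
    refine ((Finite.of_injOn (s := Ico t0 (t0 + D.l) ∩ D.γ ⁻¹' J) (t := J) (f := D.γ) (fun x hx ↦ hx.2)
      (fun x hx y hy e ↦ D.inj_mod x y e (abs_lt.2 ⟨by linarith [hx.1.1, hy.1.2], by linarith [hx.1.2, hy.1.1]⟩)) hJf).union (finite_singleton (t0 + D.l))).subset ?_
    rintro x ⟨hx, hxJ⟩
    rcases eq_or_lt_of_le hx.2 with h | h
    · exact .inr h
    · exact .inl ⟨⟨hx.1, h⟩, hxJ⟩
  obtain ⟨N, a, ha0, haN, hm, hmem, hgap⟩ := sorted_nodes hT (p := t0) (q := t0 + D.l) ⟨⟨le_rfl, by linarith⟩, i0, ht0.symm⟩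
    ⟨⟨by linarith, le_rfl⟩, i0, by simp only [D.γ_periodic t0, ht0]⟩ fun x hx ↦ hx.1
  have key : ∀ k, ∃ s, k < N → IsArc D.γ (a k) (a (k + 1)) s := fun k ↦ by
    by_cases hk : k < N
    swap
    · exact ⟨id, fun h ↦ absurd h hk⟩
    have hlt := hm k (k + 1) k.lt_succ_self hk
    obtain ⟨u, hu⟩ := nonempty_Ioo.2 hlt
    have hk1 := (hmem k hk.le).1
    have hk2 := (hmem (k + 1) hk).1
    have hgl : a (k + 1) < a k + D.l := by
      by_contra! hc
      exact hgap k hk t1 ⟨by linarith [hk1.1, hk2.2], by linarith [hk1.1, hk2.2]⟩ ⟨ht1, by rw [mem_preimage, e1]; exact hJ0 i0⟩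
    have := mem_range_self (f := D.γ) u
    rw [D.range, ← B.cover] at this
    obtain ⟨i, _, ⟨x, hx, rfl⟩, e⟩ := mem_iUnion.1 this
    obtain ⟨s, hs⟩ := arc_gap D.γ_cont hl D.γ_periodic D.inj_mod hJf.isClosed hgl (hmem k hk.le).2 (hmem (k + 1) hk).2
      (fun v hv h ↦ hgap k hk v hv ⟨⟨hk1.1.trans hv.1.le, hv.2.le.trans hk2.2⟩, h⟩) (hC i) (hfr i) (by simpa using hJ0 i) ⟨i, by simp⟩ hu hx e.symm
    exact ⟨s, fun _ ↦ hs⟩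
  choose s hs using key
  refine ⟨N, a, s, Nat.pos_of_ne_zero fun h ↦ ?_, by rw [haN, ha0], hm, fun i hi ↦ ?_, hs⟩
  · subst h
    linarith
  · obtain ⟨j, hj⟩ := (hmem i hi).2
    exact ⟨j, hj.symm⟩

lemma exists_pre (D : JordanDomain) (B : PiecewiseAnalyticBoundary D) {lam : ℝ} (hmin : ∀ i, lam ≤ B.extAngle i) :
    ∃ P : Pre D.G lam, ∀ f : ℂ → ℂ, Continuous f → ∀ b : Fin P.N → Bool,
      ∑ k, ∫ x in O01, f (P.σ k (b k) x) * ‖deriv (P.σ k (b k)) x‖ = ∫ s in zrR..D.l, f (D.γ s) := by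
  obtain ⟨N, a, s, hN, haN, hm, hJ, hs⟩ := arcs_exist D B
  have hs : ∀ k : Fin N, IsArc D.γ (a k) (a (k + 1)) (s k) := fun k ↦ hs k k.2
  choose hC g gc gm g0 g1 hg using hs
  have hm' : ∀ i j, i ≤ j → j ≤ N → a i ≤ a j := fun i j h h2 ↦ h.eq_or_lt.elim (fun e ↦ e ▸ le_rfl) fun h ↦ (hm i j h h2).le
  have gI : ∀ k : Fin N, ∀ x ∈ I01, g k x ∈ Icc (a k) (a (k + 1)) := fun k x hx ↦ by
    rw [← g0, ← g1]
    exact ⟨(gm k).monotoneOn bsp hx hx.1, (gm k).monotoneOn hx bsp hx.2⟩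
  have gO : ∀ k : Fin N, ∀ x ∈ O01, g k x ∈ Ioo (a k) (a (k + 1)) := fun k x hx ↦ by
    rw [← g0, ← g1]
    exact ⟨gm k bsp ⟨hx.1.le, hx.2.le⟩ hx.1, gm k ⟨hx.1.le, hx.2.le⟩ bsp hx.2⟩
  let σ : Fin N → Bool → ℂ → ℂ := fun k b z ↦ s k (bif b then z else 1 - z)
  have hCb : ∀ k b, Cf (σ k b) := fun k b ↦ by
    cases b
    · exact (hC k).rev
    · exact hC k
  let y : Bool → ℝ → ℝ := fun b x ↦ bif b then x else 1 - x
  have yI : ∀ b, ∀ x ∈ I01, y b x ∈ I01 := fun b x hx ↦ by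
    cases b
    · exact ⟨by simp [y, hx.2], by simp [y, hx.1]⟩
    · exact hx
  have yO : ∀ b, ∀ x ∈ O01, y b x ∈ O01 := fun b x hx ↦ by
    cases b
    · exact ⟨by simp [y, hx.2], by simp [y, hx.1]⟩
    · exact hx
  have hv : ∀ k b, ∀ x ∈ I01, σ k b x = D.γ (g k (y b x)) := fun k b x hx ↦ by
    rw [hg k _ (yI b x hx)]
    cases b <;> simp [σ, y]
  have hv0 : ∀ k b, σ k b 0 = D.γ (a (k + (bif b then 0 else 1))) := fun k b ↦ by
    have := hv k b 0 bsp
    rw [ofReal_zero] at this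
    rw [this]
    cases b <;> simp [y, g0, g1]
  obtain ⟨r, hr, hr1⟩ := ((eventually_all.2 fun k ↦ eventually_all.2 fun b ↦ (hCb k b).bounds).and (Ioc_mem_nhdsGT one_pos)).exists
  refine ⟨⟨N, σ, fun k b z ↦ ?_, r, r, r⁻¹, hr1.1, hr1.1, ?_, fun k b ↦ (hr k b).1, fun k b z hz w hw ↦ ((hr k b).2 z hz w hw).1,
    fun k b z hz w hw ↦ ?_, fun k b x hx ↦ ?_, fun z hz ↦ ?_, fun j k b b' hjk x hx x' hx' e ↦ ?_, fun j k b e ↦ ?_, fun k b ↦ ?_⟩, fun f hf b ↦ ?_⟩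
  · cases b <;> simp [σ]
  · exact hr1.2.trans ((one_le_inv₀ hr1.1).2 hr1.2)
  · rw [le_inv_mul_iff₀ hr1.1]
    exact ((hr k b).2 z hz w hw).2
  · rw [hv k b x hx, ← D.range]
    exact mem_range_self _
  · rw [← D.range, ← D.γ_periodic.image_Icc D.l_pos (a 0)] at hz
    obtain ⟨u, hu, rfl⟩ := hz
    obtain ⟨k, hk, hk'⟩ := exists_gap a hu.1 N hN (haN ▸ hu.2)
    obtain ⟨x, hx, e⟩ := intermediate_value_Icc zero_le_one (gc ⟨k, hk⟩) (by rwa [g0, g1])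
    exact ⟨⟨k, hk⟩, x, hx, by rw [hv _ _ _ hx]; exact congrArg _ e⟩
  · rw [hv j b x ⟨hx.1.le, hx.2.le⟩, hv k b' x' hx'] at e
    have h1 := gO j _ (yO b x hx)
    have h2 := gI k _ (yI b' x' hx')
    have l1 := hm' 0 j (Nat.zero_le _) j.2.le
    have l2 := hm' (j + 1) N j.2 le_rfl
    have l3 := hm' 0 k (Nat.zero_le _) k.2.le
    have l4 := hm' (k + 1) N k.2 le_rfl
    have := D.inj_mod _ _ e (abs_lt.2 ⟨by linarith [h1.1, h2.2], by linarith [h1.2, h2.1]⟩)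
    rw [this] at h1
    rcases lt_or_gt_of_ne (Fin.val_ne_of_ne hjk) with h | h
    · linarith [hm' (j + 1) k h k.2.le, h1.2, h2.1]
    · linarith [hm' (k + 1) j h j.2.le, h1.1, h2.2]
  · rw [hv0, hv0] at e
    set c := bif b then 0 else 1
    have hc : c = 0 ∨ c = 1 := by cases b <;> simp [c]
    have hjN := j.2
    have hkN := k.2
    have : |a (j + c) - a (k + c)| < D.l := by
      rw [abs_lt]
      rcases hc with h | h <;> simp only [h, add_zero]
      · constructor <;> linarith [hm' 0 j (Nat.zero_le _) hjN.le, hm' 0 k (Nat.zero_le _) hkN.le, hm j N hjN le_rfl, hm k N hkN le_rfl]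
      · constructor <;> linarith [hm 0 (j + 1) (Nat.succ_pos _) hjN, hm 0 (k + 1) (Nat.succ_pos _) hkN, hm' (j + 1) N hjN le_rfl, hm' (k + 1) N hkN le_rfl]
    have e' := D.inj_mod _ _ e this
    by_contra hne
    rcases lt_or_gt_of_ne (Fin.val_ne_of_ne hne) with h | h
    · linarith [hm (j + c) (k + c) bom bom]
    · linarith [hm (k + c) (j + c) bom bom]
  · obtain ⟨j, hj⟩ := hJ (k + (bif b then 0 else 1)) (by have := k.2; cases b <;> simp <;> omega)
    rw [hv0, hj]
    exact ⟨_, B.extAngle_mem j, hmin j, B.extAngle_spec j⟩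
  · have key : ∀ k, ∫ x in O01, f (σ k (b k) x) * ‖deriv (σ k (b k)) x‖ = ∫ u in a k..a (k + 1), f (D.γ u) := fun k ↦ by
      have hgap : g k 1 ≤ g k 0 + D.l := by
        rw [g0, g1]
        linarith [hm' 0 k (Nat.zero_le _) k.2.le, hm' (k + 1) N k.2 le_rfl]
      have := arclen D.γ_cont D.γ_unitSpeed (gc k) (gm k) hgap (hg k) (fun x hx ↦ (hC k).an hx) hf
      rw [g0, g1] at this
      rw [← integral_Ioc_eq_integral_Ioo, ← intervalIntegral.integral_of_le zero_le_one, ← this]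
      cases b k
      · have h1 : ∀ x : ℝ, deriv (σ k false) x = -deriv (s k) (1 - x) := fun x ↦ deriv_comp_const_sub (f := s k) 1 (x : ℂ)
        have h2 := intervalIntegral.integral_comp_sub_left (a := 0) (b := 1) (fun x : ℝ ↦ f (s k x) * ‖deriv (s k) x‖) 1
        simp only [sub_self, sub_zero, ofReal_sub, ofReal_one] at h2
        rw [← h2]
        simp only [h1, norm_neg]
        rfl
      · rfl
    refine (fsc rfl fun k _ ↦ key k).trans ?_
    have h3 := intervalIntegral.sum_integral_adjacent_intervals (f := fun u ↦ f (D.γ u)) (μ := volume) (a := a) (n := N)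
      fun k _ ↦ (hf.comp D.γ_cont).intervalIntegrable _ _
    rw [haN] at h3
    refine (Fin.sum_univ_eq_sum_range (fun k ↦ ∫ u in a k..a (k + 1), f (D.γ u)) N).trans (h3.trans ?_)
    simpa using (D.γ_periodic.comp f).intervalIntegral_add_eq (a 0) 0

lemma JordanDomain.IsONPolys.orth {D : JordanDomain} {p : ℕ → Polynomial ℂ} (hp : D.IsONPolys p) (n : ℕ) : ∀ d ≤ n, ∀ q : Polynomial ℂ, q.degree < d →
    ∫ s in zrR..D.l, q.eval (D.γ s) * cnj ((p n).eval (D.γ s)) = 0 := by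
  have hγ := D.γ_cont
  intro d
  induction d with
  | zero =>
    intro _ q hq
    have : q = 0 := Polynomial.degree_eq_bot.1 (by simpa using hq)
    simp [this]
  | succ d ih =>
    intro hd q hq
    have hlc : (p d).coeff d ≠ 0 := by
      obtain ⟨c, hc, h⟩ := hp.2.1 d
      rw [Polynomial.leadingCoeff, hp.1 d] at h
      rw [h]
      exact_mod_cast hc.ne'
    set c := q.coeff d / (p d).coeff d
    have h1 := ih bom (q - Polynomial.C c * p d) (by
      rw [Polynomial.degree_lt_iff_coeff_zero]
      intro m hm
      rw [Polynomial.coeff_sub, Polynomial.coeff_C_mul]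
      rcases hm.eq_or_lt with rfl | h
      · rw [div_mul_cancel₀ _ hlc, sub_self]
      · rw [(Polynomial.degree_lt_iff_coeff_zero _ _).1 hq m h, Polynomial.coeff_eq_zero_of_natDegree_lt (by rwa [hp.1]), mul_zero, sub_zero])
    have h2 := hp.2.2 d n
    rw [if_neg bom] at h2
    have h3 := (mul_eq_zero.1 h2).resolve_left (by simpa using D.l_pos.ne')
    have : ∀ s, (q - Polynomial.C c * p d).eval (D.γ s) * cnj ((p n).eval (D.γ s)) =
        q.eval (D.γ s) * cnj ((p n).eval (D.γ s)) - c * ((p d).eval (D.γ s) * cnj ((p n).eval (D.γ s))) := fun s ↦ by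
      simp; ring
    simp only [this] at h1
    rw [intervalIntegral.integral_sub (Continuous.intervalIntegrable bfp _ _) (Continuous.intervalIntegrable bfp _ _),
      intervalIntegral.integral_const_mul, h3, mul_zero, sub_zero] at h1
    exact h1

theorem orthonormalPolys_decay_rate
    (D : JordanDomain) (B : PiecewiseAnalyticBoundary D)
    (lam : ℝ) (hlam0 : 0 < lam) (hlam2 : lam < 2)
    (hmin : ∀ i, lam ≤ B.extAngle i) (hattained : ∃ i, B.extAngle i = lam)
    (p : ℕ → Polynomial ℂ) (hp : D.IsONPolys p)
    (F : Set ℂ) (hF : IsCompact F) (hFG : F ⊆ D.G) :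
    ∃ C : ℝ, 0 < C ∧ ∀ ζ ∈ F, ∀ n : ℕ, 0 < n →
      ‖(p n).eval ζ‖ ≤ C * (n : ℝ) ^ (-(lam / (4 - 2 * lam))) := by
  obtain ⟨P, hP⟩ := exists_pre D B hmin
  obtain ⟨Γ, e, hσ, hΩ, hco⟩ := P.geo D.isOpen D.nonempty (D.range ▸ isPreconnected_range D.γ_cont)
  choose b hb using hσ
  have hI : ∀ f : ℂ → ℂ, Continuous f → ∑ k, ∫ x in O01, f (Γ.σ k x) * ‖deriv (Γ.σ k) x‖ = ∫ s in zrR..D.l, f (D.γ s) := fun f hf ↦ by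
    rw [← hP f hf fun k ↦ b (e.symm k), ← e.sum_comp]
    simp [hb]
  obtain ⟨Δ, hΔ⟩ := Γ.exists_dat D.isOpen D.bounded (D.range ▸ range_nonempty _) D.simplyConnected hF hFG
  have hE : ∀ n, Γ.En (p n) ≤ D.l := fun n ↦ by
    have h1 := hp.2.2 n n
    rw [if_pos rfl, ← hI (fun z ↦ (p n).eval z * cnj ((p n).eval z)) bfp] at h1
    have h2 : ((Γ.En (p n) : ℝ) : ℂ) = ∑ k, ∫ x in O01, (p n).eval (Γ.σ k x) * cnj ((p n).eval (Γ.σ k x)) * ‖deriv (Γ.σ k) x‖ := by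
      rw [Geo.En, ofReal_sum]
      refine fsc rfl fun k _ ↦ ?_
      rw [← integral_complex_ofReal]
      simp only [mul_conj, normSq_eq_norm_sq, ofReal_mul]
    rw [← h2, one_div, inv_mul_eq_one₀ (by simpa using D.l_pos.ne')] at h1
    exact (ofReal_injective h1).ge
  have ho : ∀ n, ∀ k < n, ∑ j, ∫ x in O01, Γ.cw (p n) j x * Γ.σ j x ^ k = 0 := fun n k hk ↦ by
    have h1 := hp.orth n n le_rfl (Polynomial.X ^ k) (by rw [Polynomial.degree_X_pow]; exact_mod_cast hk)
    rw [← hI (fun z ↦ (Polynomial.X ^ k).eval z * cnj ((p n).eval z)) bfp] at h1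
    rw [← h1]
    refine fsc rfl fun j _ ↦ integral_congr_ae (.of_forall fun x ↦ ?_)
    simp [Geo.cw]
    ring
  obtain ⟨C, hC, H⟩ := Δ.final hΩ D.l_pos hE ho hlam0 hlam2 hco
  obtain ⟨K, hK⟩ := hF.exists_bound_of_continuousOn (Δ.hκ.continuousOn.mono hFG)
  refine ⟨(|K| + 1) * C, by positivity, fun ζ hζ n hn ↦ (H n hn ζ (hFG hζ) (hΔ ζ hζ)).trans ?_⟩
  rw [mul_assoc]
  exact mul_le_mul_of_nonneg_right ((hK ζ hζ).trans (by linarith [le_abs_self K])) pvt
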